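/- Let k ≥ 1. Let S(X, k; 3, 4) = Σ 2^{k·rk₄ Cl⁺(8d)} and let A(X; 3, 4) be the number of terms, where both range over squarefree integers d with d ≡ 3 (mod 4), 1 < 2d ≤ X, and every prime p dividing d satisfying (2/p) = 1. Then S(X, k; 3, 4) ~ N(k, 2)·A(X; 3, 4) as X → ∞, where N(k, 2) is the total number of 𝔽₂-vector subspaces of 𝔽₂^k. -/

import Mathlib

open NumberField IntermediateField
open scoped nonZeroDivisors

/-- The subgroup of invertible fractional ideals generated by principal fractional ideals
with a totally positive generator. -/
def narrowPrincipals (F : Type*) [Field F] :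
    Subgroup (FractionalIdeal (𝓞 F)⁰ F)ˣ :=
  Subgroup.closure {I | ∃ x : F, (∀ φ : F →+* ℝ, 0 < φ x) ∧
    ((I : FractionalIdeal (𝓞 F)⁰ F) : Submodule (𝓞 F) F) = Submodule.span (𝓞 F) {x}}

/-- The narrow class group: nonzero fractional ideals modulo principal fractional ideals
generated by totally positive elements. -/
abbrev NarrowClassGroup (F : Type*) [Field F] :=
  (FractionalIdeal (𝓞 F)⁰ F)ˣ ⧸ narrowPrincipals F

/-- `ℚ(√n)` as a subfield of `ℂ`. -/
noncomputable def quadField (n : ℕ) : IntermediateField ℚ ℂ := ℚ⟮(Real.sqrt n : ℂ)⟯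

open scoped Classical

/-- `|G²/G⁴|`, i.e. `2^{rk₄ G}` where `rk₄` is the 4-rank of `G`. -/
noncomputable def fourRankPow (G : Type*) [CommGroup G] : ℕ :=
  Nat.card ((powMonoidHom 2 : G →* G).range ⧸
    ((powMonoidHom 4 : G →* G).range.subgroupOf (powMonoidHom 2 : G →* G).range))

/-- The condition on `d`: squarefree, `d ≡ 3 (mod 4)`, `1 < 2d ≤ X`, and every prime
`p ∣ d` satisfies `(2/p) = 1`. -/
def dCond (X : ℝ) (d : ℕ) : Prop :=
  Squarefree d ∧ d % 4 = 3 ∧ 1 < 2 * d ∧ (2 * d : ℝ) ≤ X ∧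
    ∀ p : ℕ, p.Prime → p ∣ d → jacobiSym 2 p = 1

/-- `S(X, k; 3, 4) = Σ_d 2^{k·rk₄ Cl⁺(8d)}`, over squarefree `d ≡ 3 (mod 4)` with
`1 < 2d ≤ X` and `(2/p) = 1` for all primes `p ∣ d`. -/
noncomputable def Scount (k : ℕ) (X : ℝ) : ℝ :=
  ∑ d ∈ Finset.range (⌊X⌋₊ + 1),
    if dCond X d then (fourRankPow (NarrowClassGroup (quadField (2 * d))) : ℝ) ^ k else 0

/-- `A(X; 3, 4)`: the number of `d` as above. -/
noncomputable def Acount34 (X : ℝ) : ℝ :=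
  ∑ d ∈ Finset.range (⌊X⌋₊ + 1), if dCond X d then 1 else 0

set_option linter.unusedSectionVars false
set_option linter.unusedVariables false

namespace FK

/-- The theorem of Legendre in the form needed. -/
theorem legendre_aux (b c : ℕ) (hb : 0 < b) (hc : 2 ≤ c) (hsq : Squarefree (b * c))
    (β γ : ℤ) (hβ : (c : ℤ) ∣ β ^ 2 - b) (hγ : (b : ℤ) ∣ γ ^ 2 + c) :
    ∃ w s t : ℤ, w ≠ 0 ∧ w ^ 2 = b * s ^ 2 - c * t ^ 2 := by
  have hns : ¬ IsSquare (b * c) := by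
    rintro ⟨r, hr⟩
    have h1 := hsq r ⟨1, by rw [hr]; ring⟩
    rw [Nat.isUnit_iff] at h1
    subst h1
    have : 2 ≤ b * c := by nlinarith
    omega
  have hnsc : ¬ IsSquare c := by
    rintro ⟨r, hr⟩
    have h1 := hsq r ⟨b, by rw [hr]; ring⟩
    rw [Nat.isUnit_iff] at h1
    subst h1
    omega
  -- it suffices to find a nontrivial solution
  suffices h : ∃ w s t : ℤ, (w ≠ 0 ∨ s ≠ 0 ∨ t ≠ 0) ∧ w ^ 2 = b * s ^ 2 - c * t ^ 2 by
    obtain ⟨w, s, t, hne, h⟩ := h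
    refine ⟨w, s, t, ?_, h⟩
    rintro rfl
    have hst : (b * s) ^ 2 = (b * c : ℤ) * t ^ 2 := by
      have : (b : ℤ) * s ^ 2 = c * t ^ 2 := by linarith
      calc ((b : ℤ) * s) ^ 2 = b * (b * s ^ 2) := by ring
        _ = _ := by rw [this]; ring
    by_cases ht : t = 0
    · subst ht
      have : s = 0 := by
        simpa [hb.ne'] using hst
      simp [this] at hne
    · apply hns
      have hdvd : t ∣ b * s := by
        rw [← Int.pow_dvd_pow_iff two_ne_zero, hst]
        exact Dvd.intro_left _ rfl
      obtain ⟨r, hr⟩ := hdvd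
      have : r ^ 2 = (b * c : ℤ) := by
        rw [hr] at hst
        have ht2 : t ^ 2 ≠ 0 := pow_ne_zero 2 ht
        apply mul_right_cancel₀ ht2
        rw [← hst]; ring
      refine ⟨r.natAbs, ?_⟩
      zify
      rw [← this, ← sq, sq_abs]
  have : NeZero b := ⟨hb.ne'⟩
  have : NeZero c := ⟨by omega⟩
  let S : Finset (ℕ × ℕ × ℕ) :=
    Finset.range (Nat.sqrt (b * c) + 1) ×ˢ Finset.range (Nat.sqrt c + 1) ×ˢ
      Finset.range (Nat.sqrt b + 1)
  let φ : ℕ × ℕ × ℕ → ZMod c × ZMod b := fun x =>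
    ((x.1 : ZMod c) - (β : ZMod c) * x.2.1, (x.1 : ZMod b) - (γ : ZMod b) * x.2.2)
  have hcard : (Finset.univ : Finset (ZMod c × ZMod b)).card < S.card := by
    simp only [Finset.card_univ, Fintype.card_prod, ZMod.card, S, Finset.card_product,
      Finset.card_range]
    have h1 := Nat.lt_succ_sqrt (b * c)
    have h2 := Nat.lt_succ_sqrt c
    have h3 := Nat.lt_succ_sqrt b
    simp only [Nat.succ_eq_add_one] at h1 h2 h3
    set p := Nat.sqrt (b * c) + 1
    set q := Nat.sqrt c + 1
    set r := Nat.sqrt b + 1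
    by_contra hcon
    push Not at hcon
    have e1 : b * c * (c * b) < (p * (q * r)) * (p * (q * r)) := by
      calc b * c * (c * b) < (p * p) * ((q * q) * (r * r)) := by
            apply Nat.mul_lt_mul_of_lt_of_le h1 (Nat.mul_le_mul h2.le h3.le) (by positivity)
        _ = _ := by ring
    have e2 := Nat.mul_le_mul hcon hcon
    have : b * c * (c * b) = c * b * (c * b) := by ring
    omega
  obtain ⟨x, hx, y, hy, hxy, hφ⟩ := Finset.exists_ne_map_eq_of_card_lt_of_maps_to hcard
    (f := φ) (fun _ _ => Finset.mem_coe.2 (Finset.mem_univ _))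
  obtain ⟨w1, s1, t1⟩ := x
  obtain ⟨w2, s2, t2⟩ := y
  simp only [S, Finset.mem_product, Finset.mem_range, Nat.lt_succ_iff] at hx hy
  simp only [φ, Prod.mk.injEq] at hφ
  set w : ℤ := (w1 : ℤ) - w2 with hw
  set s : ℤ := (s1 : ℤ) - s2 with hs
  set t : ℤ := (t1 : ℤ) - t2 with ht
  have hne : w ≠ 0 ∨ s ≠ 0 ∨ t ≠ 0 := by
    by_contra hcon
    push Not at hcon
    apply hxy
    simp only [Prod.mk.injEq]
    omega
  have hc1 : (c : ℤ) ∣ w - β * s := by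
    rw [← ZMod.intCast_zmod_eq_zero_iff_dvd]
    have := hφ.1
    push_cast [hw, hs]
    linear_combination this
  have hb1 : (b : ℤ) ∣ w - γ * t := by
    rw [← ZMod.intCast_zmod_eq_zero_iff_dvd]
    have := hφ.2
    push_cast [hw, ht]
    linear_combination this
  have sqb : ∀ (a1 a2 n : ℕ), a1 ≤ Nat.sqrt n → a2 ≤ Nat.sqrt n →
      ((a1 : ℤ) - a2) ^ 2 ≤ n := by
    intro a1 a2 n h1 h2
    have h3 : ((Nat.sqrt n : ℕ) : ℤ) * (Nat.sqrt n) ≤ n := by exact_mod_cast Nat.sqrt_le n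
    have h1' : (a1 : ℤ) ≤ Nat.sqrt n := by exact_mod_cast h1
    have h2' : (a2 : ℤ) ≤ Nat.sqrt n := by exact_mod_cast h2
    have : |(a1 : ℤ) - a2| ≤ Nat.sqrt n := by rw [abs_le]; constructor <;> omega
    calc ((a1 : ℤ) - a2) ^ 2 = |(a1 : ℤ) - a2| ^ 2 := (sq_abs _).symm
      _ ≤ (Nat.sqrt n : ℤ) ^ 2 := by gcongr
      _ ≤ n := by rw [sq]; exact h3
  have nsq : ∀ (n : ℕ) (a : ℤ), ¬ IsSquare n → a ^ 2 ≠ n := by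
    intro n a h h2
    apply h
    refine ⟨a.natAbs, ?_⟩
    zify
    rw [← h2, ← sq, sq_abs]
  have bw : w ^ 2 < (b : ℤ) * c := by
    have h1 := sqb w1 w2 (b * c) hx.1 hy.1
    have h2 := nsq (b * c) w hns
    push_cast at h1 h2
    exact lt_of_le_of_ne h1 h2
  have bs : s ^ 2 < (c : ℤ) := lt_of_le_of_ne (sqb s1 s2 c hx.2.1 hy.2.1) (nsq c s hnsc)
  have bt : t ^ 2 ≤ (b : ℤ) := sqb t1 t2 b hx.2.2 hy.2.2
  have hbz : (0 : ℤ) < b := by exact_mod_cast hb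
  have hcz : (0 : ℤ) < c := by exact_mod_cast (by omega : 0 < c)
  have hcop : IsCoprime (c : ℤ) (b : ℤ) := by
    rw [Int.isCoprime_iff_gcd_eq_one, Int.gcd_natCast_natCast]
    exact (Nat.coprime_of_squarefree_mul hsq).symm
  have hdv : (c : ℤ) * b ∣ w ^ 2 - b * s ^ 2 + c * t ^ 2 := by
    apply hcop.mul_dvd
    · obtain ⟨e, he⟩ := hc1
      obtain ⟨e', he'⟩ := hβ
      exact ⟨e * (w + β * s) + e' * s ^ 2 + t ^ 2, by
        linear_combination (w + β * s) * he + s ^ 2 * he'⟩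
    · obtain ⟨e, he⟩ := hb1
      obtain ⟨e', he'⟩ := hγ
      exact ⟨e * (w + γ * t) + e' * t ^ 2 - s ^ 2, by
        linear_combination (w + γ * t) * he + t ^ 2 * he'⟩
  obtain ⟨q, hq⟩ := hdv
  have q0 : 0 ≤ q := by
    by_contra hneg
    have : q ≤ -1 := by omega
    have h5 : (c : ℤ) * b * q ≤ c * b * (-1) := by gcongr
    nlinarith [sq_nonneg w, sq_nonneg t, mul_lt_mul_of_pos_left bs hbz]
  have q1 : q ≤ 1 := by
    by_contra hneg
    have : 2 ≤ q := by omega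
    have h5 : (c : ℤ) * b * 2 ≤ c * b * q := by gcongr
    nlinarith [sq_nonneg s, mul_le_mul_of_nonneg_left bt hcz.le, mul_nonneg hbz.le (sq_nonneg s)]
  interval_cases q
  · exact ⟨w, s, t, hne, by linarith⟩
  · refine ⟨w * s - c * t, s ^ 2 + c, w + s * t, Or.inr (Or.inl (by positivity)), ?_⟩
    have : w ^ 2 + c * t ^ 2 = b * (s ^ 2 + c) := by linarith
    calc (w * s - c * t) ^ 2 = (s ^ 2 + c) * (w ^ 2 + c * t ^ 2) - c * (w + s * t) ^ 2 := by ring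
      _ = _ := by rw [this]; ring

theorem exists_sqrt_mod (a : ℤ) (c : ℕ) (hc : Squarefree c)
    (h : ∀ p : ℕ, p.Prime → p ∣ c → ∃ β : ℤ, (p : ℤ) ∣ β ^ 2 - a) :
    ∃ β : ℤ, (c : ℤ) ∣ β ^ 2 - a := by
  induction c using Nat.recOnMul with
  | zero => exact absurd hc not_squarefree_zero
  | one => exact ⟨0, by simp⟩
  | prime p hp => exact h p hp dvd_rfl
  | mul m n ihm ihn =>
    have hcop := Nat.coprime_of_squarefree_mul hc
    obtain ⟨β, hβ⟩ := ihm (hc.of_mul_left) (fun p hp hd => h p hp (hd.mul_right n))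
    obtain ⟨γ, hγ⟩ := ihn (hc.of_mul_right) (fun p hp hd => h p hp (hd.mul_left m))
    have hcz : IsCoprime (m : ℤ) (n : ℤ) := by
      rw [Int.isCoprime_iff_gcd_eq_one, Int.gcd_natCast_natCast]; exact hcop
    obtain ⟨u, v, huv⟩ := hcz
    refine ⟨u * m * γ + v * n * β, ?_⟩
    push_cast
    apply IsCoprime.mul_dvd ⟨u, v, huv⟩
    · have e : (m : ℤ) ∣ (u * m * γ + v * n * β) - β :=
        ⟨u * γ - u * β, by linear_combination β * huv⟩
      have := (e.mul_right ((u * m * γ + v * n * β) + β)).add hβ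
      convert this using 1
      ring
    · have e : (n : ℤ) ∣ (u * m * γ + v * n * β) - γ :=
        ⟨v * β - v * γ, by linear_combination γ * huv⟩
      have := (e.mul_right ((u * m * γ + v * n * β) + γ)).add hγ
      convert this using 1
      ring

theorem sqrt_mod_of_jacobi {p : ℕ} (hp : p.Prime) {a : ℤ} (h : jacobiSym a p = 1) :
    ∃ β : ℤ, (p : ℤ) ∣ β ^ 2 - a := by
  have : Fact p.Prime := ⟨hp⟩
  obtain ⟨x, hx⟩ := ZMod.isSquare_of_jacobiSym_eq_one h
  obtain ⟨β, rfl⟩ := ZMod.intCast_surjective x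
  refine ⟨β, ?_⟩
  rw [← ZMod.intCast_zmod_eq_zero_iff_dvd]
  push_cast
  rw [hx]; ring

theorem jacobi_of_sq_mul {p : ℕ} (hp : p.Prime) {a w s : ℤ} (h : (p : ℤ) ∣ w ^ 2 - a * s ^ 2)
    (hs : ¬ (p : ℤ) ∣ s) (ha : ¬ (p : ℤ) ∣ a) : jacobiSym a p = 1 := by
  have : Fact p.Prime := ⟨hp⟩
  rw [← jacobiSym.legendreSym.to_jacobiSym]
  rw [← ZMod.intCast_zmod_eq_zero_iff_dvd] at h hs ha
  rw [legendreSym.eq_one_iff p ha]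
  refine ⟨(w : ZMod p) / s, ?_⟩
  push_cast at h
  field_simp
  linear_combination -h

/-- `b` is a norm from `ℚ(√D)`. -/
def IsNormQ (D b : ℕ) : Prop := ∃ s t : ℚ, (b : ℚ) = s ^ 2 - D * t ^ 2

theorem isNormQ_of_legendre (b c : ℕ) (hb : 0 < b) (hc : 2 ≤ c) (hsq : Squarefree (b * c))
    (hβ : ∀ p : ℕ, p.Prime → p ∣ c → ∃ β : ℤ, (p : ℤ) ∣ β ^ 2 - b)
    (hγ : ∀ p : ℕ, p.Prime → p ∣ b → ∃ γ : ℤ, (p : ℤ) ∣ γ ^ 2 - (-c)) : IsNormQ (b * c) b := by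
  obtain ⟨β, hβ⟩ := exists_sqrt_mod b c hsq.of_mul_right hβ
  obtain ⟨γ, hγ⟩ := exists_sqrt_mod (-c) b hsq.of_mul_left hγ
  obtain ⟨w, s, t, hw, h⟩ := legendre_aux b c hb hc hsq β γ hβ (by simpa using hγ)
  refine ⟨b * s / w, t / w, ?_⟩
  have hw' : (w : ℚ) ≠ 0 := by exact_mod_cast hw
  have h' : (w : ℚ) ^ 2 = b * s ^ 2 - c * t ^ 2 := by exact_mod_cast h
  push_cast
  field_simp
  rw [h']

theorem isNormQ_legendre (b c : ℕ) (hb : 0 < b) (hsq : Squarefree (b * c))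
    (h : IsNormQ (b * c) b) :
    (∀ p : ℕ, p.Prime → p ∣ c → jacobiSym b p = 1) ∧
    (∀ p : ℕ, p.Prime → p ∣ b → jacobiSym (-c) p = 1) := by
  obtain ⟨x, y, hxy⟩ := h
  -- integer solution
  have hIntg : ∃ s t w : ℤ, w ≠ 0 ∧ (b : ℤ) * w ^ 2 = s ^ 2 - (b * c : ℕ) * t ^ 2 := by
    refine ⟨x.num * y.den, y.num * x.den, x.den * y.den, by simp, ?_⟩
    have hx : (x.den : ℚ) ≠ 0 := by simp
    have hy : (y.den : ℚ) ≠ 0 := by simp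
    have : ((b : ℚ)) * (x.den * y.den) ^ 2 = (x.num * y.den) ^ 2
        - (b * c : ℕ) * (y.num * x.den) ^ 2 := by
      rw [hxy, ← Rat.mul_den_eq_num x, ← Rat.mul_den_eq_num y]
      push_cast
      ring
    exact_mod_cast this
  -- primitive integer solution by minimality
  have hmin : ∃ s t w : ℤ, w ≠ 0 ∧ (b : ℤ) * w ^ 2 = s ^ 2 - (b * c : ℕ) * t ^ 2 ∧
      ∀ p : ℕ, p.Prime → ¬ ((p : ℤ) ∣ s ∧ (p : ℤ) ∣ t ∧ (p : ℤ) ∣ w) := by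
    let P : ℕ → Prop := fun n => ∃ s t w : ℤ, w ≠ 0 ∧ w.natAbs = n ∧
      (b : ℤ) * w ^ 2 = s ^ 2 - (b * c : ℕ) * t ^ 2
    have hP : ∃ n, P n := by
      obtain ⟨s, t, w, hw, h⟩ := hIntg
      exact ⟨_, s, t, w, hw, rfl, h⟩
    obtain ⟨s, t, w, hw, hn, h⟩ := Nat.find_spec hP
    refine ⟨s, t, w, hw, h, ?_⟩
    rintro p hp ⟨⟨s', rfl⟩, ⟨t', rfl⟩, ⟨w', rfl⟩⟩
    have hp0 : (p : ℤ) ≠ 0 := by exact_mod_cast hp.ne_zero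
    have hw' : w' ≠ 0 := right_ne_zero_of_mul hw
    refine Nat.find_min hP (m := w'.natAbs) ?_ ⟨s', t', w', hw', rfl, ?_⟩
    · rw [← hn, Int.natAbs_mul, Int.natAbs_natCast]
      have h1 : 0 < w'.natAbs := Int.natAbs_pos.2 hw'
      have h2 := hp.two_le
      nlinarith
    · have hp2 : (p : ℤ) ^ 2 ≠ 0 := pow_ne_zero 2 hp0
      apply mul_left_cancel₀ hp2
      linear_combination h
  obtain ⟨s, t, w, hw, h, hprim⟩ := hmin
  have hbs : (b : ℤ) ∣ s := by
    have h1 : (b : ℤ) ∣ s ^ 2 := ⟨w ^ 2 + c * t ^ 2, by push_cast at h; linarith⟩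
    have hsb : Squarefree (b : ℤ) := by
      rw [Int.squarefree_natCast]; exact hsq.of_mul_left
    exact (hsb.dvd_pow_iff_dvd two_ne_zero).1 h1
  obtain ⟨s', rfl⟩ := hbs
  have hb0 : (b : ℤ) ≠ 0 := by exact_mod_cast hb.ne'
  have h2 : w ^ 2 = b * s' ^ 2 - c * t ^ 2 := by
    apply mul_left_cancel₀ hb0
    push_cast at h
    linear_combination h
  have hcop := Nat.coprime_of_squarefree_mul hsq
  have key : ∀ p : ℕ, p.Prime → ∀ n : ℕ, Squarefree n → p ∣ n → ∀ u : ℤ,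
      (p : ℤ) ^ 2 ∣ n * u ^ 2 → (p : ℤ) ∣ u := by
    intro p hp n hn hpn u hu
    obtain ⟨n', rfl⟩ := hpn
    have hp0 : (p : ℤ) ≠ 0 := by exact_mod_cast hp.ne_zero
    have h3 : (p : ℤ) ∣ n' * u ^ 2 := by
      rw [sq] at hu
      push_cast at hu
      rw [mul_assoc] at hu
      exact (mul_dvd_mul_iff_left hp0).1 hu
    have hpp : Prime (p : ℤ) := Nat.prime_iff_prime_int.1 hp
    rcases hpp.dvd_or_dvd h3 with h4 | h4
    · exfalso
      have h5 : p ∣ n' := by exact_mod_cast h4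
      have := Nat.coprime_of_squarefree_mul hn
      have h6 := Nat.dvd_gcd dvd_rfl h5
      rw [this] at h6
      exact hp.one_lt.ne' (Nat.dvd_one.1 h6)
    · exact hpp.dvd_of_dvd_pow h4
  constructor
  · intro p hp hpc
    have hpp : Prime (p : ℤ) := Nat.prime_iff_prime_int.1 hp
    have hpcz : (p : ℤ) ∣ c := by exact_mod_cast hpc
    have hpb : ¬ (p : ℤ) ∣ b := by
      intro hh
      have hh' : p ∣ b := by exact_mod_cast hh
      have h6 := Nat.dvd_gcd hh' hpc
      rw [hcop] at h6
      exact hp.one_lt.ne' (Nat.dvd_one.1 h6)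
    refine jacobi_of_sq_mul hp (w := w) (s := s') ?_ ?_ hpb
    · rw [h2]
      exact (hpcz.mul_right (-t ^ 2)).trans (by ring_nf; exact dvd_rfl)
    · intro hs
      have hw2 : (p : ℤ) ∣ w := by
        apply hpp.dvd_of_dvd_pow (n := 2)
        rw [h2]
        exact dvd_sub ((dvd_pow hs two_ne_zero).mul_left _) (hpcz.mul_right _)
      have h7 : (p : ℤ) ^ 2 ∣ c * t ^ 2 := by
        have : (c : ℤ) * t ^ 2 = b * s' ^ 2 - w ^ 2 := by linarith
        rw [this]
        exact dvd_sub ((pow_dvd_pow_of_dvd hs 2).mul_left _) (pow_dvd_pow_of_dvd hw2 2)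
      exact hprim p hp ⟨hs.mul_left _, key p hp c hsq.of_mul_right hpc t h7, hw2⟩
  · intro p hp hpb
    have hpp : Prime (p : ℤ) := Nat.prime_iff_prime_int.1 hp
    have hpbz : (p : ℤ) ∣ b := by exact_mod_cast hpb
    have hpc : ¬ (p : ℤ) ∣ -c := by
      rw [dvd_neg]
      intro hh
      have hh' : p ∣ c := by exact_mod_cast hh
      have h6 := Nat.dvd_gcd hpb hh'
      rw [hcop] at h6
      exact hp.one_lt.ne' (Nat.dvd_one.1 h6)
    refine jacobi_of_sq_mul hp (w := w) (s := t) ?_ ?_ hpc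
    · rw [h2]
      exact (hpbz.mul_right (s' ^ 2)).trans (by ring_nf; exact dvd_rfl)
    · intro hs
      have hw2 : (p : ℤ) ∣ w := by
        apply hpp.dvd_of_dvd_pow (n := 2)
        rw [h2]
        exact dvd_sub (hpbz.mul_right _) ((dvd_pow hs two_ne_zero).mul_left _)
      exact hprim p hp ⟨hpbz.mul_right _, hs, hw2⟩

/-- The set of `m ∣ d` counted by the 4-rank. -/
def goodSplit (d m : ℕ) : Prop :=
  (∀ p : ℕ, p.Prime → p ∣ d / m → jacobiSym m p = 1) ∧
  (∀ p : ℕ, p.Prime → p ∣ m → jacobiSym (-(d / m : ℕ)) p = 1)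

/-- `2 ^ rk₄` as a count. -/
noncomputable def fcount (d : ℕ) : ℕ := (d.divisors.filter (goodSplit d)).card

theorem isNormQ_mul {D a b : ℕ} (ha : IsNormQ D a) (hb : IsNormQ D b) : IsNormQ D (a * b) := by
  obtain ⟨s, t, h⟩ := ha
  obtain ⟨u, v, h'⟩ := hb
  exact ⟨s * u + D * t * v, s * v + t * u, by push_cast; rw [h, h']; ring⟩

theorem isNormQ_of_sq_mul {D a r : ℕ} (hr : r ≠ 0) (h : IsNormQ D (r ^ 2 * a)) : IsNormQ D a := by
  obtain ⟨s, t, h⟩ := h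
  have hr' : (r : ℚ) ≠ 0 := by exact_mod_cast hr
  refine ⟨s / r, t / r, ?_⟩
  push_cast at h
  field_simp
  linarith

theorem isNormQ_two {d : ℕ} (hsq : Squarefree d) (hd : d % 4 = 3)
    (hp : ∀ p : ℕ, p.Prime → p ∣ d → jacobiSym 2 p = 1) : IsNormQ (2 * d) 2 := by
  have hodd : Nat.Coprime 2 d := by
    rw [Nat.coprime_two_left, Nat.odd_iff]; omega
  apply isNormQ_of_legendre 2 d two_pos (by omega)
  · rw [Nat.squarefree_mul hodd]; exact ⟨Nat.prime_two.squarefree, hsq⟩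
  · intro p hpp hpd
    exact_mod_cast sqrt_mod_of_jacobi hpp (hp p hpp hpd)
  · intro p hpp hp2
    rw [Nat.prime_dvd_prime_iff_eq hpp Nat.prime_two] at hp2
    subst hp2
    exact ⟨1, by omega⟩

theorem isNormQ_iff_goodSplit {d : ℕ} (hsq : Squarefree d) (hd : d % 4 = 3)
    (hp : ∀ p : ℕ, p.Prime → p ∣ d → jacobiSym 2 p = 1) {m : ℕ} (hm : m ∣ d) : IsNormQ (2 * d) m ↔ goodSplit d m := by
  obtain ⟨n, rfl⟩ := hm
  have hm0 : 0 < m := by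
    rcases Nat.eq_zero_or_pos m with h | h
    · subst h; simp at hd
    · exact h
  have hn0 : 0 < n := by
    rcases Nat.eq_zero_or_pos n with h | h
    · subst h; simp at hd
    · exact h
  have hodd : Nat.Coprime 2 (m * n) := by
    rw [Nat.coprime_two_left, Nat.odd_iff]; omega
  have hsq2 : Squarefree (m * (2 * n)) := by
    have : m * (2 * n) = 2 * (m * n) := by ring
    rw [this, Nat.squarefree_mul hodd]; exact ⟨Nat.prime_two.squarefree, hsq⟩
  have hmm : 2 * (m * n) = m * (2 * n) := by ring
  unfold goodSplit
  rw [Nat.mul_div_cancel_left n hm0, hmm]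
  have hJ : ∀ p : ℕ, p.Prime → p ∣ m → jacobiSym (-(2 * n : ℕ)) p = jacobiSym (-n) p := by
    intro p hpp hpm
    have : (-(2 * n : ℕ) : ℤ) = 2 * (-n) := by push_cast; ring
    rw [this, jacobiSym.mul_left, hp p hpp (hpm.mul_right n), one_mul]
  constructor
  · intro h
    obtain ⟨h1, h2⟩ := isNormQ_legendre m (2 * n) hm0 hsq2 h
    refine ⟨fun p hpp hpn => h1 p hpp (hpn.mul_left 2), fun p hpp hpm => ?_⟩
    rw [← hJ p hpp hpm]
    exact h2 p hpp hpm
  · rintro ⟨h1, h2⟩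
    apply isNormQ_of_legendre m (2 * n) hm0 (by omega) hsq2
    · intro p hpp hpc
      rcases (Nat.Prime.dvd_mul hpp).1 hpc with h | h
      · rw [Nat.prime_dvd_prime_iff_eq hpp Nat.prime_two] at h
        subst h
        exact ⟨m, by
          have : (m : ℤ) ^ 2 - m = m * (m - 1) := by ring
          rw [this]
          exact (Int.even_mul_pred_self m).two_dvd⟩
      · exact sqrt_mod_of_jacobi hpp (h1 p hpp h)
    · intro p hpp hpm
      apply sqrt_mod_of_jacobi hpp
      rw [hJ p hpp hpm]
      exact h2 p hpp hpm

/-- Divisors of `2d` which are norms: twice the count for `d`. -/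
theorem card_norm_divisors {d : ℕ} (hsq : Squarefree d) (hd : d % 4 = 3)
    (hp : ∀ p : ℕ, p.Prime → p ∣ d → jacobiSym 2 p = 1) :
    ((2 * d).divisors.filter (IsNormQ (2 * d))).card = 2 * fcount d := by
  have hodd : Nat.Coprime 2 d := by
    rw [Nat.coprime_two_left, Nat.odd_iff]; omega
  have hd0 : d ≠ 0 := by rintro rfl; simp at hd
  have h2 := isNormQ_two hsq hd hp
  have e : (2 * d).divisors.filter (IsNormQ (2 * d)) =
      (d.divisors.filter (goodSplit d)) ∪ (d.divisors.filter (goodSplit d)).image (2 * ·) := by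
    ext b
    simp only [Finset.mem_filter, Nat.mem_divisors, Finset.mem_union, Finset.mem_image]
    constructor
    · rintro ⟨⟨hb, _⟩, hn⟩
      by_cases hb2 : 2 ∣ b
      · right
        obtain ⟨m, rfl⟩ := hb2
        have hmd : m ∣ d := Nat.dvd_of_mul_dvd_mul_left two_pos hb
        refine ⟨m, ⟨⟨hmd, hd0⟩, ?_⟩, rfl⟩
        rw [← isNormQ_iff_goodSplit hsq hd hp hmd]
        apply isNormQ_of_sq_mul two_ne_zero
        have := isNormQ_mul h2 hn
        convert this using 1
        ring
      · left
        have hmd : b ∣ d := by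
          have : Nat.Coprime b 2 := by
            rw [Nat.coprime_two_right, Nat.odd_iff]; omega
          exact this.dvd_of_dvd_mul_left hb
        exact ⟨⟨hmd, hd0⟩, (isNormQ_iff_goodSplit hsq hd hp hmd).1 hn⟩
    · rintro (⟨⟨hb, _⟩, hg⟩ | ⟨m, ⟨⟨hm, _⟩, hg⟩, rfl⟩)
      · exact ⟨⟨hb.mul_left 2, by omega⟩, (isNormQ_iff_goodSplit hsq hd hp hb).2 hg⟩
      · exact ⟨⟨Nat.mul_dvd_mul_left 2 hm, by omega⟩,
          isNormQ_mul h2 ((isNormQ_iff_goodSplit hsq hd hp hm).2 hg)⟩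
  rw [e, Finset.card_union_of_disjoint, Finset.card_image_of_injective, fcount]
  · ring
  · intro a b h; simpa using h
  · rw [Finset.disjoint_left]
    intro b hb hb2
    simp only [Finset.mem_filter, Nat.mem_divisors, Finset.mem_image] at hb hb2
    obtain ⟨m, -, rfl⟩ := hb2
    have : 2 ∣ d := (Dvd.intro m rfl).trans hb.1.1
    omega
end FK

namespace FK

/-- A field presented as `ℚ(√D)`, with `r = √D`. -/
structure QF (K : Type*) [Field K] [CharZero K] (D : ℕ) (r : K) : Prop where
  sq : r ^ 2 = D
  sqf : Squarefree D
  mod4 : D % 4 = 2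
  rep : ∀ x : K, ∃ s t : ℚ, x = s + t * r

section
variable {K : Type*} [Field K] [CharZero K] {D : ℕ} {r : K}

theorem QF.no_sq (h : QF K D r) (s t : ℚ) (hst : s ^ 2 = D * t ^ 2) : t = 0 := by
  by_contra ht
  have h1 : IsSquare ((D : ℕ) : ℚ) := ⟨s / t, by field_simp; linear_combination -hst⟩
  rw [Rat.isSquare_natCast_iff] at h1
  obtain ⟨a, ha⟩ := h1
  have := h.sqf a ⟨1, by rw [ha, mul_one]⟩
  rw [Nat.isUnit_iff] at this
  have h4 := h.mod4
  subst this; omega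

theorem QF.inj (h : QF K D r) {s t s' t' : ℚ} (e : (s : K) + t * r = s' + t' * r) :
    s = s' ∧ t = t' := by
  have e2 : ((s - s' : ℚ) : K) = ((t' - t : ℚ) : K) * r := by
    push_cast; linear_combination e
  have e3 : (s - s') ^ 2 = D * (t' - t) ^ 2 := by
    have : (((s - s') ^ 2 : ℚ) : K) = ((D * (t' - t) ^ 2 : ℚ) : K) := by
      push_cast at e2 ⊢
      rw [e2, mul_pow, h.sq]; ring
    exact_mod_cast this
  have e4 := h.no_sq _ _ e3
  rw [e4] at e3
  have : s - s' = 0 := by simpa using e3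
  constructor <;> linarith

/-- rational part -/
noncomputable def QF.re (h : QF K D r) (x : K) : ℚ := (h.rep x).choose
/-- irrational part -/
noncomputable def QF.im (h : QF K D r) (x : K) : ℚ := (h.rep x).choose_spec.choose

theorem QF.eq (h : QF K D r) (x : K) : x = h.re x + h.im x * r :=
  (h.rep x).choose_spec.choose_spec

theorem QF.re_im (h : QF K D r) {x : K} {s t : ℚ} (e : x = s + t * r) :
    h.re x = s ∧ h.im x = t := h.inj (by rw [← h.eq x, e])

theorem QF.re_mul (h : QF K D r) (x y : K) : h.re (x * y) = h.re x * h.re y + D * (h.im x * h.im y)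
    ∧ h.im (x * y) = h.re x * h.im y + h.im x * h.re y := by
  apply h.re_im
  conv_lhs => rw [h.eq x, h.eq y]
  push_cast
  linear_combination (h.im x : K) * h.im y * h.sq

theorem QF.re_add (h : QF K D r) (x y : K) : h.re (x + y) = h.re x + h.re y
    ∧ h.im (x + y) = h.im x + h.im y := by
  apply h.re_im
  conv_lhs => rw [h.eq x, h.eq y]
  push_cast
  ring

theorem QF.re_rat (h : QF K D r) (q : ℚ) : h.re (q : K) = q ∧ h.im (q : K) = 0 := by
  apply h.re_im; simp

theorem QF.re_one (h : QF K D r) : h.re (1 : K) = 1 ∧ h.im (1 : K) = 0 := by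
  apply h.re_im; simp

theorem QF.re_zero (h : QF K D r) : h.re (0 : K) = 0 ∧ h.im (0 : K) = 0 := by
  apply h.re_im; simp

/-- conjugation -/
noncomputable def QF.conj (h : QF K D r) : K →+* K where
  toFun x := h.re x - h.im x * r
  map_zero' := by simp [h.re_zero]
  map_one' := by simp [h.re_one]
  map_add' x y := by simp only [h.re_add]; push_cast; ring
  map_mul' x y := by
    simp only [h.re_mul]; push_cast
    linear_combination (-(h.im x : K) * h.im y) * h.sq

theorem QF.conj_apply (h : QF K D r) (x : K) : h.conj x = h.re x - h.im x * r := rfl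

theorem QF.re_conj (h : QF K D r) (x : K) : h.re (h.conj x) = h.re x ∧ h.im (h.conj x) = -h.im x := by
  apply h.re_im; rw [h.conj_apply]; push_cast; ring

theorem QF.conj_conj (h : QF K D r) (x : K) : h.conj (h.conj x) = x := by
  conv_rhs => rw [h.eq x]
  rw [h.conj_apply, (h.re_conj x).1, (h.re_conj x).2]; push_cast; ring

/-- norm -/
noncomputable def QF.nm (h : QF K D r) (x : K) : ℚ := h.re x ^ 2 - D * h.im x ^ 2

theorem QF.mul_conj (h : QF K D r) (x : K) : x * h.conj x = (h.nm x : K) := by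
  conv_lhs => rw [h.conj_apply]
  nth_rewrite 1 [h.eq x]
  rw [QF.nm]; push_cast
  linear_combination (-(h.im x : K) ^ 2) * h.sq

theorem QF.add_conj (h : QF K D r) (x : K) : x + h.conj x = ((2 * h.re x : ℚ) : K) := by
  conv_lhs => rw [h.conj_apply]
  nth_rewrite 1 [h.eq x]
  push_cast; ring

theorem QF.conj_rat (h : QF K D r) (q : ℚ) : h.conj (q : K) = q := by simp

theorem QF.nm_mul (h : QF K D r) (x y : K) : h.nm (x * y) = h.nm x * h.nm y := by
  simp only [QF.nm, h.re_mul]; ring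

theorem QF.nm_rat (h : QF K D r) (q : ℚ) : h.nm (q : K) = q ^ 2 := by
  simp [QF.nm, h.re_rat]

theorem QF.nm_one (h : QF K D r) : h.nm (1 : K) = 1 := by
  simp [QF.nm, h.re_one]

theorem QF.nm_conj (h : QF K D r) (x : K) : h.nm (h.conj x) = h.nm x := by
  simp [QF.nm, h.re_conj]

theorem QF.nm_ne_zero (h : QF K D r) {x : K} (hx : x ≠ 0) : h.nm x ≠ 0 := by
  intro e
  have := h.mul_conj x
  rw [e] at this
  simp [hx] at this

theorem QF.conj_r (h : QF K D r) : h.conj r = -r := by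
  have := h.re_im (x := r) (s := 0) (t := 1) (by simp)
  rw [h.conj_apply, this.1, this.2]; simp

/-- a real embedding -/
noncomputable def QF.emb (h : QF K D r) : K →+* ℝ where
  toFun x := h.re x + h.im x * Real.sqrt D
  map_zero' := by simp [h.re_zero]
  map_one' := by simp [h.re_one]
  map_add' x y := by simp only [h.re_add]; push_cast; ring
  map_mul' x y := by
    simp only [h.re_mul]; push_cast
    have : Real.sqrt D ^ 2 = D := Real.sq_sqrt (by positivity)
    linear_combination (-(h.im x : ℝ) * h.im y) * this

/-- totally positive -/
def QF.TP (h : QF K D r) (x : K) : Prop := 0 < h.re x ∧ 0 < h.nm x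

theorem QF.tp_iff (h : QF K D r) (x : K) : (∀ φ : K →+* ℝ, 0 < φ x) ↔ h.TP x := by
  have key : ∀ φ : K →+* ℝ, φ x * φ (h.conj x) = h.nm x ∧ φ x + φ (h.conj x) = 2 * h.re x := by
    intro φ
    constructor
    · rw [← map_mul, h.mul_conj]; simp
    · rw [← map_add, h.add_conj, map_ratCast]; push_cast; ring
  constructor
  · intro H
    have h1 := H h.emb
    have h2 := H (h.emb.comp h.conj)
    obtain ⟨k1, k2⟩ := key h.emb
    simp only [RingHom.comp_apply] at h2
    refine ⟨?_, ?_⟩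
    · have : (0 : ℝ) < h.re x := by linarith
      exact_mod_cast this
    · have : (0 : ℝ) < h.nm x := by rw [← k1]; positivity
      exact_mod_cast this
  · rintro ⟨h1, h2⟩ φ
    obtain ⟨k1, k2⟩ := key φ
    have h1' : (0 : ℝ) < h.re x := by exact_mod_cast h1
    have h2' : (0 : ℝ) < h.nm x := by exact_mod_cast h2
    by_contra hn
    push Not at hn
    have : φ (h.conj x) ≤ 0 := by
      by_contra hc
      push Not at hc
      nlinarith
    linarith

theorem QF.tp_mul (h : QF K D r) {x y : K} (hx : h.TP x) (hy : h.TP y) : h.TP (x * y) := by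
  rw [← h.tp_iff] at *
  intro φ; rw [map_mul]; exact mul_pos (hx φ) (hy φ)

theorem QF.tp_add (h : QF K D r) {x y : K} (hx : h.TP x) (hy : h.TP y) : h.TP (x + y) := by
  rw [← h.tp_iff] at *
  intro φ; rw [map_add]; exact add_pos (hx φ) (hy φ)

theorem QF.tp_inv (h : QF K D r) {x : K} (hx : h.TP x) : h.TP x⁻¹ := by
  rw [← h.tp_iff] at *
  intro φ; rw [map_inv₀]; exact inv_pos.2 (hx φ)

theorem QF.tp_ne (h : QF K D r) {x : K} (hx : h.TP x) : x ≠ 0 := by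
  rintro rfl
  have := hx.1
  rw [h.re_zero.1] at this
  exact lt_irrefl _ this

theorem QF.tp_rat (h : QF K D r) {q : ℚ} (hq : 0 < q) : h.TP (q : K) := by
  refine ⟨by rwa [(h.re_rat q).1], by rw [h.nm_rat]; positivity⟩

theorem QF.tp_one (h : QF K D r) : h.TP (1 : K) := by
  refine ⟨by rw [h.re_one.1]; norm_num, by rw [h.nm_one]; norm_num⟩

theorem QF.tp_or_neg (h : QF K D r) {x : K} (hx : 0 < h.nm x) : h.TP x ∨ h.TP (-x) := by
  have e : -x = ((-1 : ℚ) : K) * x := by simp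
  have hre : h.re (-x) = - h.re x := by
    rw [e, (h.re_mul _ _).1, (h.re_rat _).1, (h.re_rat _).2]; ring
  have hnm : h.nm (-x) = h.nm x := by
    rw [e, h.nm_mul, h.nm_rat]; ring
  have : h.re x ≠ 0 := by
    intro e0
    rw [QF.nm, e0] at hx
    have : (0 : ℚ) ≤ D * h.im x ^ 2 := by positivity
    linarith
  rcases this.lt_or_gt with h1 | h1
  · right; exact ⟨by rw [hre]; linarith, by rw [hnm]; exact hx⟩
  · left; exact ⟨h1, hx⟩

/-- integrality criterion -/
theorem QF.isIntegral_of (h : QF K D r) {x : K} {a b : ℤ} (ha : 2 * h.re x = a) (hb : h.nm x = b) :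
    IsIntegral ℤ x := by
  refine ⟨Polynomial.X ^ 2 - Polynomial.C a * Polynomial.X + Polynomial.C b, ?_, ?_⟩
  · rw [sub_add]
    refine Polynomial.monic_X_pow_sub ?_
    compute_degree
    norm_num
  · have e1 := h.mul_conj x
    have e2 := h.add_conj x
    rw [ha] at e2; rw [hb] at e1
    simp only [Polynomial.eval₂_add, Polynomial.eval₂_sub, Polynomial.eval₂_mul,
      Polynomial.eval₂_pow, Polynomial.eval₂_X, Polynomial.eval₂_C]
    simp only [Rat.cast_intCast] at e1 e2
    simp only [eq_intCast]
    rw [← e1, ← e2]; ring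

theorem QF.of_isIntegral (h : QF K D r) {x : K} (hx : IsIntegral ℤ x) :
    ∃ m n : ℤ, h.re x = m ∧ h.im x = n := by
  have hc : IsIntegral ℤ (h.conj x) := hx.map (h.conj.toIntAlgHom)
  have i1 : IsIntegral ℤ ((h.nm x : ℚ) : K) := h.mul_conj x ▸ hx.mul hc
  have i2 : IsIntegral ℤ ((2 * h.re x : ℚ) : K) := h.add_conj x ▸ hx.add hc
  have inj : Function.Injective (algebraMap ℚ K) := (algebraMap ℚ K).injective
  have i1' : IsIntegral ℤ (h.nm x) := by
    rw [← isIntegral_algebraMap_iff inj]; simpa using i1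
  have i2' : IsIntegral ℤ (2 * h.re x) := by
    rw [← isIntegral_algebraMap_iff inj]; simpa using i2
  obtain ⟨a, ha⟩ := IsIntegrallyClosed.isIntegral_iff.1 i1'
  obtain ⟨m, hm⟩ := IsIntegrallyClosed.isIntegral_iff.1 i2'
  simp only [algebraMap_int_eq, eq_intCast] at ha hm
  -- (2 im)^2 * D is an integer
  have e1 : (D : ℚ) * (2 * h.im x) ^ 2 = ((m ^ 2 - 4 * a : ℤ) : ℚ) := by
    push_cast; rw [ha, hm, QF.nm]; ring
  have hden : (2 * h.im x).den = 1 := by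
    set q := 2 * h.im x with hq
    have e2 : (D : ℤ) * q.num ^ 2 = (m ^ 2 - 4 * a) * q.den ^ 2 := by
      have : (D : ℚ) * (q.num) ^ 2 = ((m ^ 2 - 4 * a : ℤ) : ℚ) * q.den ^ 2 := by
        rw [← e1, ← Rat.mul_den_eq_num q]; ring
      exact_mod_cast this
    have hcop : IsCoprime ((q.den : ℤ) ^ 2) (q.num ^ 2) := by
      apply IsCoprime.pow
      rw [Int.isCoprime_iff_gcd_eq_one]
      have := q.reduced
      rw [Int.gcd_comm]; simpa [Int.gcd, Nat.Coprime] using this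
    have : ((q.den : ℤ) ^ 2) ∣ D := hcop.dvd_of_dvd_mul_right (by rw [e2]; exact Dvd.intro_left _ rfl)
    have h3 : q.den * q.den ∣ D := by rw [← pow_two]; exact_mod_cast this
    have := h.sqf _ h3
    rwa [Nat.isUnit_iff] at this
  obtain ⟨n, hn⟩ : ∃ n : ℤ, 2 * h.im x = n := ⟨_, ((Rat.den_eq_one_iff _).1 hden).symm⟩
  rw [hn] at e1
  have e3 : (D : ℤ) * n ^ 2 = m ^ 2 - 4 * a := by exact_mod_cast e1
  have hD : (D : ℤ) % 4 = 2 := by have := h.mod4; omega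
  obtain ⟨c, hc⟩ : ∃ c : ℤ, (D : ℤ) = 4 * c + 2 := ⟨D / 4, by omega⟩
  have hme : Even m := by
    have : Even (m ^ 2) := ⟨(2 * c + 1) * n ^ 2 + 2 * a, by rw [hc] at e3; linear_combination -e3⟩
    exact (Int.even_pow' two_ne_zero).1 this
  obtain ⟨m', rfl⟩ := hme
  have hne : Even n := by
    have : Even (n ^ 2) := by
      rw [hc] at e3
      exact ⟨m' ^ 2 - a - c * n ^ 2, by linarith⟩
    exact (Int.even_pow' two_ne_zero).1 this
  obtain ⟨n', rfl⟩ := hne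
  refine ⟨m', n', ?_, ?_⟩
  · push_cast at hm; linarith
  · push_cast at hn; linarith

theorem QF.isIntegral_mk (h : QF K D r) (m n : ℤ) : IsIntegral ℤ ((m : K) + n * r) := by
  have e := h.re_im (x := (m : K) + n * r) (s := m) (t := n) (by simp)
  refine h.isIntegral_of (a := 2 * m) (b := m ^ 2 - D * n ^ 2) ?_ ?_
  · rw [e.1]; push_cast; ring
  · rw [QF.nm, e.1, e.2]; push_cast; ring

end

end FK

namespace FK

theorem rat_gcd (u v : ℚ) (hu : u ≠ 0) : ∃ g : ℚ, g ≠ 0 ∧ ∃ a b k l : ℤ, u = g * a ∧ v = g * b ∧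
    g = k * u + l * v := by
  have hu1 := Rat.mul_den_eq_num u
  have hv1 := Rat.mul_den_eq_num v
  have hud : (u.den : ℚ) ≠ 0 := by simp
  have hvd : (v.den : ℚ) ≠ 0 := by simp
  set p : ℤ := u.num * v.den
  set q : ℤ := v.num * u.den
  have hp : (p : ℚ) = u * (u.den * v.den) := by simp only [p]; push_cast; rw [← hu1]; ring
  have hq : (q : ℚ) = v * (u.den * v.den) := by simp only [q]; push_cast; rw [← hv1]; ring
  have hN : (u.den * v.den : ℚ) ≠ 0 := mul_ne_zero hud hvd
  have hp0 : p ≠ 0 := by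
    intro e; rw [e] at hp; simp [hu] at hp
  have hg0 : (Int.gcd p q : ℚ) ≠ 0 := by
    have : Int.gcd p q ≠ 0 := by intro e; exact hp0 (Int.gcd_eq_zero_iff.1 e).1
    exact_mod_cast this
  obtain ⟨a, ha⟩ := Int.gcd_dvd_left p q
  obtain ⟨b, hb⟩ := Int.gcd_dvd_right p q
  have hbez : ((Int.gcd p q : ℤ) : ℚ) = ((p * Int.gcdA p q + q * Int.gcdB p q : ℤ) : ℚ) := by
    rw [← Int.gcd_eq_gcd_ab]
  have ha' : (p : ℚ) = (Int.gcd p q : ℚ) * a := by exact_mod_cast ha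
  have hb' : (q : ℚ) = (Int.gcd p q : ℚ) * b := by exact_mod_cast hb
  refine ⟨Int.gcd p q / (u.den * v.den), div_ne_zero hg0 hN, a, b, Int.gcdA p q, Int.gcdB p q,
    ?_, ?_, ?_⟩
  · rw [div_mul_eq_mul_div, ← ha', hp]; field_simp
  · rw [div_mul_eq_mul_div, ← hb', hq]; field_simp
  · push_cast at hbez
    rw [div_eq_iff hN, hbez, hp, hq]; ring

theorem rat_gcd3 (u v w : ℚ) (hu : u ≠ 0) : ∃ g : ℚ, 0 < g ∧ ∃ a b c k l m : ℤ,
    u = g * a ∧ v = g * b ∧ w = g * c ∧ g = k * u + l * v + m * w := by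
  obtain ⟨g, hg, a, b, k, l, h1, h2, h3⟩ := rat_gcd u v hu
  obtain ⟨g', hg', a', b', k', l', h1', h2', h3'⟩ := rat_gcd g w hg
  rcases hg'.lt_or_gt with h | h
  · refine ⟨-g', by linarith, -(a' * a), -(a' * b), -b', -(k' * k), -(k' * l), -l', ?_, ?_, ?_, ?_⟩
    · rw [h1, h1']; push_cast; ring
    · rw [h2, h1']; push_cast; ring
    · rw [h2']; push_cast; ring
    · conv_lhs => rw [h3', h3]
      push_cast; ring
  · refine ⟨g', h, (a' * a), (a' * b), b', (k' * k), (k' * l), l', ?_, ?_, ?_, ?_⟩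
    · rw [h1, h1']; push_cast; ring
    · rw [h2, h1']; push_cast; ring
    · rw [h2']
    · conv_lhs => rw [h3', h3]
      push_cast; ring

variable {K : Type*} [Field K] [NumberField K] {D : ℕ} {r : K}

/-- principal fractional ideal -/
noncomputable abbrev PI (x : K) : FractionalIdeal (𝓞 K)⁰ K := FractionalIdeal.spanSingleton (𝓞 K)⁰ x

theorem fi_add_sup (I J : FractionalIdeal (𝓞 K)⁰ K) : I + J = I ⊔ J := (FractionalIdeal.sup_eq_add I J).symm

theorem PI_mul (x y : K) : PI x * PI y = PI (x * y) :=
  FractionalIdeal.spanSingleton_mul_spanSingleton x y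

theorem PI_one : PI (1 : K) = 1 := FractionalIdeal.spanSingleton_one

theorem PI_ne {x : K} (hx : x ≠ 0) : PI x ≠ 0 := by
  rwa [Ne, FractionalIdeal.spanSingleton_eq_zero_iff]

theorem mem_PI {x y : K} : x ∈ PI y ↔ ∃ z : K, IsIntegral ℤ z ∧ z * y = x := by
  rw [FractionalIdeal.mem_spanSingleton]
  constructor
  · rintro ⟨z, hz⟩
    exact ⟨z, z.2, by rw [← hz, Algebra.smul_def]⟩
  · rintro ⟨z, hz, e⟩
    exact ⟨(⟨z, hz⟩ : 𝓞 K), e⟩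

theorem PI_le {x : K} {I : FractionalIdeal (𝓞 K)⁰ K} : PI x ≤ I ↔ x ∈ I :=
  FractionalIdeal.spanSingleton_le_iff_mem

theorem int_smul_mem {I : FractionalIdeal (𝓞 K)⁰ K} {z x : K} (hz : IsIntegral ℤ z) (hx : x ∈ I) :
    z * x ∈ I := by
  exact I.1.smul_mem (⟨z, hz⟩ : 𝓞 K) hx

theorem add_mem_I {I : FractionalIdeal (𝓞 K)⁰ K} {z x : K} (hz : z ∈ I) (hx : x ∈ I) :
    z + x ∈ I := I.1.add_mem hz hx

theorem PI_eq_iff {x y : K} (hx : x ≠ 0) (hy : y ≠ 0) :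
    PI x = PI y ↔ IsIntegral ℤ (x / y) ∧ IsIntegral ℤ (y / x) := by
  rw [le_antisymm_iff, PI_le, PI_le, mem_PI, mem_PI]
  constructor
  · rintro ⟨⟨z, hz, e⟩, ⟨z', hz', e'⟩⟩
    constructor
    · rw [← e, mul_div_assoc, div_self hy, mul_one]; exact hz
    · rw [← e', mul_div_assoc, div_self hx, mul_one]; exact hz'
  · rintro ⟨h1, h2⟩
    exact ⟨⟨_, h1, div_mul_cancel₀ _ hy⟩, ⟨_, h2, div_mul_cancel₀ _ hx⟩⟩

theorem gen_two (I : FractionalIdeal (𝓞 K)⁰ K) (hI : I ≠ 0) :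
    ∃ α β : K, α ≠ 0 ∧ I = PI α + PI β := by
  obtain ⟨x, hx, hx0⟩ : ∃ x ∈ I, x ≠ 0 := by
    by_contra hc
    push Not at hc
    exact hI (FractionalIdeal.eq_zero_iff.2 hc)
  obtain ⟨y, hy⟩ := IsDedekindDomain.exists_add_spanSingleton_mul_eq (a := PI x) (b := 1) (c := I)
    (PI_le.2 hx) (PI_ne hx0) one_ne_zero
  exact ⟨x, y, hx0, by rw [← hy, mul_one]⟩

theorem sq_one {c : FractionalIdeal (𝓞 K)⁰ K} (h : c * c = 1) : c = 1 := by
  have h0 : (1 + c) ≠ 0 := by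
    intro e
    have : (1 : FractionalIdeal (𝓞 K)⁰ K) ≤ 0 := by
      rw [← e, fi_add_sup]; exact le_sup_left
    exact one_ne_zero (le_antisymm this (FractionalIdeal.zero_le _))
  have h1 : (1 + c) * (1 + c) = (1 + c) * 1 := by
    have : (1 + c) * (1 + c) = (1 + 1) + (c + c) := by
      rw [add_mul, mul_add, one_mul, mul_add, mul_one, h, one_mul]; abel
    rw [this, fi_add_sup, fi_add_sup, fi_add_sup,
      fi_add_sup, sup_idem, sup_idem, mul_one]
  have h2 : 1 + c = 1 := mul_left_cancel₀ h0 h1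
  have h3 : c ≤ 1 := by
    conv_rhs => rw [← h2]
    rw [fi_add_sup]; exact le_sup_right
  refine le_antisymm h3 ?_
  calc (1 : FractionalIdeal (𝓞 K)⁰ K) = c * c := h.symm
    _ ≤ c * 1 := by gcongr
    _ = c := mul_one _

theorem sq_inj {a b : FractionalIdeal (𝓞 K)⁰ K} (ha : a ≠ 0) (h : a * a = b * b) : a = b := by
  have : (b / a) * (b / a) = 1 := by
    rw [div_mul_div_comm, ← h, div_self (mul_ne_zero ha ha)]
  have := sq_one this
  rw [div_eq_one_iff_eq ha] at this
  exact this.symm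

/-- conjugate ideal -/
noncomputable def QF.cI (h : QF K D r) :
    FractionalIdeal (𝓞 K)⁰ K →+* FractionalIdeal (𝓞 K)⁰ K :=
  FractionalIdeal.extendedHom' (f := RingOfIntegers.mapRingHom h.conj) K
    (nonZeroDivisors_le_comap_nonZeroDivisors_of_injective _ (by
      intro x y hxy
      apply RingOfIntegers.ext
      apply h.conj.injective
      rw [← RingOfIntegers.mapRingHom_apply, ← RingOfIntegers.mapRingHom_apply, hxy]))

theorem QF.cI_PI (h : QF K D r) (x : K) : h.cI (PI x) = PI (h.conj x) := by
  rw [QF.cI, FractionalIdeal.extendedHom'_apply, FractionalIdeal.extended_spanSingleton]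
  congr 1
  obtain ⟨a, b, hb, rfl⟩ := IsFractionRing.div_surjective (A := 𝓞 K) x
  rw [map_div₀, map_div₀, IsLocalization.map_eq, IsLocalization.map_eq]
  rfl

theorem QF.cI_cI (h : QF K D r) (I : FractionalIdeal (𝓞 K)⁰ K) : h.cI (h.cI I) = I := by
  by_cases hI : I = 0
  · rw [hI, map_zero, map_zero]
  obtain ⟨α, β, -, rfl⟩ := gen_two I hI
  simp only [map_add, h.cI_PI, h.conj_conj]

theorem QF.cI_ne (h : QF K D r) {I : FractionalIdeal (𝓞 K)⁰ K} (hI : I ≠ 0) : h.cI I ≠ 0 := by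
  intro e; apply hI; rw [← h.cI_cI I, e, map_zero]

theorem QF.normI (h : QF K D r) (I : FractionalIdeal (𝓞 K)⁰ K) (hI : I ≠ 0) :
    ∃ g : ℚ, 0 < g ∧ I * h.cI I = PI (g : K) := by
  obtain ⟨α, β, hα, rfl⟩ := gen_two I hI
  set γ := α * h.conj β with hγ
  have hγc : h.conj γ = β * h.conj α := by rw [hγ, map_mul, h.conj_conj]; ring
  obtain ⟨g, hg, a, b, c, k, l, m, ha, hb, hc, hk⟩ := rat_gcd3 (h.nm α) (2 * h.re γ) (h.nm β)
    (h.nm_ne_zero hα)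
  have hgK : (g : K) ≠ 0 := by exact_mod_cast hg.ne'
  refine ⟨g, hg, ?_⟩
  have e : (PI α + PI β) * h.cI (PI α + PI β) = PI (h.nm α : K) + PI γ + (PI (h.conj γ) +
      PI (h.nm β : K)) := by
    rw [map_add, h.cI_PI, h.cI_PI, add_mul, mul_add, mul_add, PI_mul, PI_mul, PI_mul, PI_mul,
      h.mul_conj, h.mul_conj, hγc]
  rw [e]
  simp only [fi_add_sup]
  have hnγ : h.nm γ = g ^ 2 * (a * c) := by rw [hγ, h.nm_mul, h.nm_conj, ha, hc]; ring
  have hIntg : IsIntegral ℤ (γ / g) := by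
    have e1 : γ / g = ((g⁻¹ : ℚ) : K) * γ := by push_cast; field_simp
    refine h.isIntegral_of (a := b) (b := a * c) ?_ ?_
    · rw [e1, (h.re_mul _ _).1, (h.re_rat _).1, (h.re_rat _).2]
      field_simp
      linear_combination hb
    · rw [e1, h.nm_mul, h.nm_rat, hnγ]; push_cast; field_simp
  have hIntg' : IsIntegral ℤ (h.conj γ / g) := by
    have : h.conj γ / g = h.conj (γ / g) := by rw [map_div₀, h.conj_rat]
    rw [this]
    exact hIntg.map (h.conj.toIntAlgHom)
  apply le_antisymm
  · refine sup_le (sup_le ?_ ?_) (sup_le ?_ ?_)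
    · rw [PI_le, mem_PI]; exact ⟨a, isIntegral_algebraMap (x := a), by rw [ha]; push_cast; ring⟩
    · rw [PI_le, mem_PI]; exact ⟨_, hIntg, div_mul_cancel₀ _ hgK⟩
    · rw [PI_le, mem_PI]; exact ⟨_, hIntg', div_mul_cancel₀ _ hgK⟩
    · rw [PI_le, mem_PI]; exact ⟨c, isIntegral_algebraMap (x := c), by rw [hc]; push_cast; ring⟩
  · rw [PI_le]
    set J := (PI (h.nm α : K) ⊔ PI γ) ⊔ (PI (h.conj γ) ⊔ PI (h.nm β : K)) with hJ
    have m1 : (h.nm α : K) ∈ J := PI_le.1 (le_sup_left.trans le_sup_left)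
    have m2 : γ ∈ J := PI_le.1 (le_sup_right.trans le_sup_left)
    have m3 : h.conj γ ∈ J := PI_le.1 (le_sup_left.trans le_sup_right)
    have m4 : (h.nm β : K) ∈ J := PI_le.1 (le_sup_right.trans le_sup_right)
    have e2 : (g : K) = (k : K) * (h.nm α) + (l : K) * (γ + h.conj γ) + (m : K) * h.nm β := by
      rw [h.add_conj]
      exact_mod_cast congrArg (fun q : ℚ => (q : K)) hk
    rw [e2]
    exact add_mem_I (add_mem_I (int_smul_mem (isIntegral_algebraMap (x := k)) m1)
      (int_smul_mem (isIntegral_algebraMap (x := l)) (add_mem_I m2 m3)))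
      (int_smul_mem (isIntegral_algebraMap (x := m)) m4)

theorem PI_rat_inj {q q' : ℚ} (hq : 0 < q) (hq' : 0 < q') (e : PI (q : K) = PI (q' : K)) :
    q = q' := by
  have h1 : (q : K) ≠ 0 := by exact_mod_cast hq.ne'
  have h2 : (q' : K) ≠ 0 := by exact_mod_cast hq'.ne'
  obtain ⟨i1, i2⟩ := (PI_eq_iff h1 h2).1 e
  have inj : Function.Injective (algebraMap ℚ K) := (algebraMap ℚ K).injective
  have i1' : IsIntegral ℤ (q / q') := by
    rw [← isIntegral_algebraMap_iff inj]; simpa using i1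
  have i2' : IsIntegral ℤ (q' / q) := by
    rw [← isIntegral_algebraMap_iff inj]; simpa using i2
  obtain ⟨a, ha⟩ := IsIntegrallyClosed.isIntegral_iff.1 i1'
  obtain ⟨b, hb⟩ := IsIntegrallyClosed.isIntegral_iff.1 i2'
  simp only [algebraMap_int_eq, eq_intCast] at ha hb
  have hab : a * b = 1 := by
    have : (a : ℚ) * b = 1 := by rw [ha, hb]; field_simp
    exact_mod_cast this
  have ha0 : 0 < a := by
    have : (0 : ℚ) < a := by rw [ha]; positivity
    exact_mod_cast this
  have : a = 1 := by
    rcases Int.eq_one_or_neg_one_of_mul_eq_one hab with h | h <;> omega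
  rw [this] at ha
  field_simp at ha
  simpa using ha.symm

/-- the ideal `(b, √D)` -/
noncomputable def bI (r : K) (b : ℕ) : FractionalIdeal (𝓞 K)⁰ K := PI (b : K) + PI r

theorem QF.r_int (h : QF K D r) : IsIntegral ℤ r := by
  have := h.isIntegral_mk 0 1
  simpa using this

theorem QF.bI_sq (h : QF K D r) {b : ℕ} (hb : b ∣ D) : bI r b * bI r b = PI (b : K) := by
  obtain ⟨c, rfl⟩ := hb
  have hcop : Nat.Coprime b c := Nat.coprime_of_squarefree_mul h.sqf
  have e : bI r b * bI r b = PI ((b : K) * b) + PI ((b : K) * r) + (PI (r * b) + PI (r * r)) := by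
    rw [bI, add_mul, mul_add, mul_add, PI_mul, PI_mul, PI_mul, PI_mul]
  have hr2 : r * r = b * c := by have := h.sq; push_cast at this; rw [← this]; ring
  rw [e, hr2]
  simp only [fi_add_sup]
  apply le_antisymm
  · refine sup_le (sup_le ?_ ?_) (sup_le ?_ ?_)
    · rw [PI_le, mem_PI]; exact ⟨b, by simpa using isIntegral_algebraMap (R := ℤ) (A := K) (x := (b : ℤ)), by ring⟩
    · rw [PI_le, mem_PI]; exact ⟨r, h.r_int, by ring⟩
    · rw [PI_le, mem_PI]; exact ⟨r, h.r_int, by ring⟩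
    · rw [PI_le, mem_PI]; exact ⟨c, by simpa using isIntegral_algebraMap (R := ℤ) (A := K) (x := (c : ℤ)), by ring⟩
  · rw [PI_le]
    set J := (PI ((b : K) * b) ⊔ PI ((b : K) * r)) ⊔ (PI (r * b) ⊔ PI ((b : K) * c))
    have m1 : ((b : K) * b) ∈ J := PI_le.1 (le_sup_left.trans le_sup_left)
    have m4 : (b : K) * c ∈ J := PI_le.1 (le_sup_right.trans le_sup_right)
    have hbez := Nat.gcd_eq_gcd_ab b c
    rw [hcop] at hbez
    have hbez' : (1 : K) = b * (Nat.gcdA b c : K) + c * (Nat.gcdB b c : K) := by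
      exact_mod_cast congrArg (fun q : ℤ => (q : K)) hbez
    have : (b : K) = (Nat.gcdA b c : K) * (b * b) + (Nat.gcdB b c : K) * (b * c) := by
      linear_combination (b : K) * hbez'
    rw [this]
    exact add_mem_I (int_smul_mem (isIntegral_algebraMap (x := Nat.gcdA b c)) m1)
      (int_smul_mem (isIntegral_algebraMap (x := Nat.gcdB b c)) m4)

theorem QF.D_pos (h : QF K D r) : 0 < D := by have := h.mod4; omega

theorem QF.bI_ne (h : QF K D r) {b : ℕ} (hb : b ∣ D) : bI r b ≠ 0 := by
  intro e
  have h1 := h.bI_sq hb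
  rw [e, mul_zero] at h1
  have hb0 : (b : K) ≠ 0 := by
    have := Nat.pos_of_dvd_of_pos hb h.D_pos
    exact_mod_cast this.ne'
  exact PI_ne hb0 h1.symm

theorem PI_neg (x : K) : PI (-x) = PI x := by
  apply le_antisymm
  · rw [PI_le, mem_PI]; exact ⟨-1, by simpa using isIntegral_algebraMap (R := ℤ) (A := K) (x := -1), by ring⟩
  · rw [PI_le, mem_PI]; exact ⟨-1, by simpa using isIntegral_algebraMap (R := ℤ) (A := K) (x := -1), by ring⟩

theorem QF.cI_bI (h : QF K D r) (b : ℕ) : h.cI (bI r b) = bI r b := by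
  rw [bI, map_add, h.cI_PI, h.cI_PI, h.conj_r, PI_neg, map_natCast]

end FK

namespace FK

theorem sqfree_ratio {b b' : ℕ} (hb : Squarefree b) (hb' : Squarefree b') {q : ℚ}
    (e : (b : ℚ) = q ^ 2 * b') : b = b' := by
  have h1 : (b : ℤ) * q.den ^ 2 = q.num ^ 2 * b' := by
    have : (b : ℚ) * q.den ^ 2 = (q.num : ℚ) ^ 2 * b' := by
      rw [e, ← Rat.mul_den_eq_num q]; ring
    exact_mod_cast this
  have h2 : b * q.den ^ 2 = q.num.natAbs ^ 2 * b' := by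
    have : ((b * q.den ^ 2 : ℕ) : ℤ) = ((q.num.natAbs ^ 2 * b' : ℕ) : ℤ) := by
      push_cast; rw [h1, sq_abs]
    exact_mod_cast this
  have hc : Nat.Coprime (q.num.natAbs ^ 2) (q.den ^ 2) := Nat.Coprime.pow _ _ q.reduced
  have d1 : q.den * q.den ∣ b' := by
    rw [← pow_two]
    exact hc.symm.dvd_of_dvd_mul_left (h2 ▸ Dvd.intro_left _ rfl)
  have d2 : q.num.natAbs * q.num.natAbs ∣ b := by
    rw [← pow_two]
    exact hc.dvd_of_dvd_mul_right (h2 ▸ Dvd.intro _ rfl)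
  have e1 := Nat.isUnit_iff.1 (hb' _ d1)
  have e2 := Nat.isUnit_iff.1 (hb _ d2)
  rw [e1, e2] at h2
  simpa using h2

variable {K : Type*} [Field K] [NumberField K] {D : ℕ} {r : K}

theorem isInt_int (a : ℤ) : IsIntegral ℤ (a : K) := isIntegral_algebraMap (R := ℤ) (A := K) (x := a)

theorem isInt_nat (a : ℕ) : IsIntegral ℤ (a : K) := by simpa using isInt_int (K := K) (a : ℤ)

theorem QF.sq_div (h : QF K D r) {p : ℕ} (hp : p.Prime) (hpD : ¬ p ∣ D) {x z : K}
    (hx : IsIntegral ℤ x) (hz : IsIntegral ℤ z) (e : x * x = p * z) :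
    ∃ y : K, IsIntegral ℤ y ∧ x = p * y := by
  obtain ⟨m, n, hm, hn⟩ := h.of_isIntegral hx
  obtain ⟨m', n', hm', hn'⟩ := h.of_isIntegral hz
  have e1 := (h.re_mul x x).1
  have e2 := (h.re_mul x x).2
  have ep : ((p : ℕ) : K) = ((p : ℚ) : K) := by simp
  rw [e, ep, (h.re_mul _ _).1, (h.re_rat _).1, (h.re_rat _).2, hm, hn, hm'] at e1
  rw [e, ep, (h.re_mul _ _).2, (h.re_rat _).1, (h.re_rat _).2, hm, hn, hn'] at e2
  have f1 : (p : ℤ) * m' = m * m + D * (n * n) := by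
    have : (p : ℚ) * m' = m * m + D * (n * n) := by rw [← e1]; ring
    exact_mod_cast this
  have f2 : (p : ℤ) * n' = 2 * (m * n) := by
    have : (p : ℚ) * n' = 2 * (m * n) := by linear_combination e2
    exact_mod_cast this
  have hpi : Prime (p : ℤ) := Nat.prime_iff_prime_int.1 hp
  have hp2 : ¬ (p : ℤ) ∣ 2 := by
    intro hd
    have : p ∣ 2 := by exact_mod_cast hd
    have h2 : p = 2 := (Nat.prime_dvd_prime_iff_eq hp Nat.prime_two).1 this
    apply hpD; rw [h2]; have := h.mod4; omega
  have hpD' : ¬ (p : ℤ) ∣ D := by exact_mod_cast hpD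
  have hmn : (p : ℤ) ∣ m ∧ (p : ℤ) ∣ n := by
    have := (hpi.dvd_or_dvd (Dvd.intro _ f2 : (p : ℤ) ∣ 2 * (m * n))).resolve_left hp2
    rcases hpi.dvd_or_dvd this with hh | hh
    · refine ⟨hh, ?_⟩
      have h3 : (p : ℤ) ∣ D * (n * n) := by
        rw [← Int.dvd_add_right (Dvd.dvd.mul_right hh m)]; exact Dvd.intro _ f1
      have h4 := (hpi.dvd_or_dvd h3).resolve_left hpD'
      rcases hpi.dvd_or_dvd h4 with h5 | h5 <;> exact h5
    · refine ⟨?_, hh⟩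
      have h3 : (p : ℤ) ∣ m * m := by
        rw [← Int.dvd_add_left (Dvd.dvd.mul_left (Dvd.dvd.mul_right hh n) (D : ℤ))]
        exact Dvd.intro _ f1
      rcases hpi.dvd_or_dvd h3 with h5 | h5 <;> exact h5
  obtain ⟨⟨a, ha⟩, ⟨b, hb⟩⟩ := hmn
  refine ⟨a + b * r, h.isIntegral_mk a b, ?_⟩
  rw [h.eq x, hm, hn, ha, hb]; push_cast; ring

theorem QF.inv_ideal (h : QF K D r) {I : FractionalIdeal (𝓞 K)⁰ K} (hI : I ≠ 0) (hc : h.cI I = I) :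
    ∃ c : ℚ, 0 < c ∧ ∃ b : ℕ, b ∣ D ∧ I = PI (c : K) * bI r b := by
  obtain ⟨n, hn, e⟩ := h.normI I hI
  rw [hc] at e
  have hnum : 0 < n.num := Rat.num_pos.2 hn
  obtain ⟨b, a, hba, hb⟩ := Nat.sq_mul_squarefree (n.num.natAbs * n.den)
  have hne : n.num.natAbs * n.den ≠ 0 := by
    have : n.num ≠ 0 := hnum.ne'
    simp [this]
  have hb0 : b ≠ 0 := hb.ne_zero
  have ha0 : a ≠ 0 := by rintro rfl; apply hne; rw [← hba]; ring
  have hdq : (n.den : ℚ) ≠ 0 := by simp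
  have haq : (0 : ℚ) < a := by exact_mod_cast Nat.pos_of_ne_zero ha0
  have hbq : (0 : ℚ) < b := by exact_mod_cast Nat.pos_of_ne_zero hb0
  have hnn : n = b * (a / n.den) ^ 2 := by
    have h1 : ((a ^ 2 * b : ℕ) : ℚ) = ((n.num.natAbs * n.den : ℕ) : ℚ) := by rw [hba]
    push_cast at h1
    have h2 : ((n.num.natAbs : ℕ) : ℚ) = n.num := by
      rw [← Int.cast_natCast, Int.natAbs_of_nonneg hnum.le]
    rw [h2, ← Rat.mul_den_eq_num n] at h1
    field_simp
    linear_combination -h1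
  set c : ℚ := a / n.den with hcdef
  have hcpos : 0 < c := by positivity
  have hcK : (c : K) ≠ 0 := by exact_mod_cast hcpos.ne'
  set I' := PI ((c : K)⁻¹) * I with hI'
  have hII : I = PI (c : K) * I' := by
    rw [hI', ← mul_assoc, PI_mul, mul_inv_cancel₀ hcK, PI_one, one_mul]
  have hsq : I' * I' = PI (b : K) := by
    have : I' * I' = (PI ((c : K)⁻¹) * PI ((c : K)⁻¹)) * (I * I) := by rw [hI']; ring
    rw [this, e, PI_mul, PI_mul, hnn]
    congr 1; push_cast; field_simp
  have hI'0 : I' ≠ 0 := by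
    intro e0; rw [e0, mul_zero] at hII; exact hI hII
  have hbD : b ∣ D := by
    rw [← Nat.prod_primeFactors_of_squarefree hb]
    apply Finset.prod_primes_dvd
    · intro p hp; exact (Nat.prime_of_mem_primeFactors hp).prime
    · intro p hp
      have hpp := Nat.prime_of_mem_primeFactors hp
      obtain ⟨b', hb'⟩ := Nat.dvd_of_mem_primeFactors hp
      by_contra hpD
      have hp0 : (p : K) ≠ 0 := by exact_mod_cast hpp.ne_zero
      have hle : I' ≤ PI (p : K) := by
        intro x hx
        have hxx : x * x ∈ I' * I' := FractionalIdeal.mul_mem_mul hx hx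
        rw [hsq, mem_PI] at hxx
        obtain ⟨z, hz, hz'⟩ := hxx
        have hxi : IsIntegral ℤ x := by
          apply IsIntegral.of_pow (n := 2) two_pos
          rw [pow_two, ← hz']; exact hz.mul (isInt_nat b)
        obtain ⟨y, hy, hy'⟩ := h.sq_div hpp hpD hxi (hz.mul (isInt_nat b')) (by
          rw [← hz', hb']; push_cast; ring)
        exact mem_PI.2 ⟨y, hy, by rw [hy']; ring⟩
      have hle2 : I' * I' ≤ PI ((p : K) * p) := by
        rw [← PI_mul]; exact mul_le_mul' hle hle
      rw [hsq, PI_le, mem_PI] at hle2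
      obtain ⟨z, hz, hz'⟩ := hle2
      have hz2 : z = ((b / (p * p) : ℚ) : K) := by push_cast; rw [← hz']; field_simp
      rw [hz2] at hz
      have inj : Function.Injective (algebraMap ℚ K) := (algebraMap ℚ K).injective
      have i1' : IsIntegral ℤ (b / (p * p) : ℚ) := by
        rw [← isIntegral_algebraMap_iff inj]; simpa using hz
      obtain ⟨t, ht⟩ := IsIntegrallyClosed.isIntegral_iff.1 i1'
      simp only [algebraMap_int_eq, eq_intCast] at ht
      have hpq : (p : ℚ) ≠ 0 := by exact_mod_cast hpp.ne_zero
      have ht2 : (b : ℤ) = (p * p : ℕ) * t := by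
        have : (b : ℚ) = (p * p) * t := by rw [ht]; field_simp
        exact_mod_cast this
      have hdv : p * p ∣ b := by
        have : ((p * p : ℕ) : ℤ) ∣ (b : ℤ) := Dvd.intro _ ht2.symm
        exact_mod_cast this
      have := Nat.isUnit_iff.1 (hb p hdv)
      exact hpp.one_lt.ne' this
  refine ⟨c, hcpos, b, hbD, ?_⟩
  rw [hII]
  congr 1
  exact sq_inj hI'0 (by rw [hsq, h.bI_sq hbD])

theorem QF.norm_PI (h : QF K D r) {x : K} (hx : h.TP x) : PI x * h.cI (PI x) = PI (h.nm x : K) := by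
  rw [h.cI_PI, PI_mul, h.mul_conj]

theorem QF.torsion (h : QF K D r) {I : FractionalIdeal (𝓞 K)⁰ K} (hI : I ≠ 0) {x : K} (hx : h.TP x)
    (e : I * I = PI x) : ∃ b : ℕ, b ∣ D ∧ ∃ w : K, h.TP w ∧ I = PI w * bI r b := by
  obtain ⟨n, hn, hnI⟩ := h.normI I hI
  have hnm : h.nm x = n ^ 2 := by
    apply PI_rat_inj (K := K) hx.2 (by positivity)
    rw [← h.norm_PI hx, ← e, map_mul]
    have : I * I * (h.cI I * h.cI I) = (I * h.cI I) * (I * h.cI I) := by ring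
    rw [this, hnI, PI_mul]; push_cast; congr 1; ring
  have hnK : (n : K) ≠ 0 := by exact_mod_cast hn.ne'
  set y : K := x * ((n⁻¹ : ℚ) : K) with hy
  have hyTP : h.TP y := h.tp_mul hx (h.tp_rat (by positivity))
  have hny : h.nm y = 1 := by
    rw [hy, h.nm_mul, h.nm_rat, hnm]; field_simp
  have hyc : y * h.conj y = 1 := by rw [h.mul_conj, hny]; simp
  set z := 1 + y with hz
  have hzTP : h.TP z := h.tp_add h.tp_one hyTP
  have hz0 := h.tp_ne hzTP
  have hzz : y * h.conj z = z := by rw [hz, map_add, map_one, mul_add, hyc]; ring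
  have hcz0 : h.conj z ≠ 0 := by intro e0; rw [e0, mul_zero] at hzz; exact hz0 hzz.symm
  -- I = PI y * conj I
  have hIy : I = PI y * h.cI I := by
    have hI2 := h.cI_ne hI
    apply mul_left_cancel₀ hI
    rw [e]
    have : I * (PI y * h.cI I) = PI y * (I * h.cI I) := by ring
    rw [this, hnI, PI_mul]
    congr 1; rw [hy]; push_cast; field_simp
  set I' := PI z⁻¹ * I with hI'
  have hI'0 : I' ≠ 0 := mul_ne_zero (PI_ne (inv_ne_zero hz0)) hI
  have hcI' : h.cI I' = I' := by
    rw [hI', map_mul, h.cI_PI]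
    conv_rhs => rw [hIy]
    rw [← mul_assoc, PI_mul]
    congr 2
    rw [map_inv₀]
    nth_rewrite 2 [← hzz]
    have hy0 := h.tp_ne hyTP
    field_simp
  obtain ⟨c, hc, b, hb, hIb⟩ := h.inv_ideal hI'0 hcI'
  refine ⟨b, hb, z * c, h.tp_mul hzTP (h.tp_rat hc), ?_⟩
  rw [← PI_mul, mul_assoc, ← hIb, hI', ← mul_assoc, PI_mul, mul_inv_cancel₀ hz0, PI_one, one_mul]

theorem QF.square_iff (h : QF K D r) {b : ℕ} (hb : b ∣ D) :
    (∃ J : FractionalIdeal (𝓞 K)⁰ K, J ≠ 0 ∧ ∃ x : K, h.TP x ∧ bI r b = PI x * (J * J)) ↔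
      IsNormQ D b := by
  have hb0 : (0 : ℚ) < b := by exact_mod_cast Nat.pos_of_dvd_of_pos hb h.D_pos
  constructor
  · rintro ⟨J, hJ, x, hx, e⟩
    obtain ⟨g, hg, hgJ⟩ := h.normI J hJ
    have h1 : (b : ℚ) = h.nm x * g ^ 2 := by
      apply PI_rat_inj (K := K) hb0 (mul_pos hx.2 (by positivity))
      have e1 : PI (b : K) = bI r b * h.cI (bI r b) := by rw [h.cI_bI, h.bI_sq hb]
      have e2 : bI r b * h.cI (bI r b) = (PI x * h.cI (PI x)) * ((J * h.cI J) * (J * h.cI J)) := by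
        rw [e, map_mul, map_mul]; ring
      push_cast
      rw [e1, e2, h.norm_PI hx, hgJ, PI_mul, PI_mul]; congr 1; push_cast; ring
    refine ⟨h.re x * g, h.im x * g, ?_⟩
    rw [h1, QF.nm]; ring
  · rintro ⟨s, t, e⟩
    have hx' := h.re_im (x := (s : K) + t * r) (s := s) (t := t) rfl
    have hnm : h.nm ((s : K) + t * r) = b := by rw [QF.nm, hx'.1, hx'.2, e]
    obtain ⟨x, hx, hxn⟩ : ∃ x : K, h.TP x ∧ h.nm x = b := by
      rcases h.tp_or_neg (x := (s : K) + t * r) (by rw [hnm]; exact hb0) with h1 | h1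
      · exact ⟨_, h1, hnm⟩
      · refine ⟨_, h1, ?_⟩
        have e : -((s : K) + t * r) = ((-1 : ℚ) : K) * ((s : K) + t * r) := by simp
        rw [e, h.nm_mul, h.nm_rat, hnm]; ring
    have hx0 := h.tp_ne hx
    set c := PI x⁻¹ * bI r b with hc
    have hcc : c * h.cI c = 1 := by
      rw [hc, map_mul, h.cI_bI, h.cI_PI]
      have : PI x⁻¹ * bI r b * (PI (h.conj x⁻¹) * bI r b) = (PI x⁻¹ * PI (h.conj x⁻¹)) * (bI r b * bI r b) := by
        ring
      rw [this, PI_mul, h.bI_sq hb, PI_mul, map_inv₀]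
      have h2 : x⁻¹ * (h.conj x)⁻¹ * b = 1 := by
        rw [← mul_inv, h.mul_conj, hxn]
        have : ((b : ℚ) : K) ≠ 0 := by exact_mod_cast hb0.ne'
        push_cast at this ⊢
        field_simp
      rw [h2, PI_one]
    set J := 1 + c with hJ
    have hJ0 : J ≠ 0 := by
      intro e0
      have : (1 : FractionalIdeal (𝓞 K)⁰ K) ≤ 0 := by
        rw [← e0, hJ, fi_add_sup]; exact le_sup_left
      exact one_ne_zero (le_antisymm this (FractionalIdeal.zero_le _))
    have hcJ : c * h.cI J = J := by
      rw [hJ, map_add, map_one, mul_add, hcc, mul_one, add_comm]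
    obtain ⟨g, hg, hgJ⟩ := h.normI J hJ0
    have hgK : (g : K) ≠ 0 := by exact_mod_cast hg.ne'
    refine ⟨J, hJ0, x * ((g⁻¹ : ℚ) : K), h.tp_mul hx (h.tp_rat (by positivity)), ?_⟩
    have h3 : J * J = c * PI (g : K) := by
      nth_rewrite 1 [← hcJ]
      rw [mul_assoc, mul_comm (h.cI J), hgJ]
    rw [h3, hc]
    have : PI (x * ((g⁻¹ : ℚ) : K)) * (PI x⁻¹ * bI r b * PI (g : K)) =
      (PI (x * ((g⁻¹ : ℚ) : K)) * PI x⁻¹ * PI (g : K)) * bI r b := by ring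
    rw [this, PI_mul, PI_mul]
    have h4 : x * ((g⁻¹ : ℚ) : K) * x⁻¹ * (g : K) = 1 := by push_cast; field_simp
    rw [h4, PI_one, one_mul]

end FK

namespace FK

variable {K : Type*} [Field K] [NumberField K] {D : ℕ} {r : K}

noncomputable def QF.toK (h : QF K D r) : Pell.Solution₁ (D : ℤ) →* K where
  toFun a := (a.x : K) + a.y * r
  map_one' := by simp
  map_mul' a b := by
    have := h.sq
    simp only [Pell.Solution₁.x_mul, Pell.Solution₁.y_mul]; push_cast
    linear_combination (-(a.y : K) * b.y) * this

theorem QF.toK_apply (h : QF K D r) (a : Pell.Solution₁ (D : ℤ)) : h.toK a = (a.x : K) + a.y * r := rfl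

theorem QF.toK_re (h : QF K D r) (a : Pell.Solution₁ (D : ℤ)) :
    h.re (h.toK a) = a.x ∧ h.im (h.toK a) = a.y := by
  apply h.re_im; rw [h.toK_apply]; push_cast; rfl

theorem QF.toK_nm (h : QF K D r) (a : Pell.Solution₁ (D : ℤ)) : h.nm (h.toK a) = 1 := by
  rw [QF.nm, (h.toK_re a).1, (h.toK_re a).2]
  exact_mod_cast a.prop

theorem QF.toK_inj (h : QF K D r) {a b : Pell.Solution₁ (D : ℤ)} (e : h.toK a = h.toK b) : a = b := by
  have h1 := h.toK_re a
  have h2 := h.toK_re b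
  rw [e] at h1
  apply Pell.Solution₁.ext
  · have := h1.1.symm.trans h2.1; exact_mod_cast this
  · have := h1.2.symm.trans h2.2; exact_mod_cast this

theorem QF.unit_TP (h : QF K D r) {a₁ : Pell.Solution₁ (D : ℤ)} (ha : Pell.IsFundamental a₁)
    {u : K} (hu : h.TP u) (hn : h.nm u = 1) (hi : IsIntegral ℤ u) : ∃ n : ℤ, u = h.toK a₁ ^ n := by
  obtain ⟨m, n, hm, hn'⟩ := h.of_isIntegral hi
  have hp : m ^ 2 - (D : ℤ) * n ^ 2 = 1 := by
    rw [QF.nm, hm, hn'] at hn; exact_mod_cast hn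
  have hu' : u = h.toK (Pell.Solution₁.mk m n hp) := by
    rw [h.toK_apply]; simp only [Pell.Solution₁.x_mk, Pell.Solution₁.y_mk]
    rw [h.eq u, hm, hn']; push_cast; rfl
  obtain ⟨k, hk⟩ := ha.eq_zpow_or_neg_zpow (Pell.Solution₁.mk m n hp)
  refine ⟨k, ?_⟩
  rcases hk with hk | hk
  · rw [hu', hk, map_zpow]
  · exfalso
    have h1 : (Pell.Solution₁.mk m n hp).x < 0 := by
      rw [hk, Pell.Solution₁.x_neg]
      have := Pell.Solution₁.x_zpow_pos ha.x_pos k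
      omega
    have h2 := hu.1
    rw [Pell.Solution₁.x_mk] at h1
    rw [hm] at h2
    have : 0 < m := by exact_mod_cast h2
    omega

theorem QF.conj_ne (h : QF K D r) {x : K} (hx : x ≠ 0) : h.conj x ≠ 0 := by
  simpa using hx

theorem QF.conj_fix (h : QF K D r) {x : K} (hx : h.conj x = x) : x = (h.re x : K) := by
  have h1 := h.add_conj x
  rw [hx] at h1
  have h2 : (2 : K) ≠ 0 := two_ne_zero
  apply mul_left_cancel₀ h2
  push_cast at h1
  linear_combination h1

theorem QF.ratio (h : QF K D r) {x y : K} (hx : x ≠ 0) (hy : y ≠ 0)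
    (e : x / h.conj x = y / h.conj y) : ∃ q : ℚ, h.nm x = q ^ 2 * h.nm y := by
  have hcx := h.conj_ne hx
  have hcy := h.conj_ne hy
  have h1 : h.conj (x / y) = x / y := by
    rw [map_div₀]; field_simp at e ⊢; linear_combination -e
  have h2 := h.conj_fix h1
  refine ⟨h.re (x / y), ?_⟩
  rw [← h.nm_rat, ← h2, ← h.nm_mul]
  congr 1; field_simp

theorem QF.gen_nm (h : QF K D r) {b : ℕ} (hb : b ∣ D) {x : K} (hx : h.TP x) (e : bI r b = PI x) :
    h.nm x = b := by
  symm
  have hb0 : (0 : ℚ) < b := by exact_mod_cast Nat.pos_of_dvd_of_pos hb h.D_pos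
  apply PI_rat_inj (K := K) hb0 hx.2
  rw [← h.norm_PI hx, ← e, h.cI_bI, h.bI_sq hb]; simp

theorem PI_unit {u : K} (hu : u ≠ 0) (e : PI u = 1) : IsIntegral ℤ u := by
  have : u ∈ PI (1 : K) := by rw [PI_one, ← e, ← PI_le]
  obtain ⟨z, hz, e⟩ := mem_PI.1 this
  rw [← e, mul_one]; exact hz

theorem QF.tp_conj (h : QF K D r) {x : K} (hx : h.TP x) : h.TP (h.conj x) := by
  refine ⟨?_, ?_⟩
  · rw [(h.re_conj x).1]; exact hx.1
  · rw [h.nm_conj]; exact hx.2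

theorem QF.nm_inv (h : QF K D r) {x : K} (hx : x ≠ 0) : h.nm x⁻¹ = (h.nm x)⁻¹ := by
  have := h.nm_mul x x⁻¹
  rw [mul_inv_cancel₀ hx, h.nm_one] at this
  exact eq_inv_of_mul_eq_one_right this.symm

theorem QF.gen_unit (h : QF K D r) {a₁ : Pell.Solution₁ (D : ℤ)} (ha : Pell.IsFundamental a₁)
    {b : ℕ} {x : K} (hx : h.TP x) (e : bI r b = PI x) :
    ∃ n : ℤ, x / h.conj x = h.toK a₁ ^ n := by
  have hx0 := h.tp_ne hx
  have hc := h.tp_conj hx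
  have hc0 := h.tp_ne hc
  apply h.unit_TP ha
  · rw [div_eq_mul_inv]; exact h.tp_mul hx (h.tp_inv hc)
  · rw [div_eq_mul_inv, h.nm_mul, h.nm_inv hc0, h.nm_conj, mul_inv_cancel₀ hx.2.ne']
  · apply PI_unit (div_ne_zero hx0 hc0)
    have h1 : PI (h.conj x) = PI x := by rw [← h.cI_PI, ← e, h.cI_bI]
    rw [div_eq_mul_inv, ← PI_mul, ← h1, PI_mul, mul_inv_cancel₀ hc0, PI_one]

theorem QF.tp_toK (h : QF K D r) {a₁ : Pell.Solution₁ (D : ℤ)} (ha : Pell.IsFundamental a₁) (m : ℤ) :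
    h.TP (h.toK a₁ ^ m) := by
  rw [← map_zpow]
  refine ⟨?_, ?_⟩
  · rw [(h.toK_re _).1]; exact_mod_cast Pell.Solution₁.x_zpow_pos ha.x_pos m
  · rw [h.toK_nm]; norm_num

theorem QF.toK_conj (h : QF K D r) (a : Pell.Solution₁ (D : ℤ)) : h.conj (h.toK a) = (h.toK a)⁻¹ := by
  apply eq_inv_of_mul_eq_one_right
  rw [h.mul_conj, h.toK_nm]; simp

theorem QF.kernel (h : QF K D r) : ∃ b0, b0 ∣ D ∧ b0 ≠ 1 ∧ ∀ b, b ∣ D →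
    ((∃ x, h.TP x ∧ bI r b = PI x) ↔ b = 1 ∨ b = b0) := by
  have hD := h.D_pos
  have hns : ¬ IsSquare (D : ℤ) := by
    rintro ⟨s, hs⟩
    have := h.no_sq s 1 (by have : (D : ℚ) = s * s := by exact_mod_cast hs
                            rw [this]; ring)
    norm_num at this
  obtain ⟨a₁, ha⟩ := Pell.IsFundamental.exists_of_not_isSquare (by exact_mod_cast hD) hns
  have hε := h.tp_toK ha 1
  rw [zpow_one] at hε
  set ε := h.toK a₁ with hεdef
  have hεc : h.conj ε = ε⁻¹ := h.toK_conj a₁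
  have hε0 : ε ≠ 0 := h.tp_ne hε
  have hz : h.TP (1 + ε) := h.tp_add h.tp_one hε
  have hz0 := h.tp_ne hz
  have hconjz : ε * h.conj (1 + ε) = 1 + ε := by
    rw [map_add, map_one, hεc]; field_simp
    ring
  have hIntg : ∀ a : Pell.Solution₁ (D : ℤ), IsIntegral ℤ (h.toK a) := fun a => h.isIntegral_mk a.x a.y
  have hPε : PI ε = 1 := by
    rw [← PI_one]
    apply le_antisymm
    · rw [PI_le, mem_PI]; exact ⟨ε, hIntg _, by ring⟩
    · rw [PI_le, mem_PI]; exact ⟨ε⁻¹, by rw [hεdef, ← map_inv]; exact hIntg _, by field_simp⟩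
  obtain ⟨b0, c, hb0, hc, e0⟩ : ∃ (b0 : ℕ) (c : ℚ), b0 ∣ D ∧ 0 < c ∧ PI (1 + ε) = PI (c : K) * bI r b0 := by
    have := h.inv_ideal (I := PI (1 + ε)) (PI_ne hz0) (by
      rw [h.cI_PI]; nth_rewrite 2 [← hconjz]; rw [← PI_mul, hPε, one_mul])
    aesop
  have hcK : (c : K) ≠ 0 := by exact_mod_cast hc.ne'
  set x0 : K := (1 + ε) * ((c⁻¹ : ℚ) : K) with hx0
  have hx0TP : h.TP x0 := h.tp_mul hz (h.tp_rat (by positivity))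
  have hx00 := h.tp_ne hx0TP
  have hbx0 : bI r b0 = PI x0 := by
    rw [hx0, ← PI_mul, e0, mul_right_comm, PI_mul]
    push_cast
    rw [mul_inv_cancel₀ hcK, PI_one, one_mul]
  have hx0c : x0 / h.conj x0 = ε := by
    rw [div_eq_iff (h.conj_ne hx00), hx0, map_mul, h.conj_rat]
    nth_rewrite 1 [← hconjz]; ring
  have hb1 : bI r 1 = 1 := by
    apply sq_one
    rw [h.bI_sq (one_dvd D)]; simp [PI_one]
  refine ⟨b0, hb0, ?_, ?_⟩
  · rintro rfl
    have hn := h.gen_nm hb0 hx0TP hbx0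
    obtain ⟨m, hm⟩ := h.unit_TP ha hx0TP (by rw [hn]; simp) (PI_unit hx00 (by rw [← hbx0, hb1]))
    rw [hm, map_zpow₀, hεc] at hx0c
    have h2 : h.toK (a₁ ^ (2 * m - 1)) = h.toK 1 := by
      rw [map_zpow, map_one, ← hεdef, zpow_sub₀ hε0, zpow_one, two_mul, zpow_add₀ hε0]
      rw [div_eq_one_iff_eq hε0]
      rw [inv_zpow, div_inv_eq_mul] at hx0c
      exact hx0c
    have h3 := h.toK_inj h2
    rw [ha.zpow_eq_one_iff] at h3
    omega
  · intro b hb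
    have hbs : Squarefree b := h.sqf.squarefree_of_dvd hb
    constructor
    · rintro ⟨x, hx, e⟩
      have hxn := h.gen_nm hb hx e
      obtain ⟨n, hn⟩ := h.gen_unit ha hx e
      rw [← hεdef] at hn
      have key : ∀ m : ℤ, h.conj (ε ^ m) = (ε ^ m)⁻¹ := fun m => by
        rw [map_zpow₀, hεc, inv_zpow]
      rcases Int.even_or_odd' n with ⟨m, hm | hm⟩
      · left
        obtain ⟨q, hq⟩ := h.ratio (h.tp_ne hx) (zpow_ne_zero m hε0) (by
          rw [hn, key, hm, div_inv_eq_mul, ← zpow_add₀ hε0]; congr 1; ring)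
        have : h.nm (ε ^ m) = 1 := by rw [hεdef, ← map_zpow, h.toK_nm]
        rw [this, hxn] at hq
        exact sqfree_ratio (b' := 1) hbs squarefree_one (by simpa using hq)
      · right
        obtain ⟨q, hq⟩ := h.ratio (h.tp_ne hx) (mul_ne_zero (zpow_ne_zero m hε0) hx00) (by
          rw [hn, map_mul, key, hm, mul_div_mul_comm, hx0c, div_inv_eq_mul, ← zpow_add₀ hε0,
            ← zpow_add_one₀ hε0]; congr 1; ring)
        have : h.nm (ε ^ m) = 1 := by rw [hεdef, ← map_zpow, h.toK_nm]
        rw [h.nm_mul, this, hxn, h.gen_nm hb0 hx0TP hbx0, one_mul] at hq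
        exact sqfree_ratio hbs (h.sqf.squarefree_of_dvd hb0) hq
    · rintro (rfl | rfl)
      · exact ⟨1, h.tp_one, by rw [hb1, PI_one]⟩
      · exact ⟨x0, hx0TP, hbx0⟩

end FK

namespace FK

/-- The 4-rank count in terms of 2-torsion squares. -/
theorem fourRankPow_eq (G : Type*) [CommGroup G] [Finite G] :
    fourRankPow G = Nat.card {g : G // g ^ 2 = 1 ∧ ∃ y, y ^ 2 = g} := by
  set S2 := (powMonoidHom 2 : G →* G).range with hS2
  set S4 := (powMonoidHom 4 : G →* G).range with hS4
  have hle : S4 ≤ S2 := by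
    rintro x ⟨y, rfl⟩
    refine ⟨y ^ 2, ?_⟩
    simp only [powMonoidHom_apply]; rw [← pow_mul]
  let φ : S2 →* G := (powMonoidHom 2 : G →* G).comp S2.subtype
  have hr : φ.range = S4 := by
    ext x; constructor
    · rintro ⟨⟨_, y, rfl⟩, rfl⟩
      refine ⟨y, ?_⟩
      simp [φ, ← pow_mul]
    · rintro ⟨y, rfl⟩
      refine ⟨⟨y ^ 2, y, rfl⟩, ?_⟩
      simp [φ, ← pow_mul]
  have h1 : Nat.card S2 = Nat.card φ.ker * Nat.card S4 := by
    have := Subgroup.card_eq_card_quotient_mul_card_subgroup φ.ker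
    rw [this, ← hr, Nat.card_congr (QuotientGroup.quotientKerEquivRange φ).toEquiv, mul_comm]
  have h2 : Nat.card S2 = fourRankPow G * Nat.card S4 := by
    have := Subgroup.card_eq_card_quotient_mul_card_subgroup (S4.subgroupOf S2)
    rw [this, fourRankPow]
    congr 1
    exact Nat.card_congr (Subgroup.subgroupOfEquivOfLe hle).toEquiv
  have h3 : 0 < Nat.card S4 := Nat.card_pos
  have h4 : fourRankPow G = Nat.card φ.ker := Nat.eq_of_mul_eq_mul_right h3 (h2.symm.trans h1)
  rw [h4]
  refine Nat.card_congr ⟨fun x => ⟨x.1.1, ?_, ?_⟩, fun g => ⟨⟨g.1, ?_⟩, ?_⟩, fun x => rfl, fun x => rfl⟩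
  · exact x.2
  · obtain ⟨y, hy⟩ := x.1.2; exact ⟨y, hy⟩
  · obtain ⟨y, hy⟩ := g.2.2; exact ⟨y, hy⟩
  · exact g.2.1

variable {K : Type*} [Field K] [NumberField K] {D : ℕ} {r : K}

theorem QF.mem_np (h : QF K D r) (I : (FractionalIdeal (𝓞 K)⁰ K)ˣ) :
    I ∈ narrowPrincipals K ↔ ∃ x : K, h.TP x ∧ (I : FractionalIdeal (𝓞 K)⁰ K) = PI x := by
  have base : ∀ (J : (FractionalIdeal (𝓞 K)⁰ K)ˣ) (x : K),
      ((J : FractionalIdeal (𝓞 K)⁰ K) : Submodule (𝓞 K) K) = Submodule.span (𝓞 K) {x} ↔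
      (J : FractionalIdeal (𝓞 K)⁰ K) = PI x := by
    intro J x
    rw [← FractionalIdeal.coe_spanSingleton (𝓞 K)⁰ x, FractionalIdeal.coeToSubmodule_inj]
  constructor
  · intro hI
    refine Subgroup.closure_induction (p := fun (I : (FractionalIdeal (𝓞 K)⁰ K)ˣ) _ => ∃ x : K, h.TP x ∧ (I : FractionalIdeal (𝓞 K)⁰ K) = PI x)
      ?_ ?_ ?_ ?_ hI
    · rintro J ⟨x, hx, e⟩
      exact ⟨x, (h.tp_iff x).1 hx, (base J x).1 e⟩
    · exact ⟨1, h.tp_one, by rw [PI_one]; rfl⟩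
    · rintro J J' - - ⟨x, hx, e⟩ ⟨x', hx', e'⟩
      exact ⟨x * x', h.tp_mul hx hx', by rw [Units.val_mul, e, e', PI_mul]⟩
    · rintro J - ⟨x, hx, e⟩
      refine ⟨x⁻¹, h.tp_inv hx, ?_⟩
      have : PI x * PI x⁻¹ = 1 := by rw [PI_mul, mul_inv_cancel₀ (h.tp_ne hx), PI_one]
      rw [← e] at this
      exact (Units.inv_eq_of_mul_eq_one_right this)
  · rintro ⟨x, hx, e⟩
    exact Subgroup.subset_closure ⟨x, (h.tp_iff x).2 hx, (base I x).2 e⟩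

noncomputable def cl (I : FractionalIdeal (𝓞 K)⁰ K) (hI : I ≠ 0) : NarrowClassGroup K :=
  QuotientGroup.mk (Units.mk0 I hI)

theorem cl_mul {I J : FractionalIdeal (𝓞 K)⁰ K} (hI : I ≠ 0) (hJ : J ≠ 0) :
    cl I hI * cl J hJ = cl (I * J) (mul_ne_zero hI hJ) := by
  unfold cl
  rw [← QuotientGroup.mk_mul]; congr 1; ext; simp

theorem cl_surj (g : NarrowClassGroup K) : ∃ I, ∃ hI : I ≠ 0, g = cl I hI := by
  obtain ⟨u, rfl⟩ := QuotientGroup.mk_surjective g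
  exact ⟨u, u.ne_zero, by unfold cl; congr 1; ext; simp⟩

theorem QF.cl_one (h : QF K D r) {I : FractionalIdeal (𝓞 K)⁰ K} (hI : I ≠ 0) :
    cl I hI = 1 ↔ ∃ x : K, h.TP x ∧ I = PI x := by
  unfold cl
  rw [QuotientGroup.eq_one_iff, h.mem_np]; rfl

theorem QF.cl_eq (h : QF K D r) {I J : FractionalIdeal (𝓞 K)⁰ K} (hI : I ≠ 0) (hJ : J ≠ 0) :
    cl I hI = cl J hJ ↔ ∃ x : K, h.TP x ∧ I = PI x * J := by
  unfold cl
  rw [eq_comm, QuotientGroup.eq, h.mem_np]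
  have : (((Units.mk0 J hJ)⁻¹ * Units.mk0 I hI : (FractionalIdeal (𝓞 K)⁰ K)ˣ) : FractionalIdeal (𝓞 K)⁰ K) = J⁻¹ * I := by
    simp
  rw [this]
  refine exists_congr fun x => and_congr_right fun _ => ?_
  rw [inv_mul_eq_iff_eq_mul₀ hJ, mul_comm]

theorem QF.finite_G (h : QF K D r) : Finite (NarrowClassGroup K) := by
  have hr0 : r ≠ 0 := by
    intro e; have := h.sq; rw [e] at this
    have h2 : (D : K) ≠ 0 := by exact_mod_cast h.D_pos.ne'
    apply h2; rw [← this]; ring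
  have : Finite ((FractionalIdeal (𝓞 K)⁰ K)ˣ ⧸ (toPrincipalIdeal (𝓞 K) K).range) :=
    Finite.of_equiv _ (ClassGroup.equiv K).toEquiv
  let f : ((FractionalIdeal (𝓞 K)⁰ K)ˣ ⧸ (toPrincipalIdeal (𝓞 K) K).range) × Bool → NarrowClassGroup K :=
    fun p => (QuotientGroup.mk p.1.out : NarrowClassGroup K) * if p.2 then cl (PI r) (PI_ne hr0) else 1
  apply Finite.of_surjective f
  intro g
  obtain ⟨I, rfl⟩ := QuotientGroup.mk_surjective g
  set J := (QuotientGroup.mk I : (FractionalIdeal (𝓞 K)⁰ K)ˣ ⧸ (toPrincipalIdeal (𝓞 K) K).range).out with hJ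
  have h1 : (QuotientGroup.mk J : (FractionalIdeal (𝓞 K)⁰ K)ˣ ⧸ (toPrincipalIdeal (𝓞 K) K).range) =
    QuotientGroup.mk I := Quotient.out_eq' _
  rw [QuotientGroup.eq] at h1
  obtain ⟨x, hx⟩ := h1
  rw [toPrincipalIdeal_eq_iff] at hx
  have key : ∀ y : K, h.TP y → PI (x : K) = PI y → ∃ a, f a = QuotientGroup.mk I := by
    intro y hy e
    refine ⟨(QuotientGroup.mk I, false), ?_⟩
    have e1 : f (QuotientGroup.mk I, false) = (QuotientGroup.mk J : NarrowClassGroup K) := by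
      simp only [f, Bool.false_eq_true, if_false]
      exact mul_one (QuotientGroup.mk J : NarrowClassGroup K)
    rw [e1, QuotientGroup.eq, h.mem_np]
    refine ⟨y, hy, ?_⟩
    rw [← e]; exact hx.symm
  have key2 : ∀ y : K, h.TP y → PI (x : K) = PI y * PI r → ∃ a, f a = QuotientGroup.mk I := by
    intro y hy e
    refine ⟨(QuotientGroup.mk I, true), ?_⟩
    simp only [f, if_true]
    rw [← hJ]
    unfold cl
    rw [← QuotientGroup.mk_mul, QuotientGroup.eq, h.mem_np]
    refine ⟨y, hy, ?_⟩
    have hxx : PI (x : K) = ((J⁻¹ * I : (FractionalIdeal (𝓞 K)⁰ K)ˣ) : FractionalIdeal (𝓞 K)⁰ K) := hx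
    rw [e] at hxx
    have h3 : ((J * Units.mk0 (PI r) (PI_ne hr0))⁻¹ * I : (FractionalIdeal (𝓞 K)⁰ K)ˣ) =
      (Units.mk0 (PI r) (PI_ne hr0))⁻¹ * (J⁻¹ * I) := by group
    rw [h3, Units.val_mul, ← hxx, Units.val_inv_eq_inv_val, Units.val_mk0, mul_comm, mul_assoc,
      mul_inv_cancel₀ (PI_ne hr0), mul_one]
  rcases lt_or_gt_of_ne (h.nm_ne_zero x.ne_zero) with hn | hn
  · have hnr : h.nm r = -D := by
      have := h.re_im (x := r) (s := 0) (t := 1) (by simp)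
      rw [QF.nm, this.1, this.2]; ring
    have hD : (0 : ℚ) < D := by exact_mod_cast h.D_pos
    have hn2 : 0 < h.nm (x * r⁻¹ : K) := by
      rw [h.nm_mul, h.nm_inv hr0, hnr]
      exact mul_pos_of_neg_of_neg hn (by rw [inv_lt_zero]; linarith)
    rcases h.tp_or_neg hn2 with h4 | h4
    · exact key2 _ h4 (by rw [PI_mul]; congr 1; field_simp)
    · exact key2 _ h4 (by rw [PI_mul, ← PI_neg]; congr 1; field_simp)
  · rcases h.tp_or_neg hn with h4 | h4
    · exact key _ h4 rfl
    · exact key _ h4 (PI_neg _).symm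

/-- symmetric difference product of squarefree divisors -/
def sd (b c : ℕ) : ℕ := (b / b.gcd c) * (c / b.gcd c)

theorem sd_eq {b c : ℕ} (hb : 0 < b) : (sd b c : ℚ) * (b.gcd c) ^ 2 = b * c := by
  have h1 := Nat.div_mul_cancel (Nat.gcd_dvd_left b c)
  have h2 := Nat.div_mul_cancel (Nat.gcd_dvd_right b c)
  have : sd b c * (b.gcd c) ^ 2 = b * c := by
    unfold sd
    calc _ = (b / b.gcd c * b.gcd c) * (c / b.gcd c * b.gcd c) := by ring
      _ = _ := by rw [h1, h2]
  exact_mod_cast this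

theorem sd_dvd {b c D : ℕ} (hb : b ∣ D) (hc : c ∣ D) (hD : 0 < D) : sd b c ∣ D := by
  have hb0 := Nat.pos_of_dvd_of_pos hb hD
  have hg : 0 < b.gcd c := Nat.gcd_pos_of_pos_left _ hb0
  unfold sd
  exact (Nat.coprime_div_gcd_div_gcd hg).mul_dvd_of_dvd_of_dvd
    ((Nat.div_dvd_of_dvd (Nat.gcd_dvd_left b c)).trans hb)
    ((Nat.div_dvd_of_dvd (Nat.gcd_dvd_right b c)).trans hc)

theorem QF.cl_sd (h : QF K D r) {b c : ℕ} (hb : b ∣ D) (hc : c ∣ D) :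
    cl (bI r b) (h.bI_ne hb) * cl (bI r c) (h.bI_ne hc) =
      cl (bI r (sd b c)) (h.bI_ne (sd_dvd hb hc h.D_pos)) := by
  have hb0 := Nat.pos_of_dvd_of_pos hb h.D_pos
  rw [cl_mul, h.cl_eq]
  have hg : 0 < b.gcd c := Nat.gcd_pos_of_pos_left _ hb0
  refine ⟨((b.gcd c : ℚ) : K), h.tp_rat (by exact_mod_cast hg), ?_⟩
  apply sq_inj (mul_ne_zero (h.bI_ne hb) (h.bI_ne hc))
  rw [mul_mul_mul_comm, h.bI_sq hb, h.bI_sq hc, mul_mul_mul_comm, h.bI_sq (sd_dvd hb hc h.D_pos),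
    PI_mul, PI_mul, PI_mul]
  congr 1
  have := sd_eq (b := b) (c := c) hb0
  have h2 : (((sd b c : ℚ) * (b.gcd c) ^ 2 : ℚ) : K) = ((b * c : ℚ) : K) := by rw [this]
  push_cast at h2 ⊢
  rw [← h2]; ring

theorem sd_cancel {b c c' : ℕ} (hb : 0 < b) (hc : Squarefree c) (hc' : Squarefree c')
    (e : sd b c = sd b c') : c = c' := by
  have h1 := sd_eq (b := b) (c := c) hb
  have h2 := sd_eq (b := b) (c := c') hb
  rw [e] at h1
  have hg : (0 : ℚ) < b.gcd c := by exact_mod_cast Nat.gcd_pos_of_pos_left _ hb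
  have hg' : (0 : ℚ) < b.gcd c' := by exact_mod_cast Nat.gcd_pos_of_pos_left _ hb
  have hbq : (0 : ℚ) < b := by exact_mod_cast hb
  apply sqfree_ratio hc hc' (q := (b.gcd c : ℚ) / b.gcd c')
  have h3 : (sd b c' : ℚ) = b * c' / (b.gcd c') ^ 2 := by rw [← h2]; field_simp
  rw [h3] at h1
  apply mul_left_cancel₀ hbq.ne'
  rw [← h1]; field_simp

theorem sd_self {b : ℕ} (hb : 0 < b) : sd b b = 1 := by
  unfold sd; rw [Nat.gcd_self, Nat.div_self hb]

theorem sd_one {b : ℕ} : sd b 1 = b := by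
  unfold sd; simp

theorem QF.main_count (h : QF K D r) :
    (D.divisors.filter (fun b => IsNormQ D b)).card = 2 * fourRankPow (NarrowClassGroup K) := by
  have := h.finite_G
  have : Fintype (NarrowClassGroup K) := Fintype.ofFinite _
  rw [fourRankPow_eq]
  set T : Finset (NarrowClassGroup K) := Finset.univ.filter (fun g => g ^ 2 = 1 ∧ ∃ y, y ^ 2 = g) with hT
  have hcard : Nat.card {g : NarrowClassGroup K // g ^ 2 = 1 ∧ ∃ y, y ^ 2 = g} = T.card := by
    rw [Nat.card_eq_fintype_card, Fintype.card_subtype]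
  rw [hcard]
  set f : ℕ → NarrowClassGroup K := fun b => if hb : b ∣ D then cl (bI r b) (h.bI_ne hb) else 1 with hf
  have fe : ∀ {b : ℕ} (hb : b ∣ D), f b = cl (bI r b) (h.bI_ne hb) := fun hb => by simp [hf, hb]
  have fsq : ∀ {b : ℕ} (hb : b ∣ D), f b ^ 2 = 1 := by
    intro b hb
    rw [fe hb, pow_two, h.cl_sd hb hb, h.cl_one]
    refine ⟨1, h.tp_one, ?_⟩
    rw [sd_self (Nat.pos_of_dvd_of_pos hb h.D_pos)]
    have : bI r 1 = 1 := sq_one (by rw [h.bI_sq (one_dvd D)]; simp)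
    rw [this, PI_one]
  have fT : ∀ {b : ℕ}, b ∣ D → (f b ∈ T ↔ IsNormQ D b) := by
    intro b hb
    rw [hT, Finset.mem_filter, ← h.square_iff hb]
    constructor
    · rintro ⟨-, -, y, hy⟩
      obtain ⟨J, hJ, rfl⟩ := cl_surj y
      refine ⟨J, hJ, ?_⟩
      rw [← h.cl_eq (h.bI_ne hb) (mul_ne_zero hJ hJ), ← fe hb, ← hy, pow_two, cl_mul]
    · rintro ⟨J, hJ, hx⟩
      refine ⟨Finset.mem_univ _, fsq hb, cl J hJ, ?_⟩
      rw [← h.cl_eq (h.bI_ne hb) (mul_ne_zero hJ hJ)] at hx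
      rw [fe hb, hx, pow_two, cl_mul]
  rw [Finset.card_eq_sum_card_fiberwise (f := f) (t := T)]
  swap
  · intro b hb
    rw [Finset.mem_coe, Finset.mem_filter, Nat.mem_divisors] at hb
    exact (fT hb.1.1).2 hb.2
  rw [Finset.sum_const_nat (m := 2), mul_comm]
  intro g hg
  have hg' := hg
  rw [hT, Finset.mem_filter] at hg'
  obtain ⟨-, hg1, -⟩ := hg'
  obtain ⟨I, hI, rfl⟩ := cl_surj g
  obtain ⟨b, hb, hbI⟩ : ∃ b, b ∣ D ∧ f b = cl I hI := by
    rw [pow_two, cl_mul, h.cl_one] at hg1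
    obtain ⟨x, hx, e⟩ := hg1
    obtain ⟨b, hb, w, hw, e⟩ := h.torsion hI hx e
    refine ⟨b, hb, ?_⟩
    rw [fe hb, eq_comm, h.cl_eq]
    exact ⟨w, hw, e⟩
  rw [← hbI] at hg ⊢
  obtain ⟨b0, hb0, hb01, hker⟩ := h.kernel
  have hbp := Nat.pos_of_dvd_of_pos hb h.D_pos
  have : (Finset.filter (fun a => f a = f b) (D.divisors.filter (fun b => IsNormQ D b))) = {b, sd b b0} := by
    ext c
    rw [Finset.mem_filter, Finset.mem_filter, Nat.mem_divisors, Finset.mem_insert, Finset.mem_singleton]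
    have one_iff : ∀ {e : ℕ}, e ∣ D → (f e = 1 ↔ e = 1 ∨ e = b0) := by
      intro e he
      rw [fe he, h.cl_one, hker e he]
    have hmul : ∀ {x y : ℕ}, x ∣ D → y ∣ D → f x * f y = f (sd x y) := by
      intro x y hx hy
      rw [fe hx, fe hy, fe (sd_dvd hx hy h.D_pos), h.cl_sd hx hy]
    constructor
    · rintro ⟨⟨⟨hc, -⟩, -⟩, e⟩
      have h1 : f (sd b c) = 1 := by rw [← hmul hb hc, e, ← pow_two, fsq hb]
      have hcs := h.sqf.squarefree_of_dvd hc
      rcases (one_iff (sd_dvd hb hc h.D_pos)).1 h1 with h2 | h2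
      · left
        exact (sd_cancel hbp hcs (h.sqf.squarefree_of_dvd hb) (h2.trans (sd_self hbp).symm))
      · right
        have hsd := sd_dvd hb hb0 h.D_pos
        apply sd_cancel hbp hcs (h.sqf.squarefree_of_dvd hsd)
        rw [h2]
        symm
        have q1 := sd_eq (b := b) (c := b0) hbp
        have q2 := sd_eq (b := b) (c := sd b b0) hbp
        have hbq : (0 : ℚ) < b := by exact_mod_cast hbp
        have hgq : (0 : ℚ) < b.gcd b0 := by exact_mod_cast Nat.gcd_pos_of_pos_left _ hbp
        have hgq2 : (0 : ℚ) < b.gcd (sd b b0) := by exact_mod_cast Nat.gcd_pos_of_pos_left _ hbp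
        apply sqfree_ratio (h.sqf.squarefree_of_dvd (sd_dvd hb hsd h.D_pos)) (h.sqf.squarefree_of_dvd hb0)
          (q := b / (b.gcd b0 * b.gcd (sd b b0)))
        have q3 : (sd b b0 : ℚ) = b * b0 / (b.gcd b0) ^ 2 := by rw [← q1]; field_simp
        have q4 : (sd b (sd b b0) : ℚ) = b * sd b b0 / (b.gcd (sd b b0)) ^ 2 := by rw [← q2]; field_simp
        rw [q4, q3]; field_simp
    · have hN := (fT hb).1 hg
      rintro (rfl | rfl)
      · exact ⟨⟨⟨hb, h.D_pos.ne'⟩, hN⟩, rfl⟩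
      · have hsd := sd_dvd hb hb0 h.D_pos
        have e : f (sd b b0) = f b := by
          rw [← hmul hb hb0, (one_iff hb0).2 (Or.inr rfl)]; exact mul_one (f b)
        refine ⟨⟨⟨hsd, h.D_pos.ne'⟩, ?_⟩, e⟩
        rw [← fT hsd, e]; exact hg
  rw [this, Finset.card_pair]
  intro e
  apply hb01
  apply sd_cancel hbp (h.sqf.squarefree_of_dvd hb0) squarefree_one
  rw [sd_one]; exact e.symm

end FK

namespace FK

theorem sqrt_sq (n : ℕ) : ((Real.sqrt n : ℝ) : ℂ) ^ 2 = n := by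
  rw [← Complex.ofReal_pow, Real.sq_sqrt (Nat.cast_nonneg n)]; simp

theorem sqrt_int (n : ℕ) : IsIntegral ℚ ((Real.sqrt n : ℝ) : ℂ) := by
  apply IsIntegral.of_pow (n := 2) (by norm_num)
  rw [sqrt_sq]
  have := isIntegral_algebraMap (R := ℚ) (A := ℂ) (x := (n : ℚ))
  simpa using this

theorem numberField_quad (n : ℕ) : NumberField (quadField n) := by
  have : FiniteDimensional ℚ (quadField n) := IntermediateField.adjoin.finiteDimensional (sqrt_int n)
  exact ⟨⟩

theorem quad_rep (n : ℕ) (x : ℂ) (hx : x ∈ quadField n) : ∃ s t : ℚ, x = s + t * ((Real.sqrt n : ℝ) : ℂ) := by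
  have h1 : x ∈ (quadField n).toSubalgebra := hx
  unfold quadField at h1
  rw [IntermediateField.adjoin_simple_toSubalgebra_of_isAlgebraic (sqrt_int n).isAlgebraic] at h1
  clear hx
  induction h1 using Algebra.adjoin_induction with
  | mem y hy =>
    rw [Set.mem_singleton_iff] at hy
    exact ⟨0, 1, by rw [hy]; simp⟩
  | algebraMap q => exact ⟨q, 0, by simp⟩
  | add a b _ _ ha hb =>
    obtain ⟨s, t, rfl⟩ := ha
    obtain ⟨s', t', rfl⟩ := hb
    exact ⟨s + s', t + t', by push_cast; ring⟩
  | mul a b _ _ ha hb =>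
    obtain ⟨s, t, rfl⟩ := ha
    obtain ⟨s', t', rfl⟩ := hb
    refine ⟨s * s' + n * (t * t'), s * t' + t * s', ?_⟩
    push_cast
    have := sqrt_sq n
    linear_combination (t * t' : ℂ) * this

theorem quad_mem (n : ℕ) : ((Real.sqrt n : ℝ) : ℂ) ∈ quadField n :=
  IntermediateField.mem_adjoin_simple_self ℚ _

theorem quad_QF (n : ℕ) (hsq : Squarefree n) (hn : n % 4 = 2) :
    QF (quadField n) n (⟨((Real.sqrt n : ℝ) : ℂ), quad_mem n⟩ : quadField n) where
  sq := by
    apply Subtype.ext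
    push_cast
    exact sqrt_sq n
  sqf := hsq
  mod4 := hn
  rep := by
    intro x
    obtain ⟨s, t, e⟩ := quad_rep n x.1 x.2
    exact ⟨s, t, by apply Subtype.ext; push_cast; rw [e]⟩

theorem fourRank_eq_fcount (d : ℕ) (hsq : Squarefree d) (hd : d % 4 = 3)
    (hp : ∀ p : ℕ, p.Prime → p ∣ d → jacobiSym 2 p = 1) :
    fourRankPow (NarrowClassGroup (quadField (2 * d))) = fcount d := by
  have := numberField_quad (2 * d)
  have hq := quad_QF (2 * d) (by
    rw [Nat.squarefree_mul_iff]
    refine ⟨?_, Nat.prime_two.prime.squarefree, hsq⟩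
    rw [Nat.coprime_two_left, Nat.odd_iff]; omega) (by omega)
  have h1 := hq.main_count
  have h2 := card_norm_divisors hsq hd hp
  have h3 := h1.symm.trans h2
  omega

end FK

namespace FK
open Finset

lemma sum_inv_le (N : ℕ) : ∑ n ∈ Ioc 0 N, (1:ℝ)/n ≤ 1 + Real.log N := by
  have h := harmonic_le_one_add_log N
  rw [harmonic_eq_sum_Icc] at h
  push_cast at h
  have e : Ioc 0 N = Icc 1 N := by ext; simp; omega
  rw [e]; simpa using h

lemma le_sum_inv (N : ℕ) : Real.log (N+1) ≤ ∑ n ∈ Ioc 0 N, (1:ℝ)/n := by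
  have h := log_add_one_le_harmonic N
  rw [harmonic_eq_sum_Icc] at h
  push_cast at h
  have e : Ioc 0 N = Icc 1 N := by ext; simp; omega
  rw [e]; simpa using h

open ArithmeticFunction in
lemma sum_Lambda_floor (N : ℕ) :
    ∑ n ∈ Ioc 0 N, Real.log n = ∑ n ∈ Ioc 0 N, vonMangoldt n * ((N / n : ℕ):ℝ) := by
  rw [← sum_Ioc_mul_zeta_eq_sum, vonMangoldt_mul_zeta]
  rfl

open ArithmeticFunction in
lemma psi_nat (N : ℕ) : Chebyshev.psi N = ∑ n ∈ Ioc 0 N, vonMangoldt n := by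
  unfold Chebyshev.psi; simp

open ArithmeticFunction in
lemma sum_Lambda_le {N : ℕ} (hN : 1 ≤ N) :
    ∑ n ∈ Ioc 0 N, vonMangoldt n / n ≤ Real.log N + (Real.log 4 + 4) := by
  have h1 := sum_Lambda_floor N
  have hN' : (0:ℝ) < N := by exact_mod_cast hN
  have h2 : ∑ n ∈ Ioc 0 N, Real.log n ≤ N * Real.log N := by
    calc _ ≤ ∑ n ∈ Ioc 0 N, Real.log N := by
          apply sum_le_sum; intro i hi
          simp only [mem_Ioc] at hi
          apply Real.log_le_log <;> exact_mod_cast (by omega)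
      _ = _ := by simp
  have h3 : ∑ n ∈ Ioc 0 N, vonMangoldt n * ((N:ℝ)/n - 1) ≤
      ∑ n ∈ Ioc 0 N, vonMangoldt n * ((N / n : ℕ):ℝ) := by
    apply sum_le_sum; intro i hi
    apply mul_le_mul_of_nonneg_left _ vonMangoldt_nonneg
    have := Nat.lt_floor_add_one ((N:ℝ)/i)
    rw [Nat.floor_div_eq_div] at this
    linarith
  have h4 := Chebyshev.psi_le_const_mul_self hN'.le
  rw [psi_nat] at h4
  have h5 : ∑ n ∈ Ioc 0 N, vonMangoldt n * ((N:ℝ)/n - 1) =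
      N * (∑ n ∈ Ioc 0 N, vonMangoldt n / n) - ∑ n ∈ Ioc 0 N, vonMangoldt n := by
    rw [mul_sum, ← sum_sub_distrib]
    apply sum_congr rfl; intros; ring
  have : N * (∑ n ∈ Ioc 0 N, vonMangoldt n / n) ≤ N * (Real.log N + (Real.log 4 + 4)) := by
    rw [h5] at h3
    nlinarith
  exact le_of_mul_le_mul_left this hN'

lemma log_fact_ge (N : ℕ) (hN : 1 ≤ N) : N * Real.log N - N ≤ ∑ n ∈ Ioc 0 N, Real.log n := by
  have h := Real.pow_div_factorial_le_exp (N:ℝ) (by positivity) N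
  have hf : (0:ℝ) < (N.factorial:ℝ) := by exact_mod_cast N.factorial_pos
  have hN' : (0:ℝ) < N := by exact_mod_cast hN
  have h2 := Real.log_le_log (by positivity) h
  rw [Real.log_exp, Real.log_div (by positivity) hf.ne', Real.log_pow] at h2
  have : Real.log (N.factorial) = ∑ n ∈ Ioc 0 N, Real.log n := by
    clear h h2 hf hN' hN
    induction N with
    | zero => simp
    | succ N ih =>
      have e : Ioc 0 (N+1) = insert (N+1) (Ioc 0 N) := by ext; simp; omega
      rw [e, sum_insert (by simp), Nat.factorial_succ, Nat.cast_mul,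
        Real.log_mul (by positivity) (by positivity), ih]
  linarith

open ArithmeticFunction in
lemma le_sum_Lambda {N : ℕ} (hN : 1 ≤ N) :
    Real.log N - 1 ≤ ∑ n ∈ Ioc 0 N, vonMangoldt n / n := by
  have hN' : (0:ℝ) < N := by exact_mod_cast hN
  have h1 := sum_Lambda_floor N
  have h2 := log_fact_ge N hN
  have h3 : ∑ n ∈ Ioc 0 N, vonMangoldt n * ((N / n : ℕ):ℝ) ≤ N * ∑ n ∈ Ioc 0 N, vonMangoldt n / n := by
    rw [mul_sum]
    apply sum_le_sum; intro i hi
    have : ((N/i : ℕ):ℝ) ≤ (N:ℝ)/i := Nat.cast_div_le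
    calc _ ≤ vonMangoldt i * ((N:ℝ)/i) := mul_le_mul_of_nonneg_left this vonMangoldt_nonneg
      _ = _ := by ring
  have : N * (Real.log N - 1) ≤ N * ∑ n ∈ Ioc 0 N, vonMangoldt n / n := by linarith
  exact le_of_mul_le_mul_left this hN'

open ArithmeticFunction in
lemma sum_logp_le {N : ℕ} (hN : 1 ≤ N) :
    ∑ p ∈ Nat.primesLE N, Real.log p / p ≤ Real.log N + (Real.log 4 + 4) := by
  refine le_trans ?_ (sum_Lambda_le hN)
  calc _ = ∑ p ∈ Nat.primesLE N, vonMangoldt p / p := by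
        apply sum_congr rfl; intro p hp
        rw [vonMangoldt_apply_prime (Nat.mem_primesLE.1 hp).2]
    _ ≤ _ := by
        apply sum_le_sum_of_subset_of_nonneg
        · intro p hp
          have := Nat.mem_primesLE.1 hp
          simp [this.1, this.2.pos]
        · intro i _ _
          exact div_nonneg vonMangoldt_nonneg (by positivity)

/-- Abel bound. -/
lemma abel_bound (f g : ℕ → ℝ) (K : ℝ) (a : ℕ) (hf : ∀ n, |∑ i ∈ Ioc a n, f i| ≤ K)
    (hg0 : ∀ n, a < n → 0 ≤ g n) (hg : ∀ n, a < n → g (n+1) ≤ g n) (b : ℕ) :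
    |∑ i ∈ Ioc a b, f i * g i| ≤ K * g (a+1) := by
  have hK : 0 ≤ K := (abs_nonneg _).trans (hf 0)
  have key : ∀ b, a ≤ b → ∃ s : ℝ, |s| ≤ K * (g (a+1) - g (b+1)) ∧
      ∑ i ∈ Ioc a b, f i * g i = s + (∑ i ∈ Ioc a b, f i) * g (b+1) := by
    intro b hb
    induction b, hb using Nat.le_induction with
    | base => exact ⟨0, by simp, by simp⟩
    | succ b hb ih =>
      obtain ⟨s, hs, e⟩ := ih
      have h1 : Ioc a (b+1) = insert (b+1) (Ioc a b) := by
        ext; simp; omega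
      refine ⟨s + (∑ i ∈ Ioc a (b+1), f i) * (g (b+1) - g (b+2)), ?_, ?_⟩
      · have h2 := hg (b+1) (by omega)
        have h3 : |(∑ i ∈ Ioc a (b+1), f i) * (g (b+1) - g (b+2))| ≤ K * (g (b+1) - g (b+2)) := by
          rw [abs_mul, abs_of_nonneg (a := g (b+1) - g (b+2)) (by simpa using h2)]
          exact mul_le_mul_of_nonneg_right (hf _) (by simpa using h2)
        calc _ ≤ |s| + _ := abs_add_le _ _
          _ ≤ _ := by have := add_le_add hs h3; convert! this using 1; ring
      · rw [h1, sum_insert (by simp), sum_insert (by simp), e]; ring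
  rcases le_or_gt a b with hb | hb
  · obtain ⟨s, hs, e⟩ := key b hb
    rw [e]
    have h4 := hg0 (b+1) (by omega)
    calc _ ≤ |s| + |(∑ i ∈ Ioc a b, f i) * g (b+1)| := abs_add_le _ _
      _ ≤ K * (g (a+1) - g (b+1)) + K * g (b+1) := by
        apply add_le_add hs
        rw [abs_mul, abs_of_nonneg h4]
        exact mul_le_mul_of_nonneg_right (hf _) h4
      _ = _ := by ring
  · rw [Ioc_eq_empty (by omega)]
    simp only [sum_empty, abs_zero]
    exact mul_nonneg hK (hg0 _ (by omega))

/-- Multiplicative extension on squarefree numbers. -/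
noncomputable def mulf (g : ℕ → ℝ) (n : ℕ) : ℝ := ∏ p ∈ n.primeFactors, g p

noncomputable def sf (N : ℕ) : Finset ℕ := (Ioc 0 N).filter Squarefree

lemma mem_sf {N n : ℕ} : n ∈ sf N ↔ (0 < n ∧ n ≤ N) ∧ Squarefree n := by simp [sf]

lemma mulf_nonneg {g : ℕ → ℝ} (hg : ∀ p, 0 ≤ g p) (n : ℕ) : 0 ≤ mulf g n :=
  prod_nonneg fun p _ => hg p

lemma mulf_one (g : ℕ → ℝ) : mulf g 1 = 1 := by simp [mulf]

lemma mulf_mul {g : ℕ → ℝ} {m n : ℕ} (h : m.Coprime n) : mulf g (m*n) = mulf g m * mulf g n := by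
  unfold mulf
  rw [h.primeFactors_mul, prod_union h.disjoint_primeFactors]

lemma mulf_prime {g : ℕ → ℝ} {p : ℕ} (h : p.Prime) : mulf g p = g p := by
  simp [mulf, h.primeFactors]

lemma mulf_div {g : ℕ → ℝ} {n : ℕ} (h : Squarefree n) :
    mulf g n / n = ∏ p ∈ n.primeFactors, (g p / p) := by
  rw [prod_div_distrib]
  congr 1
  have := (Nat.prod_primeFactors_of_squarefree h).symm
  conv_lhs => rw [this]
  push_cast; rfl

lemma sum_sf_le {g : ℕ → ℝ} (hg : ∀ p, 0 ≤ g p) (N : ℕ) :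
    ∑ n ∈ sf N, mulf g n / n ≤ ∏ p ∈ Nat.primesLE N, (1 + g p / p) := by
  rw [Finset.prod_one_add]
  calc _ = ∑ n ∈ sf N, ∏ p ∈ n.primeFactors, (g p / p) :=
        sum_congr rfl fun n hn => mulf_div (mem_sf.1 hn).2
    _ = ∑ t ∈ (sf N).image Nat.primeFactors, ∏ p ∈ t, (g p / p) := by
        rw [sum_image]
        intro a ha b hb e
        have := Nat.prod_primeFactors_of_squarefree (mem_sf.1 ha).2
        have h2 := Nat.prod_primeFactors_of_squarefree (mem_sf.1 hb).2
        rw [← this, ← h2, e]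
    _ ≤ _ := by
        apply sum_le_sum_of_subset_of_nonneg
        · intro t ht
          obtain ⟨n, hn, rfl⟩ := mem_image.1 ht
          rw [mem_powerset]
          intro p hp
          have h1 := Nat.prime_of_mem_primeFactors hp
          have h2 := Nat.le_of_mem_primeFactors hp
          exact Nat.mem_primesLE.2 ⟨h2.trans (mem_sf.1 hn).1.2, h1⟩
        · intro t _ _
          exact prod_nonneg fun p _ => div_nonneg (hg p) (by positivity)

lemma prod_le_exp {g : ℕ → ℝ} (hg : ∀ p, 0 ≤ g p) (N : ℕ) :
    ∏ p ∈ Nat.primesLE N, (1 + g p / p) ≤ Real.exp (∑ p ∈ Nat.primesLE N, g p / p) := by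
  rw [Real.exp_sum]
  apply prod_le_prod
  · intro p _; have := div_nonneg (hg p) (Nat.cast_nonneg (α := ℝ) p); positivity
  · intro p _; rw [add_comm]; exact Real.add_one_le_exp _

lemma sum_sf_le_exp {g : ℕ → ℝ} (hg : ∀ p, 0 ≤ g p) (N : ℕ) :
    ∑ n ∈ sf N, mulf g n / n ≤ Real.exp (∑ p ∈ Nat.primesLE N, g p / p) :=
  (sum_sf_le hg N).trans (prod_le_exp hg N)

lemma sum_inv_sq_le (N : ℕ) : ∑ n ∈ Ioc 0 N, (1:ℝ)/n^2 ≤ 2 := by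
  have : ∀ N : ℕ, ∑ n ∈ Ioc 0 (N+1), (1:ℝ)/n^2 ≤ 2 - 1/(N+1) := by
    intro N
    induction N with
    | zero => norm_num
    | succ N ih =>
      have e : Ioc 0 (N+1+1) = insert (N+1+1) (Ioc 0 (N+1)) := by ext; simp; omega
      rw [e, sum_insert (by simp)]
      have : (1:ℝ)/((N+1+1:ℕ):ℝ)^2 ≤ 1/(N+1) - 1/((N+1:ℕ)+1) := by
        push_cast
        rw [div_sub_div _ _ (by positivity) (by positivity), div_le_div_iff₀ (by positivity) (by positivity)]
        nlinarith [sq_nonneg (N:ℝ)]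
      linarith
  rcases N with _ | N
  · simp
  have h := this N
  have : (0:ℝ) ≤ 1/(N+1) := by positivity
  linarith

end FK

namespace FK
open Finset

lemma harm_le_sf (N : ℕ) : ∑ n ∈ Ioc 0 N, (1:ℝ)/n ≤ 2 * ∑ m ∈ sf N, (1:ℝ)/m := by
  have h1 : ∑ n ∈ Ioc 0 N, (1:ℝ)/n ≤ ∑ x ∈ sf N ×ˢ Ioc 0 N, (1:ℝ)/(x.1 * x.2^2) := by
    have : ∀ n : ℕ, ∃ x : ℕ × ℕ, x.2^2 * x.1 = n ∧ Squarefree x.1 := by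
      intro n
      obtain ⟨a, b, h, h'⟩ := Nat.sq_mul_squarefree n
      exact ⟨(a, b), h, h'⟩
    choose F hF hF2 using this
    calc _ = ∑ n ∈ Ioc 0 N, (1:ℝ)/((F n).1 * (F n).2^2) := by
          apply sum_congr rfl; intro n _
          have := hF n
          conv_lhs => rw [← this]
          push_cast; ring
      _ = ∑ x ∈ (Ioc 0 N).image F, (1:ℝ)/(x.1 * x.2^2) := by
          rw [sum_image]
          intro a _ b _ e
          rw [← hF a, ← hF b, e]
      _ ≤ _ := by
          apply sum_le_sum_of_subset_of_nonneg
          · intro x hx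
            obtain ⟨n, hn, rfl⟩ := mem_image.1 hx
            simp only [mem_Ioc] at hn
            have e := hF n
            have p1 : 0 < (F n).1 := Nat.pos_of_ne_zero (by rintro h; rw [h] at e; simp at e; omega)
            have p2 : 0 < (F n).2 := Nat.pos_of_ne_zero (by rintro h; rw [h] at e; simp at e; omega)
            simp only [mem_product, mem_sf, mem_Ioc]
            refine ⟨⟨⟨p1, ?_⟩, hF2 n⟩, p2, ?_⟩
            · exact (Nat.le_mul_of_pos_left _ (by positivity)).trans (e.le.trans hn.2)
            · nlinarith
          · intros; positivity
  refine h1.trans ?_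
  rw [sum_product, mul_comm, sum_mul]
  apply sum_le_sum; intro m _
  calc _ = (1:ℝ)/m * ∑ n ∈ Ioc 0 N, (1:ℝ)/n^2 := by
        rw [mul_sum]; apply sum_congr rfl; intros; field_simp
    _ ≤ _ := mul_le_mul_of_nonneg_left (sum_inv_sq_le N) (by positivity)

lemma loglog_le {N : ℕ} (hN : 2 ≤ N) :
    Real.log (Real.log N) - Real.log 2 ≤ ∑ p ∈ Nat.primesLE N, (1:ℝ)/p := by
  have h1 := (le_sum_inv N).trans (harm_le_sf N)
  have h2 := sum_sf_le_exp (g := fun _ => 1) (fun _ => zero_le_one) N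
  simp only [mulf, prod_const_one] at h2
  have hN' : (2:ℝ) ≤ N := by exact_mod_cast hN
  have h3 : Real.log N ≤ Real.log (N+1) := Real.log_le_log (by linarith) (by linarith)
  have h4 : 0 < Real.log N := Real.log_pos (by linarith)
  have h5 : Real.log N / 2 ≤ Real.exp (∑ p ∈ Nat.primesLE N, (1:ℝ)/p) := by linarith
  have h6 := Real.log_le_log (by positivity) h5
  rwa [Real.log_exp, Real.log_div h4.ne' (by norm_num)] at h6

lemma markov_sum (w l : ℕ → ℝ) (hw : ∀ p, 0 ≤ w p) (P : Finset ℕ) (hl : ∀ p ∈ P, 0 ≤ l p) :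
    ∑ t ∈ P.powerset, (∏ p ∈ t, w p) * ∑ p ∈ t, l p ≤
      (∑ p ∈ P, w p * l p) * ∑ t ∈ P.powerset, ∏ p ∈ t, w p := by
  induction P using Finset.induction_on with
  | empty => simp
  | insert a P ha ih =>
    have ih := ih (fun p hp => hl p (mem_insert_of_mem hp))
    have hla := hl a (mem_insert_self _ _)
    rw [sum_powerset_insert ha, sum_powerset_insert ha, sum_insert ha]
    have e1 : ∑ t ∈ P.powerset, (∏ p ∈ insert a t, w p) * ∑ p ∈ insert a t, l p =
        w a * l a * (∑ t ∈ P.powerset, ∏ p ∈ t, w p) +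
        w a * ∑ t ∈ P.powerset, (∏ p ∈ t, w p) * ∑ p ∈ t, l p := by
      rw [mul_sum, mul_sum, ← sum_add_distrib]
      apply sum_congr rfl; intro t ht
      have : a ∉ t := fun h => ha (mem_powerset.1 ht h)
      rw [prod_insert this, sum_insert this]; ring
    have e2 : ∑ t ∈ P.powerset, (∏ p ∈ insert a t, w p) =
        w a * ∑ t ∈ P.powerset, ∏ p ∈ t, w p := by
      rw [mul_sum]
      apply sum_congr rfl; intro t ht
      have : a ∉ t := fun h => ha (mem_powerset.1 ht h)
      rw [prod_insert this]
    rw [e1, e2]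
    have hG : 0 ≤ ∑ t ∈ P.powerset, ∏ p ∈ t, w p :=
      sum_nonneg fun t _ => prod_nonneg fun p _ => hw p
    have h0 := hw a
    set G := ∑ t ∈ P.powerset, ∏ p ∈ t, w p
    set L := ∑ t ∈ P.powerset, (∏ p ∈ t, w p) * ∑ p ∈ t, l p
    set S := ∑ p ∈ P, w p * l p
    have : w a * L ≤ w a * (S * G) := mul_le_mul_of_nonneg_left ih h0
    have h7 : 0 ≤ w a * l a * (w a * G) := by positivity
    nlinarith

lemma fifth_root (N : ℕ) (hN : 32 ≤ N) : ∃ y : ℕ, 2 ≤ y ∧ y^5 ≤ N ∧ N < (y+1)^5 := by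
  let P := fun y : ℕ => y^5 ≤ N
  refine ⟨Nat.findGreatest P N, ?_, ?_, ?_⟩
  · exact Nat.le_findGreatest (by omega) (show 2^5 ≤ N by omega)
  · exact Nat.findGreatest_spec (P := P) (m := 2) (by omega) (show 2^5 ≤ N by omega)
  · by_contra h
    push Not at h
    have h1 : Nat.findGreatest P N + 1 ≤ N :=
      le_trans (Nat.le_self_pow (by norm_num) _) h
    exact Nat.findGreatest_is_greatest (P := P) (n := N) (Nat.lt_succ_self _) h1 h

theorem rankin : ∃ C : ℝ, 0 < C ∧ ∀ h : ℕ → ℝ, (∀ p, 0 ≤ h p) → (∀ p, h p ≤ 2) → ∀ N : ℕ, 1 ≤ N →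
    ∏ p ∈ Nat.primesLE N, (1 + h p / p) ≤ C * ∑ n ∈ sf N, mulf h n / n := by
  set C0 : ℝ := Real.log 4 + 4 with hC0
  have hC0p : 0 < C0 := by have := Real.log_pos (show (1:ℝ) < 4 by norm_num); linarith
  set N0 : ℕ := ⌈Real.exp (20 * C0)⌉₊ + 32 with hN0
  refine ⟨max (3^(N0+1)) (2 * Real.exp 60), by positivity, ?_⟩
  intro h h0 h2 N hN
  have hw : ∀ p : ℕ, 0 ≤ h p / p := fun p => div_nonneg (h0 p) (by positivity)
  have hS1 : 1 ≤ ∑ n ∈ sf N, mulf h n / n := by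
    have : (1:ℕ) ∈ sf N := mem_sf.2 ⟨⟨by norm_num, hN⟩, squarefree_one⟩
    have := single_le_sum (f := fun n : ℕ => mulf h n / n)
      (fun i _ => div_nonneg (mulf_nonneg h0 i) (by positivity)) this
    simpa [mulf_one] using this
  by_cases hsmall : N < N0
  · have h3 : ∏ p ∈ Nat.primesLE N, (1 + h p / p) ≤ 3^(N0+1) := by
      calc _ ≤ ∏ p ∈ Nat.primesLE N, (3:ℝ) := by
            apply prod_le_prod
            · intro p _; have := hw p; positivity
            · intro p hp
              have hp1 : (1:ℝ) ≤ p := by exact_mod_cast (Nat.mem_primesLE.1 hp).2.one_le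
              have : h p / p ≤ h p := div_le_self (h0 p) hp1
              linarith [h2 p]
        _ = 3 ^ (Nat.primesLE N).card := by simp
        _ ≤ _ := by
            apply pow_le_pow_right₀ (by norm_num)
            have : Nat.primesLE N ⊆ Finset.range (N+1) := by
              intro p hp; have := (Nat.mem_primesLE.1 hp).1; simp; omega
            have := card_le_card this
            rw [card_range] at this; omega
    calc _ ≤ (3:ℝ)^(N0+1) := h3
      _ ≤ max (3^(N0+1)) (2 * Real.exp 60) * 1 := by rw [mul_one]; exact le_max_left _ _
      _ ≤ _ := mul_le_mul_of_nonneg_left hS1 (by positivity)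
  · push Not at hsmall
    have hN' : (1:ℝ) ≤ N := by exact_mod_cast hN
    have hlogN : 20 * C0 ≤ Real.log N := by
      rw [Real.le_log_iff_exp_le (by linarith)]
      calc _ ≤ ((⌈Real.exp (20 * C0)⌉₊ : ℕ):ℝ) := Nat.le_ceil _
        _ ≤ N := by exact_mod_cast (by omega)
    have hlogN0 : 0 < Real.log N := by linarith
    obtain ⟨y, hy2, hy5, hyN⟩ := fifth_root N (by omega)
    have hy2' : (2:ℝ) ≤ y := by exact_mod_cast hy2
    have hly : 5 * Real.log y ≤ Real.log N := by
      rw [← Real.log_rpow (by linarith)]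
      apply Real.log_le_log (by positivity)
      exact_mod_cast hy5
    have hly2 : Real.log N ≤ 10 * Real.log y := by
      rw [← Real.log_rpow (by linarith)]
      apply Real.log_le_log (by linarith)
      have : N ≤ y^10 := by
        calc N ≤ (y+1)^5 := hyN.le
          _ ≤ (y^2)^5 := Nat.pow_le_pow_left (by nlinarith) 5
          _ = _ := by ring
      exact_mod_cast this
    have hlogy : 0 < Real.log y := Real.log_pos (by linarith)
    set P := Nat.primesLE y with hP
    set G := ∏ p ∈ P, (1 + h p / p) with hG
    have hGe : G = ∑ t ∈ P.powerset, ∏ p ∈ t, (h p / p) := by rw [hG, Finset.prod_one_add]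
    have hG0 : 0 ≤ G := prod_nonneg fun p _ => by have := hw p; positivity
    have hprime : ∀ p ∈ P, p.Prime := fun p hp => (Nat.mem_primesLE.1 hp).2
    have hm := markov_sum (fun p => h p / p) (fun p => Real.log p) hw P
      (fun p hp => Real.log_natCast_nonneg p)
    rw [← hGe] at hm
    have hs : ∑ p ∈ P, h p / p * Real.log p ≤ 2 * (Real.log y + C0) := by
      calc _ ≤ ∑ p ∈ P, 2 * (Real.log p / p) := by
            apply sum_le_sum; intro p _
            have : 0 ≤ Real.log p / p := div_nonneg (Real.log_natCast_nonneg p) (by positivity)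
            calc _ = h p * (Real.log p / p) := by ring
              _ ≤ _ := mul_le_mul_of_nonneg_right (h2 p) this
        _ = 2 * ∑ p ∈ P, Real.log p / p := by rw [mul_sum]
        _ ≤ _ := by have := sum_logp_le (N := y) (by omega); linarith
    -- the large part
    have hbig : (∑ t ∈ P.powerset with ¬ (∏ p ∈ t, p ≤ N), ∏ p ∈ t, (h p / p)) * Real.log N ≤
        2 * (Real.log y + C0) * G := by
      refine le_trans ?_ (hm.trans (mul_le_mul_of_nonneg_right hs hG0))
      rw [sum_mul]
      refine le_trans (sum_le_sum (g := fun t => (∏ p ∈ t, h p / p) * ∑ p ∈ t, Real.log p) ?_) ?_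
      · intro t ht
        simp only [mem_filter, mem_powerset] at ht
        apply mul_le_mul_of_nonneg_left _ (prod_nonneg fun p _ => hw p)
        rw [← Real.log_prod (fun p hp => by
          have := (hprime p (ht.1 hp)).pos; positivity)]
        apply Real.log_le_log (by linarith)
        have := ht.2
        push Not at this
        have h9 : (N:ℝ) ≤ ((∏ p ∈ t, p : ℕ):ℝ) := by exact_mod_cast this.le
        rwa [Nat.cast_prod] at h9
      · apply sum_le_sum_of_subset_of_nonneg (filter_subset _ _)
        intro t _ _
        exact mul_nonneg (prod_nonneg fun p _ => hw p)
          (sum_nonneg fun p _ => Real.log_natCast_nonneg p)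
    have hsplit := sum_filter_add_sum_filter_not P.powerset (fun t => ∏ p ∈ t, p ≤ N)
      (fun t => ∏ p ∈ t, (h p / p))
    rw [← hGe] at hsplit
    have hbig2 : (∑ t ∈ P.powerset with ¬ (∏ p ∈ t, p ≤ N), ∏ p ∈ t, (h p / p)) ≤ G / 2 := by
      have : (∑ t ∈ P.powerset with ¬ (∏ p ∈ t, p ≤ N), ∏ p ∈ t, (h p / p)) * Real.log N ≤
          G / 2 * Real.log N := by
        refine hbig.trans ?_
        nlinarith
      exact le_of_mul_le_mul_right this hlogN0
    have hsm : (∑ t ∈ P.powerset with (∏ p ∈ t, p ≤ N), ∏ p ∈ t, (h p / p)) ≤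
        ∑ n ∈ sf N, mulf h n / n := by
      have e : ∀ t ∈ P.powerset, (∏ p ∈ t, p).primeFactors = t ∧ Squarefree (∏ p ∈ t, p) := by
        intro t ht
        rw [mem_powerset] at ht
        refine ⟨Nat.primeFactors_prod (fun p hp => hprime p (ht hp)), ?_⟩
        apply Finset.squarefree_prod_of_pairwise_isCoprime
        · intro p hp q hq hpq
          exact Nat.isCoprime_iff_coprime.2
            ((Nat.coprime_primes (hprime p (ht hp)) (hprime q (ht hq))).2 hpq) |> fun h => by
              exact (Nat.coprime_iff_isRelPrime.1 ((Nat.coprime_primes (hprime p (ht hp)) (hprime q (ht hq))).2 hpq))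
        · intro p hp; exact (hprime p (ht hp)).prime.squarefree
      calc _ = ∑ t ∈ P.powerset with (∏ p ∈ t, p ≤ N), mulf h (∏ p ∈ t, p) / ((∏ p ∈ t, p : ℕ):ℝ) := by
            apply sum_congr rfl; intro t ht
            have := e t (mem_filter.1 ht).1
            rw [mulf_div this.2, this.1]
        _ = ∑ n ∈ (P.powerset.filter (fun t => ∏ p ∈ t, p ≤ N)).image (fun t => ∏ p ∈ t, p), mulf h n / n := by
            rw [sum_image]
            intro s hs t ht e'
            have h1 := (e s (mem_filter.1 hs).1).1
            have h2 := (e t (mem_filter.1 ht).1).1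
            simp only at e'
            rw [← h1, ← h2, e']
        _ ≤ _ := by
            apply sum_le_sum_of_subset_of_nonneg
            · intro n hn
              obtain ⟨t, ht, rfl⟩ := mem_image.1 hn
              have ht := mem_filter.1 ht
              exact mem_sf.2 ⟨⟨Nat.pos_of_ne_zero (e t ht.1).2.ne_zero, ht.2⟩, (e t ht.1).2⟩
            · intro i _ _
              exact div_nonneg (mulf_nonneg h0 i) (by positivity)
    have hGle : G ≤ 2 * ∑ n ∈ sf N, mulf h n / n := by linarith
    -- extend from y to N
    have hyleN : y ≤ N := le_trans (Nat.le_self_pow (by norm_num) _) hy5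
    have hsub : P ⊆ Nat.primesLE N := by
      intro p hp; have := Nat.mem_primesLE.1 hp
      exact Nat.mem_primesLE.2 ⟨this.1.trans hyleN, this.2⟩
    have hext : ∏ p ∈ Nat.primesLE N \ P, (1 + h p / p) ≤ Real.exp 60 := by
      calc _ ≤ ∏ p ∈ Nat.primesLE N \ P, Real.exp (h p / p) := by
            apply prod_le_prod
            · intro p _; have := hw p; positivity
            · intro p _; rw [add_comm]; exact Real.add_one_le_exp _
        _ = Real.exp (∑ p ∈ Nat.primesLE N \ P, h p / p) := by rw [Real.exp_sum]
        _ ≤ _ := by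
            apply Real.exp_le_exp.2
            have : ∑ p ∈ Nat.primesLE N \ P, h p / p ≤
                (2 / Real.log y) * ∑ p ∈ Nat.primesLE N \ P, Real.log p / p := by
              rw [mul_sum]
              apply sum_le_sum; intro p hp
              rw [mem_sdiff] at hp
              have hpy : y < p := by
                by_contra hc
                exact hp.2 (Nat.mem_primesLE.2 ⟨by omega, (Nat.mem_primesLE.1 hp.1).2⟩)
              have hp0 : (0:ℝ) < p := by exact_mod_cast (by omega)
              have hlp : Real.log y ≤ Real.log p :=
                Real.log_le_log (by linarith) (by exact_mod_cast hpy.le)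
              have h1 : 1 ≤ Real.log p / Real.log y := (one_le_div hlogy).2 hlp
              have h3 : h p ≤ 2 * (Real.log p / Real.log y) := by linarith [h2 p]
              calc _ ≤ 2 * (Real.log p / Real.log y) / p :=
                    div_le_div_of_nonneg_right h3 hp0.le
                _ = _ := by field_simp
            refine this.trans ?_
            have h4 : ∑ p ∈ Nat.primesLE N \ P, Real.log p / p ≤ Real.log N + C0 := by
              refine le_trans ?_ (sum_logp_le hN)
              apply sum_le_sum_of_subset_of_nonneg sdiff_subset
              intro i _ _
              exact div_nonneg (Real.log_natCast_nonneg i) (by positivity)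
            rw [div_mul_eq_mul_div, div_le_iff₀ hlogy]
            linarith
    have hfin : ∏ p ∈ Nat.primesLE N, (1 + h p / p) =
        (∏ p ∈ Nat.primesLE N \ P, (1 + h p / p)) * G := by
      rw [hG, prod_sdiff hsub]
    rw [hfin]
    have hS0 : 0 ≤ ∑ n ∈ sf N, mulf h n / n := by linarith
    calc _ ≤ Real.exp 60 * (2 * ∑ n ∈ sf N, mulf h n / n) :=
          mul_le_mul hext hGle hG0 (by positivity)
      _ = 2 * Real.exp 60 * ∑ n ∈ sf N, mulf h n / n := by ring
      _ ≤ _ := mul_le_mul_of_nonneg_right (le_max_right _ _) hS0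

end FK

namespace FK
open Finset

lemma geom_nonneg (x : ℝ) (h : -1 ≤ x) (n : ℕ) : 0 ≤ ∑ i ∈ range n, x^i := by
  rcases eq_or_lt_of_le h with rfl | h
  · rw [neg_one_geom_sum]; split_ifs <;> norm_num
  · rcases n with _ | n
    · simp
    · exact (geom_sum_pos' (by linarith) (Nat.succ_ne_zero n)).le

/-- A completely multiplicative function bounded by one. -/
structure CM (ψ : ℕ → ℝ) : Prop where
  one : ψ 1 = 1
  mul : ∀ m n, ψ (m*n) = ψ m * ψ n
  le : ∀ n, |ψ n| ≤ 1

lemma CM.pow {ψ : ℕ → ℝ} (h : CM ψ) (m k : ℕ) : ψ (m^k) = ψ m ^ k := by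
  induction k with
  | zero => simp [h.one]
  | succ k ih => rw [pow_succ, h.mul, ih, pow_succ]

lemma CM.mulf_eq {ψ : ℕ → ℝ} (h : CM ψ) {n : ℕ} (hn : Squarefree n) : mulf ψ n = ψ n := by
  have key : ∀ s : Finset ℕ, ∏ p ∈ s, ψ p = ψ (∏ p ∈ s, p) := by
    intro s
    induction s using Finset.induction_on with
    | empty => simp [h.one]
    | insert a s ha ih => rw [prod_insert ha, prod_insert ha, h.mul, ih]
  unfold mulf
  rw [key, Nat.prod_primeFactors_of_squarefree hn]

noncomputable def dsum (ψ : ℕ → ℝ) (n : ℕ) : ℝ := ∑ d ∈ n.divisors, ψ d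

noncomputable def af (ψ : ℕ → ℝ) : ArithmeticFunction ℝ := ⟨fun n => if n = 0 then 0 else ψ n, by simp⟩

lemma af_apply (ψ : ℕ → ℝ) {n : ℕ} (hn : n ≠ 0) : af ψ n = ψ n := by
  show (if n = 0 then 0 else ψ n) = _
  simp [hn]

lemma af_mult {ψ : ℕ → ℝ} (h : CM ψ) : (af ψ).IsMultiplicative := by
  rw [ArithmeticFunction.IsMultiplicative.iff_ne_zero]
  refine ⟨by rw [af_apply _ one_ne_zero, h.one], ?_⟩
  intro m n hm hn _
  rw [af_apply _ hm, af_apply _ hn, af_apply _ (mul_ne_zero hm hn), h.mul]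

open ArithmeticFunction in
lemma dsum_eq (ψ : ℕ → ℝ) (n : ℕ) : dsum ψ n = (af ψ * (zeta : ArithmeticFunction ℝ)) n := by
  rw [coe_mul_zeta_apply]
  unfold dsum
  apply sum_congr rfl
  intro d hd
  rw [af_apply]
  rintro rfl; simp at hd

lemma dsum_nonneg {ψ : ℕ → ℝ} (h : CM ψ) (n : ℕ) : 0 ≤ dsum ψ n := by
  induction n using Nat.recOnPosPrimePosCoprime with
  | zero => simp [dsum]
  | one => simp [dsum, h.one]
  | prime_pow p k hp hk =>
    unfold dsum
    rw [Nat.sum_divisors_prime_pow hp]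
    simp only [h.pow]
    exact geom_nonneg _ (abs_le.1 (h.le p)).1 _
  | coprime a b ha hb hab iha ihb =>
    have : dsum ψ (a*b) = dsum ψ a * dsum ψ b := by
      simp only [dsum_eq]
      exact ((af_mult h).mul ArithmeticFunction.isMultiplicative_zeta.natCast).map_mul_of_coprime hab
    rw [this]; positivity

lemma mulf_eq_dsum {ψ : ℕ → ℝ} (h : CM ψ) {n : ℕ} (hn : Squarefree n) :
    mulf (fun p => 1 + ψ p) n = dsum ψ n := by
  have := (af_mult h).prodPrimeFactors_one_add_of_squarefree hn
  unfold mulf dsum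
  rw [prod_congr rfl (g := fun p => 1 + af ψ p), this]
  · apply sum_congr rfl
    intro d hd
    rw [af_apply]
    rintro rfl; simp at hd
  · intro p hp
    rw [af_apply]
    exact (Nat.prime_of_mem_primeFactors hp).ne_zero

noncomputable def afd (ψ : ℕ → ℝ) : ArithmeticFunction ℝ := ⟨fun n => ψ n / n, by simp⟩

lemma afd_apply (ψ : ℕ → ℝ) (n : ℕ) : afd ψ n = ψ n / n := rfl

lemma afd_mul (ψ : ℕ → ℝ) (n : ℕ) : (afd (fun _ => 1) * afd ψ) n = dsum ψ n / n := by
  rw [mul_comm, ArithmeticFunction.mul_apply, Nat.sum_divisorsAntidiagonal (f := fun a b => afd ψ a * afd (fun _ => 1) b)]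
  unfold dsum
  rw [sum_div]
  apply sum_congr rfl
  intro d hd
  have hd' := Nat.mem_divisors.1 hd
  obtain ⟨e, rfl⟩ := hd'.1
  have h1 : d ≠ 0 := by rintro rfl; simp at hd'
  have h2 : e ≠ 0 := by rintro rfl; simp at hd'
  rw [Nat.mul_div_cancel_left _ (Nat.pos_of_ne_zero h1), afd_apply, afd_apply]
  push_cast
  field_simp

lemma psi_sum_bound {ψ : ℕ → ℝ} (h : CM ψ) {q : ℕ} (hq : 1 ≤ q)
    (hb : ∀ n, |∑ i ∈ Ioc 0 n, ψ i| ≤ q) (M : ℕ) :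
    |∑ a ∈ Ioc 0 M, ψ a / a| ≤ 3 + Real.log q := by
  have triv : ∀ M : ℕ, |∑ a ∈ Ioc 0 M, ψ a / a| ≤ 1 + Real.log M := by
    intro M
    refine le_trans (abs_sum_le_sum_abs _ _) (le_trans ?_ (sum_inv_le M))
    apply sum_le_sum; intro a _
    rw [abs_div, Nat.abs_cast]
    exact div_le_div_of_nonneg_right (h.le a) (by positivity)
  rcases le_or_gt M q with hM | hM
  · refine (triv M).trans ?_
    rcases Nat.eq_zero_or_pos M with rfl | hM0
    · have : 0 ≤ Real.log q := Real.log_natCast_nonneg q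
      simp; linarith
    · have : Real.log M ≤ Real.log q :=
        Real.log_le_log (by exact_mod_cast hM0) (by exact_mod_cast hM)
      linarith
  · have hq' : (1:ℝ) ≤ q := by exact_mod_cast hq
    have e : ∑ a ∈ Ioc 0 M, ψ a / a = ∑ a ∈ Ioc 0 q, ψ a / a + ∑ a ∈ Ioc q M, ψ a / a :=
      (sum_Ioc_consecutive _ (by omega) hM.le).symm
    have hp : ∀ n, |∑ i ∈ Ioc q n, ψ i| ≤ 2 * q := by
      intro n
      rcases le_or_gt q n with hn | hn
      · have e2 := sum_Ioc_consecutive ψ (Nat.zero_le q) hn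
        have : ∑ i ∈ Ioc q n, ψ i = ∑ i ∈ Ioc 0 n, ψ i - ∑ i ∈ Ioc 0 q, ψ i := by linarith
        rw [this]
        refine (abs_sub _ _).trans ?_
        linarith [hb n, hb q]
      · rw [Ioc_eq_empty (by omega)]; simp
    have ab := abel_bound ψ (fun n => 1/(n:ℝ)) (2*q) q hp (fun n _ => by positivity)
      (fun n hn => by
        apply one_div_le_one_div_of_le
        · have : 0 < n := by omega
          exact_mod_cast this
        · push_cast; linarith) M
    have e3 : ∑ i ∈ Ioc q M, ψ i * (1/(i:ℝ)) = ∑ i ∈ Ioc q M, ψ i / i := by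
      apply sum_congr rfl; intros; ring
    rw [e3] at ab
    have : 2 * (q:ℝ) * (1 / ((q+1:ℕ):ℝ)) ≤ 2 := by
      push_cast
      rw [mul_one_div, div_le_iff₀ (by linarith)]; linarith
    rw [e]
    refine (abs_add_le _ _).trans ?_
    linarith [triv q]

/-- logarithm of Euler type products. -/
lemma log_prod_ge {h : ℕ → ℝ} (h0 : ∀ p, 0 ≤ h p) (h2 : ∀ p, h p ≤ 2) (N : ℕ) :
    Real.exp (∑ p ∈ Nat.primesLE N, h p / p - 8) ≤ ∏ p ∈ Nat.primesLE N, (1 + h p / p) := by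
  have h1 : ∑ p ∈ Nat.primesLE N, (4:ℝ)/p^2 ≤ 8 := by
    calc _ ≤ ∑ n ∈ Ioc 0 N, (4:ℝ)/n^2 := by
          apply sum_le_sum_of_subset_of_nonneg
          · intro p hp
            have := Nat.mem_primesLE.1 hp
            simp [this.1, this.2.pos]
          · intros; positivity
      _ = 4 * ∑ n ∈ Ioc 0 N, (1:ℝ)/n^2 := by rw [mul_sum]; apply sum_congr rfl; intros; ring
      _ ≤ _ := by linarith [sum_inv_sq_le N]
  have h3 : Real.exp (∑ p ∈ Nat.primesLE N, (h p / p - 4/p^2)) ≤ ∏ p ∈ Nat.primesLE N, (1 + h p / p) := by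
    rw [Real.exp_sum]
    apply prod_le_prod
    · intros; positivity
    · intro p hp
      have hp2 : (2:ℝ) ≤ p := by exact_mod_cast (Nat.mem_primesLE.1 hp).2.two_le
      set u := h p / p with hu
      have hu0 : 0 ≤ u := div_nonneg (h0 p) (by positivity)
      have hu2 : u^2 ≤ 4/p^2 := by
        rw [hu, div_pow]
        apply div_le_div_of_nonneg_right _ (by positivity)
        nlinarith [h0 p, h2 p]
      calc Real.exp (u - 4/p^2) ≤ Real.exp (u - u^2) := Real.exp_le_exp.2 (by linarith)
        _ ≤ Real.exp (Real.log (1+u)) := by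
          apply Real.exp_le_exp.2
          have := Real.one_sub_inv_le_log_of_pos (show 0 < 1 + u by linarith)
          refine le_trans ?_ this
          rw [inv_eq_one_div, le_sub_iff_add_le, ← le_sub_iff_add_le', div_le_iff₀ (by linarith)]
          have : 0 ≤ u^3 := by positivity
          nlinarith
        _ = 1 + u := Real.exp_log (by linarith)
  refine le_trans (Real.exp_le_exp.2 ?_) h3
  rw [sum_sub_distrib]
  linarith

theorem sum_one_add_psi : ∃ C : ℝ, ∀ (ψ : ℕ → ℝ) (q : ℕ), CM ψ → 3 ≤ q →
    (∀ n, |∑ i ∈ Ioc 0 n, ψ i| ≤ q) → ∀ N : ℕ, 3 ≤ N →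
    ∑ p ∈ Nat.primesLE N, (1 + ψ p) / p ≤ Real.log (Real.log N) + Real.log (Real.log q) + C := by
  obtain ⟨C, hC, hR⟩ := rankin
  refine ⟨8 + Real.log (C * 8), ?_⟩
  intro ψ q h hq hb N hN
  have h0 : ∀ p, 0 ≤ 1 + ψ p := fun p => by linarith [(abs_le.1 (h.le p)).1]
  have h2 : ∀ p, 1 + ψ p ≤ 2 := fun p => by linarith [(abs_le.1 (h.le p)).2]
  have l3 : ∀ n : ℕ, 3 ≤ n → 1 ≤ Real.log n := by
    intro n hn
    rw [Real.le_log_iff_exp_le (by exact_mod_cast (by omega))]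
    have : (3:ℝ) ≤ n := by exact_mod_cast hn
    linarith [Real.exp_one_lt_d9]
  have lN := l3 N hN
  have lq := l3 q hq
  have a1 := log_prod_ge (h := fun p => 1 + ψ p) h0 h2 N
  have a2 := hR (fun p => 1 + ψ p) h0 h2 N (by omega)
  have a3 : ∑ n ∈ sf N, mulf (fun p => 1 + ψ p) n / n ≤ (2 * Real.log N) * (4 * Real.log q) := by
    calc _ = ∑ n ∈ sf N, dsum ψ n / n := sum_congr rfl fun n hn => by rw [mulf_eq_dsum h (mem_sf.1 hn).2]
      _ ≤ ∑ n ∈ Ioc 0 N, dsum ψ n / n := by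
          apply sum_le_sum_of_subset_of_nonneg (filter_subset _ _)
          intro i _ _; exact div_nonneg (dsum_nonneg h i) (by positivity)
      _ = ∑ n ∈ Ioc 0 N, (afd (fun _ => 1) * afd ψ) n := by simp only [afd_mul]
      _ = ∑ n ∈ Ioc 0 N, 1/(n:ℝ) * ∑ m ∈ Ioc 0 (N/n), ψ m / m := by
          rw [ArithmeticFunction.sum_Ioc_mul_eq_sum_sum]; rfl
      _ ≤ ∑ n ∈ Ioc 0 N, 1/(n:ℝ) * (4 * Real.log q) := by
          apply sum_le_sum; intro n _
          apply mul_le_mul_of_nonneg_left _ (by positivity)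
          have := (abs_le.1 (psi_sum_bound h (by omega) hb (N/n))).2
          linarith
      _ = (∑ n ∈ Ioc 0 N, 1/(n:ℝ)) * (4 * Real.log q) := by rw [sum_mul]
      _ ≤ _ := by
          apply mul_le_mul_of_nonneg_right _ (by linarith)
          linarith [sum_inv_le N]
  have a4 : Real.exp (∑ p ∈ Nat.primesLE N, (1 + ψ p) / p - 8) ≤ C * 8 * (Real.log N * Real.log q) := by
    refine a1.trans (a2.trans ?_)
    have := mul_le_mul_of_nonneg_left a3 hC.le
    linarith
  have a5 := Real.log_le_log (by positivity) a4
  rw [Real.log_exp, Real.log_mul (by positivity) (by positivity), Real.log_mul (x := Real.log N) (by positivity) (by positivity)] at a5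
  linarith

lemma log_eq_sum_primeFactors {n : ℕ} (hn : Squarefree n) :
    Real.log n = ∑ p ∈ n.primeFactors, Real.log p := by
  conv_lhs => rw [← Nat.prod_primeFactors_of_squarefree hn]
  rw [Nat.cast_prod, Real.log_prod]
  intro p hp
  have := (Nat.prime_of_mem_primeFactors hp).pos
  positivity

lemma sum_sf_dvd_le {g : ℕ → ℝ} (hg : ∀ p, 0 ≤ g p) (hg1 : ∀ p, g p ≤ 1) (N p : ℕ) (hp : p.Prime) :
    ∑ n ∈ sf N with p ∣ n, mulf g n ≤ ∑ m ∈ sf (N/p), mulf g m := by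
  have hdec : ∀ n ∈ (sf N).filter (p ∣ ·), n = p * (n/p) ∧ p.Coprime (n/p) ∧ n / p ∈ sf (N/p) := by
    intro n hn
    rw [mem_filter, mem_sf] at hn
    obtain ⟨⟨⟨h1, h2⟩, h3⟩, m, rfl⟩ := hn
    rw [Nat.mul_div_cancel_left _ hp.pos]
    have := Nat.squarefree_mul_iff.1 h3
    refine ⟨rfl, this.1, mem_sf.2 ⟨⟨Nat.pos_of_mul_pos_left h1, ?_⟩, this.2.2⟩⟩
    rw [Nat.le_div_iff_mul_le hp.pos, mul_comm]; exact h2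
  calc _ ≤ ∑ n ∈ sf N with p ∣ n, mulf g (n/p) := by
        apply sum_le_sum; intro n hn
        obtain ⟨e, c, _⟩ := hdec n hn
        conv_lhs => rw [e]
        rw [mulf_mul c, mulf_prime hp]
        exact mul_le_of_le_one_left (mulf_nonneg hg _) (hg1 p)
    _ = ∑ m ∈ ((sf N).filter (p ∣ ·)).image (· / p), mulf g m := by
        rw [sum_image]
        intro a ha b hb e
        simp only at e
        rw [(hdec a ha).1, (hdec b hb).1, e]
    _ ≤ _ := by
        apply sum_le_sum_of_subset_of_nonneg
        · intro m hm
          obtain ⟨n, hn, rfl⟩ := mem_image.1 hm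
          exact (hdec n hn).2.2
        · intro i _ _; exact mulf_nonneg hg i

theorem sum_mulf_le {g : ℕ → ℝ} (hg : ∀ p, 0 ≤ g p) (hg1 : ∀ p, g p ≤ 1) (N : ℕ) (hN : 2 ≤ N) :
    ∑ n ∈ sf N, mulf g n ≤ 3 * N / Real.log N * Real.exp (∑ p ∈ Nat.primesLE N, g p / p) := by
  have hN' : (2:ℝ) ≤ N := by exact_mod_cast hN
  have hlog : 0 < Real.log N := Real.log_pos (by linarith)
  have hA : ∑ n ∈ sf N, mulf g n * Real.log n ≤ Real.log 4 * N * ∑ n ∈ sf N, mulf g n / n := by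
    calc _ = ∑ n ∈ sf N, ∑ p ∈ n.primeFactors, mulf g n * Real.log p := by
          apply sum_congr rfl; intro n hn
          rw [log_eq_sum_primeFactors (mem_sf.1 hn).2, mul_sum]
      _ = ∑ p ∈ Nat.primesLE N, ∑ n ∈ sf N with p ∣ n, mulf g n * Real.log p := by
          apply sum_comm'
          intro n p
          simp only [mem_filter, Nat.mem_primesLE, Nat.mem_primeFactors, mem_sf]
          constructor
          · rintro ⟨h1, h2, h3, h4⟩
            exact ⟨⟨h1, h3⟩, (Nat.le_of_dvd h1.1.1 h3).trans h1.1.2, h2⟩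
          · rintro ⟨⟨h1, h3⟩, _, h2⟩
            exact ⟨h1, h2, h3, by omega⟩
      _ ≤ ∑ p ∈ Nat.primesLE N, ∑ m ∈ sf (N/p), mulf g m * Real.log p := by
          apply sum_le_sum; intro p hp
          rw [← sum_mul, ← sum_mul]
          exact mul_le_mul_of_nonneg_right (sum_sf_dvd_le hg hg1 N p (Nat.mem_primesLE.1 hp).2)
            (Real.log_natCast_nonneg p)
      _ = ∑ m ∈ sf N, ∑ p ∈ Nat.primesLE (N/m), mulf g m * Real.log p := by
          apply sum_comm'
          intro p m
          simp only [Nat.mem_primesLE, mem_sf]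
          constructor
          · rintro ⟨⟨h1, h2⟩, ⟨h3, h4⟩, h5⟩
            rw [Nat.le_div_iff_mul_le h2.pos] at h4
            refine ⟨⟨?_, h2⟩, ⟨h3, ?_⟩, h5⟩
            · rw [Nat.le_div_iff_mul_le h3]; linarith
            · exact le_trans (Nat.le_mul_of_pos_right _ h2.pos) h4
          · rintro ⟨⟨h1, h2⟩, ⟨h3, h4⟩, h5⟩
            rw [Nat.le_div_iff_mul_le h3] at h1
            refine ⟨⟨?_, h2⟩, ⟨h3, ?_⟩, h5⟩
            · exact le_trans (Nat.le_mul_of_pos_right _ h3) h1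
            · rw [Nat.le_div_iff_mul_le h2.pos]; linarith
      _ ≤ ∑ m ∈ sf N, Real.log 4 * N * (mulf g m / m) := by
          apply sum_le_sum; intro m hm
          rw [← mul_sum, ← Chebyshev.theta_eq_sum_primesLE_log]
          have h1 := Chebyshev.theta_le_log4_mul_x (x := ((N/m:ℕ):ℝ)) (by positivity)
          have h2 : ((N/m:ℕ):ℝ) ≤ (N:ℝ)/m := Nat.cast_div_le
          have h4 : 0 < Real.log 4 := Real.log_pos (by norm_num)
          calc _ ≤ mulf g m * (Real.log 4 * ((N:ℝ)/m)) := by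
                apply mul_le_mul_of_nonneg_left _ (mulf_nonneg hg m)
                exact h1.trans (mul_le_mul_of_nonneg_left h2 h4.le)
            _ = _ := by ring
      _ = _ := by rw [mul_sum]
  have hB : ∑ n ∈ sf N, mulf g n * (Real.log N - Real.log n) ≤ N * ∑ n ∈ sf N, mulf g n / n := by
    rw [mul_sum]
    apply sum_le_sum; intro n hn
    have hn0 : (0:ℝ) < n := by exact_mod_cast (mem_sf.1 hn).1.1
    rw [← Real.log_div (by linarith) hn0.ne']
    have : Real.log (N/n) ≤ N/n := (Real.log_le_sub_one_of_pos (by positivity)).trans (by linarith)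
    calc _ ≤ mulf g n * (N/n) := mul_le_mul_of_nonneg_left this (mulf_nonneg hg n)
      _ = _ := by ring
  have hsum : (∑ n ∈ sf N, mulf g n) * Real.log N =
      ∑ n ∈ sf N, mulf g n * Real.log n + ∑ n ∈ sf N, mulf g n * (Real.log N - Real.log n) := by
    rw [← sum_add_distrib, sum_mul]
    apply sum_congr rfl; intros; ring
  have h4 : Real.log 4 ≤ 2 := by
    have : (4:ℝ) = 2^2 := by norm_num
    rw [this, Real.log_pow]
    have := Real.log_two_lt_d9
    push_cast; linarith
  have hS := sum_sf_le_exp hg N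
  have hS0 : 0 ≤ ∑ n ∈ sf N, mulf g n / n :=
    sum_nonneg fun n _ => div_nonneg (mulf_nonneg hg n) (by positivity)
  rw [div_mul_eq_mul_div, le_div_iff₀ hlog, hsum]
  set S := ∑ n ∈ sf N, mulf g n / n
  have h5 : Real.log 4 * N * S ≤ 2 * N * S := by gcongr
  have h6 : 3 * N * S ≤ 3 * N * Real.exp (∑ p ∈ Nat.primesLE N, g p / p) := by gcongr
  linarith

end FK

namespace FK
open Finset

lemma sum_range_period (f : ℕ → ℝ) (q : ℕ) (hper : ∀ n, f (n+q) = f n)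
    (h0 : ∑ i ∈ range q, f i = 0) (n : ℕ) : ∑ i ∈ range n, f i = ∑ i ∈ range (n % q), f i := by
  have hper' : ∀ a i, f (q * a + i) = f i := by
    intro a
    induction a with
    | zero => simp
    | succ a ih => intro i; rw [← ih i, ← hper (q * a + i)]; congr 1; ring
  have hz : ∀ a, ∑ i ∈ range (q * a), f i = 0 := by
    intro a
    induction a with
    | zero => simp
    | succ a ih =>
      rw [mul_add, mul_one, sum_range_add, ih]
      simp [hper', h0]
  conv_lhs => rw [← Nat.div_add_mod n q, sum_range_add, hz]
  simp [hper']

lemma sum_Ioc_eq_range (f : ℕ → ℝ) (h0 : f 0 = 0) (n : ℕ) :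
    ∑ i ∈ Ioc 0 n, f i = ∑ i ∈ range (n+1), f i := by
  have e : range (n+1) = insert 0 (Ioc 0 n) := by
    ext i; simp only [mem_range, mem_insert, mem_Ioc]; omega
  rw [e, sum_insert (by simp), h0, zero_add]

lemma period_bound (f : ℕ → ℝ) (q : ℕ) (hq : 0 < q) (hper : ∀ n, f (n+q) = f n) (hf : ∀ n, |f n| ≤ 1)
    (hz : f 0 = 0) (h0 : ∑ i ∈ range q, f i = 0) (n : ℕ) : |∑ i ∈ Ioc 0 n, f i| ≤ q := by
  rw [sum_Ioc_eq_range f hz, sum_range_period f q hper h0]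
  calc _ ≤ ∑ i ∈ range ((n+1) % q), |f i| := abs_sum_le_sum_abs _ _
    _ ≤ ∑ i ∈ range ((n+1) % q), 1 := sum_le_sum fun i _ => hf i
    _ = (((n+1)%q : ℕ):ℝ) := by simp
    _ ≤ q := by exact_mod_cast (Nat.mod_lt _ hq).le

open ArithmeticFunction in
lemma afd_log {ψ : ℕ → ℝ} (h : CM ψ) (n : ℕ) :
    (afd (fun n => ψ n * vonMangoldt n) * afd ψ) n = ψ n * (Real.log n / n) := by
  rw [mul_apply, Nat.sum_divisorsAntidiagonal (f := fun a b => afd (fun n => ψ n * vonMangoldt n) a * afd ψ b)]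
  rw [← vonMangoldt_sum, sum_div, mul_sum]
  apply sum_congr rfl
  intro d hd
  have hd' := Nat.mem_divisors.1 hd
  obtain ⟨e, rfl⟩ := hd'.1
  have h1 : d ≠ 0 := by rintro rfl; simp at hd'
  have h2 : e ≠ 0 := by rintro rfl; simp at hd'
  rw [Nat.mul_div_cancel_left _ (Nat.pos_of_ne_zero h1), afd_apply, afd_apply, h.mul]
  push_cast
  field_simp

lemma tail_bound {ψ : ℕ → ℝ} {q : ℕ}
    (hb : ∀ n, |∑ i ∈ Ioc 0 n, ψ i| ≤ q) (g : ℕ → ℝ) (a : ℕ)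
    (hg0 : ∀ n, a < n → 0 ≤ g n) (hg : ∀ n, a < n → g (n+1) ≤ g n) (M : ℕ) :
    |∑ i ∈ Ioc a M, ψ i * g i| ≤ 2 * q * g (a+1) := by
  apply abel_bound ψ g (2*q) a _ hg0 hg
  intro n
  have hq : (0:ℝ) ≤ q := by positivity
  rcases le_or_gt a n with hn | hn
  · have e2 := sum_Ioc_consecutive ψ (Nat.zero_le a) hn
    have : ∑ i ∈ Ioc a n, ψ i = ∑ i ∈ Ioc 0 n, ψ i - ∑ i ∈ Ioc 0 a, ψ i := by linarith
    rw [this]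
    refine (abs_sub _ _).trans ?_
    linarith [hb n, hb a]
  · rw [Ioc_eq_empty (by omega)]; simp

lemma sum_psi_log_bound {ψ : ℕ → ℝ} (h : CM ψ) {q : ℕ}
    (hb : ∀ n, |∑ i ∈ Ioc 0 n, ψ i| ≤ q) (N : ℕ) :
    |∑ n ∈ Ioc 0 N, ψ n * (Real.log n / n)| ≤ 3 * Real.log 3 + 2 * q * Real.log 4 := by
  have l3 : 0 < Real.log 3 := Real.log_pos (by norm_num)
  have l4 : 0 < Real.log 4 := Real.log_pos (by norm_num)
  have triv : ∀ M : ℕ, M ≤ 3 → |∑ n ∈ Ioc 0 M, ψ n * (Real.log n / n)| ≤ 3 * Real.log 3 := by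
    intro M hM
    calc _ ≤ ∑ n ∈ Ioc 0 M, |ψ n * (Real.log n / n)| := abs_sum_le_sum_abs _ _
      _ ≤ ∑ n ∈ Ioc 0 M, Real.log 3 := by
          apply sum_le_sum; intro n hn
          simp only [mem_Ioc] at hn
          have hn1 : (1:ℝ) ≤ n := by exact_mod_cast hn.1
          have hn3 : (n:ℝ) ≤ 3 := by exact_mod_cast hn.2.trans hM
          have hl : 0 ≤ Real.log n := Real.log_nonneg hn1
          have hl3 : Real.log n ≤ Real.log 3 := Real.log_le_log (by linarith) hn3
          rw [abs_mul, abs_of_nonneg (a := Real.log n / n) (by positivity)]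
          calc _ ≤ 1 * (Real.log n / n) := mul_le_mul_of_nonneg_right (h.le n) (by positivity)
            _ ≤ Real.log n := by rw [one_mul]; exact div_le_self hl hn1
            _ ≤ _ := hl3
      _ = M * Real.log 3 := by simp
      _ ≤ _ := by
          apply mul_le_mul_of_nonneg_right _ l3.le
          exact_mod_cast hM
  rcases le_or_gt N 3 with hN | hN
  · refine (triv N hN).trans ?_
    have : (0:ℝ) ≤ 2 * q * Real.log 4 := by positivity
    linarith
  · rw [← sum_Ioc_consecutive _ (Nat.zero_le 3) hN.le]
    refine (abs_add_le _ _).trans (add_le_add (triv 3 le_rfl) ?_)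
    refine (tail_bound hb (fun n => Real.log n / n) 3 ?_ ?_ N).trans ?_
    · intro n _; exact div_nonneg (Real.log_natCast_nonneg n) (by positivity)
    · intro n hn
      have he := Real.exp_one_lt_d9
      have : (3:ℝ) < n := by exact_mod_cast hn
      apply Real.log_div_self_antitoneOn
      · show Real.exp 1 ≤ n; linarith
      · show Real.exp 1 ≤ ((n+1:ℕ):ℝ); push_cast; linarith
      · push_cast; linarith
    · apply mul_le_mul_of_nonneg_left _ (by positivity)
      norm_num
      linarith

open ArithmeticFunction in
theorem sum_psi_Lambda {ψ : ℕ → ℝ} (h : CM ψ) {q : ℕ}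
    (hb : ∀ n, |∑ i ∈ Ioc 0 n, ψ i| ≤ q) {c : ℝ} (hc : 0 < c)
    (hL : ∀ n, 1 ≤ n → c ≤ ∑ a ∈ Ioc 0 n, ψ a / a) :
    ∃ C : ℝ, ∀ N, |∑ n ∈ Ioc 0 N, ψ n * vonMangoldt n / n| ≤ C := by
  refine ⟨(3 * Real.log 3 + 2 * q * Real.log 4 + 2 * q * (Real.log 4 + 4)) / c, ?_⟩
  intro N
  have l3 : 0 < Real.log 3 := Real.log_pos (by norm_num)
  have l4 : 0 < Real.log 4 := Real.log_pos (by norm_num)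
  rcases Nat.eq_zero_or_pos N with rfl | hN
  · simp; positivity
  have hN' : (0:ℝ) < N := by exact_mod_cast hN
  rw [le_div_iff₀ hc]
  set S := fun M : ℕ => ∑ a ∈ Ioc 0 M, ψ a / a with hS
  set T := ∑ n ∈ Ioc 0 N, ψ n * vonMangoldt n / n with hT
  have e1 : ∑ n ∈ Ioc 0 N, ψ n * (Real.log n / n) =
      ∑ d ∈ Ioc 0 N, ψ d * vonMangoldt d / d * S (N/d) := by
    rw [← sum_congr rfl (fun n _ => afd_log h n), ArithmeticFunction.sum_Ioc_mul_eq_sum_sum]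
    rfl
  have e2 : S N * T = ∑ n ∈ Ioc 0 N, ψ n * (Real.log n / n) +
      ∑ d ∈ Ioc 0 N, ψ d * vonMangoldt d / d * (S N - S (N/d)) := by
    rw [e1, hT, mul_sum, ← sum_add_distrib]
    apply sum_congr rfl; intros; ring
  have e3 : |∑ d ∈ Ioc 0 N, ψ d * vonMangoldt d / d * (S N - S (N/d))| ≤ 2 * q * (Real.log 4 + 4) := by
    calc _ ≤ ∑ d ∈ Ioc 0 N, |ψ d * vonMangoldt d / d * (S N - S (N/d))| := abs_sum_le_sum_abs _ _
      _ ≤ ∑ d ∈ Ioc 0 N, vonMangoldt d * (2 * q / N) := by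
          apply sum_le_sum; intro d hd
          simp only [mem_Ioc] at hd
          have hd0 : (0:ℝ) < d := by exact_mod_cast hd.1
          have hle : N/d ≤ N := Nat.div_le_self _ _
          have e4 : S N - S (N/d) = ∑ i ∈ Ioc (N/d) N, ψ i * (1/(i:ℝ)) := by
            have := sum_Ioc_consecutive (fun a => ψ a / (a:ℝ)) (Nat.zero_le (N/d)) hle
            simp only [hS]
            rw [← this]
            simp only [add_sub_cancel_left]
            apply sum_congr rfl; intros; ring
          have e5 := tail_bound hb (fun n => 1/(n:ℝ)) (N/d) (fun n _ => by positivity)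
            (fun n hn => by
              apply one_div_le_one_div_of_le
              · have : 0 < n := lt_of_le_of_lt (Nat.zero_le _) hn
                exact_mod_cast this
              · push_cast; linarith) N
          rw [← e4] at e5
          have e6 : (1:ℝ) / ((N/d+1:ℕ):ℝ) ≤ d / N := by
            rw [div_le_div_iff₀ (by positivity) hN', one_mul]
            have := Nat.lt_mul_div_succ N hd.1
            have h7 : N ≤ d * (N/d+1) := this.le
            exact_mod_cast h7
          have e7 : |S N - S (N/d)| ≤ 2 * q * (d/N) :=
            e5.trans (mul_le_mul_of_nonneg_left e6 (by positivity))
          have hΛ : 0 ≤ vonMangoldt d := vonMangoldt_nonneg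
          rw [abs_mul, abs_div, abs_mul, Nat.abs_cast, abs_of_nonneg hΛ]
          calc _ ≤ 1 * vonMangoldt d / d * (2 * q * (d/N)) := by
                gcongr
                exact h.le d
            _ = _ := by field_simp
      _ = (∑ d ∈ Ioc 0 N, vonMangoldt d) * (2 * q / N) := by rw [sum_mul]
      _ ≤ ((Real.log 4 + 4) * N) * (2 * q / N) := by
          apply mul_le_mul_of_nonneg_right _ (by positivity)
          rw [← psi_nat]; exact Chebyshev.psi_le_const_mul_self hN'.le
      _ = _ := by field_simp
  have hSN : c ≤ S N := hL N hN
  calc |T| * c ≤ |T| * S N := mul_le_mul_of_nonneg_left hSN (abs_nonneg _)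
    _ = |S N * T| := by rw [abs_mul, abs_of_pos (hc.trans_le hSN), mul_comm]
    _ ≤ _ := by
        rw [e2]
        refine (abs_add_le _ _).trans ?_
        have := sum_psi_log_bound h hb N
        linarith

open ArithmeticFunction in
theorem nonprime_Lambda : ∃ C : ℝ, 0 ≤ C ∧ ∀ N : ℕ,
    ∑ n ∈ (Ioc 0 N).filter (fun n => ¬ n.Prime), vonMangoldt n / n ≤ C := by
  have hsum : Summable (fun n : ℕ => 4 * (1 / (n:ℝ)^(3/2:ℝ))) :=
    (Real.summable_one_div_nat_rpow.2 (by norm_num)).mul_left 4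
  refine ⟨∑' n : ℕ, 4 * (1 / (n:ℝ)^(3/2:ℝ)), tsum_nonneg fun n => by positivity, ?_⟩
  intro N
  let G : ℕ × ℕ → ℝ := fun x => Real.log x.1 / (x.1:ℝ)^x.2
  have step1 : ∑ n ∈ (Ioc 0 N).filter (fun n => ¬ n.Prime), vonMangoldt n / n ≤
      ∑ x ∈ Ioc 1 N ×ˢ Ico 2 (N+1), G x := by
    have h1 : ∑ n ∈ (Ioc 0 N).filter (fun n => ¬ n.Prime), vonMangoldt n / n =
        ∑ n ∈ ((Ioc 0 N).filter (fun n => ¬ n.Prime)).filter IsPrimePow, vonMangoldt n / n := by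
      symm
      apply sum_filter_of_ne
      intro n _ hn
      by_contra hc
      rw [vonMangoldt_eq_zero_iff.2 hc] at hn; simp at hn
    rw [h1]
    have h2 : ∀ n ∈ ((Ioc 0 N).filter (fun n => ¬ n.Prime)).filter IsPrimePow,
        ∃ x : ℕ × ℕ, x.1.Prime ∧ x.1^x.2 = n ∧ 2 ≤ x.2 ∧ x.2 ≤ N ∧ x.1 ≤ N := by
      intro n hn
      simp only [mem_filter, mem_Ioc] at hn
      obtain ⟨⟨⟨h0, hN⟩, hnp⟩, hpp⟩ := hn
      rw [isPrimePow_nat_iff] at hpp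
      obtain ⟨p, k, hp, hk, e⟩ := hpp
      refine ⟨(p, k), hp, e, ?_, ?_, ?_⟩
      · by_contra hc
        have : k = 1 := by simp only at hc; omega
        subst this
        rw [pow_one] at e; exact hnp (e ▸ hp)
      · have := Nat.lt_pow_self (n := k) hp.one_lt
        simp only; omega
      · have := Nat.le_self_pow hk.ne' p
        simp only; omega
    choose! F hF using h2
    calc _ = ∑ n ∈ ((Ioc 0 N).filter (fun n => ¬ n.Prime)).filter IsPrimePow, G (F n) := by
          apply sum_congr rfl; intro n hn
          obtain ⟨hp, e, h2, _, _⟩ := hF n hn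
          show _ = Real.log (F n).1 / ((F n).1:ℝ)^(F n).2
          conv_lhs => rw [← e]
          rw [vonMangoldt_apply_pow (by omega), vonMangoldt_apply_prime hp]
          push_cast; rfl
      _ = ∑ x ∈ (((Ioc 0 N).filter (fun n => ¬ n.Prime)).filter IsPrimePow).image F, G x := by
          rw [sum_image]
          intro a ha b hb e
          rw [← (hF a ha).2.1, ← (hF b hb).2.1, e]
      _ ≤ _ := by
          apply sum_le_sum_of_subset_of_nonneg
          · intro x hx
            obtain ⟨n, hn, rfl⟩ := mem_image.1 hx
            obtain ⟨hp, e, h2, h3, h4⟩ := hF n hn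
            simp only [mem_product, mem_Ioc, mem_Ico]
            exact ⟨⟨hp.one_lt, h4⟩, h2, by omega⟩
          · intro x _ _
            exact div_nonneg (Real.log_natCast_nonneg _) (by positivity)
  refine step1.trans ?_
  rw [sum_product]
  calc _ ≤ ∑ p ∈ Ioc 1 N, 4 * (1 / (p:ℝ)^(3/2:ℝ)) := by
        apply sum_le_sum; intro p hp
        simp only [mem_Ioc] at hp
        have hp2 : (2:ℝ) ≤ p := by exact_mod_cast hp.1
        have hp0 : (0:ℝ) < p := by linarith
        have hgeo : ∑ j ∈ Ico 2 (N+1), (1/(p:ℝ))^j ≤ 2 / p^2 := by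
          rw [sum_Ico_eq_sum_range]
          have : ∀ i, (1/(p:ℝ))^(2+i) = (1/(p:ℝ))^2 * (1/(p:ℝ))^i := fun i => by rw [pow_add]
          simp only [this]
          rw [← mul_sum]
          have hr : 1/(p:ℝ) ≤ 1/2 := one_div_le_one_div_of_le (by norm_num) hp2
          have h3 : ∑ i ∈ range (N+1-2), (1/(p:ℝ))^i ≤ 2 := by
            have hs := summable_geometric_of_lt_one (r := 1/(p:ℝ)) (by positivity) (by linarith)
            refine (hs.sum_le_tsum _ (fun i _ => by positivity)).trans ?_
            rw [tsum_geometric_of_lt_one (by positivity) (by linarith)]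
            rw [inv_le_comm₀ (by linarith) (by norm_num)]
            linarith
          calc _ ≤ (1/(p:ℝ))^2 * 2 := mul_le_mul_of_nonneg_left h3 (by positivity)
            _ = _ := by ring
        have hlog : Real.log p ≤ 2 * (p:ℝ)^(1/2:ℝ) := by
          have := Real.log_le_rpow_div hp0.le (show (0:ℝ) < 1/2 by norm_num)
          linarith
        calc ∑ y ∈ Ico 2 (N+1), G (p, y) = Real.log p * ∑ j ∈ Ico 2 (N+1), (1/(p:ℝ))^j := by
              rw [mul_sum]; apply sum_congr rfl; intro j _
              show Real.log p / (p:ℝ)^j = _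
              rw [div_pow, one_pow]; ring
          _ ≤ (2 * (p:ℝ)^(1/2:ℝ)) * (2/p^2) := by
              apply mul_le_mul hlog hgeo _ (by positivity)
              exact sum_nonneg fun i _ => by positivity
          _ = _ := by
              have : (p:ℝ)^2 = (p:ℝ)^(1/2:ℝ) * (p:ℝ)^(3/2:ℝ) := by
                rw [← Real.rpow_add hp0]; norm_num
              rw [this]; field_simp; norm_num
    _ ≤ _ := hsum.sum_le_tsum _ (fun i _ => by positivity)

end FK

namespace FK
open Finset

noncomputable def c4 (n : ℕ) : ℝ := ((ZMod.χ₄ (n : ZMod 4) : ℤ) : ℝ)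
noncomputable def c8 (n : ℕ) : ℝ := ((ZMod.χ₈ (n : ZMod 8) : ℤ) : ℝ)
noncomputable def c48 (n : ℕ) : ℝ := c4 n * c8 n

lemma c4_of_mod (n r : ℕ) (h : n % 8 = r) : c4 n = c4 r := by
  unfold c4
  have : ((n:ℕ) : ZMod 4) = (r : ZMod 4) := by
    rw [ZMod.natCast_eq_natCast_iff]
    unfold Nat.ModEq; omega
  rw [this]
lemma c8_of_mod (n r : ℕ) (h : n % 8 = r) : c8 n = c8 r := by
  unfold c8
  have : ((n:ℕ) : ZMod 8) = (r : ZMod 8) := by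
    rw [ZMod.natCast_eq_natCast_iff]
    unfold Nat.ModEq; omega
  rw [this]
lemma c48_of_mod (n r : ℕ) (h : n % 8 = r) : c48 n = c48 r := by
  unfold c48; rw [c4_of_mod n r h, c8_of_mod n r h]

lemma c4_vals : c4 0 = 0 ∧ c4 1 = 1 ∧ c4 2 = 0 ∧ c4 3 = -1 ∧ c4 4 = 0 ∧ c4 5 = 1 ∧ c4 6 = 0 ∧ c4 7 = -1 := by
  unfold c4
  refine ⟨?_, ?_, ?_, ?_, ?_, ?_, ?_, ?_⟩
  · exact_mod_cast (by decide : ZMod.χ₄ ((0:ℕ):ZMod 4) = 0)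
  · exact_mod_cast (by decide : ZMod.χ₄ ((1:ℕ):ZMod 4) = 1)
  · exact_mod_cast (by decide : ZMod.χ₄ ((2:ℕ):ZMod 4) = 0)
  · exact_mod_cast (by decide : ZMod.χ₄ ((3:ℕ):ZMod 4) = -1)
  · exact_mod_cast (by decide : ZMod.χ₄ ((4:ℕ):ZMod 4) = 0)
  · exact_mod_cast (by decide : ZMod.χ₄ ((5:ℕ):ZMod 4) = 1)
  · exact_mod_cast (by decide : ZMod.χ₄ ((6:ℕ):ZMod 4) = 0)
  · exact_mod_cast (by decide : ZMod.χ₄ ((7:ℕ):ZMod 4) = -1)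

lemma c8_vals : c8 0 = 0 ∧ c8 1 = 1 ∧ c8 2 = 0 ∧ c8 3 = -1 ∧ c8 4 = 0 ∧ c8 5 = -1 ∧ c8 6 = 0 ∧ c8 7 = 1 := by
  unfold c8
  refine ⟨?_, ?_, ?_, ?_, ?_, ?_, ?_, ?_⟩
  · exact_mod_cast (by decide : ZMod.χ₈ ((0:ℕ):ZMod 8) = 0)
  · exact_mod_cast (by decide : ZMod.χ₈ ((1:ℕ):ZMod 8) = 1)
  · exact_mod_cast (by decide : ZMod.χ₈ ((2:ℕ):ZMod 8) = 0)
  · exact_mod_cast (by decide : ZMod.χ₈ ((3:ℕ):ZMod 8) = -1)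
  · exact_mod_cast (by decide : ZMod.χ₈ ((4:ℕ):ZMod 8) = 0)
  · exact_mod_cast (by decide : ZMod.χ₈ ((5:ℕ):ZMod 8) = -1)
  · exact_mod_cast (by decide : ZMod.χ₈ ((6:ℕ):ZMod 8) = 0)
  · exact_mod_cast (by decide : ZMod.χ₈ ((7:ℕ):ZMod 8) = 1)

lemma c4_abs (n : ℕ) : |c4 n| ≤ 1 := by
  obtain ⟨h0, h1, h2, h3, h4, h5, h6, h7⟩ := c4_vals
  rw [c4_of_mod n _ rfl]
  have : n % 8 < 8 := Nat.mod_lt _ (by norm_num)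
  interval_cases h : n % 8 <;> simp [*]

lemma c8_abs (n : ℕ) : |c8 n| ≤ 1 := by
  obtain ⟨h0, h1, h2, h3, h4, h5, h6, h7⟩ := c8_vals
  rw [c8_of_mod n _ rfl]
  have : n % 8 < 8 := Nat.mod_lt _ (by norm_num)
  interval_cases h : n % 8 <;> simp [*]

lemma c4_CM : CM c4 := ⟨c4_vals.2.1, fun m n => by unfold c4; push_cast; rw [map_mul]; push_cast; rfl, c4_abs⟩
lemma c8_CM : CM c8 := ⟨c8_vals.2.1, fun m n => by unfold c8; push_cast; rw [map_mul]; push_cast; rfl, c8_abs⟩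

lemma CM.prod {f g : ℕ → ℝ} (hf : CM f) (hg : CM g) : CM (fun n => f n * g n) :=
  ⟨by simp [hf.one, hg.one], fun m n => by simp only [hf.mul, hg.mul]; ring, fun n => by
    rw [abs_mul]; exact mul_le_one₀ (hf.le n) (abs_nonneg _) (hg.le n)⟩

lemma c48_CM : CM c48 := c4_CM.prod c8_CM

lemma L_lower (f : ℕ → ℝ) (hmod : ∀ n, f n = f (n % 8)) (a b c : ℝ) (ha : a = 1 ∨ a = -1)
    (hb : b = 1 ∨ b = -1) (hc : c = 1 ∨ c = -1) (habc : 1 + a + b + c = 0)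
    (v : f 0 = 0 ∧ f 1 = 1 ∧ f 2 = 0 ∧ f 3 = a ∧ f 4 = 0 ∧ f 5 = b ∧ f 6 = 0 ∧ f 7 = c) :
    (∀ n, |∑ i ∈ Ioc 0 n, f i| ≤ 8) ∧ ∀ n, 1 ≤ n → 1/20 ≤ ∑ i ∈ Ioc 0 n, f i / i := by
  obtain ⟨h0, h1, h2, h3, h4, h5, h6, h7⟩ := v
  have h8 : f 8 = 0 := by rw [hmod 8]; exact h0
  have hper : ∀ n, f (n+8) = f n := fun n => by rw [hmod (n+8), hmod n]; simp
  have hz : ∑ i ∈ range 8, f i = 0 := by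
    simp only [sum_range_succ, range_zero, sum_empty, h0, h1, h2, h3, h4, h5, h6, h7]; linarith
  have hpart : ∀ n, |∑ i ∈ Ioc 0 n, f i| ≤ 2 := by
    intro n
    rw [sum_Ioc_eq_range f h0, sum_range_period f 8 hper hz]
    have : (n+1) % 8 < 8 := Nat.mod_lt _ (by norm_num)
    interval_cases (n+1) % 8 <;>
      simp only [sum_range_succ, range_zero, sum_empty, h0, h1, h2, h3, h4, h5, h6, h7] <;>
      rcases ha with rfl | rfl <;> rcases hb with rfl | rfl <;> rcases hc with rfl | rfl <;>
      first | (exfalso; norm_num at habc; done) | norm_num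
  refine ⟨fun n => (hpart n).trans (by norm_num), ?_⟩
  have hsm : ∀ n, 1 ≤ n → n ≤ 8 → 32/100 ≤ ∑ i ∈ Ioc 0 n, f i / i := by
    intro n hn1 hn8
    rw [sum_Ioc_eq_range (fun i => f i / i) (by simp)]
    interval_cases n <;>
      simp only [sum_range_succ, range_zero, sum_empty, h0, h1, h2, h3, h4, h5, h6, h7, h8] <;>
      rcases ha with rfl | rfl <;> rcases hb with rfl | rfl <;> rcases hc with rfl | rfl <;>
      first | (exfalso; norm_num at habc; done) | norm_num
  intro n hn
  rcases le_or_gt n 8 with h | h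
  · exact le_trans (by norm_num) (hsm n hn h)
  · rw [← sum_Ioc_consecutive _ (Nat.zero_le 8) h.le]
    have e0 : ∑ i ∈ Ioc 0 8, f i = 0 := by
      rw [sum_Ioc_eq_range f h0, sum_range_succ, hz, h8]; simp
    have := abel_bound f (fun n => 1/(n:ℝ)) 2 8 (fun m => by
        rcases le_or_gt 8 m with hm | hm
        · have := sum_Ioc_consecutive f (Nat.zero_le 8) hm
          rw [e0, zero_add] at this
          rw [this]; exact hpart m
        · rw [Ioc_eq_empty (by omega)]; simp) (fun n _ => by positivity)
      (fun n hn => by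
        apply one_div_le_one_div_of_le
        · have : 0 < n := by omega
          exact_mod_cast this
        · push_cast; linarith) n
    have e1 : ∑ i ∈ Ioc 8 n, f i * (1/(i:ℝ)) = ∑ i ∈ Ioc 8 n, f i / i := by
      apply sum_congr rfl; intros; ring
    rw [e1] at this
    have h9 := (abs_le.1 this).1
    have h10 := hsm 8 (by norm_num) le_rfl
    norm_num at h9
    linarith

lemma c4_L : (∀ n, |∑ i ∈ Ioc 0 n, c4 i| ≤ 8) ∧ ∀ n, 1 ≤ n → 1/20 ≤ ∑ i ∈ Ioc 0 n, c4 i / i :=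
  L_lower c4 (fun n => c4_of_mod n _ rfl) (-1) 1 (-1) (by norm_num) (by norm_num) (by norm_num) (by norm_num) c4_vals
lemma c8_L : (∀ n, |∑ i ∈ Ioc 0 n, c8 i| ≤ 8) ∧ ∀ n, 1 ≤ n → 1/20 ≤ ∑ i ∈ Ioc 0 n, c8 i / i :=
  L_lower c8 (fun n => c8_of_mod n _ rfl) (-1) (-1) 1 (by norm_num) (by norm_num) (by norm_num) (by norm_num) c8_vals
lemma c48_vals : c48 0 = 0 ∧ c48 1 = 1 ∧ c48 2 = 0 ∧ c48 3 = 1 ∧ c48 4 = 0 ∧ c48 5 = -1 ∧ c48 6 = 0 ∧ c48 7 = -1 := by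
  obtain ⟨h0, h1, h2, h3, h4, h5, h6, h7⟩ := c4_vals
  obtain ⟨g0, g1, g2, g3, g4, g5, g6, g7⟩ := c8_vals
  simp only [c48, *]; norm_num
lemma c48_L : (∀ n, |∑ i ∈ Ioc 0 n, c48 i| ≤ 8) ∧ ∀ n, 1 ≤ n → 1/20 ≤ ∑ i ∈ Ioc 0 n, c48 i / i :=
  L_lower c48 (fun n => c48_of_mod n _ rfl) 1 (-1) (-1) (by norm_num) (by norm_num) (by norm_num) (by norm_num) c48_vals

open ArithmeticFunction in
lemma sum_primes_of_Lambda (f : ℕ → ℝ) (hf : ∀ n, |f n| ≤ 1) {C C1 : ℝ}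
    (hC : ∀ N, |∑ n ∈ Ioc 0 N, f n * vonMangoldt n / n| ≤ C)
    (hC1 : ∀ N : ℕ, ∑ n ∈ (Ioc 0 N).filter (fun n => ¬ n.Prime), vonMangoldt n / n ≤ C1) (N : ℕ) :
    |∑ p ∈ Nat.primesLE N, f p * (Real.log p / p)| ≤ C + C1 := by
  have e : Nat.primesLE N = (Ioc 0 N).filter Nat.Prime := by
    ext p; simp only [Nat.mem_primesLE, mem_filter, mem_Ioc]
    constructor
    · rintro ⟨h1, h2⟩; exact ⟨⟨h2.pos, h1⟩, h2⟩
    · rintro ⟨⟨_, h1⟩, h2⟩; exact ⟨h1, h2⟩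
  have e2 := sum_filter_add_sum_filter_not (Ioc 0 N) Nat.Prime (fun n => f n * vonMangoldt n / n)
  have e3 : ∑ p ∈ Nat.primesLE N, f p * (Real.log p / p) =
      ∑ n ∈ (Ioc 0 N).filter Nat.Prime, f n * vonMangoldt n / n := by
    rw [e]; apply sum_congr rfl; intro p hp
    rw [vonMangoldt_apply_prime (mem_filter.1 hp).2]; ring
  have e4 : |∑ n ∈ (Ioc 0 N).filter (fun n => ¬ n.Prime), f n * vonMangoldt n / n| ≤ C1 := by
    refine le_trans (abs_sum_le_sum_abs _ _) (le_trans (sum_le_sum ?_) (hC1 N))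
    intro n _
    have : 0 ≤ vonMangoldt n := vonMangoldt_nonneg
    rw [abs_div, abs_mul, Nat.abs_cast, abs_of_nonneg this]
    exact div_le_div_of_nonneg_right (mul_le_of_le_one_left this (hf n)) (by positivity)
  rw [e3, eq_sub_of_add_eq e2]
  refine (abs_sub _ _).trans (add_le_add (hC N) e4)

lemma primes_char_bound : ∃ C : ℝ, 0 ≤ C ∧ ∀ N, |∑ p ∈ Nat.primesLE N, c4 p * (Real.log p / p)| ≤ C ∧
    |∑ p ∈ Nat.primesLE N, c8 p * (Real.log p / p)| ≤ C ∧
    |∑ p ∈ Nat.primesLE N, c48 p * (Real.log p / p)| ≤ C := by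
  obtain ⟨C1, h0, h1⟩ := nonprime_Lambda
  obtain ⟨A, hA⟩ := sum_psi_Lambda c4_CM (q := 8) (fun n => by exact_mod_cast c4_L.1 n) (c := 1/20) (by norm_num) c4_L.2
  obtain ⟨B, hB⟩ := sum_psi_Lambda c8_CM (q := 8) (fun n => by exact_mod_cast c8_L.1 n) (c := 1/20) (by norm_num) c8_L.2
  obtain ⟨D, hD⟩ := sum_psi_Lambda c48_CM (q := 8) (fun n => by exact_mod_cast c48_L.1 n) (c := 1/20) (by norm_num) c48_L.2
  have hA' := sum_primes_of_Lambda c4 c4_CM.le hA h1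
  have hB' := sum_primes_of_Lambda c8 c8_CM.le hB h1
  have hD' := sum_primes_of_Lambda c48 c48_CM.le hD h1
  have a0 := (abs_nonneg _).trans (hA 0)
  have b0 := (abs_nonneg _).trans (hB 0)
  have d0 := (abs_nonneg _).trans (hD 0)
  refine ⟨A + B + D + C1, by linarith, fun N => ⟨?_, ?_, ?_⟩⟩
  · linarith [hA' N]
  · linarith [hB' N]
  · linarith [hD' N]

lemma class_ind (p : ℕ) (hp : p.Prime) (hp2 : p ≠ 2) :
    (if p % 8 = 1 then (1:ℝ) else 0) = (1 + c4 p + c8 p + c48 p)/4 ∧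
    (if p % 8 = 7 then (1:ℝ) else 0) = (1 - c4 p + c8 p - c48 p)/4 := by
  have hodd : p % 2 = 1 := hp.eq_two_or_odd.resolve_left hp2
  obtain ⟨h0, h1, h2, h3, h4, h5, h6, h7⟩ := c4_vals
  obtain ⟨g0, g1, g2, g3, g4, g5, g6, g7⟩ := c8_vals
  have : p % 8 = 1 ∨ p % 8 = 3 ∨ p % 8 = 5 ∨ p % 8 = 7 := by omega
  unfold c48
  rcases this with h | h | h | h <;> rw [c4_of_mod p _ h, c8_of_mod p _ h] <;> simp [*] <;> norm_num

lemma sum_logp_ge : ∃ C : ℝ, ∀ N : ℕ, 1 ≤ N →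
    Real.log N - C ≤ ∑ p ∈ Nat.primesLE N, Real.log p / p := by
  obtain ⟨C1, h0, h1⟩ := nonprime_Lambda
  refine ⟨1 + C1, fun N hN => ?_⟩
  have e : Nat.primesLE N = (Ioc 0 N).filter Nat.Prime := by
    ext p; simp only [Nat.mem_primesLE, mem_filter, mem_Ioc]
    constructor
    · rintro ⟨h1, h2⟩; exact ⟨⟨h2.pos, h1⟩, h2⟩
    · rintro ⟨⟨_, h1⟩, h2⟩; exact ⟨h1, h2⟩
  have e2 := sum_filter_add_sum_filter_not (Ioc 0 N) Nat.Prime (fun n => ArithmeticFunction.vonMangoldt n / n)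
  have e3 : ∑ p ∈ Nat.primesLE N, (Real.log p / p) =
      ∑ n ∈ (Ioc 0 N).filter Nat.Prime, ArithmeticFunction.vonMangoldt n / n := by
    rw [e]; apply sum_congr rfl; intro p hp
    rw [ArithmeticFunction.vonMangoldt_apply_prime (mem_filter.1 hp).2]
  have := le_sum_Lambda hN
  have := h1 N
  linarith

/-- Mertens in the classes 1, 7 mod 8. -/
lemma mertens_class : ∃ C : ℝ, 0 ≤ C ∧ ∀ a : ℕ, (a = 1 ∨ a = 7) → ∀ N : ℕ, 1 ≤ N →
    |∑ p ∈ (Nat.primesLE N).filter (· % 8 = a), Real.log p / p - Real.log N / 4| ≤ C := by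
  obtain ⟨C, hC0, hC⟩ := primes_char_bound
  obtain ⟨D, hD⟩ := sum_logp_ge
  refine ⟨C + |D| + Real.log 4 + 4 + 1, by
    have := Real.log_nonneg (show (1:ℝ) ≤ 4 by norm_num); positivity, ?_⟩
  intro a ha N hN
  obtain ⟨u4, u8, u48⟩ := hC N
  have hD' := hD N hN
  have hU := sum_logp_le hN
  have hDa := le_abs_self D
  have hDb := abs_nonneg D
  set L := ∑ p ∈ Nat.primesLE N, Real.log p / p with hL
  have key : ∀ s : ℝ, (s = 1 ∨ s = -1) →
      (∀ p, p.Prime → p ≠ 2 → (if p % 8 = a then (1:ℝ) else 0) = (1 + s * c4 p + c8 p + s * c48 p)/4) →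
      |∑ p ∈ (Nat.primesLE N).filter (· % 8 = a), Real.log p / p -
        (L + s * ∑ p ∈ Nat.primesLE N, c4 p * (Real.log p / p) +
        ∑ p ∈ Nat.primesLE N, c8 p * (Real.log p / p) + s * ∑ p ∈ Nat.primesLE N, c48 p * (Real.log p / p))/4| ≤ 1 := by
    intro s hs hid
    have e : ∑ p ∈ (Nat.primesLE N).filter (· % 8 = a), Real.log p / p -
        (L + s * ∑ p ∈ Nat.primesLE N, c4 p * (Real.log p / p) +
        ∑ p ∈ Nat.primesLE N, c8 p * (Real.log p / p) + s * ∑ p ∈ Nat.primesLE N, c48 p * (Real.log p / p))/4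
        = ∑ p ∈ Nat.primesLE N, ((if p % 8 = a then (1:ℝ) else 0) - (1 + s * c4 p + c8 p + s * c48 p)/4) * (Real.log p / p) := by
      rw [hL, mul_sum, mul_sum, ← sum_add_distrib, ← sum_add_distrib, ← sum_add_distrib, sum_div, sum_filter,
        ← sum_sub_distrib]
      apply sum_congr rfl; intro p _
      split_ifs <;> ring
    rw [e]
    have e2 : ∑ p ∈ Nat.primesLE N, ((if p % 8 = a then (1:ℝ) else 0) - (1 + s * c4 p + c8 p + s * c48 p)/4) * (Real.log p / p)
        = ∑ p ∈ Nat.primesLE N, if p = 2 then -(1/4) * (Real.log 2 / 2) else 0 := by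
      apply sum_congr rfl; intro p hp
      by_cases h2 : p = 2
      · subst h2
        have h28 : ¬ (2 % 8 = a) := by omega
        simp only [h28, if_false, if_true, c48, c4_vals.2.2.1, c8_vals.2.2.1]
        norm_num
      · rw [hid p (Nat.mem_primesLE.1 hp).2 h2]; simp [h2]
    rw [e2, sum_ite_eq']
    have l2 := Real.log_two_lt_d9
    have l2' := Real.log_two_gt_d9
    split_ifs
    · rw [abs_le]; constructor <;> linarith
    · simp
  have l4 := Real.log_nonneg (show (1:ℝ) ≤ 4 by norm_num)
  have a4 := abs_le.1 u4
  have a8 := abs_le.1 u8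
  have a48 := abs_le.1 u48
  rcases ha with rfl | rfl
  · have := key 1 (by norm_num) (fun p hp h2 => by rw [(class_ind p hp h2).1]; ring)
    rw [abs_le] at this ⊢
    constructor <;> linarith
  · have := key (-1) (by norm_num) (fun p hp h2 => by rw [(class_ind p hp h2).2]; ring)
    rw [abs_le] at this ⊢
    constructor <;> linarith

end FK

namespace FK
open Finset

noncomputable def s0 (p : ℕ) : ℝ := if p % 8 = 1 ∨ p % 8 = 7 then 1 else 0

def S0 (n : ℕ) : Prop := ∀ p ∈ n.primeFactors, p % 8 = 1 ∨ p % 8 = 7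

lemma s0_nonneg (p : ℕ) : 0 ≤ s0 p := by unfold s0; split_ifs <;> norm_num
lemma s0_le (p : ℕ) : s0 p ≤ 1 := by unfold s0; split_ifs <;> norm_num

lemma mulf_s0 (n : ℕ) : mulf s0 n = if S0 n then 1 else 0 := by
  unfold mulf S0 s0
  split_ifs with h
  · exact prod_eq_one fun p hp => if_pos (h p hp)
  · push Not at h
    obtain ⟨p, hp, h1⟩ := h
    refine prod_eq_zero hp (if_neg ?_)
    push Not; exact h1

lemma s0_eq (p : ℕ) (hp : p.Prime) (h2 : p ≠ 2) : s0 p = (1 + c8 p) / 2 := by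
  have hodd : p % 2 = 1 := hp.eq_two_or_odd.resolve_left h2
  obtain ⟨g0, g1, g2, g3, g4, g5, g6, g7⟩ := c8_vals
  have : p % 8 = 1 ∨ p % 8 = 3 ∨ p % 8 = 5 ∨ p % 8 = 7 := by omega
  unfold s0
  rcases this with h | h | h | h <;> rw [c8_of_mod p _ h] <;> simp [*]

lemma S0_odd {n : ℕ} (hn : n ≠ 0) (h : S0 n) : n % 2 = 1 := by
  by_contra h1
  have : 2 ∈ n.primeFactors := by simp [Nat.prime_two, hn]; omega
  have := h 2 this
  omega

lemma primes_class_count : ∃ K : ℕ, 2 ≤ K ∧ ∀ a : ℕ, (a = 1 ∨ a = 7) → ∀ N : ℕ, 2 * K ≤ N →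
    (N:ℝ) / (2 * K) ≤ Real.log N * (((Nat.primesLE N).filter (fun p => p % 8 = a ∧ N / K < p)).card : ℝ) := by
  obtain ⟨C, hC0, hC⟩ := mertens_class
  obtain ⟨K, hK⟩ := exists_nat_gt (Real.exp (8 * C + 4))
  have hK0 : (0:ℝ) < K := (Real.exp_pos _).trans hK
  have hlK : 8 * C + 4 ≤ Real.log K := by
    rw [Real.le_log_iff_exp_le hK0]; exact hK.le
  have hK2 : 2 ≤ K := by
    have h1 : (8 * C + 4) + 1 ≤ Real.exp (8 * C + 4) := Real.add_one_le_exp _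
    have : (2:ℝ) ≤ K := by linarith
    exact_mod_cast this
  refine ⟨K, hK2, fun a ha N hN => ?_⟩
  set w := N / K with hw
  have hw1 : 1 ≤ w := by
    rw [hw, Nat.le_div_iff_mul_le (by omega)]; omega
  have hwN : w ≤ N := Nat.div_le_self _ _
  have hwK : w * K ≤ N := Nat.div_mul_le_self _ _
  have hNw : N < (w + 1) * K := by
    rw [hw]; have := Nat.lt_div_mul_add (a := N) (b := K) (by omega); nlinarith
  have h1 := abs_le.1 (hC a ha N (by omega))
  have h2 := abs_le.1 (hC a ha w hw1)
  have hN0 : (0:ℝ) < N := by have : 0 < N := by omega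
                             exact_mod_cast this
  have hw0 : (0:ℝ) < w := by exact_mod_cast hw1
  have hlog : Real.log w + Real.log K ≤ Real.log N := by
    rw [← Real.log_mul hw0.ne' hK0.ne']
    apply Real.log_le_log (by positivity)
    exact_mod_cast hwK
  have hsplit : ∑ p ∈ (Nat.primesLE N).filter (· % 8 = a), Real.log p / p =
      ∑ p ∈ (Nat.primesLE w).filter (· % 8 = a), Real.log p / p +
      ∑ p ∈ (Nat.primesLE N).filter (fun p => p % 8 = a ∧ w < p), Real.log p / p := by
    rw [← sum_union]
    · apply sum_congr _ (fun _ _ => rfl)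
      ext p; simp only [mem_filter, mem_union, Nat.mem_primesLE]
      constructor
      · rintro ⟨⟨h1, h2⟩, h3⟩
        by_cases h : p ≤ w
        · exact Or.inl ⟨⟨h, h2⟩, h3⟩
        · exact Or.inr ⟨⟨h1, h2⟩, h3, by omega⟩
      · rintro (⟨⟨h1, h2⟩, h3⟩ | ⟨⟨h1, h2⟩, h3, h4⟩)
        · exact ⟨⟨by omega, h2⟩, h3⟩
        · exact ⟨⟨h1, h2⟩, h3⟩
    · rw [disjoint_left]; intro p; simp only [mem_filter, Nat.mem_primesLE]; omega
  have h3 : 1 ≤ ∑ p ∈ (Nat.primesLE N).filter (fun p => p % 8 = a ∧ w < p), Real.log p / p := by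
    linarith
  have h4 : ∑ p ∈ (Nat.primesLE N).filter (fun p => p % 8 = a ∧ w < p), Real.log p / p ≤
      ∑ p ∈ (Nat.primesLE N).filter (fun p => p % 8 = a ∧ w < p), Real.log N / w := by
    apply sum_le_sum
    intro p hp
    simp only [mem_filter, Nat.mem_primesLE] at hp
    have hpp : (0:ℝ) < p := by exact_mod_cast hp.1.2.pos
    apply div_le_div₀ (Real.log_nonneg (by exact_mod_cast (by omega : 1 ≤ N))) _ hw0 (by exact_mod_cast hp.2.2.le)
    exact Real.log_le_log hpp (by exact_mod_cast hp.1.1)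
  rw [sum_const, nsmul_eq_mul] at h4
  have h5 := h3.trans h4
  rw [← mul_div_assoc, le_div_iff₀ hw0, one_mul] at h5
  rw [mul_comm (Real.log N)]
  refine le_trans ?_ h5
  rw [div_le_iff₀ (by positivity)]
  have : N ≤ w * (2 * K) := by nlinarith
  exact_mod_cast this

lemma sum_c8_ge : ∃ C : ℝ, ∀ N : ℕ, |∑ p ∈ Nat.primesLE N, c8 p / p| ≤ C := by
  obtain ⟨C, hC0, hC⟩ := primes_char_bound
  have l2 : 0 < Real.log 2 := Real.log_pos (by norm_num)
  refine ⟨C * (1 / Real.log 2), fun N => ?_⟩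
  have e : ∀ N (F : ℕ → ℝ), ∑ p ∈ Nat.primesLE N, F p = ∑ p ∈ Ioc 1 N, if p.Prime then F p else 0 := by
    intro N F
    rw [← sum_filter]
    apply sum_congr _ (fun _ _ => rfl)
    ext p; simp only [Nat.mem_primesLE, mem_filter, mem_Ioc]
    constructor
    · rintro ⟨h1, h2⟩; exact ⟨⟨h2.one_lt, h1⟩, h2⟩
    · rintro ⟨⟨_, h1⟩, h2⟩; exact ⟨h1, h2⟩
  have := abel_bound (fun p => if p.Prime then c8 p * (Real.log p / p) else 0)
    (fun n => 1 / Real.log n) C 1 (fun n => by rw [← e]; exact (hC n).2.1)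
    (fun n hn => by have : 0 ≤ Real.log n := Real.log_natCast_nonneg n
                    positivity)
    (fun n hn => by
      apply one_div_le_one_div_of_le (Real.log_pos (by exact_mod_cast hn))
      apply Real.log_le_log
      · have : 0 < n := by omega
        exact_mod_cast this
      · push_cast; linarith) N
  rw [e]
  norm_num at this ⊢
  refine le_trans (le_of_eq ?_) this
  congr 1
  apply sum_congr rfl
  intro p hp
  split_ifs
  · have : Real.log p ≠ 0 := (Real.log_pos (by exact_mod_cast (mem_Ioc.1 hp).1)).ne'
    field_simp
  · simp

lemma sum_s0_ge : ∃ C : ℝ, ∀ N : ℕ, 2 ≤ N →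
    Real.log (Real.log N) / 2 - C ≤ ∑ p ∈ Nat.primesLE N, s0 p / p := by
  obtain ⟨C, hC⟩ := sum_c8_ge
  refine ⟨C / 2 + Real.log 2 / 2 + 1, fun N hN => ?_⟩
  have h1 := loglog_le hN
  have h2 := (abs_le.1 (hC N)).1
  have h3 : ∑ p ∈ Nat.primesLE N, s0 p / p =
      (∑ p ∈ Nat.primesLE N, (1:ℝ)/p + ∑ p ∈ Nat.primesLE N, c8 p / p)/2 - 1/4 := by
    have : ∑ p ∈ Nat.primesLE N, ((1/(p:ℝ) + c8 p/p)/2 - s0 p / p) = ∑ p ∈ Nat.primesLE N, if p = 2 then (1/4:ℝ) else 0 := by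
      apply sum_congr rfl; intro p hp
      by_cases h : p = 2
      · subst h; simp [s0, c8_vals.2.2.1]; norm_num
      · rw [s0_eq p (Nat.mem_primesLE.1 hp).2 h]; simp only [h, if_false]; ring
    rw [sum_ite_eq', if_pos (by simp [Nat.mem_primesLE, Nat.prime_two, hN]), sum_sub_distrib, ← sum_div, sum_add_distrib] at this
    linarith
  linarith

lemma sum_S0_ge : ∃ c : ℝ, 0 < c ∧ ∀ M : ℕ, 2 ≤ M →
    c * Real.sqrt (Real.log M) ≤ ∑ n ∈ (sf M).filter S0, (1:ℝ) / n := by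
  obtain ⟨C, hC⟩ := sum_s0_ge
  obtain ⟨R, hR0, hR⟩ := rankin
  refine ⟨Real.exp (-C - 8) / R, by positivity, fun M hM => ?_⟩
  have h1 := hR s0 s0_nonneg (fun p => (s0_le p).trans (by norm_num)) M (by omega)
  have h2 := log_prod_ge s0_nonneg (fun p => (s0_le p).trans (by norm_num)) M
  have h3 := hC M hM
  have hl : 0 < Real.log M := Real.log_pos (by exact_mod_cast (by omega : 1 < M))
  have h4 : Real.exp (-C-8) * Real.sqrt (Real.log M) ≤ Real.exp (∑ p ∈ Nat.primesLE M, s0 p / p - 8) := by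
    have : Real.sqrt (Real.log M) = Real.exp (Real.log (Real.log M) / 2) := by
      rw [← Real.log_sqrt hl.le, Real.exp_log (Real.sqrt_pos.2 hl)]
    rw [this, ← Real.exp_add]
    apply Real.exp_le_exp.2; linarith
  have h5 : ∑ n ∈ (sf M).filter S0, (1:ℝ) / n = ∑ n ∈ sf M, mulf s0 n / n := by
    rw [sum_filter]; apply sum_congr rfl; intro n _; rw [mulf_s0]; split_ifs <;> simp
  rw [h5, div_mul_eq_mul_div, div_le_iff₀ hR0]
  linarith

/-- The set counted by `A`. -/
noncomputable def Aset (Y : ℕ) : Finset ℕ := (sf Y).filter (fun d => S0 d ∧ d % 4 = 3)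

theorem A_lower : ∃ c : ℝ, 0 < c ∧ ∃ Y0 : ℕ, ∀ Y : ℕ, Y0 ≤ Y →
    c * Y / Real.sqrt (Real.log Y) ≤ (Aset Y).card := by
  obtain ⟨c, hc0, hc⟩ := sum_S0_ge
  obtain ⟨K, hK2, hK⟩ := primes_class_count
  refine ⟨c / (16 * K), by positivity, (2 * K + 32) ^ 10, fun Y hY => ?_⟩
  have hY32 : 32 ≤ Y := by
    have : 2 * K + 32 ≤ (2 * K + 32) ^ 10 := Nat.le_self_pow (by norm_num) _
    omega
  obtain ⟨M, hM2, hM5, hMY⟩ := fifth_root Y hY32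
  have hM10 : Y < M ^ 10 := by
    have : (M + 1) ^ 5 ≤ (M ^ 2) ^ 5 := Nat.pow_le_pow_left (by nlinarith) 5
    calc Y < (M+1)^5 := hMY
      _ ≤ _ := this
      _ = M ^ 10 := by ring
  have hMK : 2 * K + 32 < M := by
    by_contra h
    have : M ^ 10 ≤ (2 * K + 32) ^ 10 := Nat.pow_le_pow_left (by omega) _
    omega
  have hYM : ∀ m, 0 < m → m ≤ M → M ^ 4 ≤ Y / m := by
    intro m hm hmM
    rw [Nat.le_div_iff_mul_le hm]
    calc M ^ 4 * m ≤ M ^ 4 * M := Nat.mul_le_mul_left _ hmM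
      _ = M ^ 5 := by ring
      _ ≤ Y := hM5
  have hM4 : M * K + M < M ^ 4 := by
    have h1 : M * K + M ≤ M * M := by nlinarith
    have : M * M < M ^ 4 := by
      have : 1 < M * M := by nlinarith
      calc M * M < M * M * (M * M) := by nlinarith
        _ = M ^ 4 := by ring
    omega
  let aa : ℕ → ℕ := fun m => if m % 4 = 1 then 7 else 1
  let P : ℕ → Finset ℕ := fun m => (Nat.primesLE (Y/m)).filter (fun p => p % 8 = aa m ∧ (Y/m) / K < p)
  have haa : ∀ m, aa m = 1 ∨ aa m = 7 := by intro m; simp only [aa]; split_ifs <;> simp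
  have hPM : ∀ m, 0 < m → m ≤ M → ∀ p ∈ P m, M < p := by
    intro m hm hmM p hp
    have h1 : (Y/m)/K < p := (mem_filter.1 hp).2.2
    have h2 : M ≤ (Y/m)/K := by
      rw [Nat.le_div_iff_mul_le (by omega)]
      have := hYM m hm hmM
      omega
    omega
  have hYl : 0 < Real.log Y := Real.log_pos (by exact_mod_cast (by omega : 1 < Y))
  have hcard : (((sf M).filter S0).sigma P).card ≤ (Aset Y).card := by
    apply card_le_card_of_injOn (fun x => x.1 * x.2)
    · rintro ⟨m, p⟩ hx
      simp only [coe_sigma, Set.mem_sigma_iff, mem_coe, mem_filter, mem_sf] at hx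
      obtain ⟨⟨⟨⟨hm0, hmM⟩, hmsq⟩, hmS⟩, hp⟩ := hx
      have hpM := hPM m hm0 hmM p hp
      simp only [P, mem_filter, Nat.mem_primesLE] at hp
      have hcop : m.Coprime p := by
        rw [Nat.coprime_comm, hp.1.2.coprime_iff_not_dvd]
        intro h; have := Nat.le_of_dvd hm0 h; omega
      simp only [Aset, coe_filter, Set.mem_ofPred_eq, mem_sf]
      have hmod : p % 8 = 1 ∨ p % 8 = 7 := by rw [hp.2.1]; exact haa m
      refine ⟨⟨⟨Nat.mul_pos hm0 hp.1.2.pos, ?_⟩, (Nat.squarefree_mul hcop).2 ⟨hmsq, hp.1.2.squarefree⟩⟩, ?_, ?_⟩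
      · calc m * p ≤ m * (Y / m) := Nat.mul_le_mul_left _ hp.1.1
          _ ≤ Y := Nat.mul_div_le _ _
      · intro q hq
        rw [hcop.primeFactors_mul, mem_union] at hq
        rcases hq with hq | hq
        · exact hmS q hq
        · rw [hp.1.2.primeFactors, mem_singleton] at hq; rw [hq]; exact hmod
      · have hodd := S0_odd hm0.ne' hmS
        have h8 := hp.2.1
        simp only [aa] at h8
        rw [Nat.mul_mod]
        split_ifs at h8 with h4
        · have : p % 4 = 3 := by omega
          rw [h4, this]
        · have e1 : p % 4 = 1 := by omega
          have e2 : m % 4 = 3 := by omega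
          rw [e1, e2]
    · rintro ⟨m, p⟩ hx ⟨m', p'⟩ hx' heq
      simp only [coe_sigma, Set.mem_sigma_iff, mem_coe, mem_filter, mem_sf] at hx hx'
      obtain ⟨⟨⟨⟨hm0, hmM⟩, hmsq⟩, hmS⟩, hp⟩ := hx
      obtain ⟨⟨⟨⟨hm0', hmM'⟩, hmsq'⟩, hmS'⟩, hp'⟩ := hx'
      have hpM := hPM m hm0 hmM p hp
      have hpM' := hPM m' hm0' hmM' p' hp'
      simp only [P, mem_filter, Nat.mem_primesLE] at hp hp'
      simp only at heq
      have hd : p ∣ m' * p' := by rw [← heq]; exact dvd_mul_left _ _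
      have hpp : p = p' := by
        rcases (hp.1.2.dvd_mul).1 hd with h | h
        · have := Nat.le_of_dvd hm0' h; omega
        · exact (Nat.prime_dvd_prime_iff_eq hp.1.2 hp'.1.2).1 h
      subst hpp
      have : m = m' := Nat.eq_of_mul_eq_mul_right hp.1.2.pos heq
      subst this; rfl
  have hcard' : (((sf M).filter S0).sigma P).card = ∑ m ∈ (sf M).filter S0, (P m).card := card_sigma _ _
  have hterm : ∀ m ∈ (sf M).filter S0, (Y:ℝ) / (4 * K * Real.log Y) * (1 / m) ≤ ((P m).card : ℝ) := by
    intro m hm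
    simp only [mem_filter, mem_sf] at hm
    obtain ⟨⟨⟨hm0, hmM⟩, hmsq⟩, hmS⟩ := hm
    have h4 := hYM m hm0 hmM
    have h1 := hK (aa m) (haa m) (Y/m) (by
      have : M ≤ M^4 := Nat.le_self_pow (by norm_num) _
      omega)
    have hN1 : 1 ≤ Y / m := by
      have : 1 ≤ M ^ 4 := Nat.one_le_pow _ _ (by omega)
      omega
    have h2 : Real.log ((Y/m : ℕ):ℝ) ≤ Real.log Y := by
      apply Real.log_le_log (by exact_mod_cast hN1)
      exact_mod_cast Nat.div_le_self _ _
    have h3 : (((Y/m : ℕ):ℝ)) / (2 * K) ≤ Real.log Y * ((P m).card : ℝ) :=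
      h1.trans (mul_le_mul_of_nonneg_right h2 (by positivity))
    have h5 : (Y:ℝ) / m ≤ 2 * ((Y/m : ℕ):ℝ) := by
      rw [div_le_iff₀ (by exact_mod_cast hm0)]
      have : Y ≤ 2 * (Y/m) * m := by
        have := Nat.lt_div_mul_add (a := Y) (b := m) hm0
        nlinarith
      exact_mod_cast this
    have hK0 : (0:ℝ) < K := by exact_mod_cast (by omega : 0 < K)
    rw [div_le_iff₀ (by positivity)] at h3
    rw [div_mul_div_comm, mul_one, div_le_iff₀ (by positivity)]
    rw [div_le_iff₀ (by exact_mod_cast hm0)] at h5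
    have hm0' : (0:ℝ) < m := by exact_mod_cast hm0
    calc (Y:ℝ) ≤ 2 * ((Y/m : ℕ):ℝ) * m := h5
      _ ≤ 2 * (Real.log Y * ((P m).card : ℝ) * (2 * K)) * m := by gcongr
      _ = _ := by ring
  have hfin : (Y:ℝ) / (4 * K * Real.log Y) * (c * Real.sqrt (Real.log M)) ≤ (Aset Y).card := by
    calc (Y:ℝ) / (4 * K * Real.log Y) * (c * Real.sqrt (Real.log M))
        ≤ (Y:ℝ) / (4 * K * Real.log Y) * ∑ n ∈ (sf M).filter S0, (1:ℝ) / n := by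
          apply mul_le_mul_of_nonneg_left (hc M hM2); positivity
      _ = ∑ n ∈ (sf M).filter S0, (Y:ℝ) / (4 * K * Real.log Y) * ((1:ℝ) / n) := mul_sum _ _ _
      _ ≤ ∑ n ∈ (sf M).filter S0, ((P n).card : ℝ) := sum_le_sum hterm
      _ ≤ (Aset Y).card := by exact_mod_cast hcard' ▸ hcard
  refine le_trans ?_ hfin
  have hlM : Real.log Y / 16 ≤ Real.log M := by
    have : Real.log Y ≤ Real.log ((M:ℝ)^10) := Real.log_le_log (by positivity) (by exact_mod_cast hM10.le)
    rw [Real.log_pow] at this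
    push_cast at this
    linarith
  have hs : Real.sqrt (Real.log Y) / 4 ≤ Real.sqrt (Real.log M) := by
    rw [show Real.sqrt (Real.log Y) / 4 = Real.sqrt (Real.log Y / 16) by
      rw [Real.sqrt_div hYl.le, show (16:ℝ) = 4^2 by norm_num, Real.sqrt_sq (by norm_num)]]
    exact Real.sqrt_le_sqrt hlM
  have hsq := Real.mul_self_sqrt hYl.le
  have hs0 : 0 < Real.sqrt (Real.log Y) := Real.sqrt_pos.2 hYl
  calc c / (16 * K) * Y / Real.sqrt (Real.log Y)
      = (Y:ℝ) / (4 * K * Real.log Y) * (c * (Real.sqrt (Real.log Y) / 4)) := by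
        rw [show (Y:ℝ) / (4 * K * Real.log Y) = Y / (4 * K * (Real.sqrt (Real.log Y) * Real.sqrt (Real.log Y))) by rw [hsq]]
        generalize Real.sqrt (Real.log Y) = s at *
        have hK0 : (0:ℝ) < K := by exact_mod_cast (by omega : 0 < K)
        field_simp; ring
    _ ≤ _ := by gcongr

end FK

namespace FK
open Finset

lemma char_sum_bound {f : ℕ → ℝ} (hf : CM f) {q : ℕ} (hq : 0 < q) (hper : ∀ n, f (n + q) = f n)
    {a : ℕ} (ha : a.Coprime q) (hfa : f a ≠ 1) (n : ℕ) : |∑ i ∈ Ioc 0 n, f i| ≤ q := by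
  have h0 : f 0 = 0 := by
    have := hf.mul 0 a
    rw [zero_mul] at this
    have h1 : f 0 * (f a - 1) = 0 := by linarith
    rcases mul_eq_zero.1 h1 with h | h
    · exact h
    · exact absurd (by linarith) hfa
  have hmod : ∀ n, f (n % q) = f n := by
    intro n
    have : ∀ k m, f (m + q * k) = f m := by
      intro k m
      induction k with
      | zero => simp
      | succ k ih => rw [Nat.mul_succ, ← Nat.add_assoc, hper, ih]
    conv_rhs => rw [← Nat.mod_add_div n q]
    rw [this]
  have hz : ∑ i ∈ range q, f i = 0 := by
    have hinj : Set.InjOn (fun i => a * i % q) (range q : Set ℕ) := by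
      intro i hi j hj hij
      simp only [coe_range, Set.mem_Iio] at hi hj
      have : a * i ≡ a * j [MOD q] := hij
      have := Nat.ModEq.cancel_left_of_coprime (by rw [Nat.gcd_comm]; exact ha) this
      unfold Nat.ModEq at this
      rwa [Nat.mod_eq_of_lt hi, Nat.mod_eq_of_lt hj] at this
    have himg : (range q).image (fun i => a * i % q) = range q := by
      apply eq_of_subset_of_card_le
      · intro x hx
        obtain ⟨i, _, rfl⟩ := mem_image.1 hx
        exact mem_range.2 (Nat.mod_lt _ hq)
      · rw [card_image_of_injOn hinj]
    have e : ∑ i ∈ range q, f i = f a * ∑ i ∈ range q, f i := by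
      conv_lhs => rw [← himg, sum_image hinj]
      rw [mul_sum]
      apply sum_congr rfl; intro i _
      rw [hmod, hf.mul]
    have h1 : (f a - 1) * ∑ i ∈ range q, f i = 0 := by linarith
    rcases mul_eq_zero.1 h1 with h | h
    · exact absurd (by linarith) hfa
    · exact h
  exact period_bound f q hq hper hf.le h0 hz n

/-- Jacobi symbol of naturals as a real. -/
noncomputable def J (m n : ℕ) : ℝ := ((jacobiSym (m:ℤ) n : ℤ) : ℝ)

lemma J_mul_left (a b n : ℕ) : J (a * b) n = J a n * J b n := by
  unfold J; push_cast; rw [jacobiSym.mul_left]; push_cast; rfl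

lemma J_mul_right (a : ℕ) {m n : ℕ} (hm : m ≠ 0) (hn : n ≠ 0) : J a (m * n) = J a m * J a n := by
  unfold J; have : NeZero m := ⟨hm⟩; have : NeZero n := ⟨hn⟩
  rw [jacobiSym.mul_right]; push_cast; rfl

lemma J_one_left (n : ℕ) : J 1 n = 1 := by unfold J; simp
lemma J_one_right (n : ℕ) : J n 1 = 1 := by unfold J; simp

lemma J_cases (m n : ℕ) : J m n = 0 ∨ J m n = 1 ∨ J m n = -1 := by
  unfold J
  rcases jacobiSym.trichotomy (m:ℤ) n with h | h | h <;> rw [h] <;> simp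

lemma J_abs (m n : ℕ) : |J m n| ≤ 1 := by
  rcases J_cases m n with h | h | h <;> rw [h] <;> simp

lemma J_per (m n : ℕ) : J (m + n) n = J m n := by
  unfold J
  congr 1
  rw [jacobiSym.mod_left, jacobiSym.mod_left (m:ℤ)]; simp

lemma J_per_dvd (m n q : ℕ) (h : n ∣ q) : J (m + q) n = J m n := by
  obtain ⟨k, rfl⟩ := h
  unfold J
  congr 1
  rw [jacobiSym.mod_left, jacobiSym.mod_left (m:ℤ)]; simp

lemma J_ne_zero {m n : ℕ} (h : m.Coprime n) : J m n ≠ 0 := by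
  unfold J
  have : jacobiSym (m:ℤ) n ≠ 0 := jacobiSym.ne_zero (by simpa using h)
  exact_mod_cast this

lemma J_eq_zero {m n : ℕ} (hn : n ≠ 0) (h : ¬ m.Coprime n) : J m n = 0 := by
  unfold J
  have : NeZero n := ⟨hn⟩
  have : jacobiSym (m:ℤ) n = 0 := jacobiSym.eq_zero_iff_not_coprime.2 (by simpa [Nat.Coprime] using h)
  rw [this]; simp

lemma J_CM (n : ℕ) : CM (fun m => J m n) := ⟨J_one_left n, fun a b => J_mul_left a b n, fun a => J_abs a n⟩

lemma J_sq {m n : ℕ} (h : m.Coprime n) : J m n * J m n = 1 := by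
  rcases J_cases m n with h1 | h1 | h1
  · exact absurd h1 (J_ne_zero h)
  · rw [h1]; norm_num
  · rw [h1]; norm_num

/-- Nonresidue with prescribed other residue. -/
lemma exists_nonres {p R : ℕ} (hp : p.Prime) (hp2 : p ≠ 2) (hR : p.Coprime R) :
    ∃ a : ℕ, a.Coprime p ∧ a.Coprime R ∧ J a p = -1 ∧ a % R = 1 % R := by
  have : Fact p.Prime := ⟨hp⟩
  obtain ⟨x, hx⟩ := FiniteField.exists_nonsquare (F := ZMod p) (by rw [ZMod.ringChar_zmod_n]; exact hp2)
  obtain ⟨a, ha1, ha2⟩ := Nat.chineseRemainder hR x.val 1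
  have hxa : ((a:ℕ) : ZMod p) = x := by
    have : ((a:ℕ) : ZMod p) = ((x.val : ℕ) : ZMod p) := (ZMod.natCast_eq_natCast_iff _ _ _).2 ha1
    rw [this, ZMod.natCast_zmod_val]
  have hJ : J a p = -1 := by
    unfold J
    rw [← jacobiSym.legendreSym.to_jacobiSym]
    have : legendreSym p (a:ℤ) = -1 := by
      rw [legendreSym.eq_neg_one_iff]
      simpa [hxa] using hx
    rw [this]; simp
  refine ⟨a, ?_, ?_, hJ, ha2⟩
  · by_contra h
    have := J_eq_zero hp.ne_zero h
    rw [hJ] at this; norm_num at this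
  · have : Nat.gcd a R = Nat.gcd 1 R := Nat.ModEq.gcd_eq ha2
    rw [Nat.Coprime, this]; simp

lemma J_mod (a b n : ℕ) (h : a % n = b % n) : J a n = J b n := by
  unfold J
  congr 1
  rw [jacobiSym.mod_left, jacobiSym.mod_left (b:ℤ)]
  congr 1
  exact_mod_cast h

lemma J_sum_bound_aux {p R : ℕ} (hp : p.Prime) (hp2 : p ≠ 2) (hR : p.Coprime R) (hR0 : R ≠ 0) (n : ℕ) :
    |∑ i ∈ Ioc 0 n, J i (p * R)| ≤ (p * R : ℕ) := by
  obtain ⟨a, h1, h2, h3, h4⟩ := exists_nonres hp hp2 hR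
  apply char_sum_bound (J_CM (p*R)) (Nat.mul_pos hp.pos (by omega)) (fun n => J_per n _) (a := a)
    (Nat.Coprime.mul_right h1 h2)
  rw [J_mul_right a hp.ne_zero hR0, h3, J_mod a 1 R h4, J_one_left]; norm_num

lemma J_sum_bound {m n : ℕ} (hm : Squarefree m) (hn : Squarefree n) (hmo : m % 2 = 1) (hno : n % 2 = 1)
    (hmn : m ≠ n) (L : ℕ) : |∑ i ∈ Ioc 0 L, J i (m * n)| ≤ (m * n : ℕ) := by
  have key : ∀ m n : ℕ, Squarefree m → n ≠ 0 → m % 2 = 1 → ∀ p, p.Prime → p ∣ m → ¬ p ∣ n →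
      |∑ i ∈ Ioc 0 L, J i (m * n)| ≤ (m * n : ℕ) := by
    intro m n hm hn hmo p hp hpm hpn
    obtain ⟨r, rfl⟩ := hpm
    have hc := (Nat.squarefree_mul_iff.1 hm).1
    rw [mul_assoc]
    apply J_sum_bound_aux hp
    · rintro rfl; omega
    · exact Nat.Coprime.mul_right hc ((hp.coprime_iff_not_dvd).2 hpn)
    · rintro h
      rcases mul_eq_zero.1 h with h | h
      · subst h; simp at hmo
      · exact hn h
  have hm0 := hm.ne_zero
  have hn0 := hn.ne_zero
  by_cases h1 : m.primeFactors ⊆ n.primeFactors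
  · have h2 : ¬ n.primeFactors ⊆ m.primeFactors := by
      intro h2
      apply hmn
      rw [← Nat.prod_primeFactors_of_squarefree hm, ← Nat.prod_primeFactors_of_squarefree hn, subset_antisymm h1 h2]
    obtain ⟨p, hp1, hp2⟩ := not_subset.1 h2
    rw [Nat.mul_comm m n]
    simp only [Nat.mem_primeFactors, not_and, not_not] at hp1 hp2
    exact key n m hn hm0 hno p hp1.1 hp1.2.1 (fun h => hm0 (hp2 hp1.1 h))
  · obtain ⟨p, hp1, hp2⟩ := not_subset.1 h1
    simp only [Nat.mem_primeFactors, not_and, not_not] at hp1 hp2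
    exact key m n hm hn0 hmo p hp1.1 hp1.2.1 (fun h => hn0 (hp2 hp1.1 h))

/-- Reciprocity for odd naturals. -/
lemma J_recip {m n : ℕ} (hm : m % 2 = 1) (hn : n % 2 = 1) :
    J m n = J n m * ((1 + c4 m + c4 n - c4 m * c4 n) / 2) := by
  have hm4 : m % 4 = 1 ∨ m % 4 = 3 := by omega
  have hn4 : n % 4 = 1 ∨ n % 4 = 3 := by omega
  have v1 : ∀ m : ℕ, m % 4 = 1 → c4 m = 1 := fun m h => by
    unfold c4; rw [ZMod.χ₄_nat_one_mod_four h]; simp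
  have v3 : ∀ m : ℕ, m % 4 = 3 → c4 m = -1 := fun m h => by
    unfold c4; rw [ZMod.χ₄_nat_three_mod_four h]; simp
  unfold J
  rcases hm4 with h | h
  · rw [jacobiSym.quadratic_reciprocity_one_mod_four h (Nat.odd_iff.2 hn), v1 m h]; ring
  · rcases hn4 with h' | h'
    · rw [jacobiSym.quadratic_reciprocity_one_mod_four' (Nat.odd_iff.2 hm) h', v1 n h']; ring
    · rw [jacobiSym.quadratic_reciprocity_three_mod_four h h', v3 n h', v3 m h]; push_cast; ring

end FK

namespace FK
open Finset

lemma LS {b : ℕ → ℝ} (hb : ∀ n, |b n| ≤ 1) (hs : ∀ n, b n ≠ 0 → n % 2 = 1 ∧ Squarefree n) (L N : ℕ) :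
    ∑ l ∈ Ioc 0 L, (∑ n ∈ Ioc 0 N, b n * J l n)^2 ≤ (L:ℝ) * N + (N:ℝ)^4 := by
  have e : ∑ l ∈ Ioc 0 L, (∑ n ∈ Ioc 0 N, b n * J l n)^2 =
      ∑ n ∈ Ioc 0 N, ∑ n' ∈ Ioc 0 N, b n * b n' * ∑ l ∈ Ioc 0 L, J l n * J l n' := by
    simp_rw [sq, sum_mul_sum]
    rw [sum_comm]
    apply sum_congr rfl; intro n _
    rw [sum_comm]
    apply sum_congr rfl; intro n' _
    rw [mul_sum]
    apply sum_congr rfl; intro l _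
    ring
  rw [e]
  have hterm : ∀ n ∈ Ioc 0 N, ∀ n' ∈ Ioc 0 N, b n * b n' * ∑ l ∈ Ioc 0 L, J l n * J l n' ≤
      (if n = n' then (L:ℝ) else 0) + (N:ℝ)^2 := by
    intro n hn n' hn'
    rw [mem_Ioc] at hn hn'
    by_cases hbn : b n = 0
    · rw [hbn]; simp only [zero_mul]; split_ifs <;> positivity
    by_cases hbn' : b n' = 0
    · rw [hbn']; simp only [zero_mul, mul_zero]; split_ifs <;> positivity
    have hbb : |b n * b n'| ≤ 1 := by
      rw [abs_mul]; exact mul_le_one₀ (hb n) (abs_nonneg _) (hb n')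
    have h1 : ∀ x : ℝ, b n * b n' * x ≤ |x| := fun x => by
      refine (le_abs_self _).trans ?_
      rw [abs_mul]; exact mul_le_of_le_one_left (abs_nonneg _) hbb
    refine (h1 _).trans ?_
    split_ifs with h
    · have : |∑ l ∈ Ioc 0 L, J l n * J l n'| ≤ L := by
        refine (abs_sum_le_sum_abs _ _).trans ?_
        refine (sum_le_card_nsmul _ _ 1 ?_).trans (by simp)
        intro l _
        rw [abs_mul]; exact mul_le_one₀ (J_abs _ _) (abs_nonneg _) (J_abs _ _)
      have : (0:ℝ) ≤ (N:ℝ)^2 := by positivity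
      linarith
    · have h2 := J_sum_bound (hs n hbn).2 (hs n' hbn').2 (hs n hbn).1 (hs n' hbn').1 h L
      simp_rw [J_mul_right _ (show n ≠ 0 by omega) (show n' ≠ 0 by omega)] at h2
      refine h2.trans ?_
      rw [zero_add]; push_cast
      have a1 : (n:ℝ) ≤ N := by exact_mod_cast hn.2
      have a2 : (n':ℝ) ≤ N := by exact_mod_cast hn'.2
      rw [sq]; gcongr
  refine (sum_le_sum fun n hn => sum_le_sum fun n' hn' => hterm n hn n' hn').trans ?_
  simp only [sum_add_distrib, sum_const, Nat.card_Ioc, nsmul_eq_mul]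
  have : ∑ n ∈ Ioc 0 N, ∑ n' ∈ Ioc 0 N, (if n = n' then (L:ℝ) else 0) = N * L := by
    rw [sum_congr rfl (fun n hn => by rw [sum_ite_eq, if_pos hn])]
    simp
  rw [this]
  simp only [Nat.sub_zero]
  apply le_of_eq; ring

lemma div_sum (F : ℕ → ℕ → ℝ) (M : ℕ) : ∑ m ∈ Ioc 0 M, ∑ a ∈ m.divisors, F a m =
    ∑ a ∈ Ioc 0 M, ∑ c ∈ Ioc 0 (M/a), F a (a*c) := by
  rw [sum_sigma', sum_sigma']
  apply sum_nbij' (fun x => ⟨x.2, x.1/x.2⟩) (fun x => ⟨x.1*x.2, x.1⟩)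
  · rintro ⟨m, a⟩ h
    simp only [mem_sigma, mem_Ioc, Nat.mem_divisors] at h ⊢
    obtain ⟨⟨h1, h2⟩, h3, h4⟩ := h
    have ha : 0 < a := Nat.pos_of_dvd_of_pos h3 h1
    exact ⟨⟨ha, (Nat.le_of_dvd h1 h3).trans h2⟩, Nat.div_pos (Nat.le_of_dvd h1 h3) ha, Nat.div_le_div_right h2⟩
  · rintro ⟨a, c⟩ h
    simp only [mem_sigma, mem_Ioc, Nat.mem_divisors] at h ⊢
    obtain ⟨⟨h1, h2⟩, h3, h4⟩ := h
    refine ⟨⟨Nat.mul_pos h1 h3, ?_⟩, dvd_mul_right _ _, (Nat.mul_pos h1 h3).ne'⟩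
    rw [Nat.le_div_iff_mul_le h1] at h4; rw [mul_comm]; exact h4
  · rintro ⟨m, a⟩ h
    simp only [mem_sigma, mem_Ioc, Nat.mem_divisors] at h ⊢
    rw [Nat.mul_div_cancel' h.2.1]
  · rintro ⟨a, c⟩ h
    simp only [mem_sigma, mem_Ioc] at h ⊢
    rw [Nat.mul_div_cancel_left _ h.1.1]
  · rintro ⟨m, a⟩ h
    simp only [mem_sigma, mem_Ioc, Nat.mem_divisors] at h ⊢
    rw [Nat.mul_div_cancel' h.2.1]

noncomputable def tau (n : ℕ) : ℝ := (n.divisors.card : ℝ)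

lemma tau_nonneg (n : ℕ) : 0 ≤ tau n := by unfold tau; positivity

lemma tau_mul (m n : ℕ) : tau (m*n) ≤ tau m * tau n := by
  unfold tau
  rw [Nat.divisors_mul]
  exact_mod_cast card_mul_le

lemma tau_eq (n : ℕ) : tau n = ∑ _a ∈ n.divisors, (1:ℝ) := by unfold tau; simp

lemma sum_inv_le' {M X : ℕ} (h : M ≤ X) : ∑ n ∈ Ioc 0 M, (1:ℝ)/n ≤ 1 + Real.log X := by
  refine le_trans ?_ (sum_inv_le X)
  apply sum_le_sum_of_subset_of_nonneg (Ioc_subset_Ioc_right h)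
  intros; positivity

lemma H_ge_one (X : ℕ) : (1:ℝ) ≤ 1 + Real.log X := by
  have := Real.log_natCast_nonneg X; linarith

lemma sum_tau_le {M X : ℕ} (h : M ≤ X) : ∑ m ∈ Ioc 0 M, tau m ≤ M * (1 + Real.log X) := by
  simp_rw [tau_eq]
  rw [div_sum (fun _ _ => 1)]
  calc _ ≤ ∑ a ∈ Ioc 0 M, (M:ℝ) * (1/a) := by
        apply sum_le_sum; intro a ha
        simp only [sum_const, Nat.card_Ioc, nsmul_eq_mul, Nat.sub_zero, mul_one]
        rw [mul_one_div]; exact Nat.cast_div_le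
    _ = M * ∑ a ∈ Ioc 0 M, 1/(a:ℝ) := by rw [mul_sum]
    _ ≤ _ := by gcongr; exact sum_inv_le' h

lemma sum_tau_div_le {M X : ℕ} (h : M ≤ X) : ∑ m ∈ Ioc 0 M, tau m / m ≤ (1 + Real.log X)^2 := by
  have : ∀ m ∈ Ioc 0 M, tau m / m = ∑ _a ∈ m.divisors, (1:ℝ)/m := by
    intro m _; rw [tau_eq, sum_div]
  rw [sum_congr rfl this, div_sum (fun _ m => 1/(m:ℝ))]
  calc _ ≤ ∑ a ∈ Ioc 0 M, 1/(a:ℝ) * (1 + Real.log X) := by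
        apply sum_le_sum; intro a ha
        have : ∀ c ∈ Ioc 0 (M/a), 1/(((a*c : ℕ)):ℝ) = 1/(a:ℝ) * (1/c) := by
          intro c _; push_cast; rw [div_mul_div_comm, one_mul]
        rw [sum_congr rfl this, ← mul_sum]
        gcongr
        exact sum_inv_le' ((Nat.div_le_self _ _).trans h)
    _ = (∑ a ∈ Ioc 0 M, 1/(a:ℝ)) * (1 + Real.log X) := by rw [sum_mul]
    _ ≤ _ := by
        rw [sq]
        have := H_ge_one X
        gcongr; exact sum_inv_le' h

lemma sum_tau_sq_le {M X : ℕ} (h : M ≤ X) : ∑ m ∈ Ioc 0 M, tau m ^ 2 ≤ M * (1 + Real.log X)^3 := by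
  have : ∀ m ∈ Ioc 0 M, tau m ^ 2 = ∑ _a ∈ m.divisors, tau m := by
    intro m _; rw [sq]; nth_rw 1 [tau_eq]; rw [sum_mul]; simp
  have hH := H_ge_one X
  rw [sum_congr rfl this, div_sum (fun _ m => tau m)]
  calc _ ≤ ∑ a ∈ Ioc 0 M, (M * (1 + Real.log X)) * (tau a / a) := by
        apply sum_le_sum; intro a ha
        calc _ ≤ ∑ c ∈ Ioc 0 (M/a), tau a * tau c := sum_le_sum fun c _ => tau_mul a c
          _ = tau a * ∑ c ∈ Ioc 0 (M/a), tau c := by rw [mul_sum]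
          _ ≤ tau a * ((M/a : ℝ) * (1 + Real.log X)) := by
              apply mul_le_mul_of_nonneg_left _ (tau_nonneg a)
              refine (sum_tau_le ((Nat.div_le_self M a).trans h)).trans ?_
              gcongr; exact Nat.cast_div_le
          _ = _ := by ring
    _ = (M * (1 + Real.log X)) * ∑ a ∈ Ioc 0 M, tau a / a := by rw [mul_sum]
    _ ≤ (M * (1 + Real.log X)) * (1 + Real.log X)^2 := by gcongr; exact sum_tau_div_le h
    _ = _ := by ring

/-- the box estimate, long `m` range. -/
lemma box_aux {a b : ℕ → ℝ} (ha : ∀ n, |a n| ≤ 1) (hb : ∀ n, |b n| ≤ 1)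
    (hs : ∀ n, b n ≠ 0 → n % 2 = 1 ∧ Squarefree n) {M N X : ℕ} (hNM : N ≤ M) (hMX : M ≤ X) :
    |∑ m ∈ Ioc 0 M, ∑ n ∈ Ioc 0 N, a m * b n * J m n|^6 ≤ 2 * (M:ℝ)^6 * (N:ℝ)^5 * (1 + Real.log X)^9 := by
  set H := 1 + Real.log X with hH
  have hH1 : 1 ≤ H := H_ge_one X
  set S : ℕ → ℝ := fun n => ∑ m ∈ Ioc 0 M, a m * J m n with hS
  set Ns := (Ioc 0 N).filter (fun n => n % 2 = 1 ∧ Squarefree n) with hNs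
  have e1 : ∑ m ∈ Ioc 0 M, ∑ n ∈ Ioc 0 N, a m * b n * J m n = ∑ n ∈ Ns, b n * S n := by
    rw [sum_comm, hNs, sum_filter]
    apply sum_congr rfl; intro n _
    split_ifs with h
    · rw [hS, mul_sum]; apply sum_congr rfl; intros; ring
    · have : b n = 0 := by by_contra h'; exact h (hs n h')
      simp [this]
  have e2 : |∑ n ∈ Ns, b n * S n| ≤ ∑ n ∈ Ns, |S n| := by
    refine (abs_sum_le_sum_abs _ _).trans (sum_le_sum fun n _ => ?_)
    rw [abs_mul]; exact mul_le_of_le_one_left (abs_nonneg _) (hb n)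
  have hcard : (Ns.card : ℝ) ≤ N := by
    have : Ns.card ≤ N := (card_filter_le _ _).trans (by simp)
    exact_mod_cast this
  have e3 : (∑ n ∈ Ns, |S n|)^3 ≤ (N:ℝ)^2 * ∑ n ∈ Ns, |S n|^3 := by
    have h1 := pow_sum_le_card_mul_sum_pow (s := Ns) (f := fun n => |S n|) (fun n _ => abs_nonneg _) 2
    refine h1.trans ?_
    gcongr
  let P := (Ioc 0 M) ×ˢ ((Ioc 0 M) ×ˢ (Ioc 0 M))
  let π : ℕ × ℕ × ℕ → ℕ := fun t => t.1 * (t.2.1 * t.2.2)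
  let b' : ℕ → ℝ := fun n => if n ∈ Ns then (if 0 ≤ S n then 1 else -1) else 0
  let T : ℕ → ℝ := fun l => ∑ n ∈ Ioc 0 N, b' n * J l n
  have hb'1 : ∀ n, |b' n| ≤ 1 := by intro n; simp only [b']; split_ifs <;> simp
  have hb's : ∀ n, b' n ≠ 0 → n % 2 = 1 ∧ Squarefree n := by
    intro n hn
    simp only [b'] at hn
    have : n ∈ Ns := by by_contra h; simp [h] at hn
    exact (mem_filter.1 this).2
  have e4 : ∑ n ∈ Ns, |S n|^3 = ∑ t ∈ P, a t.1 * (a t.2.1 * a t.2.2) * T (π t) := by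
    have h1 : ∀ n ∈ Ns, |S n|^3 = ∑ t ∈ P, a t.1 * (a t.2.1 * a t.2.2) * (b' n * J (π t) n) := by
      intro n hn
      have h2 : |S n|^3 = b' n * (S n * (S n * S n)) := by
        simp only [b', if_pos hn]
        split_ifs with h
        · rw [abs_of_nonneg h]; ring
        · rw [abs_of_neg (not_le.1 h)]; ring
      rw [h2]
      have h3 : S n * (S n * S n) = ∑ t ∈ P, (a t.1 * J t.1 n) * ((a t.2.1 * J t.2.1 n) * (a t.2.2 * J t.2.2 n)) := by
        simp only [hS, P]
        rw [sum_product, sum_mul]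
        apply sum_congr rfl; intro i _
        rw [sum_mul_sum, mul_sum, sum_product]
        apply sum_congr rfl; intro j _
        rw [mul_sum]
      rw [h3, mul_sum]
      apply sum_congr rfl; intro t _
      simp only [π, J_mul_left]; ring
    rw [sum_congr rfl h1, sum_comm]
    apply sum_congr rfl; intro t _
    simp only [T]
    rw [mul_sum, hNs, sum_filter]
    apply sum_congr rfl; intro n hn
    by_cases h : n ∈ Ns
    · rw [if_pos (mem_filter.1 h).2]
    · have h' : ¬ (n % 2 = 1 ∧ Squarefree n) := fun h'' => h (mem_filter.2 ⟨hn, h''⟩)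
      rw [if_neg h']; simp [b', h]
  have e5 : ∑ t ∈ P, a t.1 * (a t.2.1 * a t.2.2) * T (π t) ≤ ∑ t ∈ P, |T (π t)| := by
    apply sum_le_sum; intro t _
    refine (le_abs_self _).trans ?_
    rw [abs_mul, abs_mul, abs_mul]
    refine mul_le_of_le_one_left (abs_nonneg _) ?_
    exact mul_le_one₀ (ha _) (by positivity) (mul_le_one₀ (ha _) (abs_nonneg _) (ha _))
  have hmaps : ∀ t ∈ P, π t ∈ Ioc 0 (M^3) := by
    rintro ⟨x, y, w⟩ ht
    simp only [P, mem_product, mem_Ioc, π] at ht ⊢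
    obtain ⟨⟨h1, h2⟩, ⟨h3, h4⟩, h5, h6⟩ := ht
    refine ⟨by positivity, ?_⟩
    calc x * (y * w) ≤ M * (M * M) := by gcongr
      _ = M^3 := by ring
  let r : ℕ → ℝ := fun l => ((P.filter (fun t => π t = l)).card : ℝ)
  have e6 : ∀ F : ℕ → ℝ, ∑ t ∈ P, F (π t) = ∑ l ∈ Ioc 0 (M^3), r l * F l := by
    intro F
    rw [← sum_fiberwise_of_maps_to hmaps]
    apply sum_congr rfl; intro l _
    rw [sum_congr rfl (g := fun _ => F l) (fun t ht => by rw [(mem_filter.1 ht).2])]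
    simp [r]
  have hr : ∀ l, 0 < l → r l ≤ tau l ^ 2 := by
    intro l hl
    have : (P.filter (fun t => π t = l)).card ≤ (l.divisors ×ˢ l.divisors).card := by
      apply card_le_card_of_injOn (fun t => (t.1, t.2.1))
      · rintro ⟨x, y, w⟩ ht
        simp only [mem_coe, mem_filter, π] at ht
        simp only [coe_product, Set.mem_prod, mem_coe, Nat.mem_divisors]
        exact ⟨⟨⟨_, ht.2.symm⟩, hl.ne'⟩, ⟨x * w, by rw [← ht.2]; ring⟩, hl.ne'⟩
      · rintro ⟨x, y, w⟩ ht ⟨x', y', w'⟩ ht' heq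
        simp only [mem_coe, mem_filter, π, P, mem_product, mem_Ioc, Prod.mk.injEq] at ht ht' heq ⊢
        obtain ⟨rfl, rfl⟩ := heq
        refine ⟨rfl, rfl, ?_⟩
        have : x * (y * w) = x * (y * w') := ht.2.trans ht'.2.symm
        exact Nat.eq_of_mul_eq_mul_left ht.1.2.1.1 (Nat.eq_of_mul_eq_mul_left ht.1.1.1 this)
    rw [card_product] at this
    simp only [r, tau, sq]; exact_mod_cast this
  have e7 : ∑ l ∈ Ioc 0 (M^3), r l ^ 2 ≤ ((M:ℝ) * H^3)^3 := by
    have h1 : ∑ l ∈ Ioc 0 (M^3), r l ^ 2 = ∑ t ∈ P, r (π t) := by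
      rw [e6 r]; apply sum_congr rfl; intros; ring
    rw [h1]
    calc ∑ t ∈ P, r (π t) ≤ ∑ t ∈ P, tau t.1^2 * (tau t.2.1^2 * tau t.2.2^2) := by
          apply sum_le_sum; intro t ht
          refine (hr _ (mem_Ioc.1 (hmaps t ht)).1).trans ?_
          rw [← mul_pow, ← mul_pow]
          apply pow_le_pow_left₀ (tau_nonneg _)
          simp only [π]
          refine (tau_mul _ _).trans ?_
          exact mul_le_mul_of_nonneg_left (tau_mul _ _) (tau_nonneg _)
      _ = (∑ m ∈ Ioc 0 M, tau m^2)^3 := by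
          simp only [P]
          rw [sum_product, pow_succ', sq, sum_mul]
          apply sum_congr rfl; intro i _
          rw [sum_mul_sum, mul_sum, sum_product]
          apply sum_congr rfl; intro j _
          rw [mul_sum]
      _ ≤ _ := by
          apply pow_le_pow_left₀
          · exact sum_nonneg fun _ _ => sq_nonneg _
          · exact sum_tau_sq_le hMX
  have e8 : (∑ t ∈ P, |T (π t)|)^2 ≤ ((M:ℝ) * H^3)^3 * (2 * (M:ℝ)^3 * N) := by
    rw [e6 (fun l => |T l|)]
    refine (sum_mul_sq_le_sq_mul_sq _ _ _).trans ?_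
    have h1 : ∑ l ∈ Ioc 0 (M^3), |T l|^2 ≤ 2 * (M:ℝ)^3 * N := by
      have := LS hb'1 hb's (M^3) N
      simp only [sq_abs]
      refine this.trans ?_
      have hNM' : (N:ℝ) ≤ M := by exact_mod_cast hNM
      push_cast
      have : (N:ℝ)^4 ≤ (M:ℝ)^3 * N := by
        rw [pow_succ]; gcongr
      linarith
    exact mul_le_mul e7 h1 (sum_nonneg fun _ _ => sq_nonneg _) (by positivity)
  rw [e1]
  have hA : 0 ≤ ∑ n ∈ Ns, |S n| := sum_nonneg fun _ _ => abs_nonneg _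
  calc |∑ n ∈ Ns, b n * S n|^6 ≤ (∑ n ∈ Ns, |S n|)^6 := pow_le_pow_left₀ (abs_nonneg _) e2 _
    _ = ((∑ n ∈ Ns, |S n|)^3)^2 := by ring
    _ ≤ ((N:ℝ)^2 * ∑ t ∈ P, |T (π t)|)^2 := by
        apply pow_le_pow_left₀ (by positivity)
        refine e3.trans ?_
        rw [e4]; gcongr
    _ = (N:ℝ)^4 * (∑ t ∈ P, |T (π t)|)^2 := by ring
    _ ≤ (N:ℝ)^4 * (((M:ℝ) * H^3)^3 * (2 * (M:ℝ)^3 * N)) := by gcongr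
    _ = _ := by ring

end FK

namespace FK
open Finset

lemma box1 {a b : ℕ → ℝ} (ha : ∀ n, |a n| ≤ 1) (hb : ∀ n, |b n| ≤ 1)
    (hs : ∀ n, b n ≠ 0 → n % 2 = 1 ∧ Squarefree n) {M N X : ℕ} (hNM : N ≤ M) (hMX : M ≤ X)
    {ζ : ℝ} (h0 : 0 < ζ) (hN : ζ^6 ≤ N) :
    |∑ m ∈ Ioc 0 M, ∑ n ∈ Ioc 0 N, a m * b n * J m n| * ζ ≤ 2 * M * N * (1 + Real.log X)^2 := by
  have h1 := box_aux ha hb hs hNM hMX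
  have hH1 := H_ge_one X
  set H := 1 + Real.log X
  rw [← pow_le_pow_iff_left₀ (by positivity) (by positivity) (show 6 ≠ 0 by norm_num), mul_pow]
  calc _ ≤ (2 * (M:ℝ)^6 * (N:ℝ)^5 * H^9) * N := by gcongr
    _ = 2 * ((M:ℝ)^6 * (N:ℝ)^6) * H^9 := by ring
    _ ≤ 64 * ((M:ℝ)^6 * (N:ℝ)^6) * H^12 := by
        have : H^9 ≤ H^12 := pow_le_pow_right₀ hH1 (by norm_num)
        gcongr
        norm_num
    _ = _ := by ring

lemma box {a b : ℕ → ℝ} (ha : ∀ n, |a n| ≤ 1) (hb : ∀ n, |b n| ≤ 1)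
    (hsa : ∀ n, a n ≠ 0 → n % 2 = 1 ∧ Squarefree n)
    (hs : ∀ n, b n ≠ 0 → n % 2 = 1 ∧ Squarefree n) {M N X : ℕ} (hMX : M ≤ X) (hNX : N ≤ X)
    {ζ : ℝ} (h0 : 0 < ζ) (hM : ζ^6 ≤ M) (hN : ζ^6 ≤ N) :
    |∑ m ∈ Ioc 0 M, ∑ n ∈ Ioc 0 N, a m * b n * J m n| * ζ ≤ 4 * M * N * (1 + Real.log X)^2 := by
  have hH1 := H_ge_one X
  rcases le_total N M with h | h
  · refine (box1 ha hb hs h hMX h0 hN).trans ?_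
    gcongr; norm_num
  · have key : ∀ i j : ℕ, |∑ n ∈ Ioc 0 N, ∑ m ∈ Ioc 0 M, (b n * c4 n ^ i) * (a m * c4 m ^ j) * J n m| * ζ ≤
        2 * N * M * (1 + Real.log X)^2 := by
      intro i j
      have hc : ∀ k n, |c4 n ^ k| ≤ 1 := fun k n => by rw [abs_pow]; exact pow_le_one₀ (abs_nonneg _) (c4_abs n)
      apply box1 (a := fun n => b n * c4 n ^ i) (b := fun m => a m * c4 m ^ j) _ _ _ h hNX h0 hM
      · intro n; rw [abs_mul]; exact mul_le_one₀ (hb n) (abs_nonneg _) (hc i n)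
      · intro n; rw [abs_mul]; exact mul_le_one₀ (ha n) (abs_nonneg _) (hc j n)
      · intro n hn; exact hsa n (left_ne_zero_of_mul hn)
    have e : ∑ m ∈ Ioc 0 M, ∑ n ∈ Ioc 0 N, a m * b n * J m n =
      1/2 * (∑ n ∈ Ioc 0 N, ∑ m ∈ Ioc 0 M, (b n * c4 n ^ 0) * (a m * c4 m ^ 0) * J n m) +
      1/2 * (∑ n ∈ Ioc 0 N, ∑ m ∈ Ioc 0 M, (b n * c4 n ^ 0) * (a m * c4 m ^ 1) * J n m) +
      1/2 * (∑ n ∈ Ioc 0 N, ∑ m ∈ Ioc 0 M, (b n * c4 n ^ 1) * (a m * c4 m ^ 0) * J n m) -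
      1/2 * (∑ n ∈ Ioc 0 N, ∑ m ∈ Ioc 0 M, (b n * c4 n ^ 1) * (a m * c4 m ^ 1) * J n m) := by
      rw [sum_comm]
      simp only [mul_sum, ← sum_add_distrib, ← sum_sub_distrib]
      apply sum_congr rfl; intro n _
      apply sum_congr rfl; intro m _
      by_cases h1 : a m = 0
      · simp [h1]
      by_cases h2 : b n = 0
      · simp [h2]
      rw [J_recip (hsa m h1).1 (hs n h2).1]; ring
    rw [e]
    have k00 := key 0 0
    have k01 := key 0 1
    have k10 := key 1 0
    have k11 := key 1 1
    generalize (∑ n ∈ Ioc 0 N, ∑ m ∈ Ioc 0 M, (b n * c4 n ^ 0) * (a m * c4 m ^ 0) * J n m) = A at *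
    generalize (∑ n ∈ Ioc 0 N, ∑ m ∈ Ioc 0 M, (b n * c4 n ^ 0) * (a m * c4 m ^ 1) * J n m) = B at *
    generalize (∑ n ∈ Ioc 0 N, ∑ m ∈ Ioc 0 M, (b n * c4 n ^ 1) * (a m * c4 m ^ 0) * J n m) = C at *
    generalize (∑ n ∈ Ioc 0 N, ∑ m ∈ Ioc 0 M, (b n * c4 n ^ 1) * (a m * c4 m ^ 1) * J n m) = D at *
    have h4 : |1/2 * A + 1/2 * B + 1/2 * C - 1/2 * D| ≤ 1/2 * (|A| + |B| + |C| + |D|) := by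
      rw [abs_le]
      have := neg_abs_le A; have := neg_abs_le B; have := neg_abs_le C; have := neg_abs_le D
      have := le_abs_self A; have := le_abs_self B; have := le_abs_self C; have := le_abs_self D
      constructor <;> linarith
    nlinarith [mul_le_mul_of_nonneg_right h4 h0.le]

/-- number of naturals in `(x,y]`. -/
lemma card_real_Ioc {x y : ℝ} (hx : 0 ≤ x) (hxy : x ≤ y) (s : Finset ℕ) (hs : ∀ n ∈ s, x < n ∧ (n:ℝ) ≤ y) :
    (s.card : ℝ) ≤ y - x + 1 := by
  have h1 : s ⊆ Ioc ⌊x⌋₊ ⌊y⌋₊ := by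
    intro n hn
    rw [mem_Ioc]
    exact ⟨(Nat.floor_lt hx).2 (hs n hn).1, Nat.le_floor (hs n hn).2⟩
  have h2 := card_le_card h1
  rw [Nat.card_Ioc] at h2
  have h3 : ((⌊y⌋₊ - ⌊x⌋₊ : ℕ) : ℝ) = (⌊y⌋₊:ℝ) - ⌊x⌋₊ := by
    rw [Nat.cast_sub (Nat.floor_le_floor hxy)]
  have h4 : (s.card : ℝ) ≤ ((⌊y⌋₊ - ⌊x⌋₊ : ℕ) : ℝ) := by exact_mod_cast h2
  have h5 := Nat.floor_le (hx.trans hxy)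
  have h6 := Nat.lt_floor_add_one x
  linarith

theorem hyperbola {a b : ℕ → ℝ} (ha : ∀ n, |a n| ≤ 1) (hb : ∀ n, |b n| ≤ 1) {w : ℝ} (hw : 1 ≤ w)
    (hsa : ∀ n, a n ≠ 0 → n % 2 = 1 ∧ Squarefree n ∧ w^12 < n)
    (hsb : ∀ n, b n ≠ 0 → n % 2 = 1 ∧ Squarefree n ∧ w^12 < n) (Y : ℕ) :
    |∑ m ∈ Ioc 0 Y, ∑ n ∈ Ioc 0 (Y/m), a m * b n * J m n| ≤ 6 * Y * (1 + Real.log Y)^3 / w := by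
  have hw0 : 0 < w := by linarith
  rcases Nat.eq_zero_or_pos Y with hY | hY
  · subst hY; simp
  have hYr : (1:ℝ) ≤ Y := by exact_mod_cast hY
  have hH1 := H_ge_one Y
  have hlY := Real.log_natCast_nonneg Y
  set H := 1 + Real.log Y with hH
  let jj : ℕ → ℕ := fun m => ⌊w * Real.log m⌋₊
  let E : ℕ → ℝ := fun j => Real.exp ((j+1)/w)
  have hE0 : ∀ j, 0 < E j := fun j => Real.exp_pos _
  have hE1 : ∀ m : ℕ, 0 < m → (m:ℝ) < E (jj m) := by
    intro m hm
    have hm' : (0:ℝ) < m := by exact_mod_cast hm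
    rw [← Real.log_lt_iff_lt_exp hm', lt_div_iff₀ hw0, mul_comm]
    exact Nat.lt_floor_add_one _
  have hE2 : ∀ m : ℕ, 0 < m → E (jj m) ≤ m * Real.exp (1/w) := by
    intro m hm
    have hm' : (0:ℝ) < m := by exact_mod_cast hm
    have : E (jj m) = Real.exp ((jj m : ℝ)/w) * Real.exp (1/w) := by
      rw [← Real.exp_add, ← add_div]
    rw [this]
    gcongr
    rw [← Real.le_log_iff_exp_le hm', div_le_iff₀ hw0, mul_comm]
    apply Nat.floor_le
    have := Real.log_natCast_nonneg m
    positivity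
  set Jm := ⌊w * Real.log Y⌋₊ with hJm
  have hjj : ∀ m ∈ Ioc 0 Y, jj m ∈ range (Jm + 1) := by
    intro m hm
    rw [mem_Ioc] at hm
    rw [mem_range, Nat.lt_succ_iff]
    apply Nat.floor_le_floor
    gcongr
    · exact_mod_cast hm.1
    · exact_mod_cast hm.2
  -- split
  have hsplit : ∑ m ∈ Ioc 0 Y, ∑ n ∈ Ioc 0 (Y/m), a m * b n * J m n =
      ∑ m ∈ Ioc 0 Y, ∑ n ∈ (Ioc 0 (Y/m)).filter (fun n : ℕ => E (jj m) * n ≤ Y), a m * b n * J m n +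
      ∑ m ∈ Ioc 0 Y, ∑ n ∈ (Ioc 0 (Y/m)).filter (fun n : ℕ => ¬ E (jj m) * n ≤ Y), a m * b n * J m n := by
    rw [← sum_add_distrib]
    apply sum_congr rfl; intro m _
    rw [sum_filter_add_sum_filter_not]
  have hmain : |∑ m ∈ Ioc 0 Y, ∑ n ∈ (Ioc 0 (Y/m)).filter (fun n : ℕ => E (jj m) * n ≤ Y), a m * b n * J m n|
      ≤ 4 * Y * H^3 / w := by
    rw [← sum_fiberwise_of_maps_to hjj]
    refine (abs_sum_le_sum_abs _ _).trans ?_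
    have hblock : ∀ j ∈ range (Jm+1), |∑ m ∈ (Ioc 0 Y).filter (fun m => jj m = j),
        ∑ n ∈ (Ioc 0 (Y/m)).filter (fun n : ℕ => E (jj m) * n ≤ Y), a m * b n * J m n| ≤ 4 * Y * H^2 / w^2 := by
      intro j _
      set M := min ⌊E j⌋₊ Y with hM
      set N := ⌊Y / E j⌋₊ with hN
      have hNY : N ≤ Y := by
        have : (Y:ℝ) / E j ≤ Y := div_le_self (by positivity) (Real.one_le_exp (by positivity))
        calc N ≤ ⌊(Y:ℝ)⌋₊ := Nat.floor_le_floor this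
          _ = Y := Nat.floor_natCast _
      have hMN : (M:ℝ) * N ≤ Y := by
        have h1 : (M:ℝ) ≤ E j := by
          calc (M:ℝ) ≤ (⌊E j⌋₊ : ℝ) := by exact_mod_cast min_le_left _ _
            _ ≤ E j := Nat.floor_le (hE0 j).le
        have h2 : (N:ℝ) ≤ Y / E j := Nat.floor_le (by have := hE0 j; positivity)
        calc (M:ℝ) * N ≤ E j * (Y / E j) := by have := hE0 j; gcongr
          _ = Y := by field_simp [(hE0 j).ne']
      have e : ∑ m ∈ (Ioc 0 Y).filter (fun m => jj m = j),
          ∑ n ∈ (Ioc 0 (Y/m)).filter (fun n : ℕ => E (jj m) * n ≤ Y), a m * b n * J m n =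
          ∑ m ∈ Ioc 0 M, ∑ n ∈ Ioc 0 N, (if jj m = j then a m else 0) * b n * J m n := by
        have h1 : ∑ m ∈ Ioc 0 M, ∑ n ∈ Ioc 0 N, (if jj m = j then a m else 0) * b n * J m n =
            ∑ m ∈ (Ioc 0 M).filter (fun m => jj m = j), ∑ n ∈ Ioc 0 N, a m * b n * J m n := by
          rw [sum_filter]; apply sum_congr rfl; intro m _
          split_ifs <;> simp
        rw [h1]
        have h2 : (Ioc 0 Y).filter (fun m => jj m = j) = (Ioc 0 M).filter (fun m => jj m = j) := by
          ext m
          simp only [mem_filter, mem_Ioc, hM, le_min_iff]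
          constructor
          · rintro ⟨⟨h1, h2⟩, h3⟩
            refine ⟨⟨h1, Nat.le_floor ?_, h2⟩, h3⟩
            rw [← h3]; exact (hE1 m h1).le
          · rintro ⟨⟨h1, _, h2⟩, h3⟩; exact ⟨⟨h1, h2⟩, h3⟩
        rw [h2]
        apply sum_congr rfl; intro m hm
        simp only [mem_filter, mem_Ioc] at hm
        apply sum_congr _ (fun _ _ => rfl)
        ext n
        simp only [mem_filter, mem_Ioc]
        rw [hm.2]
        constructor
        · rintro ⟨⟨h1, _⟩, h3⟩
          refine ⟨h1, Nat.le_floor ?_⟩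
          rw [le_div_iff₀ (hE0 j)]; linarith
        · rintro ⟨h1, h3⟩
          have h4 : (n:ℝ) ≤ Y / E j := (Nat.le_floor_iff (by have := hE0 j; positivity)).1 h3
          rw [le_div_iff₀ (hE0 j)] at h4
          refine ⟨⟨h1, ?_⟩, by linarith⟩
          rw [Nat.le_div_iff_mul_le hm.1.1]
          have h5 := hE1 m hm.1.1
          rw [hm.2] at h5
          have : (n:ℝ) * m ≤ Y := by
            refine le_trans ?_ h4; gcongr
          exact_mod_cast this
      rw [e]
      rw [le_div_iff₀ (by positivity)]
      by_cases hMw : w^12 ≤ M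
      · by_cases hNw : w^12 ≤ N
        · have := box (a := fun m => if jj m = j then a m else 0) (b := b) (M := M) (N := N) (X := Y) (ζ := w^2)
            (fun n => by show |if jj n = j then a n else 0| ≤ 1
                         split_ifs
                         · exact ha n
                         · simp) hb
            (fun n hn => by
              have : a n ≠ 0 := by intro h; simp [h] at hn
              exact ⟨(hsa n this).1, (hsa n this).2.1⟩)
            (fun n hn => ⟨(hsb n hn).1, (hsb n hn).2.1⟩) (min_le_right _ _) hNY (by positivity)
            (by rw [← pow_mul]; exact hMw) (by rw [← pow_mul]; exact hNw)
          refine this.trans ?_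
          rw [mul_assoc 4]
          gcongr
        · rw [sum_eq_zero]
          · simp; positivity
          · intro m _; apply sum_eq_zero; intro n hn
            have : b n = 0 := by
              by_contra h
              have h1 := (hsb n h).2.2
              have h2 : (n:ℝ) ≤ N := by exact_mod_cast (mem_Ioc.1 hn).2
              linarith
            simp [this]
      · rw [sum_eq_zero]
        · simp; positivity
        · intro m hm; apply sum_eq_zero; intro n _
          have : a m = 0 := by
            by_contra h
            have h1 := (hsa m h).2.2
            have h2 : (m:ℝ) ≤ M := by exact_mod_cast (mem_Ioc.1 hm).2
            linarith
          simp [this]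
    refine (sum_le_card_nsmul _ _ _ hblock).trans ?_
    rw [card_range, nsmul_eq_mul]
    have h1 : ((Jm + 1 : ℕ) : ℝ) ≤ w * H := by
      push_cast
      have : (Jm : ℝ) ≤ w * Real.log Y := Nat.floor_le (by positivity)
      rw [hH]; nlinarith
    calc ((Jm + 1 : ℕ) : ℝ) * (4 * Y * H^2 / w^2) ≤ (w * H) * (4 * Y * H^2 / w^2) := by gcongr
      _ = _ := by field_simp
  have herr : |∑ m ∈ Ioc 0 Y, ∑ n ∈ (Ioc 0 (Y/m)).filter (fun n : ℕ => ¬ E (jj m) * n ≤ Y), a m * b n * J m n|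
      ≤ 2 * Y * H / w := by
    refine (abs_sum_le_sum_abs _ _).trans ?_
    have h1 : ∀ m ∈ Ioc 0 Y, |∑ n ∈ (Ioc 0 (Y/m)).filter (fun n : ℕ => ¬ E (jj m) * n ≤ Y), a m * b n * J m n| ≤
        (Y:ℝ)/w * (1/m) + (if m ≤ ⌊(Y:ℝ)/w^12⌋₊ then (1:ℝ) else 0) := by
      intro m hm
      rw [mem_Ioc] at hm
      have hm0 : (0:ℝ) < m := by exact_mod_cast hm.1
      split_ifs with h
      · have hx : (Y:ℝ) / (m * Real.exp (1/w)) ≤ (Y:ℝ)/m := by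
          apply div_le_div_of_nonneg_left (by positivity) hm0
          have : 1 ≤ Real.exp (1/w) := Real.one_le_exp (by positivity)
          nlinarith
        have hc := card_real_Ioc (x := (Y:ℝ) / (m * Real.exp (1/w))) (y := (Y:ℝ)/m) (by positivity) hx
          ((Ioc 0 (Y/m)).filter (fun n : ℕ => ¬ E (jj m) * n ≤ Y)) (by
            intro n hn
            simp only [mem_filter, mem_Ioc, not_le] at hn
            obtain ⟨⟨h1, h2⟩, h3⟩ := hn
            constructor
            · rw [div_lt_iff₀ (by positivity)]
              calc (Y:ℝ) < E (jj m) * n := h3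
                _ ≤ (m * Real.exp (1/w)) * n := by gcongr; exact hE2 m hm.1
                _ = _ := by ring
            · rw [le_div_iff₀ hm0]
              rw [Nat.le_div_iff_mul_le hm.1] at h2
              exact_mod_cast h2)
        have hexp : 1 - 1/Real.exp (1/w) ≤ 1/w := by
          have := Real.add_one_le_exp (-(1/w))
          rw [Real.exp_neg] at this
          rw [one_div (Real.exp _)]; linarith
        calc _ ≤ ∑ n ∈ (Ioc 0 (Y/m)).filter (fun n : ℕ => ¬ E (jj m) * n ≤ Y), (1:ℝ) := by
              refine (abs_sum_le_sum_abs _ _).trans (sum_le_sum fun n _ => ?_)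
              rw [abs_mul, abs_mul]
              exact mul_le_one₀ (mul_le_one₀ (ha _) (abs_nonneg _) (hb _)) (abs_nonneg _) (J_abs _ _)
          _ = (((Ioc 0 (Y/m)).filter (fun n : ℕ => ¬ E (jj m) * n ≤ Y)).card : ℝ) := by simp
          _ ≤ _ := hc
          _ = (Y:ℝ)/m * (1 - 1/Real.exp (1/w)) + 1 := by
              have := (Real.exp_pos (1/w)).ne'
              field_simp
          _ ≤ (Y:ℝ)/m * (1/w) + 1 := by gcongr
          _ = _ := by ring
      · rw [sum_eq_zero]
        · rw [abs_zero]; positivity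
        · intro n hn
          simp only [mem_filter, mem_Ioc] at hn
          have : b n = 0 := by
            by_contra hbn
            have h1 := (hsb n hbn).2.2
            apply h
            apply Nat.le_floor
            rw [le_div_iff₀ (by positivity)]
            have h2 := hn.1.2
            rw [Nat.le_div_iff_mul_le hm.1] at h2
            have h3 : (n:ℝ) * m ≤ Y := by exact_mod_cast h2
            nlinarith
          simp [this]
    refine (sum_le_sum h1).trans ?_
    rw [sum_add_distrib, ← mul_sum, ← sum_filter]
    have h2 : ∑ m ∈ (Ioc 0 Y).filter (fun m => m ≤ ⌊(Y:ℝ)/w^12⌋₊), (1:ℝ) ≤ Y / w := by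
      have : ((Ioc 0 Y).filter (fun m => m ≤ ⌊(Y:ℝ)/w^12⌋₊)) ⊆ Ioc 0 ⌊(Y:ℝ)/w^12⌋₊ := by
        intro m hm
        simp only [mem_filter, mem_Ioc] at hm ⊢; exact ⟨hm.1.1, hm.2⟩
      have h3 := card_le_card this
      rw [Nat.card_Ioc, Nat.sub_zero] at h3
      rw [sum_const, nsmul_eq_mul, mul_one]
      calc _ ≤ (⌊(Y:ℝ)/w^12⌋₊ : ℝ) := by exact_mod_cast h3
        _ ≤ (Y:ℝ)/w^12 := Nat.floor_le (by positivity)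
        _ ≤ Y / w := by
            apply div_le_div_of_nonneg_left (by positivity) hw0
            exact le_self_pow₀ hw (by norm_num)
    have h3 : (Y:ℝ)/w * ∑ m ∈ Ioc 0 Y, 1/(m:ℝ) ≤ Y/w * H := by
      gcongr; exact sum_inv_le Y
    calc _ ≤ (Y:ℝ)/w * H + Y/w := add_le_add h3 h2
      _ ≤ (Y:ℝ)/w * H + Y/w * H := by
          have : (Y:ℝ)/w * 1 ≤ Y/w * H := by gcongr
          linarith
      _ = _ := by ring
  rw [hsplit]
  refine (abs_add_le _ _).trans ((add_le_add hmain herr).trans ?_)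
  have : 2 * (Y:ℝ) * H / w ≤ 2 * Y * H^3 / w := by
    gcongr; exact le_self_pow₀ hH1 (by norm_num)
  calc _ ≤ 4 * (Y:ℝ) * H^3 / w + 2 * Y * H^3 / w := by linarith
    _ = _ := by ring

end FK

namespace FK
open Finset

section tuples
variable {ι : Type*} [Fintype ι]

noncomputable def tup (ι : Type*) [Fintype ι] (Y : ℕ) : Finset (ι → ℕ) := Fintype.piFinset fun _ => Ioc 0 Y

lemma mem_tup {Y : ℕ} {D : ι → ℕ} : D ∈ tup ι Y ↔ ∀ u, 0 < D u ∧ D u ≤ Y := by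
  simp [tup, Fintype.mem_piFinset]

/-- tuple attached to a coloring of the prime factors. -/
noncomputable def ctup {n : ℕ} (c : n.primeFactors → ι) (u : ι) : ℕ := ∏ p with c p = u, (p : ℕ)

lemma ctup_prod {n : ℕ} (hn : Squarefree n) (c : n.primeFactors → ι) : ∏ u, ctup c u = n := by
  unfold ctup
  simp only [prod_filter]
  rw [prod_comm]
  simp only [prod_ite_eq, mem_univ, if_true]
  exact (prod_coe_sort n.primeFactors (fun p => p)).trans (Nat.prod_primeFactors_of_squarefree hn)

lemma ctup_dvd {n : ℕ} (c : n.primeFactors → ι) (u : ι) (p : n.primeFactors) :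
    (p : ℕ) ∣ ctup c u ↔ c p = u := by
  have hp : (p:ℕ).Prime := Nat.prime_of_mem_primeFactors p.2
  unfold ctup
  constructor
  · intro h
    obtain ⟨q, hq, hpq⟩ := (hp.prime.dvd_finsetProd_iff _).1 h
    have : (p:ℕ) = q := (Nat.prime_dvd_prime_iff_eq hp (Nat.prime_of_mem_primeFactors q.2)).1 hpq
    have : p = q := Subtype.ext this
    rw [this]; exact (mem_filter.1 hq).2
  · intro h
    exact dvd_prod_of_mem (fun p : n.primeFactors => (p:ℕ)) (by simp [h])

lemma col {n N : ℕ} (hn : Squarefree n) (hN : n ≤ N) (h : (ι → ℕ) → ℝ) :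
    ∑ D ∈ (tup ι N).filter (fun D => ∏ u, D u = n), h D = ∑ c : n.primeFactors → ι, h (ctup c) := by
  have hn0 : 0 < n := Nat.pos_of_ne_zero hn.ne_zero
  symm
  apply sum_bij (fun c _ => ctup c)
  · intro c _
    rw [mem_filter, mem_tup]
    refine ⟨fun u => ?_, ctup_prod hn c⟩
    have : ctup c u ∣ n := by
      conv_rhs => rw [← ctup_prod hn c]
      exact dvd_prod_of_mem _ (mem_univ u)
    exact ⟨Nat.pos_of_dvd_of_pos this hn0, (Nat.le_of_dvd hn0 this).trans hN⟩
  · intro c _ c' _ heq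
    funext p
    have := (ctup_dvd c (c p) p).2 rfl
    rw [heq, ctup_dvd] at this
    exact this.symm
  · intro D hD
    rw [mem_filter, mem_tup] at hD
    obtain ⟨hD1, hD2⟩ := hD
    have hex : ∀ p : n.primeFactors, ∃ u, (p:ℕ) ∣ D u := by
      intro p
      have hp : (p:ℕ).Prime := Nat.prime_of_mem_primeFactors p.2
      have hd : (p:ℕ) ∣ ∏ u, D u := by
        rw [hD2]; exact Nat.dvd_of_mem_primeFactors p.2
      obtain ⟨u, _, h⟩ := (hp.prime.dvd_finsetProd_iff _).1 hd
      exact ⟨u, h⟩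
    choose c hc using hex
    refine ⟨c, mem_univ _, ?_⟩
    have hdvd : ∀ u, D u ∣ n := fun u => by rw [← hD2]; exact dvd_prod_of_mem _ (mem_univ u)
    have hsub : ∀ u, ctup c u ∣ D u := by
      intro u
      unfold ctup
      apply Finset.prod_dvd_of_isRelPrime
      · intro p _ q _ hpq
        exact Nat.coprime_iff_isRelPrime.1 ((Nat.coprime_primes (Nat.prime_of_mem_primeFactors p.2)
          (Nat.prime_of_mem_primeFactors q.2)).2 (fun h => hpq (Subtype.ext h)))
      · intro p hp
        rw [← (mem_filter.1 hp).2]; exact hc p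
    have hprod : ∏ u, ctup c u = ∏ u, D u := by rw [ctup_prod hn, hD2]
    funext u
    by_contra hne
    have hlt : ∏ u, ctup c u < ∏ u, D u := by
      apply prod_lt_prod
      · intro u _; exact Nat.pos_of_dvd_of_pos (hsub u) (hD1 u).1
      · intro u _; exact Nat.le_of_dvd (hD1 u).1 (hsub u)
      · exact ⟨u, mem_univ u, lt_of_le_of_ne (Nat.le_of_dvd (hD1 u).1 (hsub u)) hne⟩
    omega
  · intros; rfl

/-- tuples with squarefree product at most `Y`. -/
noncomputable def TT (ι : Type*) [Fintype ι] (Y : ℕ) : Finset (ι → ℕ) :=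
  (tup ι Y).filter (fun D => ∏ u, D u ∈ sf Y)

lemma mem_TT {Y : ℕ} {D : ι → ℕ} : D ∈ TT ι Y ↔ Squarefree (∏ u, D u) ∧ ∏ u, D u ≤ Y := by
  unfold TT
  rw [mem_filter, mem_tup, mem_sf]
  constructor
  · rintro ⟨-, h⟩; exact ⟨h.2, h.1.2⟩
  · rintro ⟨h1, h2⟩
    have hpos : 0 < ∏ u, D u := Nat.pos_of_ne_zero h1.ne_zero
    refine ⟨fun u => ?_, ⟨hpos, h2⟩, h1⟩
    have hd : D u ∣ ∏ u, D u := dvd_prod_of_mem _ (mem_univ u)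
    exact ⟨Nat.pos_of_dvd_of_pos hd hpos, (Nat.le_of_dvd hpos hd).trans h2⟩

lemma TT_sum (N : ℕ) (h : (ι → ℕ) → ℝ) :
    ∑ D ∈ TT ι N, h D = ∑ n ∈ sf N, ∑ c : n.primeFactors → ι, h (ctup c) := by
  have : ∀ n ∈ sf N, ∑ c : n.primeFactors → ι, h (ctup c)
      = ∑ D ∈ (TT ι N).filter (fun D => ∏ u, D u = n), h D := by
    intro n hn
    have hn' := mem_sf.1 hn
    rw [← col hn'.2 hn'.1.2]
    apply sum_congr _ (fun _ _ => rfl)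
    ext D
    simp only [TT, mem_filter]
    constructor
    · rintro ⟨h1, h2⟩; exact ⟨⟨h1, h2 ▸ hn⟩, h2⟩
    · rintro ⟨⟨h1, _⟩, h2⟩; exact ⟨h1, h2⟩
  rw [sum_congr rfl this]
  exact (sum_fiberwise_of_maps_to (fun D hD => (mem_filter.1 hD).2) _).symm

lemma mulf_ctup {n : ℕ} (hn : Squarefree n) (c : n.primeFactors → ι) (g : ℕ → ℝ) (u : ι) :
    mulf g (ctup c u) = ∏ p with c p = u, g p := by
  have hn0 : n ≠ 0 := hn.ne_zero
  have h0 : ctup c u ≠ 0 := by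
    have := ctup_prod hn c
    have hd : ctup c u ∣ n := by
      conv_rhs => rw [← this]
      exact dvd_prod_of_mem _ (mem_univ u)
    exact ne_zero_of_dvd_ne_zero hn0 hd
  have hpf : (ctup c u).primeFactors = (univ.filter (fun p => c p = u)).image (fun p : n.primeFactors => (p:ℕ)) := by
    ext q
    rw [Nat.mem_primeFactors, mem_image]
    constructor
    · rintro ⟨hq, hd, _⟩
      unfold ctup at hd
      obtain ⟨p, hp, hpq⟩ := (hq.prime.dvd_finsetProd_iff _).1 hd
      exact ⟨p, hp, ((Nat.prime_dvd_prime_iff_eq hq (Nat.prime_of_mem_primeFactors p.2)).1 hpq).symm⟩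
    · rintro ⟨p, hp, rfl⟩
      exact ⟨Nat.prime_of_mem_primeFactors p.2, (ctup_dvd c u p).2 (mem_filter.1 hp).2, h0⟩
  unfold mulf
  rw [hpf, prod_image (fun a _ b _ h => Subtype.ext h)]

lemma collapse (N : ℕ) (θ : ι → ℕ → ℝ) :
    ∑ D ∈ TT ι N, ∏ u, mulf (θ u) (D u) = ∑ n ∈ sf N, mulf (fun p => ∑ u, θ u p) n := by
  rw [TT_sum]
  apply sum_congr rfl
  intro n hn
  have hn' := (mem_sf.1 hn).2
  have h1 : ∀ c : n.primeFactors → ι, ∏ u, mulf (θ u) (ctup c u) = ∏ p, θ (c p) p := by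
    intro c
    simp only [mulf_ctup hn', prod_filter]
    rw [prod_comm]
    simp
  simp only [h1]
  unfold mulf
  rw [← prod_coe_sort n.primeFactors (fun p => ∑ u, θ u p), prod_univ_sum]
  simp

lemma TT_coprime {Y : ℕ} {D : ι → ℕ} (hD : D ∈ TT ι Y) {u v : ι} (h : u ≠ v) : (D u).Coprime (D v) := by
  have h1 := (mem_TT.1 hD).1
  have : D u * D v ∣ ∏ u, D u := by
    rw [← prod_pair h]
    exact prod_dvd_prod_of_subset _ _ _ (subset_univ _)
  exact Nat.coprime_of_squarefree_mul (h1.squarefree_of_dvd this)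

lemma mulf_finset_prod (g : ℕ → ℝ) (s : Finset ι) (D : ι → ℕ) (hD : ∀ u ∈ s, ∀ v ∈ s, u ≠ v → (D u).Coprime (D v)) :
    mulf g (∏ u ∈ s, D u) = ∏ u ∈ s, mulf g (D u) := by
  induction s using Finset.induction_on with
  | empty => simp [mulf_one]
  | insert a s ha ih =>
    rw [prod_insert ha, prod_insert ha, mulf_mul, ih]
    · intro u hu v hv; exact hD u (mem_insert_of_mem hu) v (mem_insert_of_mem hv)
    · apply Nat.Coprime.prod_right
      intro u hu
      exact hD a (mem_insert_self _ _) u (mem_insert_of_mem hu) (by rintro rfl; exact ha hu)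

lemma mulf_TT (g : ℕ → ℝ) {Y : ℕ} {D : ι → ℕ} (hD : D ∈ TT ι Y) :
    mulf g (∏ u, D u) = ∏ u, mulf g (D u) :=
  mulf_finset_prod g univ D (fun _ _ _ _ h => TT_coprime hD h)

lemma TT_pos {Y : ℕ} {D : ι → ℕ} (hD : D ∈ TT ι Y) (u : ι) : 0 < D u :=
  ((mem_tup.1 (mem_filter.1 hD).1) u).1

/-- split a tuple along a set `B` of indices -/
lemma split (B : Finset ι) (Y : ℕ) (G : (ι → ℕ) → ℝ) :
    ∑ D ∈ TT ι Y, G D = ∑ E ∈ (TT ι Y).filter (fun E => ∀ u ∈ B, E u = 1),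
      ∑ D ∈ (TT ι (Y / ∏ u, E u)).filter (fun D => (∀ u, u ∉ B → D u = 1) ∧ (∏ u, D u).Coprime (∏ u, E u)),
        G (E * D) := by
  rw [sum_sigma']
  have key : ∀ D : ι → ℕ, (∏ u, if u ∈ B then 1 else D u) * (∏ u, if u ∈ B then D u else 1) = ∏ u, D u := by
    intro D
    rw [← prod_mul_distrib]
    apply prod_congr rfl
    intro u _
    split_ifs <;> simp
  apply sum_bij' (fun D _ => (⟨fun u => if u ∈ B then 1 else D u, fun u => if u ∈ B then D u else 1⟩ : Σ _ : ι → ℕ, ι → ℕ))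
    (fun x _ => x.1 * x.2)
  · intro D hD
    have h := mem_TT.1 hD
    have hk := key D
    rw [← hk] at h
    have hc := Nat.coprime_of_squarefree_mul h.1
    have hp : 0 < (∏ u, if u ∈ B then 1 else D u) * (∏ u, if u ∈ B then D u else 1) := Nat.pos_of_ne_zero h.1.ne_zero
    have hp1 : 0 < (∏ u, if u ∈ B then 1 else D u) := Nat.pos_of_mul_pos_right hp
    have hp2 : 0 < (∏ u, if u ∈ B then D u else 1) := Nat.pos_of_mul_pos_left hp
    rw [mem_sigma, mem_filter, mem_filter, mem_TT, mem_TT]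
    refine ⟨⟨⟨h.1.squarefree_of_dvd (dvd_mul_right _ _), ?_⟩, fun u hu => by simp [hu]⟩,
      ⟨h.1.squarefree_of_dvd (dvd_mul_left _ _), ?_⟩, fun u hu => by simp [hu], hc.symm⟩
    · exact (Nat.le_of_dvd hp (dvd_mul_right _ _)).trans h.2
    · rw [Nat.le_div_iff_mul_le hp1, mul_comm]; exact h.2
  · rintro ⟨E, D⟩ hx
    rw [mem_sigma, mem_filter, mem_filter, mem_TT, mem_TT] at hx
    obtain ⟨⟨⟨h1, h2⟩, h3⟩, ⟨h4, h5⟩, h6, h7⟩ := hx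
    rw [mem_TT]
    simp only [Pi.mul_apply, prod_mul_distrib]
    refine ⟨(Nat.squarefree_mul h7.symm).2 ⟨h1, h4⟩, ?_⟩
    have := (Nat.le_div_iff_mul_le (Nat.pos_of_ne_zero h1.ne_zero)).1 h5
    rw [mul_comm]; exact this
  · intro D _
    funext u
    simp only [Pi.mul_apply]
    split_ifs <;> simp
  · rintro ⟨E, D⟩ hx
    rw [mem_sigma, mem_filter, mem_filter, mem_TT, mem_TT] at hx
    obtain ⟨⟨⟨h1, h2⟩, h3⟩, ⟨h4, h5⟩, h6, h7⟩ := hx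
    dsimp only at h3 h6
    have e1 : (fun u => if u ∈ B then 1 else (E * D) u) = E := by
      funext u
      split_ifs with hu
      · exact (h3 u hu).symm
      · simp [h6 u hu]
    have e2 : (fun u => if u ∈ B then (E * D) u else 1) = D := by
      funext u
      split_ifs with hu
      · simp [h3 u hu]
      · exact (h6 u hu).symm
    simp only [e1, e2]
  · intro D _
    congr 1
    funext u
    simp only [Pi.mul_apply]
    split_ifs <;> simp

lemma sum_inv_tup (Y : ℕ) : ∑ D ∈ tup ι Y, ∏ u, (1:ℝ) / D u ≤ (1 + Real.log Y) ^ Fintype.card ι := by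
  unfold tup
  rw [← prod_univ_sum (fun _ : ι => Ioc 0 Y) (fun _ n => (1:ℝ) / n)]
  rw [prod_const, card_univ]
  apply pow_le_pow_left₀ (sum_nonneg fun _ _ => by positivity) (sum_inv_le Y)

end tuples
end FK

namespace FK
open Finset

section tj
variable {I : Type*} [Fintype I]

noncomputable def ks (κ : ℝ) (p : ℕ) : ℝ := κ * s0 p

lemma ks_nonneg {κ : ℝ} (h : 0 ≤ κ) (p : ℕ) : 0 ≤ ks κ p := mul_nonneg h (s0_nonneg p)
lemma ks_le {κ : ℝ} (_h : 0 ≤ κ) (h1 : κ ≤ 1) (p : ℕ) : ks κ p ≤ 1 := mul_le_one₀ h1 (s0_nonneg p) (s0_le p)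

lemma mulf_ks_abs {κ : ℝ} (h : 0 ≤ κ) (h1 : κ ≤ 1) (n : ℕ) : |mulf (ks κ) n| ≤ 1 := by
  rw [abs_of_nonneg (mulf_nonneg (ks_nonneg h) n)]
  exact prod_le_one (fun p _ => ks_nonneg h p) (fun p _ => ks_le h h1 p)

lemma mulf_ks_S0 {κ : ℝ} {n : ℕ} (h : mulf (ks κ) n ≠ 0) : S0 n := by
  intro p hp
  unfold mulf at h
  have := prod_ne_zero_iff.1 h p hp
  unfold ks s0 at this
  by_contra hc
  simp [hc] at this

noncomputable def tj (φ : I → I → ℕ) (lam : I → ℕ) (D : I → ℕ) : ℝ :=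
  (∏ u, ∏ v, J (D u) (D v) ^ φ u v) * ∏ u, c4 (D u) ^ lam u

noncomputable def wt (κ : ℝ) (D : I → ℕ) : ℝ := ∏ u, mulf (ks κ) (D u)

noncomputable def XX (φ : I → I → ℕ) (E : I → ℕ) (v : I) (n : ℕ) : ℝ :=
  ∏ u, J (E u) n ^ φ u v * J n (E u) ^ φ v u

lemma tj_mul (φ : I → I → ℕ) (lam : I → ℕ) (E D : I → ℕ) (hE : ∀ u, 0 < E u) (hD : ∀ u, 0 < D u) :
    tj φ lam (E * D) = tj φ lam E * tj φ lam D * ∏ v, XX φ E v (D v) := by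
  have h1 : ∏ u, ∏ v, J ((E*D) u) ((E*D) v) ^ φ u v = (∏ u, ∏ v, J (E u) (E v) ^ φ u v) *
      (∏ u, ∏ v, J (D u) (D v) ^ φ u v) * ∏ v, XX φ E v (D v) := by
    have h2 : ∏ v, XX φ E v (D v) = (∏ u, ∏ v, J (E u) (D v) ^ φ u v) * ∏ u, ∏ v, J (D u) (E v) ^ φ u v := by
      unfold XX
      simp only [prod_mul_distrib]
      rw [prod_comm]
    rw [h2]
    simp only [← prod_mul_distrib]
    apply prod_congr rfl; intro u _
    apply prod_congr rfl; intro v _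
    simp only [Pi.mul_apply]
    rw [J_mul_left, J_mul_right _ (hE v).ne' (hD v).ne', J_mul_right _ (hE v).ne' (hD v).ne']
    ring
  unfold tj
  rw [h1]
  simp only [Pi.mul_apply, c4_CM.mul, mul_pow, prod_mul_distrib]
  ring

lemma abs_prod_le_one {α : Type*} (s : Finset α) (f : α → ℝ) (h : ∀ a ∈ s, |f a| ≤ 1) : |∏ a ∈ s, f a| ≤ 1 := by
  rw [abs_prod]; exact prod_le_one (fun _ _ => abs_nonneg _) h

lemma abs_pow_le_one {x : ℝ} (h : |x| ≤ 1) (n : ℕ) : |x ^ n| ≤ 1 := by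
  rw [abs_pow]; exact pow_le_one₀ (abs_nonneg _) h

lemma abs_mul_le_one {x y : ℝ} (h : |x| ≤ 1) (h' : |y| ≤ 1) : |x * y| ≤ 1 := by
  rw [abs_mul]; exact mul_le_one₀ h (abs_nonneg _) h'

lemma tj_abs (φ : I → I → ℕ) (lam D : I → ℕ) : |tj φ lam D| ≤ 1 :=
  abs_mul_le_one (abs_prod_le_one _ _ fun _ _ => abs_prod_le_one _ _ fun _ _ => abs_pow_le_one (J_abs _ _) _)
    (abs_prod_le_one _ _ fun _ _ => abs_pow_le_one (c4_abs _) _)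

lemma XX_abs (φ : I → I → ℕ) (E : I → ℕ) (v : I) (n : ℕ) : |XX φ E v n| ≤ 1 :=
  abs_prod_le_one _ _ fun _ _ => abs_mul_le_one (abs_pow_le_one (J_abs _ _) _) (abs_pow_le_one (J_abs _ _) _)

lemma wt_abs {κ : ℝ} (h : 0 ≤ κ) (h1 : κ ≤ 1) (D : I → ℕ) : |wt κ D| ≤ 1 :=
  abs_prod_le_one _ _ fun _ _ => mulf_ks_abs h h1 _

lemma wt_nonneg {κ : ℝ} (h : 0 ≤ κ) (D : I → ℕ) : 0 ≤ wt κ D :=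
  prod_nonneg fun _ _ => mulf_nonneg (ks_nonneg h) _

lemma XX_one (φ : I → I → ℕ) (E : I → ℕ) (v : I) : XX φ E v 1 = 1 := by
  unfold XX; simp [J_one_left, J_one_right]

lemma wt_mul (κ : ℝ) (E D : I → ℕ) (h : (∏ u, D u).Coprime (∏ u, E u)) :
    wt κ (E * D) = wt κ E * wt κ D := by
  unfold wt
  rw [← prod_mul_distrib]
  apply prod_congr rfl; intro u _
  rw [Pi.mul_apply, mulf_mul]
  exact (Nat.Coprime.coprime_dvd_left (dvd_prod_of_mem _ (mem_univ u))
    (Nat.Coprime.coprime_dvd_right (dvd_prod_of_mem _ (mem_univ u)) h)).symm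

noncomputable def big (z : ℝ) (D : I → ℕ) : Finset I := univ.filter (fun u => z < (D u : ℝ))

/-- sum over pairs versus sum over tuples supported on two indices -/
lemma pair_sum {u v : I} (huv : u ≠ v) (Y e : ℕ) (g : ℕ → ℕ → ℝ)
    (hg : ∀ m n, g m n ≠ 0 → Squarefree m ∧ Squarefree n ∧ m.Coprime n ∧ m.Coprime e ∧ n.Coprime e) :
    ∑ D ∈ (TT I Y).filter (fun D => (∀ t, t ∉ ({u, v} : Finset I) → D t = 1) ∧ (∏ u, D u).Coprime e), g (D u) (D v)
      = ∑ m ∈ Ioc 0 Y, ∑ n ∈ Ioc 0 (Y / m), g m n := by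
  have hprod : ∀ D : I → ℕ, (∀ t, t ∉ ({u, v} : Finset I) → D t = 1) → ∏ t, D t = D u * D v := by
    intro D hD
    rw [← prod_pair huv]
    exact (prod_subset (subset_univ _) (fun t _ ht => hD t ht)).symm
  rw [sum_sigma']
  refine sum_of_injOn (fun D => (⟨D u, D v⟩ : Σ _ : ℕ, ℕ)) ?_ ?_ ?_ ?_
  · intro D hD D' hD' h
    have hD := (mem_filter.1 (mem_coe.1 hD)).2.1
    have hD' := (mem_filter.1 (mem_coe.1 hD')).2.1
    simp only [Sigma.mk.injEq, heq_eq_eq] at h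
    funext t
    by_cases htu : t = u
    · rw [htu, h.1]
    by_cases htv : t = v
    · rw [htv, h.2]
    rw [hD t (by simp [htu, htv]), hD' t (by simp [htu, htv])]
  · intro D hD
    have hD := mem_filter.1 (mem_coe.1 hD)
    have h1 := (mem_TT.1 hD.1).2
    rw [hprod D hD.2.1] at h1
    have hu := TT_pos hD.1 u
    have hv := TT_pos hD.1 v
    rw [mem_coe, mem_sigma, mem_Ioc, mem_Ioc]
    refine ⟨⟨hu, ?_⟩, hv, ?_⟩
    · dsimp only; nlinarith
    · dsimp only; rw [Nat.le_div_iff_mul_le hu, mul_comm]; exact h1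
  · rintro ⟨m, n⟩ hmn hni
    by_contra hne
    apply hni
    rw [mem_sigma, mem_Ioc, mem_Ioc] at hmn
    dsimp only at hmn
    obtain ⟨h1, h2, h3, h4, h5⟩ := hg m n hne
    set D : I → ℕ := fun t => if t = u then m else if t = v then n else 1 with hDdef
    have hDu : D u = m := by simp [hDdef]
    have hDv : D v = n := by simp [hDdef, huv.symm]
    have hDo : ∀ t, t ∉ ({u, v} : Finset I) → D t = 1 := by
      intro t ht
      simp only [mem_insert, mem_singleton, not_or] at ht
      simp [hDdef, ht.1, ht.2]
    have hp := hprod D hDo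
    rw [hDu, hDv] at hp
    refine ⟨D, ?_, by simp [hDu, hDv]⟩
    rw [mem_coe, mem_filter, mem_TT, hp]
    refine ⟨⟨(Nat.squarefree_mul h3).2 ⟨h1, h2⟩, ?_⟩, hDo, Nat.Coprime.mul_left h4 h5⟩
    have := (Nat.le_div_iff_mul_le hmn.1.1).1 hmn.2.2
    rw [mul_comm]; exact this
  · intro D _; rfl

lemma tj_pair {φ : I → I → ℕ} (lam : I → ℕ) (hφ : ∀ u, φ u u = 0) {u v : I} (huv : φ u v = 1) (hvu : φ v u = 0)
    {D : I → ℕ} (hD : ∀ t, t ∉ ({u, v} : Finset I) → D t = 1) :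
    tj φ lam D = J (D u) (D v) * (c4 (D u) ^ lam u * c4 (D v) ^ lam v) := by
  have hne : u ≠ v := by rintro rfl; omega
  have hD' : ∀ t, t ≠ u → t ≠ v → D t = 1 := fun t h1 h2 => hD t (by simp [h1, h2])
  unfold tj
  congr 1
  · rw [Fintype.prod_eq_single u, Fintype.prod_eq_single v, huv, pow_one]
    · intro t ht
      by_cases h : t = u
      · rw [h, hφ, pow_zero]
      · rw [hD' t h ht, J_one_right, one_pow]
    · intro t ht
      apply prod_eq_one
      intro s _
      by_cases h : t = v
      · subst h
        by_cases h2 : s = u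
        · rw [h2, hvu, pow_zero]
        · by_cases h3 : s = t
          · rw [h3, hφ, pow_zero]
          · rw [hD' s h2 h3, J_one_right, one_pow]
      · rw [hD' t ht h, J_one_left, one_pow]
  · rw [Fintype.prod_eq_mul u v hne]
    intro t ht
    rw [hD' t ht.1 ht.2, c4_CM.one, one_pow]

lemma caseI {φ : I → I → ℕ} (lam : I → ℕ) (hφ : ∀ u, φ u u = 0) {κ : ℝ} (h0 : 0 ≤ κ) (h1 : κ ≤ 1)
    {u v : I} (huv : φ u v = 1) (hvu : φ v u = 0) (B : Finset I) (hu : u ∈ B) (hv : v ∈ B)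
    {w : ℝ} (hw : 1 ≤ w) (Y : ℕ) :
    |∑ D ∈ TT I Y, if big (w^12) D = B then wt κ D * tj φ lam D else 0|
      ≤ 6 * Y * (1 + Real.log Y) ^ (Fintype.card I + 3) / w := by
  have hne : u ≠ v := by rintro rfl; omega
  rw [split {u, v}]
  set H := 1 + Real.log Y with hH
  have hH1 : 1 ≤ H := H_ge_one Y
  have key : ∀ E ∈ (TT I Y).filter (fun E => ∀ t ∈ ({u, v} : Finset I), E t = 1),
      |∑ D ∈ (TT I (Y / ∏ u, E u)).filter (fun D => (∀ t, t ∉ ({u, v} : Finset I) → D t = 1) ∧ (∏ u, D u).Coprime (∏ u, E u)),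
        if big (w^12) (E * D) = B then wt κ (E * D) * tj φ lam (E * D) else 0|
      ≤ (6 * Y * H^3 / w) * ∏ t, (1:ℝ) / E t := by
    intro E hE
    rw [mem_filter] at hE
    obtain ⟨hE1, hE2⟩ := hE
    have hEpos := TT_pos hE1
    have hEu : E u = 1 := hE2 u (by simp)
    have hEv : E v = 1 := hE2 v (by simp)
    set e := ∏ u, E u with he
    have hepos : 0 < e := prod_pos fun t _ => hEpos t
    set a : I → ℕ → ℝ := fun t m => if w^12 < (m:ℝ) ∧ Squarefree m ∧ m.Coprime e then
      mulf (ks κ) m * (c4 m ^ lam t * XX φ E t m) else 0 with ha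
    set CE : ℝ := if (∀ t, t ≠ u → t ≠ v → (w^12 < (E t : ℝ) ↔ t ∈ B)) then wt κ E * tj φ lam E else 0 with hCE
    have haabs : ∀ t n, |a t n| ≤ 1 := by
      intro t n
      simp only [ha]
      split_ifs
      · exact abs_mul_le_one (mulf_ks_abs h0 h1 n) (abs_mul_le_one (abs_pow_le_one (c4_abs _) _) (XX_abs _ _ _ _))
      · simp
    have hasup : ∀ t n, a t n ≠ 0 → (n % 2 = 1 ∧ Squarefree n ∧ w^12 < n) ∧ n.Coprime e := by
      intro t n hn
      simp only [ha] at hn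
      split_ifs at hn with hc
      · have := mulf_ks_S0 (left_ne_zero_of_mul hn)
        exact ⟨⟨S0_odd hc.2.1.ne_zero this, hc.2.1, hc.1⟩, hc.2.2⟩
      · exact absurd rfl hn
    have e1 : ∀ D ∈ (TT I (Y / e)).filter (fun D => (∀ t, t ∉ ({u, v} : Finset I) → D t = 1) ∧ (∏ u, D u).Coprime e),
        (if big (w^12) (E * D) = B then wt κ (E * D) * tj φ lam (E * D) else 0)
          = CE * (a u (D u) * a v (D v) * J (D u) (D v)) := by
      intro D hD
      rw [mem_filter] at hD
      obtain ⟨hD1, hD2, hD3⟩ := hD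
      have hDpos := TT_pos hD1
      have hDsq : ∀ t, Squarefree (D t) := fun t =>
        (mem_TT.1 hD1).1.squarefree_of_dvd (dvd_prod_of_mem _ (mem_univ t))
      have hDco : ∀ t, (D t).Coprime e := fun t =>
        Nat.Coprime.coprime_dvd_left (dvd_prod_of_mem _ (mem_univ t)) hD3
      have hbig : big (w^12) (E * D) = B ↔ (∀ t, t ≠ u → t ≠ v → (w^12 < (E t : ℝ) ↔ t ∈ B)) ∧
          w^12 < (D u : ℝ) ∧ w^12 < (D v : ℝ) := by
        have hu' : (E * D) u = D u := by simp [hEu]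
        have hv' : (E * D) v = D v := by simp [hEv]
        have ht' : ∀ t, t ≠ u → t ≠ v → (E * D) t = E t := by
          intro t h1 h2; simp [hD2 t (by simp [h1, h2])]
        unfold big
        rw [Finset.ext_iff]
        simp only [mem_filter, mem_univ, true_and]
        constructor
        · intro h
          refine ⟨fun t h1 h2 => ?_, ?_, ?_⟩
          · rw [← h t, ht' t h1 h2]
          · have := (h u).2 hu; rwa [hu'] at this
          · have := (h v).2 hv; rwa [hv'] at this
        · rintro ⟨h1, h2, h3⟩ t
          by_cases h4 : t = u
          · subst h4; rw [hu']; simp [h2, hu]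
          by_cases h5 : t = v
          · subst h5; rw [hv']; simp [h3, hv]
          rw [ht' t h4 h5]; exact h1 t h4 h5
      by_cases hb : big (w^12) (E * D) = B
      · obtain ⟨hb1, hb2, hb3⟩ := hbig.1 hb
        rw [if_pos hb, hCE, if_pos hb1, wt_mul _ _ _ hD3, tj_mul _ _ _ _ hEpos hDpos, tj_pair lam hφ huv hvu hD2]
        simp only [ha]
        rw [if_pos ⟨hb2, hDsq u, hDco u⟩, if_pos ⟨hb3, hDsq v, hDco v⟩]
        have hX : ∏ t, XX φ E t (D t) = XX φ E u (D u) * XX φ E v (D v) := by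
          rw [Fintype.prod_eq_mul u v hne]
          intro t ht
          rw [hD2 t (by simp [ht.1, ht.2]), XX_one]
        have hW : wt κ D = mulf (ks κ) (D u) * mulf (ks κ) (D v) := by
          unfold wt
          rw [Fintype.prod_eq_mul u v hne]
          intro t ht
          rw [hD2 t (by simp [ht.1, ht.2]), mulf_one]
        rw [hX, hW]; ring
      · rw [if_neg hb, hCE]
        rw [hbig, not_and_or] at hb
        rcases hb with hb | hb
        · rw [if_neg hb]; ring
        · have : a u (D u) * a v (D v) = 0 := by
            rw [not_and_or] at hb
            simp only [ha]
            rcases hb with hb | hb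
            · rw [if_neg (fun h => hb h.1)]; ring
            · simp [hb]
          rw [this]; ring
    rw [sum_congr rfl e1, ← mul_sum, pair_sum hne (Y / e) e (fun m n => a u m * a v n * J m n)]
    · have hhyp := hyperbola (haabs u) (haabs v) hw (fun n hn => (hasup u n hn).1) (fun n hn => (hasup v n hn).1) (Y / e)
      rw [abs_mul]
      have hCEabs : |CE| ≤ 1 := by
        rw [hCE]; split_ifs
        · exact abs_mul_le_one (wt_abs h0 h1 _) (tj_abs _ _ _)
        · simp
      have hYe : ((Y / e : ℕ) : ℝ) ≤ Y / e := Nat.cast_div_le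
      have hlog : 1 + Real.log ((Y / e : ℕ) : ℝ) ≤ H := by
        rw [hH]
        rcases Nat.eq_zero_or_pos (Y / e) with h | h
        · rw [h]; simpa using Real.log_natCast_nonneg Y
        · have : Real.log ((Y / e : ℕ) : ℝ) ≤ Real.log Y :=
            Real.log_le_log (by exact_mod_cast h) (by exact_mod_cast Nat.div_le_self Y e)
          linarith
      have hprod : ∏ t, (1:ℝ) / E t = 1 / e := by
        rw [prod_div_distrib, he]; simp
      rw [hprod]
      have hge := H_ge_one (Y / e)
      calc _ ≤ 1 * (6 * ((Y / e : ℕ) : ℝ) * (1 + Real.log ((Y / e : ℕ) : ℝ))^3 / w) :=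
            mul_le_mul hCEabs hhyp (abs_nonneg _) (by norm_num)
        _ ≤ 1 * (6 * (Y / e) * H^3 / w) := by gcongr
        _ = _ := by ring
    · intro m n hmn
      have h3 := right_ne_zero_of_mul hmn
      have h4 := left_ne_zero_of_mul hmn
      have h5 := hasup u m (left_ne_zero_of_mul h4)
      have h6 := hasup v n (right_ne_zero_of_mul h4)
      refine ⟨h5.1.2.1, h6.1.2.1, ?_, h5.2, h6.2⟩
      by_contra hc
      exact h3 (J_eq_zero h6.1.2.1.ne_zero hc)
  calc _ ≤ ∑ E ∈ (TT I Y).filter (fun E => ∀ t ∈ ({u, v} : Finset I), E t = 1), (6 * Y * H^3 / w) * ∏ t, (1:ℝ) / E t :=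
        (abs_sum_le_sum_abs _ _).trans (sum_le_sum key)
    _ ≤ ∑ E ∈ tup I Y, (6 * Y * H^3 / w) * ∏ t, (1:ℝ) / E t := by
        apply sum_le_sum_of_subset_of_nonneg
        · intro E hE; exact (mem_filter.1 (mem_filter.1 hE).1).1
        · intros; positivity
    _ = (6 * Y * H^3 / w) * ∑ E ∈ tup I Y, ∏ t, (1:ℝ) / E t := by rw [mul_sum]
    _ ≤ (6 * Y * H^3 / w) * H ^ Fintype.card I := by
        gcongr; exact sum_inv_tup Y
    _ = _ := by ring

end tj
end FK

namespace FK
open Finset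

lemma s0_le_c8 (p : ℕ) (hp : p.Prime) : s0 p ≤ (1 + c8 p) / 2 := by
  by_cases h : p = 2
  · subst h
    unfold s0
    rw [c8_vals.2.2.1]; norm_num
  · exact (s0_eq p hp h).le

lemma exp_aux {N : ℕ} (hN : 3 ≤ N) {κ S C lq : ℝ} (hlq : 0 < lq)
    (hS : S ≤ (1 - κ) / 2 * Real.log (Real.log N) + Real.log lq + C) :
    3 * N / Real.log N * Real.exp S ≤ 3 * Real.exp C * N * (Real.log N) ^ ((-1 - κ) / 2) * lq := by
  have hN3 : (3:ℝ) ≤ N := by exact_mod_cast hN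
  have hlog : 0 < Real.log N := Real.log_pos (by linarith)
  have h1 : Real.exp S ≤ Real.log N ^ ((1 - κ) / 2) * lq * Real.exp C := by
    calc Real.exp S ≤ Real.exp ((1 - κ) / 2 * Real.log (Real.log N) + Real.log lq + C) := Real.exp_le_exp.2 hS
      _ = _ := by
        rw [Real.exp_add, Real.exp_add, Real.exp_log hlq, Real.rpow_def_of_pos hlog]
        ring_nf
  have h2 : Real.log N ^ ((-1 - κ) / 2) = Real.log N ^ ((1 - κ) / 2) / Real.log N := by
    rw [← Real.rpow_sub_one hlog.ne']; congr 1; ring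
  rw [h2]
  calc _ ≤ 3 * N / Real.log N * (Real.log N ^ ((1 - κ) / 2) * lq * Real.exp C) := by gcongr
    _ = _ := by ring

lemma abs_mulf (F : ℕ → ℝ) (n : ℕ) : |mulf F n| = mulf (fun p => |F p|) n := by
  unfold mulf; rw [abs_prod]

lemma mul_bound : ∃ C : ℝ, 0 < C ∧ ∀ κ : ℝ, 0 ≤ κ → κ ≤ 1/2 → ∀ ψ : ℕ → ℝ, CM ψ → ∀ q : ℕ, 8 ≤ q →
    (∀ n, |∑ i ∈ Ioc 0 n, ψ i| ≤ q) → (∀ n, |∑ i ∈ Ioc 0 n, ψ i * c8 i| ≤ q) →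
    ∀ F : ℕ → ℝ, (∀ p, |F p| ≤ s0 p * (1 - κ + κ * ψ p)) → ∀ N : ℕ, 3 ≤ N →
    ∑ n ∈ sf N, |mulf F n| ≤ C * N * (Real.log N) ^ ((-1 - κ) / 2) * Real.log q := by
  obtain ⟨C0, hC0⟩ := sum_one_add_psi
  refine ⟨3 * Real.exp (Real.log (Real.log 8) + 2 * |C0| + Real.log 2), by positivity, ?_⟩
  intro κ h0 h12 ψ hψ q hq hs1 hs2 F hF N hN
  have h1 : κ ≤ 1 := by linarith
  have hN3 : (3:ℝ) ≤ N := by exact_mod_cast hN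
  have hq8 : (8:ℝ) ≤ q := by exact_mod_cast hq
  have hl8 : 1 < Real.log 8 := by
    have : Real.log 8 = 3 * Real.log 2 := by
      rw [show (8:ℝ) = 2^3 by norm_num, Real.log_pow]; norm_num
    rw [this]; linarith [Real.log_two_gt_d9]
  have hlq : 1 < Real.log q := hl8.trans_le (Real.log_le_log (by norm_num) hq8)
  have hlN : 0 < Real.log N := Real.log_pos (by linarith)
  have hFn : ∀ p, 0 ≤ |F p| := fun p => abs_nonneg _
  have hψ1 : ∀ p, 0 ≤ 1 - κ + κ * ψ p ∧ 1 - κ + κ * ψ p ≤ 1 := by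
    intro p
    have := abs_le.1 (hψ.le p)
    constructor <;> nlinarith
  have hF1 : ∀ p, |F p| ≤ 1 := fun p =>
    (hF p).trans (mul_le_one₀ (s0_le p) (hψ1 p).1 (hψ1 p).2)
  have hsum := sum_mulf_le hFn hF1 N (by omega)
  simp only [← abs_mulf] at hsum
  refine hsum.trans ?_
  apply exp_aux hN (by linarith)
  have a1 := hC0 c8 8 c8_CM (by norm_num) c8_L.1 N hN
  have a2 := hC0 ψ q hψ (by omega) hs1 N hN
  have a3 := hC0 (fun n => ψ n * c8 n) q (hψ.prod c8_CM) (by omega) hs2 N hN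
  have a4 := loglog_le (N := N) (by omega)
  push_cast at a1
  have b1 : ∑ p ∈ Nat.primesLE N, |F p| / p ≤ ∑ p ∈ Nat.primesLE N, ((1 - κ)/2 * ((1 + c8 p) / p)
      + κ / 2 * ((1 + ψ p) / p) + κ / 2 * ((1 + ψ p * c8 p) / p) - κ * (1 / p)) := by
    apply sum_le_sum
    intro p hp
    have hpp : p.Prime := (Nat.mem_primesLE.1 hp).2
    have hp0 : (0:ℝ) < p := by exact_mod_cast hpp.pos
    have : |F p| ≤ (1 + c8 p) / 2 * (1 - κ + κ * ψ p) :=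
      (hF p).trans (mul_le_mul_of_nonneg_right (s0_le_c8 p hpp) (hψ1 p).1)
    calc |F p| / p ≤ ((1 + c8 p) / 2 * (1 - κ + κ * ψ p)) / p := by gcongr
      _ = _ := by ring
  rw [sum_sub_distrib, sum_add_distrib, sum_add_distrib, ← mul_sum, ← mul_sum, ← mul_sum, ← mul_sum] at b1
  have hC : C0 ≤ |C0| := le_abs_self _
  have hC' := abs_nonneg C0
  have hl8' : 0 ≤ Real.log (Real.log 8) := Real.log_nonneg hl8.le
  have hlq' : 0 ≤ Real.log (Real.log q) := Real.log_nonneg hlq.le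
  have hl2 : 0 ≤ Real.log 2 := Real.log_nonneg (by norm_num)
  have c1 := mul_le_mul_of_nonneg_left a1 (by linarith : 0 ≤ (1 - κ)/2)
  have c2 := mul_le_mul_of_nonneg_left a2 (by linarith : 0 ≤ κ/2)
  have c3 := mul_le_mul_of_nonneg_left a3 (by linarith : 0 ≤ κ/2)
  have c4' := mul_le_mul_of_nonneg_left a4 h0
  nlinarith [mul_nonneg h0 hlq', mul_nonneg (sub_nonneg.2 h1) hlq', mul_nonneg h0 hl8', mul_nonneg h0 hC',
    mul_nonneg (sub_nonneg.2 h1) hC', mul_nonneg (sub_nonneg.2 h1) hl2, mul_nonneg h0 (sub_nonneg.2 hC), mul_nonneg (sub_nonneg.2 h1) (sub_nonneg.2 hC)]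

lemma mul_bound2 : ∃ C : ℝ, 0 < C ∧ ∀ κ : ℝ, 0 ≤ κ → κ ≤ 1 →
    ∀ F : ℕ → ℝ, (∀ p, |F p| ≤ s0 p * (1 - κ)) → ∀ N : ℕ, 3 ≤ N →
    ∑ n ∈ sf N, |mulf F n| ≤ C * N * (Real.log N) ^ ((-1 - κ) / 2) := by
  obtain ⟨C0, hC0⟩ := sum_one_add_psi
  refine ⟨3 * Real.exp (Real.log (Real.log 8) + 2 * |C0|), by positivity, ?_⟩
  intro κ h0 h1 F hF N hN
  have hl8 : 1 < Real.log 8 := by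
    have : Real.log 8 = 3 * Real.log 2 := by
      rw [show (8:ℝ) = 2^3 by norm_num, Real.log_pow]; norm_num
    rw [this]; linarith [Real.log_two_gt_d9]
  have hF1 : ∀ p, |F p| ≤ 1 := fun p =>
    (hF p).trans (mul_le_one₀ (s0_le p) (by linarith) (by linarith))
  have hsum := sum_mulf_le (fun p => abs_nonneg (F p)) hF1 N (by omega)
  simp only [← abs_mulf] at hsum
  refine hsum.trans ?_
  have := exp_aux (S := ∑ p ∈ Nat.primesLE N, |F p| / p) (κ := κ) (C := Real.log (Real.log 8) + 2 * |C0|) hN one_pos ?_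
  · simpa using this
  have a1 := hC0 c8 8 c8_CM (by norm_num) c8_L.1 N hN
  push_cast at a1
  have b1 : ∑ p ∈ Nat.primesLE N, |F p| / p ≤ ∑ p ∈ Nat.primesLE N, ((1 - κ)/2 * ((1 + c8 p) / p)) := by
    apply sum_le_sum
    intro p hp
    have hpp : p.Prime := (Nat.mem_primesLE.1 hp).2
    have hp0 : (0:ℝ) < p := by exact_mod_cast hpp.pos
    have : |F p| ≤ (1 + c8 p) / 2 * (1 - κ) :=
      (hF p).trans (mul_le_mul_of_nonneg_right (s0_le_c8 p hpp) (by linarith))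
    calc |F p| / p ≤ ((1 + c8 p) / 2 * (1 - κ)) / p := by gcongr
      _ = _ := by ring
  rw [← mul_sum] at b1
  have hC : C0 ≤ |C0| := le_abs_self _
  have hC' := abs_nonneg C0
  have hl8' : 0 ≤ Real.log (Real.log 8) := Real.log_nonneg hl8.le
  have c1 := mul_le_mul_of_nonneg_left a1 (by linarith : 0 ≤ (1 - κ)/2)
  rw [Real.log_one]
  nlinarith [mul_nonneg h0 hl8', mul_nonneg h0 hC',
    mul_nonneg (sub_nonneg.2 h1) hC', mul_nonneg (sub_nonneg.2 h1) (sub_nonneg.2 hC)]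

end FK

namespace FK
open Finset

section
variable {I : Type*} [Fintype I]

lemma prod_le_z {z : ℝ} {E : I → ℕ} (hE : ∀ u, (E u : ℝ) ≤ z) : ((∏ u, E u : ℕ) : ℝ) ≤ z ^ Fintype.card I := by
  push_cast
  calc ∏ u, (E u : ℝ) ≤ ∏ _u : I, z := prod_le_prod (fun _ _ => by positivity) (fun u _ => hE u)
    _ = _ := by simp

lemma divN {Y e : ℕ} {κ : ℝ} (h0 : 0 ≤ κ) (h1 : κ ≤ 1) (hY : 9 ≤ Y) (he : 0 < e) (hz : 2 * (e:ℝ) ≤ Real.sqrt Y) :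
    3 ≤ Y / e ∧ (((Y / e : ℕ) : ℝ) * Real.log ((Y / e : ℕ) : ℝ) ^ ((-1 - κ) / 2)
      ≤ 2 * (Y * Real.log Y ^ ((-1 - κ) / 2)) * (1 / e)) := by
  have hY9 : (9:ℝ) ≤ Y := by exact_mod_cast hY
  have he0 : (0:ℝ) < e := by exact_mod_cast he
  have hs3 : (3:ℝ) ≤ Real.sqrt Y := Real.le_sqrt_of_sq_le (by linarith)
  have hss : Real.sqrt Y * Real.sqrt Y = Y := Real.mul_self_sqrt (by linarith)
  have hge : Real.sqrt Y ≤ ((Y / e : ℕ) : ℝ) := by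
    have h2 : (Y:ℝ) / e - 1 ≤ ((Y / e : ℕ) : ℝ) := by
      have := Nat.lt_floor_add_one ((Y:ℝ)/e)
      rw [Nat.floor_div_natCast, Nat.floor_natCast] at this
      linarith
    have h3 : 2 * Real.sqrt Y ≤ (Y:ℝ) / e := by
      rw [le_div_iff₀ he0]; nlinarith
    linarith
  have h3 : (3:ℝ) ≤ ((Y / e : ℕ) : ℝ) := hs3.trans hge
  refine ⟨by exact_mod_cast h3, ?_⟩
  have hYe : ((Y / e : ℕ) : ℝ) ≤ Y / e := Nat.cast_div_le
  have hlogY : 0 < Real.log Y := Real.log_pos (by linarith)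
  have hlog : Real.log Y / 2 ≤ Real.log ((Y / e : ℕ) : ℝ) := by
    rw [← Real.log_sqrt (by linarith)]
    exact Real.log_le_log (by linarith) hge
  have hp : Real.log ((Y / e : ℕ) : ℝ) ^ ((-1 - κ) / 2) ≤ 2 * Real.log Y ^ ((-1 - κ) / 2) := by
    calc _ ≤ (Real.log Y / 2) ^ ((-1 - κ) / 2) :=
          Real.rpow_le_rpow_of_nonpos (by linarith) hlog (by linarith)
      _ = Real.log Y ^ ((-1 - κ) / 2) * (1/2 : ℝ) ^ ((-1 - κ) / 2) := by
          rw [← Real.mul_rpow hlogY.le (by norm_num)]; congr 1; ring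
      _ ≤ Real.log Y ^ ((-1 - κ) / 2) * 2 := by
          gcongr
          rw [show (1/2:ℝ) = 2⁻¹ by norm_num, Real.inv_rpow (by norm_num), ← Real.rpow_neg (by norm_num)]
          calc (2:ℝ) ^ (-((-1 - κ) / 2)) ≤ 2 ^ (1:ℝ) := Real.rpow_le_rpow_of_exponent_le (by norm_num) (by linarith)
            _ = 2 := Real.rpow_one 2
      _ = _ := by ring
  calc _ ≤ (Y / e : ℝ) * (2 * Real.log Y ^ ((-1 - κ) / 2)) := by
        gcongr
    _ = _ := by ring

lemma Esum {z : ℝ} (hz : 1 ≤ z) (s : Finset (I → ℕ)) (hs : ∀ E ∈ s, ∀ u, 0 < E u ∧ (E u : ℝ) ≤ z) :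
    ∑ E ∈ s, (1:ℝ) / ((∏ u, E u : ℕ) : ℝ) ≤ (1 + Real.log z) ^ Fintype.card I := by
  have hsub : s ⊆ tup I ⌊z⌋₊ := by
    intro E hE
    rw [mem_tup]
    exact fun u => ⟨(hs E hE u).1, Nat.le_floor (hs E hE u).2⟩
  have hz1 : 1 ≤ ⌊z⌋₊ := Nat.le_floor (by simpa using hz)
  calc _ ≤ ∑ E ∈ tup I ⌊z⌋₊, (1:ℝ) / ((∏ u, E u : ℕ) : ℝ) :=
        sum_le_sum_of_subset_of_nonneg hsub (by intros; positivity)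
    _ = ∑ E ∈ tup I ⌊z⌋₊, ∏ u, (1:ℝ) / E u := by
        apply sum_congr rfl; intro E _; rw [prod_div_distrib]; simp
    _ ≤ (1 + Real.log ⌊z⌋₊) ^ Fintype.card I := sum_inv_tup _
    _ ≤ _ := by
        have := H_ge_one ⌊z⌋₊
        have h2 : Real.log ⌊z⌋₊ ≤ Real.log z :=
          Real.log_le_log (by exact_mod_cast hz1) (Nat.floor_le (by linarith))
        gcongr

lemma mulf_zero_of {g : ℕ → ℝ} {n p : ℕ} (hp : p ∈ n.primeFactors) (h : g p = 0) : mulf g n = 0 :=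
  prod_eq_zero hp h

lemma caseII : ∃ C : ℝ, 0 < C ∧ ∀ (κ : ℝ), 0 ≤ κ → κ ≤ 1 → ∀ B : Finset I, (B.card : ℝ) * κ ≤ 1 - κ →
    ∀ (Y : ℕ) (z : ℝ), 9 ≤ Y → 1 ≤ z → 2 * z ^ Fintype.card I ≤ Real.sqrt Y →
    ∑ D ∈ TT I Y, (if ∀ w, w ∉ B → (D w : ℝ) ≤ z then wt κ D else 0) ≤
      C * (Y * Real.log Y ^ ((-1 - κ) / 2)) * (1 + Real.log z) ^ Fintype.card I := by
  obtain ⟨C, hC0, hC⟩ := mul_bound2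
  refine ⟨2 * C, by positivity, ?_⟩
  intro κ h0 h1 B hB Y z hY hz hzY
  rw [split B]
  have hlogY : 0 ≤ Real.log Y := Real.log_natCast_nonneg Y
  have key : ∀ E ∈ (TT I Y).filter (fun E => ∀ u ∈ B, E u = 1),
      ∑ D ∈ (TT I (Y / ∏ u, E u)).filter (fun D => (∀ u, u ∉ B → D u = 1) ∧ (∏ u, D u).Coprime (∏ u, E u)),
        (if ∀ w, w ∉ B → ((E * D) w : ℝ) ≤ z then wt κ (E * D) else 0) ≤
      if ∀ w, (E w : ℝ) ≤ z then (2 * C) * (Y * Real.log Y ^ ((-1 - κ) / 2)) * (1 / ((∏ u, E u : ℕ) : ℝ)) else 0 := by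
    intro E hE
    rw [mem_filter] at hE
    have hEpos := TT_pos hE.1
    have hepos : 0 < ∏ u, E u := prod_pos fun t _ => hEpos t
    split_ifs with hEz
    · obtain ⟨hN3, hN⟩ := divN h0 h1 hY hepos (le_trans (by linarith [prod_le_z hEz]) hzY)
      set N := Y / ∏ u, E u with hNdef
      have hbd := hC κ h0 h1 (fun p => ∑ u, if u ∈ B then ks κ p else 0) (by
        intro p
        rw [← sum_filter, sum_const, nsmul_eq_mul, filter_mem_eq_inter, univ_inter]
        unfold ks
        rw [abs_of_nonneg (mul_nonneg (by positivity) (mul_nonneg h0 (s0_nonneg p)))]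
        nlinarith [s0_nonneg p]) N hN3
      calc _ ≤ ∑ D ∈ (TT I N).filter (fun D => (∀ u, u ∉ B → D u = 1) ∧ (∏ u, D u).Coprime (∏ u, E u)),
              ∏ u, mulf (fun p => if u ∈ B then ks κ p else 0) (D u) := by
            apply sum_le_sum
            intro D hD
            rw [mem_filter] at hD
            have hw : wt κ D = ∏ u, mulf (fun p => if u ∈ B then ks κ p else 0) (D u) := by
              unfold wt
              apply prod_congr rfl
              intro u _
              by_cases hu : u ∈ B
              · simp only [hu, if_true]
              · rw [hD.2.1 u hu, mulf_one, mulf_one]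
            rw [← hw]
            split_ifs
            · rw [wt_mul _ _ _ hD.2.2]
              have := wt_abs h0 h1 E
              rw [abs_of_nonneg (wt_nonneg h0 E)] at this
              exact mul_le_of_le_one_left (wt_nonneg h0 D) this
            · exact wt_nonneg h0 D
        _ ≤ ∑ D ∈ TT I N, ∏ u, mulf (fun p => if u ∈ B then ks κ p else 0) (D u) := by
            apply sum_le_sum_of_subset_of_nonneg (filter_subset _ _)
            intro D _ _
            apply prod_nonneg
            intro u _
            apply mulf_nonneg
            intro p; split_ifs
            · exact ks_nonneg h0 p
            · exact le_rfl
        _ = ∑ n ∈ sf N, mulf (fun p => ∑ u, if u ∈ B then ks κ p else 0) n := collapse N _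
        _ ≤ _ := (sum_le_sum fun n _ => le_abs_self _).trans hbd
        _ = C * (N * Real.log N ^ ((-1 - κ) / 2)) := by ring
        _ ≤ C * (2 * (Y * Real.log Y ^ ((-1 - κ) / 2)) * (1 / ((∏ u, E u : ℕ) : ℝ))) := by gcongr
        _ = _ := by ring
    · apply le_of_eq
      apply sum_eq_zero
      intro D hD
      rw [mem_filter] at hD
      rw [if_neg]
      intro hall
      apply hEz
      intro w
      by_cases hw : w ∈ B
      · rw [hE.2 w hw]; simpa using hz
      · have := hall w hw
        rw [Pi.mul_apply, hD.2.1 w hw, mul_one] at this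
        exact this
  refine (sum_le_sum key).trans ?_
  rw [← sum_filter, ← mul_sum]
  gcongr
  apply Esum hz
  intro E hE u
  rw [mem_filter, mem_filter] at hE
  exact ⟨TT_pos hE.1.1 u, hE.2 u⟩

end
end FK

namespace FK
open Finset

section
variable {I : Type*} [Fintype I]

noncomputable def sgn (φ : I → I → ℕ) (lam : I → ℕ) (r : I → ℕ) (N : Finset I) : ℝ :=
  (∏ u ∈ N, ∏ v ∈ N, if r u < r v then (-1:ℝ) ^ φ u v else 1) * ∏ u ∈ N, (-1:ℝ) ^ lam u

lemma c4_odd {n : ℕ} (h : n % 2 = 1) : c4 n = if n % 4 = 3 then -1 else 1 := by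
  obtain ⟨h0, h1, h2, h3, h4, h5, h6, h7⟩ := c4_vals
  have : n % 8 = 1 ∨ n % 8 = 3 ∨ n % 8 = 5 ∨ n % 8 = 7 := by omega
  rcases this with h' | h' | h' | h' <;> rw [c4_of_mod n _ h'] <;>
  [rw [if_neg (by omega), h1]; rw [if_pos (by omega), h3]; rw [if_neg (by omega), h5]; rw [if_pos (by omega), h7]]

lemma J_JJ {m n : ℕ} (hm : m % 2 = 1) (hn : n % 2 = 1) (h : m.Coprime n) :
    J m n * J n m = if m % 4 = 3 ∧ n % 4 = 3 then -1 else 1 := by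
  rw [J_recip hm hn, c4_odd hm, c4_odd hn]
  have := J_sq h.symm
  rw [mul_right_comm, this]
  by_cases h1 : m % 4 = 3 <;> by_cases h2 : n % 4 = 3 <;> simp [h1, h2] <;> norm_num

lemma tj_eq_sgn {φ : I → I → ℕ} (lam : I → ℕ) (hφ : ∀ u, φ u u = 0) {r : I → ℕ} (hr : Function.Injective r)
    (B : Finset I) (hB : ∀ u ∈ B, ∀ v ∈ B, φ u v = φ v u) {D : I → ℕ} (hD : ∀ t, t ∉ B → D t = 1)
    (hodd : ∀ t, D t % 2 = 1) (hco : ∀ u v, u ≠ v → (D u).Coprime (D v)) :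
    tj φ lam D = sgn φ lam r (univ.filter fun u => D u % 4 = 3) := by
  unfold tj sgn
  congr 1
  · set f : I → I → ℝ := fun u v => J (D u) (D v) ^ φ u v with hf
    have h1 : ∀ u v, f u v = (if r u < r v then f u v else 1) * (if r v < r u then f u v else 1) := by
      intro u v
      rcases lt_trichotomy (r u) (r v) with h | h | h
      · simp [h, h.not_gt]
      · have := hr h; subst this
        simp [hf, hφ]
      · simp [h, h.not_gt]
    have h2 : ∏ u, ∏ v, f u v = ∏ u, ∏ v, if r u < r v then f u v * f v u else 1 := by
      calc ∏ u, ∏ v, f u v = (∏ u, ∏ v, if r u < r v then f u v else 1) * ∏ u, ∏ v, if r v < r u then f u v else 1 := by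
            simp only [← prod_mul_distrib, ← h1]
        _ = (∏ u, ∏ v, if r u < r v then f u v else 1) * ∏ u, ∏ v, if r u < r v then f v u else 1 := by
            congr 1; rw [prod_comm]
        _ = _ := by
            simp only [← prod_mul_distrib]
            refine prod_congr rfl fun u _ => prod_congr rfl fun v _ => ?_
            split_ifs <;> simp
    rw [h2, prod_filter]
    apply prod_congr rfl; intro u _
    rw [prod_filter]
    by_cases h3 : D u % 4 = 3
    · rw [if_pos h3]
      apply prod_congr rfl; intro v _
      by_cases h4 : r u < r v
      · have hne : u ≠ v := by rintro rfl; exact lt_irrefl _ h4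
        simp only [h4, if_true]
        by_cases h5 : D v % 4 = 3
        · rw [if_pos h5]
          have hu : u ∈ B := by by_contra hc; rw [hD u hc] at h3; omega
          have hv : v ∈ B := by by_contra hc; rw [hD v hc] at h5; omega
          simp only [hf]
          rw [hB v hv u hu, ← mul_pow, J_JJ (hodd u) (hodd v) (hco u v hne), if_pos ⟨h3, h5⟩]
        · rw [if_neg h5]
          by_cases hv : v ∈ B
          · have hu : u ∈ B := by by_contra hc; rw [hD u hc] at h3; omega
            simp only [hf]
            rw [hB v hv u hu, ← mul_pow, J_JJ (hodd u) (hodd v) (hco u v hne), if_neg (fun h => h5 h.2), one_pow]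
          · simp only [hf, hD v hv, J_one_left, J_one_right, one_pow, mul_one]
      · simp [h4]
    · rw [if_neg h3]
      apply prod_eq_one; intro v _
      by_cases h4 : r u < r v
      · have hne : u ≠ v := by rintro rfl; exact lt_irrefl _ h4
        simp only [h4, if_true]
        by_cases hv : v ∈ B
        · by_cases hu : u ∈ B
          · simp only [hf]
            rw [hB v hv u hu, ← mul_pow, J_JJ (hodd u) (hodd v) (hco u v hne), if_neg (fun h => h3 h.1), one_pow]
          · simp only [hf, hD u hu, J_one_left, J_one_right, one_pow, mul_one]
        · simp only [hf, hD v hv, J_one_left, J_one_right, one_pow, mul_one]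
      · simp [h4]
  · rw [prod_filter]
    apply prod_congr rfl; intro u _
    rw [c4_odd (hodd u)]
    split_ifs <;> simp

noncomputable def pm (N : Finset I) (u : I) : ℝ := if u ∈ N then -1 else 1

noncomputable def fh (B : Finset I) (g : Finset I → ℝ) (T : Finset I) : ℝ :=
  (1/2) ^ B.card * ∑ N ∈ B.powerset, g N * ∏ u ∈ T, pm N u

lemma fourier (B : Finset I) (g : Finset I → ℝ) {N0 : Finset I} (h : N0 ⊆ B) :
    ∑ T ∈ B.powerset, fh B g T * ∏ u ∈ T, pm N0 u = g N0 := by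
  unfold fh
  simp only [mul_assoc, sum_mul]
  rw [← mul_sum, sum_comm]
  have : ∀ N ∈ B.powerset, ∑ T ∈ B.powerset, g N * ((∏ u ∈ T, pm N u) * ∏ u ∈ T, pm N0 u) =
      if N = N0 then g N0 * 2 ^ B.card else 0 := by
    intro N hN
    rw [← mul_sum]
    simp only [← prod_mul_distrib]
    rw [← prod_one_add]
    split_ifs with hNN
    · subst hNN
      congr 1
      rw [← prod_const]
      apply prod_congr rfl
      intro u _
      unfold pm; split_ifs <;> norm_num
    · apply mul_eq_zero_of_right
      have : ∃ u ∈ B, ¬ (u ∈ N ↔ u ∈ N0) := by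
        by_contra hc
        push Not at hc
        apply hNN
        ext u
        by_cases hu : u ∈ B
        · exact hc u hu
        · exact ⟨fun h' => absurd (mem_powerset.1 hN h') hu, fun h' => absurd (h h') hu⟩
      obtain ⟨u, hu, hne⟩ := this
      apply prod_eq_zero hu
      unfold pm
      by_cases h1 : u ∈ N <;> by_cases h2 : u ∈ N0 <;> simp_all
  rw [sum_congr rfl this, sum_ite_eq', if_pos (mem_powerset.2 h)]
  rw [mul_comm (g N0), ← mul_assoc, ← mul_pow]; norm_num

lemma fh_abs (B : Finset I) {g : Finset I → ℝ} (hg : ∀ N, |g N| ≤ 1) (T : Finset I) : |fh B g T| ≤ 1 := by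
  unfold fh
  rw [abs_mul, abs_of_pos (by positivity : (0:ℝ) < (1/2)^B.card)]
  have : |∑ N ∈ B.powerset, g N * ∏ u ∈ T, pm N u| ≤ 2 ^ B.card := by
    calc _ ≤ ∑ N ∈ B.powerset, (1:ℝ) := by
          refine (abs_sum_le_sum_abs _ _).trans (sum_le_sum fun N _ => ?_)
          apply abs_mul_le_one (hg N)
          apply abs_prod_le_one
          intro u _
          unfold pm; split_ifs <;> simp
      _ = _ := by simp
  calc _ ≤ (1/2:ℝ)^B.card * 2 ^ B.card := by gcongr
    _ = 1 := by rw [← mul_pow]; norm_num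

lemma sgn_abs (φ : I → I → ℕ) (lam : I → ℕ) (r : I → ℕ) (N : Finset I) : |sgn φ lam r N| ≤ 1 := by
  have h : |(-1:ℝ)| ≤ 1 := by simp
  apply abs_mul_le_one
  · refine abs_prod_le_one _ _ fun u _ => abs_prod_le_one _ _ fun v _ => ?_
    split_ifs
    · exact abs_pow_le_one h _
    · simp
  · exact abs_prod_le_one _ _ fun u _ => abs_pow_le_one h _

lemma CM_pow {f : ℕ → ℝ} (hf : CM f) (k : ℕ) : CM (fun n => f n ^ k) :=
  ⟨by simp only [hf.one, one_pow], fun m n => by simp only [hf.mul, mul_pow], fun n => abs_pow_le_one (hf.le n) k⟩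

lemma CM_fprod (f : I → ℕ → ℝ) (hf : ∀ u, CM (f u)) : CM (fun n => ∏ u, f u n) :=
  ⟨prod_eq_one fun u _ => (hf u).one, fun m n => by simp only [(hf _).mul, prod_mul_distrib],
    fun n => abs_prod_le_one _ _ fun u _ => (hf u).le n⟩

noncomputable def aa (φ : I → I → ℕ) (E : I → ℕ) (v : I) : ℕ := ∑ u, φ u v * (if E u % 4 = 3 then 1 else 0)

noncomputable def YY (φ : I → I → ℕ) (E : I → ℕ) (v : I) (n : ℕ) : ℝ :=
  (∏ u, J n (E u) ^ (φ u v + φ v u)) * c4 n ^ aa φ E v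

lemma YY_CM (φ : I → I → ℕ) (E : I → ℕ) (v : I) : CM (YY φ E v) :=
  (CM_fprod _ fun u => CM_pow (J_CM (E u)) _).prod (CM_pow c4_CM _)

lemma XX_eq (φ : I → I → ℕ) {E : I → ℕ} (hE : ∀ u, E u % 2 = 1) (v : I) {n : ℕ} (hn : n % 2 = 1) :
    XX φ E v n = YY φ E v n := by
  unfold XX YY aa
  rw [← prod_pow_eq_pow_sum, ← prod_mul_distrib]
  apply prod_congr rfl; intro u _
  rw [J_recip (hE u) hn, c4_odd (hE u)]
  split_ifs with h
  · rw [show (1 + -1 + c4 n - -1 * c4 n) / 2 = c4 n by ring]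
    rw [mul_pow, pow_add]; ring
  · rw [show (1 + 1 + c4 n - 1 * c4 n) / 2 = 1 by ring]
    rw [mul_pow, pow_add]; simp

/-- the local factors -/
noncomputable def ZZ (φ : I → I → ℕ) (E : I → ℕ) (T : Finset I) (v : I) (n : ℕ) : ℝ :=
  YY φ E v n * c4 n ^ (if v ∈ T then 1 else 0)

lemma ZZ_CM (φ : I → I → ℕ) (E : I → ℕ) (T : Finset I) (v : I) : CM (ZZ φ E T v) :=
  (YY_CM φ E v).prod (CM_pow c4_CM _)

noncomputable def th (φ : I → I → ℕ) (κ : ℝ) (B : Finset I) (E : I → ℕ) (T : Finset I) (v : I) (p : ℕ) : ℝ :=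
  if v ∈ B ∧ p.Coprime (∏ u, E u) then ks κ p * ZZ φ E T v p else 0

lemma th_prod (φ : I → I → ℕ) (κ : ℝ) (B : Finset I) (E : I → ℕ) {T : Finset I} (hT : T ⊆ B) {N : ℕ}
    {D : I → ℕ} (hD : D ∈ TT I N) :
    ∏ v, mulf (th φ κ B E T v) (D v) = if (∀ u, u ∉ B → D u = 1) ∧ (∏ u, D u).Coprime (∏ u, E u) then
      wt κ D * ((∏ v, YY φ E v (D v)) * ∏ v ∈ T, c4 (D v)) else 0 := by
  have hsq : ∀ t, Squarefree (D t) := fun t => (mem_TT.1 hD).1.squarefree_of_dvd (dvd_prod_of_mem _ (mem_univ t))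
  split_ifs with h
  · have h1 : ∀ v, mulf (th φ κ B E T v) (D v) = mulf (ks κ) (D v) * (YY φ E v (D v) * (if v ∈ T then c4 (D v) else 1)) := by
      intro v
      by_cases hv : v ∈ B
      · have hco : (D v).Coprime (∏ u, E u) := Nat.Coprime.coprime_dvd_left (dvd_prod_of_mem _ (mem_univ v)) h.2
        have : mulf (th φ κ B E T v) (D v) = mulf (ks κ) (D v) * mulf (ZZ φ E T v) (D v) := by
          unfold mulf
          rw [← prod_mul_distrib]
          apply prod_congr rfl; intro p hp
          unfold th
          rw [if_pos ⟨hv, Nat.Coprime.coprime_dvd_left (Nat.dvd_of_mem_primeFactors hp) hco⟩]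
        rw [this, (ZZ_CM φ E T v).mulf_eq (hsq v)]
        unfold ZZ
        split_ifs <;> simp
      · rw [h.1 v hv, mulf_one, mulf_one, (YY_CM φ E v).one, if_neg (fun h' => hv (hT h'))]; norm_num
    simp only [h1, prod_mul_distrib]
    unfold wt
    congr 2
    rw [prod_ite_mem, univ_inter]
  · rw [not_and_or] at h
    rcases h with h | h
    · push Not at h
      obtain ⟨v, hv, hv1⟩ := h
      apply prod_eq_zero (mem_univ v)
      obtain ⟨p, hp⟩ := Nat.nonempty_primeFactors.2 (show 1 < D v by have := TT_pos hD v; omega)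
      apply mulf_zero_of hp
      unfold th
      rw [if_neg (fun h' => hv h'.1)]
    · obtain ⟨p, hp, hp1, hp2⟩ := Nat.Prime.not_coprime_iff_dvd.1 h
      obtain ⟨v, _, hv⟩ := (hp.prime.dvd_finsetProd_iff _).1 hp1
      apply prod_eq_zero (mem_univ v)
      apply mulf_zero_of (p := p) (Nat.mem_primeFactors.2 ⟨hp, hv, (TT_pos hD v).ne'⟩)
      unfold th
      rw [if_neg]
      rintro ⟨_, h'⟩
      have := (Nat.Prime.coprime_iff_not_dvd hp).1 h'
      exact this hp2

lemma th_sum (φ : I → I → ℕ) (κ : ℝ) (B : Finset I) (E : I → ℕ) {T : Finset I} (hT : T ⊆ B) (N : ℕ) :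
    ∑ D ∈ (TT I N).filter (fun D => (∀ u, u ∉ B → D u = 1) ∧ (∏ u, D u).Coprime (∏ u, E u)),
      wt κ D * ((∏ v, YY φ E v (D v)) * ∏ v ∈ T, c4 (D v))
      = ∑ n ∈ sf N, mulf (fun p => ∑ v, th φ κ B E T v p) n := by
  rw [← collapse, sum_filter]
  apply sum_congr rfl
  intro D hD
  rw [th_prod φ κ B E hT hD]

lemma S0_all {κ : ℝ} {D : I → ℕ} (hD : ∀ u, 0 < D u) (h : wt κ D ≠ 0) (u : I) : D u % 2 = 1 :=
  S0_odd (hD u).ne' (mulf_ks_S0 (prod_ne_zero_iff.1 h u (mem_univ u)))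

lemma caseIII_exact {φ : I → I → ℕ} (lam : I → ℕ) (hφ : ∀ u, φ u u = 0) {r : I → ℕ} (hr : Function.Injective r)
    (κ : ℝ) (B : Finset I) (hB : ∀ u ∈ B, ∀ v ∈ B, φ u v = φ v u) {z : ℝ} (hz : 1 ≤ z) (Y : ℕ) :
    ∑ D ∈ TT I Y, (if ∀ w, w ∉ B → (D w : ℝ) ≤ z then wt κ D * tj φ lam D else 0)
      = ∑ E ∈ (TT I Y).filter (fun E => (∀ u ∈ B, E u = 1) ∧ ∀ u, (E u : ℝ) ≤ z), ∑ T ∈ B.powerset,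
        wt κ E * tj φ lam E * (fh B (sgn φ lam r) T * ∑ n ∈ sf (Y / ∏ u, E u), mulf (fun p => ∑ v, th φ κ B E T v p) n) := by
  rw [split B, ← filter_filter, sum_filter (fun E : I → ℕ => ∀ u, (E u : ℝ) ≤ z)]
  apply sum_congr rfl
  intro E hE
  rw [mem_filter] at hE
  have hEpos := TT_pos hE.1
  set e := ∏ u, E u with he
  split_ifs with hEz
  · by_cases hwE : wt κ E = 0
    · rw [hwE]
      simp only [zero_mul, sum_const_zero]
      apply sum_eq_zero
      intro D hD
      rw [mem_filter] at hD
      rw [wt_mul _ _ _ hD.2.2, hwE]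
      simp
    have hEodd := S0_all hEpos hwE
    rw [← mul_sum]
    have hth : ∀ T ∈ B.powerset, fh B (sgn φ lam r) T * ∑ n ∈ sf (Y / e), mulf (fun p => ∑ v, th φ κ B E T v p) n
        = ∑ D ∈ (TT I (Y / e)).filter (fun D => (∀ u, u ∉ B → D u = 1) ∧ (∏ u, D u).Coprime e),
          fh B (sgn φ lam r) T * (wt κ D * ((∏ v, YY φ E v (D v)) * ∏ v ∈ T, c4 (D v))) := by
      intro T hT
      rw [← th_sum φ κ B E (mem_powerset.1 hT), mul_sum]
    rw [sum_congr rfl hth, sum_comm, mul_sum]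
    apply sum_congr rfl
    intro D hD
    rw [mem_filter] at hD
    obtain ⟨hD1, hD2, hD3⟩ := hD
    have hDpos := TT_pos hD1
    rw [if_pos]
    · rw [wt_mul _ _ _ hD3, tj_mul _ _ _ _ hEpos hDpos]
      by_cases hwD : wt κ D = 0
      · rw [hwD]; simp
      have hDodd := S0_all hDpos hwD
      rw [tj_eq_sgn lam hφ hr B hB hD2 hDodd (fun u v h => TT_coprime hD1 h)]
      have hX : ∏ v, XX φ E v (D v) = ∏ v, YY φ E v (D v) :=
        prod_congr rfl fun v _ => XX_eq φ hEodd v (hDodd v)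
      rw [hX]
      have hN : (univ.filter fun u => D u % 4 = 3) ⊆ B := by
        intro u hu
        by_contra hc
        have := (mem_filter.1 hu).2
        rw [hD2 u hc] at this; omega
      have hpm : ∀ u, c4 (D u) = pm (univ.filter fun u => D u % 4 = 3) u := by
        intro u
        rw [c4_odd (hDodd u)]
        unfold pm
        simp
      rw [← fourier B (sgn φ lam r) hN]
      simp only [← hpm]
      simp only [mul_sum, sum_mul]
      apply sum_congr rfl
      intro T _
      ring
    · intro w hw
      rw [Pi.mul_apply, hD2 w hw, mul_one]; exact hEz w
  · apply sum_eq_zero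
    intro D hD
    rw [mem_filter] at hD
    rw [if_neg]
    intro hall
    apply hEz
    intro w
    by_cases hw : w ∈ B
    · rw [hE.2 w hw]; simpa using hz
    · have := hall w hw
      rw [Pi.mul_apply, hD.2.1 w hw, mul_one] at this
      exact this

end
end FK

namespace FK
open Finset

section
variable {I : Type*} [Fintype I]

lemma ZZ_per (φ : I → I → ℕ) (E : I → ℕ) (T : Finset I) (v : I) (n : ℕ) :
    ZZ φ E T v (n + 8 * ∏ u, E u) = ZZ φ E T v n := by
  have h1 : c4 (n + 8 * ∏ u, E u) = c4 n := by
    rw [c4_of_mod (n + 8 * ∏ u, E u) (n % 8) (by omega), ← c4_of_mod n _ rfl]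
  unfold ZZ YY
  rw [h1]
  congr 2
  apply prod_congr rfl; intro u _
  rw [J_per_dvd _ _ _ (Dvd.dvd.mul_left (dvd_prod_of_mem _ (mem_univ u)) 8)]

lemma F_abs (φ : I → I → ℕ) {κ : ℝ} (h0 : 0 ≤ κ) (B : Finset I) (hκ : (B.card : ℝ) * κ = 1) (E : I → ℕ) (T : Finset I)
    {u v : I} (hu : u ∈ B) (hv : v ∈ B) (huv : u ≠ v) (p : ℕ) :
    |∑ t, th φ κ B E T t p| ≤ s0 p * (1 - κ + κ * (ZZ φ E T u p * ZZ φ E T v p)) := by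
  have hc : 2 ≤ B.card := by
    rw [← card_pair huv]; apply card_le_card; intro x hx; simp at hx; rcases hx with rfl | rfl <;> assumption
  have hc' : (2:ℝ) ≤ B.card := by exact_mod_cast hc
  have hu1 := abs_le.1 ((ZZ_CM φ E T u).le p)
  have hv1 := abs_le.1 ((ZZ_CM φ E T v).le p)
  set a := ZZ φ E T u p
  set b := ZZ φ E T v p
  have hpos : 0 ≤ 1 - κ + κ * (a * b) := by
    have : -1 ≤ a * b := by nlinarith
    have : 2 * κ ≤ 1 := by nlinarith
    nlinarith
  by_cases hco : p.Coprime (∏ u, E u)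
  · have h1 : ∑ t, th φ κ B E T t p = ks κ p * ∑ t ∈ B, ZZ φ E T t p := by
      have h0 : ∀ t, th φ κ B E T t p = if t ∈ B then ks κ p * ZZ φ E T t p else 0 := by
        intro t; unfold th; by_cases ht : t ∈ B
        · rw [if_pos ⟨ht, hco⟩, if_pos ht]
        · rw [if_neg (fun h => ht h.1), if_neg ht]
      simp only [h0]
      rw [← sum_filter, filter_mem_eq_inter, univ_inter, mul_sum]
    have h2 : |∑ t ∈ B, ZZ φ E T t p| ≤ 1 + a * b + (B.card - 2) := by
      have hsub : ({u, v} : Finset I) ⊆ B := by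
        intro x hx; simp at hx; rcases hx with rfl | rfl <;> assumption
      rw [← sum_sdiff hsub, sum_pair huv]
      have h3 : |∑ t ∈ B \ {u, v}, ZZ φ E T t p| ≤ (B.card - 2 : ℝ) := by
        calc _ ≤ ∑ t ∈ B \ {u, v}, (1:ℝ) :=
              (abs_sum_le_sum_abs _ _).trans (sum_le_sum fun t _ => (ZZ_CM φ E T t).le p)
          _ = (B.card - 2 : ℝ) := by
              rw [sum_const, nsmul_eq_mul, mul_one, card_sdiff_of_subset hsub, card_pair huv, Nat.cast_sub hc]
              norm_num
      have h4 : |a + b| ≤ 1 + a * b := by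
        rw [abs_le]; constructor <;> nlinarith
      refine (abs_add_le _ _).trans ?_
      linarith
    rw [h1, abs_mul, abs_of_nonneg (ks_nonneg h0 p)]
    calc ks κ p * _ ≤ ks κ p * (1 + a * b + (B.card - 2)) := by
          gcongr; exact ks_nonneg h0 p
      _ = s0 p * (κ * (a*b) - κ + B.card * κ) := by unfold ks; ring
      _ = _ := by rw [hκ]; ring
  · have h1 : ∑ t, th φ κ B E T t p = 0 := by
      apply sum_eq_zero; intro t _
      unfold th
      rw [if_neg (fun h => hco h.2)]
    rw [h1, abs_zero]
    exact mul_nonneg (s0_nonneg p) hpos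

/-- witnesses for nonprincipal characters -/
lemma witness {φ : I → I → ℕ} (hφ1 : ∀ u v, φ u v ≤ 1) (B : Finset I)
    (hC2 : ∀ w, w ∉ B → (∃ u ∈ B, φ w u ≠ φ u w) ∧ ∃ v ∈ B, φ w v = φ v w)
    {Y : ℕ} {E : I → ℕ} (hE : E ∈ TT I Y) (hEB : ∀ u ∈ B, E u = 1) (hodd : ∀ u, E u % 2 = 1)
    {T : Finset I} (hT : T ⊆ B) (hne : ¬ ((∀ u, E u = 1) ∧ (T = ∅ ∨ T = B))) :
    ∃ u ∈ B, ∃ v ∈ B, u ≠ v ∧ ∃ a : ℕ, a.Coprime (8 * ∏ u, E u) ∧ ZZ φ E T u a * ZZ φ E T v a = -1 ∧ c8 a = 1 := by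
  by_cases hE1 : ∀ u, E u = 1
  · have hT2 : T ≠ ∅ ∧ T ≠ B := by
      constructor
      · intro h; exact hne ⟨hE1, Or.inl h⟩
      · intro h; exact hne ⟨hE1, Or.inr h⟩
    obtain ⟨u, hu⟩ := nonempty_iff_ne_empty.2 hT2.1
    obtain ⟨v, hv, hvT⟩ := exists_of_ssubset (hT.ssubset_of_ne hT2.2)
    refine ⟨u, hT hu, v, hv, (by rintro rfl; exact hvT hu), 7, ?_, ?_, c8_vals.2.2.2.2.2.2.2⟩
    · simp only [hE1, prod_const_one, mul_one]; decide
    · have hYY : ∀ t, YY φ E t 7 = 1 := by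
        intro t
        unfold YY aa
        simp [hE1, J_one_right]
      unfold ZZ
      rw [hYY, hYY, if_pos hu, if_neg hvT, c4_vals.2.2.2.2.2.2.2]; norm_num
  · push Not at hE1
    obtain ⟨w, hw⟩ := hE1
    have hwB : w ∉ B := fun h => hw (hEB w h)
    obtain ⟨⟨u, hu, hu'⟩, v, hv, hv'⟩ := hC2 w hwB
    have huv : u ≠ v := by rintro rfl; exact hu' hv'
    obtain ⟨p, hp, hpw⟩ := Nat.exists_prime_and_dvd hw
    have hp2 : p ≠ 2 := by
      rintro rfl; have := hodd w; omega
    set e := ∏ u, E u with he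
    have hesq : Squarefree e := (mem_TT.1 hE).1
    have hpe : p ∣ e := hpw.trans (dvd_prod_of_mem _ (mem_univ w))
    obtain ⟨f, hf⟩ := hpe
    have hpf : p.Coprime f := Nat.coprime_of_squarefree_mul (hf ▸ hesq)
    have hp8 : p.Coprime 8 := by
      have := (Nat.coprime_primes hp Nat.prime_two).2 hp2
      exact Nat.Coprime.pow_right 3 this
    obtain ⟨a, ha1, ha2, ha3, ha4⟩ := exists_nonres hp hp2 (R := 8 * f) (Nat.Coprime.mul_right hp8 hpf)
    have ham : ∀ m, m ∣ 8 * f → J a m = 1 := by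
      intro m hm
      rw [J_mod a 1 m, J_one_left]
      exact Nat.ModEq.of_dvd hm ha4
    have ha8 : a % 8 = 1 := by
      have : a ≡ 1 [MOD 8] := Nat.ModEq.of_dvd (dvd_mul_right 8 f) ha4
      exact this
    have hc4 : c4 a = 1 := by rw [c4_of_mod a 1 ha8, c4_vals.2.1]
    have hEw : ∀ t, t ≠ w → J a (E t) = 1 := by
      intro t ht
      apply ham
      apply Dvd.dvd.mul_left
      have h1 : E t ∣ p * f := hf ▸ dvd_prod_of_mem _ (mem_univ t)
      have h2 : (E t).Coprime p := (Nat.Coprime.coprime_dvd_right hpw (TT_coprime hE ht))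
      exact h2.dvd_of_dvd_mul_left h1
    have hEww : J a (E w) = -1 := by
      obtain ⟨m, hm⟩ := hpw
      have hm0 : m ≠ 0 := by rintro rfl; have := TT_pos hE w; omega
      rw [hm, J_mul_right _ hp.ne_zero hm0, ha3, ham m, mul_one]
      apply Dvd.dvd.mul_left
      have h1 : p * m ∣ p * f := hm ▸ hf ▸ dvd_prod_of_mem _ (mem_univ w)
      exact Nat.dvd_of_mul_dvd_mul_left hp.pos h1
    have hYY : ∀ t, YY φ E t a = (-1) ^ (φ w t + φ t w) := by
      intro t
      unfold YY
      rw [hc4, one_pow, mul_one, Fintype.prod_eq_single w, hEww]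
      intro s hs
      rw [hEw s hs, one_pow]
    refine ⟨u, hu, v, hv, huv, a, ?_, ?_, by rw [c8_of_mod a 1 ha8, c8_vals.2.1]⟩
    · rw [hf, show 8 * (p * f) = p * (8 * f) by ring]
      exact Nat.Coprime.mul_right ha1 ha2
    · unfold ZZ
      rw [hc4, hYY, hYY, one_pow, one_pow, mul_one, mul_one]
      have h1 := hφ1 w u
      have h2 := hφ1 u w
      have h3 := hφ1 w v
      have e1 : φ w u + φ u w = 1 := by omega
      rw [e1, ← hv', ← two_mul, pow_mul]; norm_num

noncomputable def PP (Y : ℕ) : ℝ := ∑ n ∈ sf Y, mulf s0 n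
noncomputable def MM (Y : ℕ) : ℝ := ∑ n ∈ sf Y, mulf (fun p => s0 p * c4 p) n

lemma caseIII : ∃ C : ℝ, 0 < C ∧ ∀ (φ : I → I → ℕ) (lam : I → ℕ) (_ : ∀ u, φ u u = 0) (_ : ∀ u v, φ u v ≤ 1)
    (r : I → ℕ) (_ : Function.Injective r)
    (κ : ℝ) (_ : 0 ≤ κ) (_ : κ ≤ 1/2) (B : Finset I) (_ : (B.card : ℝ) * κ = 1)
    (_ : ∀ u ∈ B, ∀ v ∈ B, φ u v = φ v u)
    (_ : ∀ w, w ∉ B → (∃ u ∈ B, φ w u ≠ φ u w) ∧ ∃ v ∈ B, φ w v = φ v w)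
    (Y : ℕ) (z : ℝ), 9 ≤ Y → 1 ≤ z → 2 * z ^ Fintype.card I ≤ Real.sqrt Y →
    |∑ D ∈ TT I Y, (if ∀ w, w ∉ B → (D w : ℝ) ≤ z then wt κ D * tj φ lam D else 0)
      - (fh B (sgn φ lam r) ∅ * PP Y + fh B (sgn φ lam r) B * MM Y)| ≤
      C * (Y * Real.log Y ^ ((-1 - κ) / 2)) * Real.log (8 * z ^ Fintype.card I) * (1 + Real.log z) ^ Fintype.card I := by
  obtain ⟨C, hC0, hC⟩ := mul_bound
  refine ⟨2 ^ Fintype.card I * (2 * C), by positivity, ?_⟩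
  intro φ lam hφ hφ1 r hr κ h0 h12 B hκ hB hC2 Y z hY hz hzY
  have h1 : κ ≤ 1 := by linarith
  rw [caseIII_exact lam hφ hr κ B hB hz Y]
  set g := sgn φ lam r with hg
  set EE := (TT I Y).filter (fun E => (∀ u ∈ B, E u = 1) ∧ ∀ u, (E u : ℝ) ≤ z) with hEE
  set tm : (I → ℕ) → Finset I → ℝ := fun E T =>
    wt κ E * tj φ lam E * (fh B g T * ∑ n ∈ sf (Y / ∏ u, E u), mulf (fun p => ∑ v, th φ κ B E T v p) n) with htm
  set one : I → ℕ := fun _ => 1 with hone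
  have hBne : B ≠ ∅ := by
    rintro rfl; simp at hκ
  have honeE : one ∈ EE := by
    rw [hEE, mem_filter, mem_TT]
    simp only [hone, prod_const_one]
    exact ⟨⟨squarefree_one, by omega⟩, fun _ _ => trivial, fun _ => by simpa using hz⟩
  have hwt1 : wt κ one = 1 := prod_eq_one fun _ _ => mulf_one _
  have htj1 : tj φ lam one = 1 := by
    unfold tj; simp [hone, J_one_left, c4_CM.one]
  have hZ1 : ∀ T v p, ZZ φ one T v p = c4 p ^ (if v ∈ T then 1 else 0) := by
    intro T v p
    unfold ZZ YY aa
    simp [hone, J_one_right]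
  have hth1 : ∀ T p, ∑ v, th φ κ B one T v p = ∑ v ∈ B, ks κ p * c4 p ^ (if v ∈ T then 1 else 0) := by
    intro T p
    unfold th
    simp only [hZ1]
    simp only [hone, prod_const_one, Nat.coprime_one_right_eq_true, and_true]
    rw [← sum_filter, filter_mem_eq_inter, univ_inter]
  have hmain1 : tm one ∅ = fh B g ∅ * PP Y := by
    simp only [htm, hwt1, htj1, hth1]
    simp only [hone, prod_const_one, Nat.div_one, one_mul, notMem_empty, if_false, pow_zero, mul_one, sum_const, nsmul_eq_mul]
    unfold PP
    congr 1
    apply sum_congr rfl; intro n _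
    congr 1
    funext p
    unfold ks
    rw [← mul_assoc, hκ, one_mul]
  have hmain2 : tm one B = fh B g B * MM Y := by
    simp only [htm, hwt1, htj1, hth1]
    simp only [hone, prod_const_one, Nat.div_one, one_mul]
    unfold MM
    congr 1
    apply sum_congr rfl; intro n _
    congr 1
    funext p
    have : ∀ v ∈ B, ks κ p * c4 p ^ (if v ∈ B then 1 else 0) = ks κ p * c4 p := by
      intro v hv; rw [if_pos hv, pow_one]
    rw [sum_congr rfl this, sum_const, nsmul_eq_mul]
    unfold ks
    rw [← mul_assoc, ← mul_assoc, hκ, one_mul]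
  have hmain : fh B g ∅ * PP Y + fh B g B * MM Y =
      ∑ E ∈ EE, ∑ T ∈ B.powerset, if E = one ∧ (T = ∅ ∨ T = B) then tm E T else 0 := by
    rw [sum_eq_single one]
    · simp only [true_and]
      rw [← sum_filter]
      have : B.powerset.filter (fun T => T = ∅ ∨ T = B) = {∅, B} := by
        ext T
        simp only [mem_filter, mem_powerset, mem_insert, mem_singleton]
        constructor
        · exact fun h => h.2
        · rintro (rfl | rfl)
          · simp
          · simp
      rw [this, sum_pair (Ne.symm hBne), hmain1, hmain2]
    · intro E _ hE
      apply sum_eq_zero; intro T _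
      rw [if_neg (fun h => hE h.1)]
    · intro h; exact absurd honeE h
  rw [hmain, ← sum_sub_distrib]
  simp only [← sum_sub_distrib]
  have hlz : 0 ≤ Real.log (8 * z ^ Fintype.card I) := by
    apply Real.log_nonneg
    have : 1 ≤ z ^ Fintype.card I := one_le_pow₀ hz
    linarith
  set Q := (2 * C) * (Y * Real.log Y ^ ((-1 - κ) / 2)) * Real.log (8 * z ^ Fintype.card I) with hQ
  have hlogY : 0 ≤ Real.log Y := Real.log_natCast_nonneg Y
  have hQ0 : 0 ≤ Q := by positivity
  have key : ∀ E ∈ EE, ∀ T ∈ B.powerset,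
      |tm E T - (if E = one ∧ (T = ∅ ∨ T = B) then tm E T else 0)| ≤ Q * (1 / ((∏ u, E u : ℕ) : ℝ)) := by
    intro E hE T hT
    split_ifs with hc
    · rw [sub_self, abs_zero]; positivity
    · rw [sub_zero]
      by_cases hw : wt κ E = 0
      · simp only [htm, hw, zero_mul, abs_zero]; positivity
      rw [hEE, mem_filter] at hE
      obtain ⟨hE1, hE2, hE3⟩ := hE
      have hEpos := TT_pos hE1
      have hepos : 0 < ∏ u, E u := prod_pos fun t _ => hEpos t
      obtain ⟨u, hu, v, hv, huv, a, ha, hψa, hc8⟩ := witness hφ1 B hC2 hE1 hE2 (S0_all hEpos hw) (mem_powerset.1 hT)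
        (fun h => hc ⟨funext h.1, h.2⟩)
      have hez := prod_le_z hE3
      obtain ⟨hN3, hN⟩ := divN h0 h1 hY hepos (le_trans (by linarith) hzY)
      set e := ∏ u, E u with he
      have hψ : CM (fun n => ZZ φ E T u n * ZZ φ E T v n) := (ZZ_CM φ E T u).prod (ZZ_CM φ E T v)
      have hper : ∀ n, ZZ φ E T u (n + 8 * e) * ZZ φ E T v (n + 8 * e) = ZZ φ E T u n * ZZ φ E T v n := by
        intro n; rw [ZZ_per, ZZ_per]
      have hs1 := char_sum_bound hψ (q := 8 * e) (by omega) hper ha (by rw [hψa]; norm_num)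
      have hs2 := char_sum_bound (hψ.prod c8_CM) (q := 8 * e) (by omega) (by
        intro n
        rw [hper, c8_of_mod (n + 8 * e) (n % 8) (by omega), ← c8_of_mod n _ rfl]) ha (by rw [hψa, hc8]; norm_num)
      have hb := hC κ h0 h12 _ hψ (8 * e) (by omega) hs1 hs2 (fun p => ∑ t, th φ κ B E T t p)
        (fun p => F_abs φ h0 B hκ E T hu hv huv p) (Y / e) hN3
      have hlog8 : Real.log ((8 * e : ℕ) : ℝ) ≤ Real.log (8 * z ^ Fintype.card I) := by
        apply Real.log_le_log
        · exact_mod_cast (by omega : 0 < 8 * e)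
        · push_cast; push_cast at hez; linarith
      have hlog80 : 0 ≤ Real.log ((8 * e : ℕ) : ℝ) := Real.log_natCast_nonneg _
      have hpre : |wt κ E * tj φ lam E| ≤ 1 := abs_mul_le_one (wt_abs h0 h1 _) (tj_abs _ _ _)
      have hfh : |fh B g T| ≤ 1 := fh_abs B (sgn_abs φ lam r) T
      simp only [htm]
      rw [abs_mul, abs_mul (fh B g T)]
      calc _ ≤ 1 * (1 * ∑ n ∈ sf (Y / e), |mulf (fun p => ∑ v, th φ κ B E T v p) n|) := by
            gcongr
            exact abs_sum_le_sum_abs _ _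
        _ ≤ C * (((Y / e : ℕ) : ℝ) * Real.log ((Y / e : ℕ) : ℝ) ^ ((-1 - κ) / 2)) * Real.log ((8 * e : ℕ) : ℝ) := by
            rw [one_mul, one_mul]; refine hb.trans (le_of_eq (by ring))
        _ ≤ C * (2 * (Y * Real.log Y ^ ((-1 - κ) / 2)) * (1 / e)) * Real.log (8 * z ^ Fintype.card I) := by
            gcongr
        _ = _ := by rw [hQ]; ring
  calc _ ≤ ∑ E ∈ EE, ∑ T ∈ B.powerset, Q * (1 / ((∏ u, E u : ℕ) : ℝ)) := by
        refine (abs_sum_le_sum_abs _ _).trans (sum_le_sum fun E hE => ?_)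
        exact (abs_sum_le_sum_abs _ _).trans (sum_le_sum fun T hT => key E hE T hT)
    _ = 2 ^ B.card * Q * ∑ E ∈ EE, 1 / ((∏ u, E u : ℕ) : ℝ) := by
        simp only [sum_const, card_powerset, nsmul_eq_mul]
        rw [mul_sum]
        apply sum_congr rfl; intro E _; push_cast; ring
    _ ≤ 2 ^ Fintype.card I * Q * (1 + Real.log z) ^ Fintype.card I := by
        have : 0 ≤ Real.log z := Real.log_nonneg hz
        gcongr
        · norm_num
        · exact card_le_univ B
        · apply Esum hz
          intro E hE u
          rw [hEE, mem_filter] at hE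
          exact ⟨TT_pos hE.1 u, hE.2.2 u⟩
    _ = _ := by rw [hQ]; ring

end
end FK

namespace FK
open Finset

section
variable {I : Type*} [Fintype I]

def unl (φ : I → I → ℕ) (B : Finset I) : Prop := ∀ u ∈ B, ∀ v ∈ B, φ u v = φ v u

noncomputable def mainB (φ : I → I → ℕ) (lam : I → ℕ) (r : I → ℕ) (Y : ℕ) (B : Finset I) : ℝ :=
  fh B (sgn φ lam r) ∅ * PP Y + fh B (sgn φ lam r) B * MM Y

noncomputable def ERR (n : ℕ) (κ : ℝ) (Y : ℕ) (z : ℝ) : ℝ :=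
  1 / (1 + Real.log Y) + Real.log Y ^ ((-1 - κ) / 2) * (Real.log (8 * z ^ n) * (1 + Real.log z) ^ n)

lemma per_B : ∃ C : ℝ, 0 < C ∧ ∀ (φ : I → I → ℕ) (lam : I → ℕ) (_ : ∀ u, φ u u = 0) (_ : ∀ u v, φ u v ≤ 1)
    (r : I → ℕ) (_ : Function.Injective r)
    (κ : ℝ) (_ : 0 ≤ κ) (_ : κ ≤ 1/2) (h : ℕ) (_ : (h : ℝ) * κ = 1)
    (_ : ∀ B, unl φ B → B.card ≤ h)
    (_ : ∀ B, unl φ B → B.card = h → ∀ w, w ∉ B → (∃ u ∈ B, φ w u ≠ φ u w) ∧ ∃ v ∈ B, φ w v = φ v w)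
    (Y : ℕ) (w : ℝ) (B : Finset I), 9 ≤ Y → w = (1 + Real.log Y) ^ (Fintype.card I + 4) →
    2 * (w ^ 12) ^ Fintype.card I ≤ Real.sqrt Y →
    |∑ D ∈ TT I Y, (if big (w ^ 12) D = B then wt κ D * tj φ lam D else 0)
      - (if unl φ B ∧ B.card = h then mainB φ lam r Y B else 0)| ≤
      C * (Y * ERR (Fintype.card I) κ Y (w ^ 12)) := by
  obtain ⟨C2, hC20, hC2⟩ := caseII (I := I)
  obtain ⟨C3, hC30, hC3⟩ := caseIII (I := I)
  refine ⟨6 + C2 + C3 + Fintype.card I * C2, by positivity, ?_⟩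
  intro φ lam hφ hφ1 r hr κ h0 h12 h hκ hc1 hc2 Y w B hY hw hwY
  set n := Fintype.card I with hn
  have h1 : κ ≤ 1 := by linarith
  have hL : 0 ≤ Real.log Y := Real.log_natCast_nonneg Y
  have hw1 : 1 ≤ w := by rw [hw]; exact one_le_pow₀ (by linarith)
  set z := w ^ 12 with hz
  have hz1 : 1 ≤ z := one_le_pow₀ hw1
  have hlz : 0 ≤ Real.log z := Real.log_nonneg hz1
  have hl8 : 1 ≤ Real.log (8 * z ^ n) := by
    have : Real.exp 1 ≤ 8 * z ^ n := by
      have := Real.exp_one_lt_d9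
      have := one_le_pow₀ (n := n) hz1
      linarith
    have := Real.log_le_log (Real.exp_pos 1) this
    rwa [Real.log_exp] at this
  set X1 : ℝ := Y * (1 / (1 + Real.log Y)) with hX1
  set X2 : ℝ := Y * Real.log Y ^ ((-1 - κ) / 2) * (1 + Real.log z) ^ n with hX2
  set X3 : ℝ := Y * Real.log Y ^ ((-1 - κ) / 2) * Real.log (8 * z ^ n) * (1 + Real.log z) ^ n with hX3
  have hX1n : 0 ≤ X1 := by positivity
  have hX2n : 0 ≤ X2 := by positivity
  have hX23 : X2 ≤ X3 := by
    have : X3 = Real.log (8 * z ^ n) * X2 := by rw [hX2, hX3]; ring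
    rw [this]; nlinarith
  have hE : (Y : ℝ) * ERR n κ Y z = X1 + X3 := by unfold ERR; rw [hX1, hX3]; ring
  have hn0 : (0:ℝ) ≤ n := Nat.cast_nonneg _
  have hp1 := mul_nonneg hC20.le hX1n
  have hp2 := mul_nonneg hC30.le hX1n
  have hp3 := mul_nonneg hC20.le (hX2n.trans hX23)
  have hp4 := mul_nonneg hC30.le (hX2n.trans hX23)
  have hp5 := mul_nonneg (mul_nonneg hn0 hC20.le) hX1n
  have hp6 := mul_nonneg (mul_nonneg hn0 hC20.le) (hX2n.trans hX23)
  have hp7 := mul_le_mul_of_nonneg_left hX23 hC20.le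
  have hp8 := mul_le_mul_of_nonneg_left hX23 (mul_nonneg hn0 hC20.le)
  rw [hE]
  have hoff : ∀ D : I → ℕ, big z D = B → ∀ w, w ∉ B → (D w : ℝ) ≤ z := by
    rintro D rfl w hw
    unfold big at hw; simpa using hw
  have hwn : ∀ D ∈ TT I Y, 0 ≤ wt κ D := fun D _ => wt_nonneg h0 D
  have hFb : ∀ D ∈ TT I Y, |wt κ D * tj φ lam D| ≤ wt κ D := by
    intro D hD
    rw [abs_mul, abs_of_nonneg (hwn D hD)]
    exact mul_le_of_le_one_right (hwn D hD) (tj_abs _ _ _)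
  by_cases hB : unl φ B
  · have hBle := hc1 B hB
    by_cases hBc : B.card = h
    · rw [if_pos ⟨hB, hBc⟩]
      have a3 := hC3 φ lam hφ hφ1 r hr κ h0 h12 B (by rw [hBc]; exact hκ) hB (hc2 B hB hBc) Y z hY hz1 hwY
      have a2 : |∑ D ∈ TT I Y, (if big z D = B then wt κ D * tj φ lam D else 0)
          - ∑ D ∈ TT I Y, (if ∀ w, w ∉ B → (D w : ℝ) ≤ z then wt κ D * tj φ lam D else 0)| ≤
          ∑ u ∈ B, ∑ D ∈ TT I Y, (if ∀ w, w ∉ B.erase u → (D w : ℝ) ≤ z then wt κ D else 0) := by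
        rw [sum_comm, ← sum_sub_distrib]
        refine (abs_sum_le_sum_abs _ _).trans (sum_le_sum fun D hD => ?_)
        have hnn : ∀ u ∈ B, 0 ≤ (if ∀ w, w ∉ B.erase u → (D w : ℝ) ≤ z then wt κ D else 0) := by
          intro u _; split_ifs
          · exact hwn D hD
          · exact le_rfl
        by_cases hb : big z D = B
        · rw [if_pos hb, if_pos (hoff D hb), sub_self, abs_zero]
          exact sum_nonneg hnn
        · rw [if_neg hb]
          by_cases hs : ∀ w, w ∉ B → (D w : ℝ) ≤ z
          · rw [if_pos hs, zero_sub, abs_neg]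
            have : ∃ u ∈ B, (D u : ℝ) ≤ z := by
              by_contra! hcon
              apply hb; ext u; unfold big; simp only [mem_filter, mem_univ, true_and]
              constructor
              · intro hu; by_contra hu'; exact absurd (hs u hu') (not_le.2 hu)
              · exact hcon u
            obtain ⟨u, hu, hDu⟩ := this
            refine le_trans ?_ (single_le_sum hnn hu)
            rw [if_pos]
            · exact hFb D hD
            · intro t ht
              by_cases htu : t = u
              · rw [htu]; exact hDu
              · exact hs t fun htB => ht (mem_erase.2 ⟨htu, htB⟩)
          · rw [if_neg hs, sub_self, abs_zero]
            exact sum_nonneg hnn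
      have a4 : ∑ u ∈ B, ∑ D ∈ TT I Y, (if ∀ w, w ∉ B.erase u → (D w : ℝ) ≤ z then wt κ D else 0) ≤ n * (C2 * X2) := by
        calc _ ≤ ∑ u ∈ B, C2 * X2 := by
              apply sum_le_sum; intro u hu
              have := hC2 κ h0 h1 (B.erase u) (by
                rw [card_erase_of_mem hu, hBc, Nat.cast_sub (by rw [← hBc]; exact card_pos.2 ⟨u, hu⟩)]
                push_cast; linarith) Y z hY hz1 hwY
              calc _ ≤ _ := this
                _ = C2 * X2 := by rw [hX2]; ring
          _ = B.card * (C2 * X2) := by rw [sum_const, nsmul_eq_mul]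
          _ ≤ n * (C2 * X2) := by
              gcongr; exact_mod_cast card_le_univ B
      have a5 : C3 * (Y * Real.log Y ^ ((-1 - κ) / 2)) * Real.log (8 * z ^ n) * (1 + Real.log z) ^ n = C3 * X3 := by
        rw [hX3]; ring
      rw [a5] at a3
      have a6 := abs_sub_le (∑ D ∈ TT I Y, (if big z D = B then wt κ D * tj φ lam D else 0))
        (∑ D ∈ TT I Y, (if ∀ w, w ∉ B → (D w : ℝ) ≤ z then wt κ D * tj φ lam D else 0)) (mainB φ lam r Y B)
      unfold mainB at a6 ⊢
      linarith
    · rw [if_neg (fun hh => hBc hh.2), sub_zero]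
      have hlt : B.card + 1 ≤ h := by omega
      have hlt' : (B.card : ℝ) + 1 ≤ h := by exact_mod_cast hlt
      have a2 := hC2 κ h0 h1 B (by nlinarith) Y z hY hz1 hwY
      have a3 : |∑ D ∈ TT I Y, (if big z D = B then wt κ D * tj φ lam D else 0)| ≤
          ∑ D ∈ TT I Y, (if ∀ w, w ∉ B → (D w : ℝ) ≤ z then wt κ D else 0) := by
        refine (abs_sum_le_sum_abs _ _).trans (sum_le_sum fun D hD => ?_)
        by_cases hb : big z D = B
        · rw [if_pos hb, if_pos (hoff D hb)]; exact hFb D hD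
        · rw [if_neg hb, abs_zero]; split_ifs
          · exact hwn D hD
          · exact le_rfl
      have a5 : C2 * (Y * Real.log Y ^ ((-1 - κ) / 2)) * (1 + Real.log z) ^ n = C2 * X2 := by
        rw [hX2]; ring
      linarith
  · rw [if_neg (fun hh => hB hh.1), sub_zero]
    unfold unl at hB; push Not at hB
    obtain ⟨u, hu, v, hv, huv⟩ := hB
    have a1 : |∑ D ∈ TT I Y, (if big z D = B then wt κ D * tj φ lam D else 0)| ≤
        6 * Y * (1 + Real.log Y) ^ (n + 3) / w := by
      have e1 := hφ1 u v
      have e2 := hφ1 v u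
      rcases Nat.lt_or_ge (φ u v) (φ v u) with hlt | hge
      · exact caseI lam hφ h0 h1 (u := v) (v := u) (by omega) (by omega) B hv hu hw1 Y
      · exact caseI lam hφ h0 h1 (u := u) (v := v) (by omega) (by omega) B hu hv hw1 Y
    have a2 : 6 * Y * (1 + Real.log Y) ^ (n + 3) / w = 6 * X1 := by
      rw [hw, hX1, pow_succ _ (n+3)]
      have : 1 + Real.log Y ≠ 0 := by linarith
      field_simp
    linarith

lemma combine : ∃ C : ℝ, 0 < C ∧ ∀ (φ : I → I → ℕ) (lam : I → ℕ) (_ : ∀ u, φ u u = 0) (_ : ∀ u v, φ u v ≤ 1)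
    (r : I → ℕ) (_ : Function.Injective r)
    (κ : ℝ) (_ : 0 ≤ κ) (_ : κ ≤ 1/2) (h : ℕ) (_ : (h : ℝ) * κ = 1)
    (_ : ∀ B, unl φ B → B.card ≤ h)
    (_ : ∀ B, unl φ B → B.card = h → ∀ w, w ∉ B → (∃ u ∈ B, φ w u ≠ φ u w) ∧ ∃ v ∈ B, φ w v = φ v w)
    (Y : ℕ) (w : ℝ), 9 ≤ Y → w = (1 + Real.log Y) ^ (Fintype.card I + 4) →
    2 * (w ^ 12) ^ Fintype.card I ≤ Real.sqrt Y →
    |∑ D ∈ TT I Y, wt κ D * tj φ lam D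
      - ∑ B ∈ univ.filter (fun B => unl φ B ∧ B.card = h), mainB φ lam r Y B| ≤
      C * (Y * ERR (Fintype.card I) κ Y (w ^ 12)) := by
  obtain ⟨C, hC0, hC⟩ := per_B (I := I)
  refine ⟨Fintype.card (Finset I) * C, by positivity, ?_⟩
  intro φ lam hφ hφ1 r hr κ h0 h12 h hκ hc1 hc2 Y w hY hw hwY
  have e1 : ∑ D ∈ TT I Y, wt κ D * tj φ lam D = ∑ B : Finset I, ∑ D ∈ TT I Y,
      (if big (w ^ 12) D = B then wt κ D * tj φ lam D else 0) := by
    rw [sum_comm]; simp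
  rw [e1, sum_filter, ← sum_sub_distrib]
  refine (abs_sum_le_sum_abs _ _).trans ?_
  refine (sum_le_sum fun B _ => hC φ lam hφ hφ1 r hr κ h0 h12 h hκ hc1 hc2 Y w B hY hw hwY).trans ?_
  rw [sum_const, nsmul_eq_mul, card_univ, mul_assoc]

end

lemma err_small (n : ℕ) {κ : ℝ} (hκ : 0 < κ) {C ε : ℝ} (hC : 0 < C) (hε : 0 < ε) :
    ∃ Y0 : ℕ, ∀ Y : ℕ, Y0 ≤ Y → C * (Y * ERR n κ Y (((1 + Real.log Y) ^ (n + 4)) ^ 12)) ≤ ε * (Y / Real.sqrt (Real.log Y)) := by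
  set M : ℕ := (n + 4) * 12 with hM
  set δ : ℝ := κ / (4 * (n + 1)) with hδ
  have hδ0 : 0 < δ := by positivity
  -- main limit
  have hlim : Filter.Tendsto (fun t : ℝ => C * (t ^ (-(1/2) : ℝ) +
      (3 + n * (M * (2 ^ δ / δ))) * (1 + M * (2 ^ δ / δ)) ^ n * t ^ (-(κ/4)))) Filter.atTop (nhds (C * (0 + (3 + n * (M * (2 ^ δ / δ))) * (1 + M * (2 ^ δ / δ)) ^ n * 0))) := by
    apply Filter.Tendsto.const_mul
    apply Filter.Tendsto.add
    · exact tendsto_rpow_neg_atTop (by norm_num)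
    · exact (tendsto_rpow_neg_atTop (by positivity)).const_mul _
  have hev := hlim.eventually (gt_mem_nhds (show C * (0 + (3 + n * (M * (2 ^ δ / δ))) * (1 + M * (2 ^ δ / δ)) ^ n * 0) < ε by simpa using hε))
  have htl : Filter.Tendsto (fun Y : ℕ => Real.log Y) Filter.atTop Filter.atTop :=
    Real.tendsto_log_atTop.comp tendsto_natCast_atTop_atTop
  obtain ⟨Y0, hY0⟩ := Filter.eventually_atTop.1 (htl.eventually (hev.and (Filter.eventually_ge_atTop 1)))
  refine ⟨Y0, fun Y hY => ?_⟩
  obtain ⟨h1, h2⟩ := hY0 Y hY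
  set t := Real.log Y with ht
  have ht0 : 0 < t := by linarith
  rw [← pow_mul, ← hM]
  unfold ERR
  rw [← ht]
  set s := Real.log (1 + t) with hs
  have hs0 : 0 ≤ s := Real.log_nonneg (by linarith)
  have hlz : Real.log ((1 + t) ^ M) = M * s := by rw [Real.log_pow]
  have hl8 : Real.log (8 * ((1 + t) ^ M) ^ n) = Real.log 8 + n * (M * s) := by
    rw [Real.log_mul (by norm_num) (by positivity), Real.log_pow, hlz]
  rw [hlz, hl8]
  have hl83 : Real.log 8 ≤ 3 := by
    have : (8:ℝ) = 2 ^ 3 := by norm_num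
    rw [this, Real.log_pow]
    have := Real.log_two_lt_d9; push_cast; linarith
  have htd : 1 ≤ t ^ δ := Real.one_le_rpow h2 hδ0.le
  have hsle : s ≤ 2 ^ δ / δ * t ^ δ := by
    calc s ≤ (1 + t) ^ δ / δ := Real.log_le_rpow_div (by linarith) hδ0
      _ ≤ (2 * t) ^ δ / δ := by gcongr; linarith
      _ = _ := by rw [Real.mul_rpow (by norm_num) ht0.le]; ring
  set K := 2 ^ δ / δ with hK
  have hK0 : 0 ≤ K := by positivity
  have b1 : Real.log 8 + n * (M * s) ≤ (3 + n * (M * K)) * t ^ δ := by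
    calc _ ≤ 3 * t ^ δ + n * (M * (K * t ^ δ)) := by gcongr; linarith
      _ = _ := by ring
  have b2 : 1 + M * s ≤ (1 + M * K) * t ^ δ := by
    calc _ ≤ t ^ δ + M * (K * t ^ δ) := by gcongr
      _ = _ := by ring
  have hl80 : 0 ≤ Real.log 8 := Real.log_nonneg (by norm_num)
  have b3 : t ^ ((-1 - κ) / 2) * ((Real.log 8 + n * (M * s)) * (1 + M * s) ^ n) ≤
      t ^ (-(1/2) : ℝ) * ((3 + n * (M * K)) * (1 + M * K) ^ n * t ^ (-(κ/4))) := by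
    calc _ ≤ t ^ ((-1 - κ) / 2) * (((3 + n * (M * K)) * t ^ δ) * ((1 + M * K) * t ^ δ) ^ n) := by gcongr
      _ = (3 + n * (M * K)) * (1 + M * K) ^ n * (t ^ ((-1 - κ) / 2) * (t ^ δ) ^ (n + 1)) := by rw [mul_pow]; ring
      _ = (3 + n * (M * K)) * (1 + M * K) ^ n * (t ^ (-(1/2) : ℝ) * t ^ (-(κ/4))) := by
          rw [← Real.rpow_natCast (t ^ δ), ← Real.rpow_mul ht0.le, ← Real.rpow_add ht0, ← Real.rpow_add ht0]
          congr 2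
          rw [hδ]; push_cast; field_simp; ring
      _ = _ := by ring
  have hsq : 1 / Real.sqrt t = t ^ (-(1/2) : ℝ) := by
    rw [Real.rpow_neg ht0.le, ← Real.sqrt_eq_rpow, one_div]
  have b4 : 1 / (1 + t) ≤ t ^ (-(1/2) : ℝ) * t ^ (-(1/2) : ℝ) := by
    rw [← Real.rpow_add ht0]; norm_num
    rw [Real.rpow_neg_one]; gcongr; linarith
  have hY : (0:ℝ) ≤ Y := Nat.cast_nonneg _
  calc C * (Y * (1 / (1 + t) + _)) ≤ C * (Y * (t ^ (-(1/2) : ℝ) * t ^ (-(1/2) : ℝ) + t ^ (-(1/2) : ℝ) * ((3 + n * (M * K)) * (1 + M * K) ^ n * t ^ (-(κ/4))))) := by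
        gcongr
    _ = (C * (t ^ (-(1/2) : ℝ) + (3 + n * (M * K)) * (1 + M * K) ^ n * t ^ (-(κ/4)))) * (Y * t ^ (-(1/2) : ℝ)) := by ring
    _ ≤ ε * (Y * t ^ (-(1/2) : ℝ)) := by gcongr
    _ = _ := by rw [← hsq]; ring

lemma z_small (n : ℕ) : ∃ Y0 : ℕ, ∀ Y : ℕ, Y0 ≤ Y → 2 * (((1 + Real.log Y) ^ (n + 4)) ^ 12) ^ n ≤ Real.sqrt Y := by
  set M : ℕ := (n + 4) * (12 * n) with hM
  have h := isLittleO_log_rpow_rpow_atTop (M : ℝ) (show (0:ℝ) < 1/2 by norm_num)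
  have h2 := h.bound (show (0:ℝ) < 1 / (2 * 2 ^ M) by positivity)
  have h3 := (tendsto_natCast_atTop_atTop (R := ℝ)).eventually (h2.and (Filter.eventually_ge_atTop 3))
  obtain ⟨Y0, hY0⟩ := Filter.eventually_atTop.1 h3
  refine ⟨Y0, fun Y hY => ?_⟩
  obtain ⟨h4, h5⟩ := hY0 Y hY
  have hl : 1 ≤ Real.log Y := by
    have : Real.exp 1 ≤ Y := by have := Real.exp_one_lt_d9; linarith
    have := Real.log_le_log (Real.exp_pos 1) this
    rwa [Real.log_exp] at this
  rw [Real.rpow_natCast, Real.norm_of_nonneg (by positivity), Real.norm_of_nonneg (by positivity), ← Real.sqrt_eq_rpow] at h4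
  rw [← pow_mul, ← pow_mul, ← hM]
  calc 2 * (1 + Real.log Y) ^ M ≤ 2 * (2 * Real.log Y) ^ M := by gcongr; linarith
    _ = (2 * 2 ^ M) * Real.log Y ^ M := by rw [mul_pow]; ring
    _ ≤ (2 * 2 ^ M) * (1 / (2 * 2 ^ M) * Real.sqrt Y) := by gcongr
    _ = _ := by field_simp

end FK

namespace FK
open Finset

lemma mulf_s0c4 {n : ℕ} (hn : Squarefree n) : mulf (fun p => s0 p * c4 p) n = mulf s0 n * c4 n := by
  rw [← c4_CM.mulf_eq hn]; unfold mulf; rw [prod_mul_distrib]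

lemma half_c4 {n : ℕ} (h : n % 2 = 1) : (1 - c4 n) / 2 = if n % 4 = 3 then 1 else 0 := by
  rw [c4_odd h]; split_ifs <;> norm_num

lemma PP_sub_MM (Y : ℕ) : PP Y - MM Y = 2 * (Aset Y).card := by
  unfold PP MM Aset
  rw [← sum_sub_distrib, card_filter, Nat.cast_sum, mul_sum]
  apply sum_congr rfl
  intro n hn
  have hn' := mem_sf.1 hn
  rw [mulf_s0c4 hn'.2, mulf_s0]
  by_cases h : S0 n
  · have := half_c4 (S0_odd hn'.1.1.ne' h)
    simp only [h, if_true, true_and]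
    push_cast
    rw [← this]; ring
  · simp [h]

section
variable {I : Type*} [Fintype I]

lemma sgn_succ (φ : I → I → ℕ) (lam r : I → ℕ) (N : Finset I) :
    sgn φ (fun u => lam u + 1) r N = sgn φ lam r N * (-1) ^ N.card := by
  unfold sgn
  simp only [pow_succ, prod_mul_distrib, prod_const]
  ring

lemma prod_pm {B N : Finset I} (h : N ⊆ B) : ∏ u ∈ B, pm N u = (-1) ^ N.card := by
  unfold pm
  rw [← prod_filter, prod_const, filter_mem_eq_inter, inter_eq_right.2 h]

lemma fh_succ_empty (φ : I → I → ℕ) (lam r : I → ℕ) (B : Finset I) :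
    fh B (sgn φ (fun u => lam u + 1) r) ∅ = fh B (sgn φ lam r) B := by
  unfold fh
  congr 1
  apply sum_congr rfl; intro N hN
  rw [sgn_succ, prod_pm (mem_powerset.1 hN), prod_empty, mul_one]

lemma fh_succ_self (φ : I → I → ℕ) (lam r : I → ℕ) (B : Finset I) :
    fh B (sgn φ (fun u => lam u + 1) r) B = fh B (sgn φ lam r) ∅ := by
  unfold fh
  congr 1
  apply sum_congr rfl; intro N hN
  rw [sgn_succ, prod_pm (mem_powerset.1 hN), prod_empty, mul_one, mul_assoc, ← mul_pow]
  norm_num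

noncomputable def cB (φ : I → I → ℕ) (lam r : I → ℕ) (B : Finset I) : ℝ :=
  fh B (sgn φ lam r) ∅ - fh B (sgn φ lam r) B

lemma mainB_sub (φ : I → I → ℕ) (lam r : I → ℕ) (Y : ℕ) (B : Finset I) :
    mainB φ lam r Y B - mainB φ (fun u => lam u + 1) r Y B = 2 * (cB φ lam r B * (Aset Y).card) := by
  unfold mainB
  rw [fh_succ_empty, fh_succ_self]
  have := PP_sub_MM Y
  unfold cB
  linear_combination (fh B (sgn φ lam r) ∅ - fh B (sgn φ lam r) B) * this

lemma tj_succ (φ : I → I → ℕ) (lam D : I → ℕ) :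
    tj φ (fun u => lam u + 1) D = tj φ lam D * c4 (∏ u, D u) := by
  have : c4 (∏ u, D u) = ∏ u, c4 (D u) := by
    have : ∀ s : Finset I, c4 (∏ u ∈ s, D u) = ∏ u ∈ s, c4 (D u) := by
      intro s
      induction s using Finset.induction_on with
      | empty => simp [c4_CM.one]
      | insert a s ha ih => rw [prod_insert ha, prod_insert ha, c4_CM.mul, ih]
    exact this univ
  rw [this]
  unfold tj
  simp only [pow_succ, prod_mul_distrib]
  ring

lemma wt_ctup {n : ℕ} (hn : Squarefree n) (κ : ℝ) (c : n.primeFactors → I) :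
    wt κ (ctup c) = if S0 n then κ ^ n.primeFactors.card else 0 := by
  have h1 : wt κ (ctup c) = mulf (ks κ) n := by
    have hm : ctup c ∈ TT I n := by
      rw [mem_TT, ctup_prod hn]; exact ⟨hn, le_rfl⟩
    have := mulf_TT (ks κ) hm
    rw [ctup_prod hn] at this
    rw [this]; rfl
  have h2 : mulf (ks κ) n = κ ^ n.primeFactors.card * mulf s0 n := by
    unfold mulf ks; rw [prod_mul_distrib, prod_const]
  rw [h1, h2, mulf_s0]
  split_ifs <;> simp

lemma expand3 (φ : I → I → ℕ) (lam : I → ℕ) (κ : ℝ) (Y : ℕ) :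
    ∑ d ∈ Aset Y, κ ^ d.primeFactors.card * ∑ c : d.primeFactors → I, tj φ lam (ctup c) =
    (∑ D ∈ TT I Y, wt κ D * tj φ lam D - ∑ D ∈ TT I Y, wt κ D * tj φ (fun u => lam u + 1) D) / 2 := by
  rw [← sum_sub_distrib, sum_div, TT_sum]
  unfold Aset
  rw [sum_filter]
  apply sum_congr rfl
  intro n hn
  have hn' := mem_sf.1 hn
  have : ∀ c : n.primeFactors → I, (wt κ (ctup c) * tj φ lam (ctup c) - wt κ (ctup c) * tj φ (fun u => lam u + 1) (ctup c)) / 2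
      = (if S0 n ∧ n % 4 = 3 then κ ^ n.primeFactors.card else 0) * tj φ lam (ctup c) := by
    intro c
    rw [tj_succ, ctup_prod hn'.2, wt_ctup hn'.2]
    by_cases h : S0 n
    · have h2 := half_c4 (S0_odd hn'.1.1.ne' h)
      simp only [h, if_true, true_and]
      split_ifs with h4
      · rw [if_pos h4] at h2
        linear_combination (κ ^ n.primeFactors.card * tj φ lam (ctup c)) * h2
      · rw [if_neg h4] at h2
        linear_combination (κ ^ n.primeFactors.card * tj φ lam (ctup c)) * h2
    · simp [h]
  simp only [this]
  rw [← mul_sum]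
  split_ifs <;> simp

lemma abstract_main (φ : I → I → ℕ) (lam : I → ℕ) (hφ : ∀ u, φ u u = 0) (hφ1 : ∀ u v, φ u v ≤ 1)
    (r : I → ℕ) (hr : Function.Injective r)
    (κ : ℝ) (h0 : 0 < κ) (h12 : κ ≤ 1/2) (h : ℕ) (hκ : (h : ℝ) * κ = 1)
    (hc1 : ∀ B, unl φ B → B.card ≤ h)
    (hc2 : ∀ B, unl φ B → B.card = h → ∀ w, w ∉ B → (∃ u ∈ B, φ w u ≠ φ u w) ∧ ∃ v ∈ B, φ w v = φ v w)
    {ε : ℝ} (hε : 0 < ε) : ∃ Y0 : ℕ, ∀ Y : ℕ, Y0 ≤ Y →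
    |∑ d ∈ Aset Y, κ ^ d.primeFactors.card * ∑ c : d.primeFactors → I, tj φ lam (ctup c)
      - (∑ B ∈ univ.filter (fun B => unl φ B ∧ B.card = h), cB φ lam r B) * (Aset Y).card| ≤
      ε * (Y / Real.sqrt (Real.log Y)) := by
  obtain ⟨C, hC0, hC⟩ := combine (I := I)
  obtain ⟨Y1, hY1⟩ := err_small (Fintype.card I) h0 hC0 hε
  obtain ⟨Y2, hY2⟩ := z_small (Fintype.card I)
  refine ⟨max 9 (max Y1 Y2), fun Y hY => ?_⟩
  have g1 : 9 ≤ Y := le_trans (le_max_left _ _) hY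
  have g2 : Y1 ≤ Y := le_trans ((le_max_left _ _).trans (le_max_right _ _)) hY
  have g3 : Y2 ≤ Y := le_trans ((le_max_right _ _).trans (le_max_right _ _)) hY
  have a1 := hC φ lam hφ hφ1 r hr κ h0.le h12 h hκ hc1 hc2 Y _ g1 rfl (hY2 Y g3)
  have a2 := hC φ (fun u => lam u + 1) hφ hφ1 r hr κ h0.le h12 h hκ hc1 hc2 Y _ g1 rfl (hY2 Y g3)
  have a3 := hY1 Y g2
  have a4 : ∑ B ∈ univ.filter (fun B => unl φ B ∧ B.card = h), mainB φ lam r Y B -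
      ∑ B ∈ univ.filter (fun B => unl φ B ∧ B.card = h), mainB φ (fun u => lam u + 1) r Y B =
      2 * ((∑ B ∈ univ.filter (fun B => unl φ B ∧ B.card = h), cB φ lam r B) * (Aset Y).card) := by
    rw [← sum_sub_distrib, sum_mul, mul_sum]
    exact sum_congr rfl fun B _ => mainB_sub φ lam r Y B
  rw [expand3]
  rw [abs_le] at a1 a2 ⊢
  constructor <;> linarith [a1.1, a1.2, a2.1, a2.2]

end
end FK

namespace FK
open Finset

section
variable {I : Type*} [Fintype I]

lemma J_prod_left {α : Type*} (s : Finset α) (f : α → ℕ) (n : ℕ) : J (∏ i ∈ s, f i) n = ∏ i ∈ s, J (f i) n := by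
  induction s using Finset.induction_on with
  | empty => simp [J_one_left]
  | insert a s ha ih => rw [prod_insert ha, prod_insert ha, J_mul_left, ih]

lemma J_prod_right {α : Type*} (s : Finset α) (f : α → ℕ) (hf : ∀ i, f i ≠ 0) (n : ℕ) :
    J n (∏ i ∈ s, f i) = ∏ i ∈ s, J n (f i) := by
  induction s using Finset.induction_on with
  | empty => simp [J_one_right]
  | insert a s ha ih =>
    rw [prod_insert ha, prod_insert ha, J_mul_right _ (hf a) (prod_ne_zero_iff.2 fun i _ => hf i), ih]

lemma c4_prod {α : Type*} (s : Finset α) (f : α → ℕ) : c4 (∏ i ∈ s, f i) = ∏ i ∈ s, c4 (f i) := by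
  induction s using Finset.induction_on with
  | empty => simp [c4_CM.one]
  | insert a s ha ih => rw [prod_insert ha, prod_insert ha, c4_CM.mul, ih]

lemma tj_ctup (φ : I → I → ℕ) (lam : I → ℕ) {n : ℕ} (c : n.primeFactors → I) :
    tj φ lam (ctup c) = (∏ q : n.primeFactors, ∏ p : n.primeFactors, J q p ^ φ (c q) (c p)) * ∏ p : n.primeFactors, c4 p ^ lam (c p) := by
  have hpos : ∀ p : n.primeFactors, (p : ℕ) ≠ 0 := fun p => (Nat.prime_of_mem_primeFactors p.2).ne_zero
  unfold tj ctup
  congr 1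
  · rw [← prod_fiberwise univ c]
    apply prod_congr rfl; intro u _
    rw [prod_comm' (t' := univ) (s' := fun _ => univ.filter fun q => c q = u) (by simp), ← prod_fiberwise univ c]
    apply prod_congr rfl; intro v _
    rw [J_prod_left, ← prod_pow, prod_comm]
    apply prod_congr rfl; intro q hq
    rw [J_prod_right _ _ hpos, ← prod_pow]
    apply prod_congr rfl; intro p hp
    rw [(mem_filter.1 hq).2, (mem_filter.1 hp).2]
  · rw [← prod_fiberwise univ c]
    apply prod_congr rfl; intro u _
    rw [c4_prod, ← prod_pow]
    apply prod_congr rfl; intro p hp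
    rw [(mem_filter.1 hp).2]

end

noncomputable def Mx {d : ℕ} (x : d.primeFactors → ZMod 2) (e : ZMod 2) : ℕ := ∏ p with x p = e, (p : ℕ)

noncomputable def gx {d : ℕ} (x : d.primeFactors → ZMod 2) (p : d.primeFactors) : ℝ :=
  (∏ q : d.primeFactors, J q p ^ (x p + x q).val) * c4 (p : ℕ) ^ (x p).val

lemma z2 (a : ZMod 2) : a = 0 ∨ a = 1 := by revert a; decide

lemma Mx_mul {d : ℕ} (hd : Squarefree d) (x : d.primeFactors → ZMod 2) : Mx x 1 * Mx x 0 = d := by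
  have := ctup_prod hd x
  have h2 : (univ : Finset (ZMod 2)) = {1, 0} := by decide
  rw [h2, prod_pair (by decide)] at this
  refine Eq.trans ?_ this
  unfold Mx ctup; congr

lemma dvd_Mx {d : ℕ} (x : d.primeFactors → ZMod 2) (e : ZMod 2) (p : d.primeFactors) :
    (p : ℕ) ∣ Mx x e ↔ x p = e := by
  have hp := Nat.prime_of_mem_primeFactors p.2
  unfold Mx
  constructor
  · intro h
    obtain ⟨q, hq, hpq⟩ := (Prime.dvd_finsetProd_iff hp.prime _).1 h
    have := (Nat.prime_dvd_prime_iff_eq hp (Nat.prime_of_mem_primeFactors q.2)).1 hpq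
    have : p = q := Subtype.ext this
    rw [this]; exact (mem_filter.1 hq).2
  · intro h
    exact dvd_prod_of_mem (fun p : d.primeFactors => (p : ℕ)) (mem_filter.2 ⟨mem_univ p, h⟩)

lemma gx_eq {d : ℕ} (hodd : d % 2 = 1) (x : d.primeFactors → ZMod 2) (p : d.primeFactors) :
    gx x p = if x p = 0 then J (Mx x 1) p else ((jacobiSym (-(Mx x 0 : ℕ)) p : ℤ) : ℝ) := by
  have hJ : ∀ e, ∏ q : d.primeFactors, J q p ^ (if x q = e then 1 else 0) = J (Mx x e) p := by
    intro e
    unfold Mx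
    rw [J_prod_left, prod_filter]
    apply prod_congr rfl; intro q _
    split_ifs <;> simp
  have h01 : ∀ a : ZMod 2, (0 + a).val = if a = 1 then 1 else 0 := by decide
  have h11 : ∀ a : ZMod 2, (1 + a).val = if a = 0 then 1 else 0 := by decide
  unfold gx
  rcases z2 (x p) with h | h
  · rw [if_pos h, ← hJ 1, h]; simp only [h01]; simp
  · rw [if_neg (by rw [h]; decide), h]; simp only [h11]
    rw [hJ 0]
    have hpo : (p : ℕ) % 2 = 1 := by
      have := Nat.dvd_of_mem_primeFactors p.2
      rcases Nat.mod_two_eq_zero_or_one (p : ℕ) with h' | h'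
      · have : 2 ∣ d := (Nat.dvd_of_mod_eq_zero h').trans this
        omega
      · exact h'
    rw [jacobiSym.neg _ (Nat.odd_iff.2 hpo), ZMod.χ₄_nat_eq_if_mod_four, c4_odd hpo]
    unfold J
    have h13 : (p : ℕ) % 4 = 1 ∨ (p : ℕ) % 4 = 3 := by omega
    have hv : (1 : ZMod 2).val = 1 := by decide
    rw [hv]
    rcases h13 with h3 | h3
    · simp [h3, hpo]
    · simp [h3, hpo]

lemma gx_pm {d : ℕ} (hodd : d % 2 = 1) (x : d.primeFactors → ZMod 2) (p : d.primeFactors) :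
    gx x p = 1 ∨ gx x p = -1 := by
  have hp := Nat.prime_of_mem_primeFactors p.2
  have hne : gx x p ≠ 0 := by
    unfold gx
    apply mul_ne_zero
    · rw [prod_ne_zero_iff]; intro q _
      by_cases h : q = p
      · rw [h, show x p + x p = 0 from by rcases z2 (x p) with h | h <;> rw [h] <;> decide]; simp
      · apply pow_ne_zero; apply J_ne_zero
        rw [Nat.coprime_primes (Nat.prime_of_mem_primeFactors q.2) hp]
        exact fun h' => h (Subtype.ext h')
    · apply pow_ne_zero
      have := Nat.dvd_of_mem_primeFactors p.2
      have hpo : (p : ℕ) % 2 = 1 := by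
        rcases Nat.mod_two_eq_zero_or_one (p : ℕ) with h' | h'
        · have : 2 ∣ d := (Nat.dvd_of_mod_eq_zero h').trans this
          omega
        · exact h'
      rw [c4_odd hpo]; split_ifs <;> norm_num
  rw [gx_eq hodd] at hne ⊢
  split_ifs at hne ⊢
  · rcases J_cases (Mx x 1) p with h | h
    · exact absurd h hne
    · exact h
  · rcases jacobiSym.trichotomy (-(Mx x 0 : ℕ)) p with h | h | h
    · rw [h] at hne; simp at hne
    · rw [h]; simp
    · rw [h]; simp

lemma good_iff {d : ℕ} (hd : Squarefree d) (hodd : d % 2 = 1) (x : d.primeFactors → ZMod 2) :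
    goodSplit d (Mx x 1) ↔ ∀ p, gx x p = 1 := by
  have hm := Mx_mul hd x
  have hm1 : Mx x 1 ≠ 0 := by rintro h; rw [h, zero_mul] at hm; exact hd.ne_zero hm.symm
  have hdiv : d / Mx x 1 = Mx x 0 := Nat.div_eq_of_eq_mul_right (Nat.pos_of_ne_zero hm1) hm.symm
  unfold goodSplit
  rw [hdiv]
  constructor
  · rintro ⟨h1, h2⟩ p
    rw [gx_eq hodd]
    have hp := Nat.prime_of_mem_primeFactors p.2
    split_ifs with h
    · unfold J; rw [h1 p hp ((dvd_Mx x 0 p).2 h)]; simp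
    · rw [h2 p hp ((dvd_Mx x 1 p).2 ((z2 (x p)).resolve_left h))]; simp
  · intro h
    have hmem : ∀ e, ∀ p : ℕ, p.Prime → p ∣ Mx x e → p ∈ d.primeFactors := by
      intro e p hp hpd
      rw [Nat.mem_primeFactors]
      refine ⟨hp, hpd.trans ?_, hd.ne_zero⟩
      rcases z2 e with rfl | rfl
      · exact Dvd.intro_left _ hm
      · exact Dvd.intro _ hm
    constructor
    · intro p hp hpd
      have hx := (dvd_Mx x 0 ⟨p, hmem 0 p hp hpd⟩).1 hpd
      have := h ⟨p, hmem 0 p hp hpd⟩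
      rw [gx_eq hodd, if_pos hx] at this
      unfold J at this; exact_mod_cast this
    · intro p hp hpd
      have hx := (dvd_Mx x 1 ⟨p, hmem 1 p hp hpd⟩).1 hpd
      have := h ⟨p, hmem 1 p hp hpd⟩
      rw [gx_eq hodd, if_neg (by rw [hx]; decide)] at this
      exact_mod_cast this

lemma fcount_eq {d : ℕ} (hd : Squarefree d) (hodd : d % 2 = 1) :
    (fcount d : ℝ) = ∑ x : d.primeFactors → ZMod 2, ∏ p, ((1 + gx x p) / 2) := by
  have h1 : fcount d = (univ.filter fun x : d.primeFactors → ZMod 2 => ∀ p, gx x p = 1).card := by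
    unfold fcount
    symm
    apply card_bij (fun x _ => Mx x 1)
    · intro x hx
      rw [mem_filter, Nat.mem_divisors]
      exact ⟨⟨Dvd.intro _ (Mx_mul hd x), hd.ne_zero⟩, (good_iff hd hodd x).2 (mem_filter.1 hx).2⟩
    · intro x _ y _ hxy
      have hxy : Mx x 1 = Mx y 1 := hxy
      funext p
      have a := dvd_Mx x 1 p
      have b := dvd_Mx y 1 p
      rw [hxy] at a
      have : x p = 1 ↔ y p = 1 := a.symm.trans b
      rcases z2 (x p) with h | h <;> rcases z2 (y p) with h' | h' <;> rw [h, h'] at this ⊢ <;> simp at this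
    · intro m hm
      rw [mem_filter, Nat.mem_divisors] at hm
      obtain ⟨⟨hmd, _⟩, hg⟩ := hm
      have e : Mx (fun p : d.primeFactors => if (p : ℕ) ∣ m then (1 : ZMod 2) else 0) 1 = m := by
        unfold Mx
        have hms := hd.squarefree_of_dvd hmd
        conv_rhs => rw [← Nat.prod_primeFactors_of_squarefree hms]
        rw [← prod_image (g := fun p : d.primeFactors => (p : ℕ)) (f := fun p => p) (by intro a _ b _ h; exact Subtype.ext h)]
        congr 1
        ext p
        simp only [mem_image, mem_filter, mem_univ, true_and, Subtype.exists, Nat.mem_primeFactors]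
        constructor
        · rintro ⟨q, hq, h1, rfl⟩
          by_cases h : q ∣ m
          · exact ⟨hq.1, h, hms.ne_zero⟩
          · simp [h] at h1
        · rintro ⟨hp, hpm, _⟩
          exact ⟨p, ⟨hp, hpm.trans hmd, hd.ne_zero⟩, by simp [hpm], rfl⟩
      refine ⟨fun p => if (p : ℕ) ∣ m then 1 else 0, ?_, e⟩
      rw [mem_filter]
      exact ⟨mem_univ _, (good_iff hd hodd _).1 (by rw [e]; exact hg)⟩
  rw [h1, card_filter, Nat.cast_sum]
  apply sum_congr rfl
  intro x _
  by_cases h : ∀ p, gx x p = 1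
  · rw [if_pos h, prod_eq_one]
    · simp
    · intro p _; rw [h p]; norm_num
  · rw [if_neg h]
    push Not at h
    obtain ⟨p, hp⟩ := h
    rw [prod_eq_zero (mem_univ p)]
    · simp
    · rw [(gx_pm hodd x p).resolve_left hp]; norm_num

noncomputable def phi (k : ℕ) (u v : (Fin k → ZMod 2) × (Fin k → ZMod 2)) : ℕ :=
  (∑ i, v.2 i * (v.1 i + u.1 i)).val
noncomputable def lamb (k : ℕ) (u : (Fin k → ZMod 2) × (Fin k → ZMod 2)) : ℕ := (∑ i, u.2 i * u.1 i).val

lemma prod_pow_val {ι : Type*} (s : Finset ι) {ε : ℝ} (h : ε = 1 ∨ ε = -1) (a : ι → ZMod 2) :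
    ∏ i ∈ s, ε ^ (a i).val = ε ^ (∑ i ∈ s, a i).val := by
  induction s using Finset.induction_on with
  | empty => simp
  | insert t s ht ih =>
    rw [prod_insert ht, sum_insert ht, ih]
    have : ∀ a b : ZMod 2, ε ^ a.val * ε ^ b.val = ε ^ (a + b).val := by
      intro a b
      have e1 : (1 : ZMod 2).val = 1 := by decide
      have e2 : (1 + 1 : ZMod 2).val = 0 := by decide
      rcases z2 a with rfl | rfl <;> rcases z2 b with rfl | rfl <;> rcases h with rfl | rfl <;> simp [e1, e2]
    exact this _ _

lemma pow_pow_val (ε : ℝ) (a b : ZMod 2) : (ε ^ a.val) ^ b.val = ε ^ (b * a).val := by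
  have e1 : (1 : ZMod 2).val = 1 := by decide
  rcases z2 a with rfl | rfl <;> rcases z2 b with rfl | rfl <;> simp [e1]

def reind (P : Type*) (k : ℕ) : (P → (Fin k → ZMod 2) × (Fin k → ZMod 2)) ≃ (Fin k → P → ZMod 2) × (Fin k → P → ZMod 2) where
  toFun c := (fun i p => (c p).1 i, fun i p => (c p).2 i)
  invFun s p := (fun i => s.1 i p, fun i => s.2 i p)
  left_inv _ := rfl
  right_inv _ := rfl

lemma fcount_pow (k : ℕ) {d : ℕ} (hd : Squarefree d) (hodd : d % 2 = 1) :
    (fcount d : ℝ) ^ k = ((1/2 : ℝ) ^ k) ^ d.primeFactors.card *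
      ∑ c : d.primeFactors → (Fin k → ZMod 2) × (Fin k → ZMod 2), tj (phi k) (lamb k) (ctup c) := by
  have h1 : (fcount d : ℝ) = (1/2) ^ d.primeFactors.card *
      ∑ x : d.primeFactors → ZMod 2, ∑ y : d.primeFactors → ZMod 2, ∏ p, gx x p ^ (y p).val := by
    rw [fcount_eq hd hodd, mul_sum]
    apply sum_congr rfl; intro x _
    have : ∀ p, (1 + gx x p) / 2 = (1/2) * ∑ a : ZMod 2, gx x p ^ a.val := by
      intro p
      have : (univ : Finset (ZMod 2)) = {0, 1} := by decide
      have e1 : (1 : ZMod 2).val = 1 := by decide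
      rw [this, sum_pair (by decide)]; simp [e1]; ring
    simp only [this]
    rw [prod_mul_distrib, prod_const, card_univ, Fintype.card_coe, prod_univ_sum]
    simp
  rw [h1, mul_pow, ← pow_mul, ← pow_mul, mul_comm k]
  congr 1
  rw [← Fintype.sum_prod_type' (f := fun x y : d.primeFactors → ZMod 2 => ∏ p, gx x p ^ (y p).val), ← Fintype.sum_equiv (reind d.primeFactors k).symm
    (fun s => ∏ i, ∏ p, gx (s.1 i) p ^ (s.2 i p).val) _ ?_]
  · rw [← Fin.prod_const, prod_univ_sum]
    simp only [Fintype.piFinset_univ]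
    apply Fintype.sum_equiv (Equiv.arrowProdEquivProdArrow (Fin k) _ _)
    intro a; rfl
  · intro s
    rw [tj_ctup, prod_comm]
    rw [prod_comm (f := fun q p : d.primeFactors => J (q : ℕ) (p : ℕ) ^ phi k ((reind d.primeFactors k).symm s q) ((reind d.primeFactors k).symm s p)), ← prod_mul_distrib]
    apply prod_congr rfl; intro p _
    have hp := Nat.prime_of_mem_primeFactors p.2
    have hpo : (p : ℕ) % 2 = 1 := by
      have := Nat.dvd_of_mem_primeFactors p.2
      rcases Nat.mod_two_eq_zero_or_one (p : ℕ) with h' | h'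
      · have : 2 ∣ d := (Nat.dvd_of_mod_eq_zero h').trans this
        omega
      · exact h'
    unfold gx
    simp only [mul_pow, ← prod_pow, prod_mul_distrib]
    congr 1
    · rw [prod_comm]
      apply prod_congr rfl; intro q _
      simp only [pow_pow_val]
      by_cases h : q = p
      · have : ∀ a : ZMod 2, a + a = 0 := by decide
        subst h
        unfold phi
        simp [this]
      · rw [prod_pow_val]
        · rfl
        · have := J_ne_zero ((Nat.coprime_primes (Nat.prime_of_mem_primeFactors q.2) hp).2 (fun h' => h (Subtype.ext h')))
          exact (J_cases q p).resolve_left this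
    · simp only [pow_pow_val]
      rw [prod_pow_val]
      · rfl
      · rw [c4_odd hpo]; split_ifs <;> simp

end FK

namespace FK
open Finset

noncomputable def sg (a : ZMod 2) : ℝ := (-1) ^ a.val

lemma sg_zero : sg 0 = 1 := by simp [sg]
lemma sg_one : sg 1 = -1 := by
  have e1 : (1 : ZMod 2).val = 1 := by decide
  simp [sg, e1]
lemma sg_add (a b : ZMod 2) : sg (a + b) = sg a * sg b := by
  have e2 : (1 + 1 : ZMod 2) = 0 := by decide
  rcases z2 a with rfl | rfl <;> rcases z2 b with rfl | rfl <;> simp [sg_zero, sg_one, e2]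

lemma z2n {a : ZMod 2} (h : a ≠ 0) : a = 1 := (z2 a).resolve_left h

section
variable {G : Type*} [AddCommGroup G] [Fintype G]

lemma orth (hG : ∀ x : G, x + x = 0) (W : Finset G) (hW : ∀ x ∈ W, ∀ y ∈ W, x + y ∈ W)
    (f : G → ZMod 2) (hf : ∀ x y, f (x + y) = f x + f y) :
    ∑ w ∈ W, sg (f w) = if ∀ w ∈ W, f w = 0 then (W.card : ℝ) else 0 := by
  split_ifs with h
  · rw [sum_congr rfl (fun w hw => by rw [h w hw, sg_zero]), sum_const, nsmul_eq_mul, mul_one]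
  · push Not at h
    obtain ⟨w0, hw0, hf0⟩ := h
    have key : ∑ w ∈ W, sg (f w) = ∑ w ∈ W, -sg (f w) := by
      apply sum_nbij' (fun w => w + w0) (fun w => w + w0)
      · intro w hw; exact hW w hw w0 hw0
      · intro w hw; exact hW w hw w0 hw0
      · intro w _; simp [add_assoc, hG]
      · intro w _; simp [add_assoc, hG]
      · intro w _; rw [hf, z2n hf0, sg_add, sg_one]; ring
    rw [sum_neg_distrib] at key
    linarith

lemma perp_card (hG : ∀ x : G, x + x = 0) (β : G → G → ZMod 2) (hl : ∀ x y z, β (x + y) z = β x z + β y z)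
    (hr : ∀ x y z, β z (x + y) = β z x + β z y) (hn : ∀ x, (∀ y, β x y = 0) → x = 0)
    (W : Finset G) (h0 : 0 ∈ W) (hW : ∀ x ∈ W, ∀ y ∈ W, x + y ∈ W) :
    W.card * (univ.filter fun y => ∀ x ∈ W, β x y = 0).card = Fintype.card G := by
  have h1 : ∑ y : G, ∑ x ∈ W, sg (β x y) = (W.card * (univ.filter fun y => ∀ x ∈ W, β x y = 0).card : ℕ) := by
    rw [sum_congr rfl (fun y _ => orth hG W hW (fun x => β x y) (fun a b => hl a b y)), ← sum_filter, sum_const,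
      nsmul_eq_mul, Nat.cast_mul, mul_comm]
  have h2 : ∑ y : G, ∑ x ∈ W, sg (β x y) = (Fintype.card G : ℝ) := by
    rw [sum_comm, sum_congr rfl (fun x _ => orth hG univ (fun _ _ _ _ => mem_univ _) (fun y => β x y) (fun a b => hr a b x)),
      sum_eq_single_of_mem 0 h0]
    · rw [if_pos, card_univ]
      intro y _
      have := hl 0 0 y
      rw [add_zero] at this
      exact left_eq_add.1 this
    · intro x _ hx
      rw [if_neg]
      intro h; exact hx (hn x fun y => h y (mem_univ y))
  exact_mod_cast h1.symm.trans h2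

end

abbrev VV (k : ℕ) := Fin k → ZMod 2

lemma v2 {k : ℕ} (x : VV k) : x + x = 0 := by
  funext i; have : ∀ a : ZMod 2, a + a = 0 := by decide
  exact this _
lemma vv2 {k : ℕ} (x : VV k × VV k) : x + x = 0 := Prod.ext (v2 _) (v2 _)
lemma cc {k : ℕ} (c x : VV k × VV k) : c + (c + x) = x := by rw [← add_assoc, vv2, zero_add]

noncomputable def q {k : ℕ} (u : VV k × VV k) : ZMod 2 := u.1 ⬝ᵥ u.2
noncomputable def pol {k : ℕ} (u v : VV k × VV k) : ZMod 2 := u.1 ⬝ᵥ v.2 + v.1 ⬝ᵥ u.2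

lemma q_add {k : ℕ} (u v : VV k × VV k) : q (u + v) = q u + q v + pol u v := by
  unfold q pol; simp only [Prod.fst_add, Prod.snd_add, add_dotProduct, dotProduct_add]; ring

lemma phi_def (k : ℕ) (u v : VV k × VV k) : phi k u v = (v.2 ⬝ᵥ (v.1 + u.1)).val := rfl

lemma phi_iff {k : ℕ} (u v : VV k × VV k) : phi k u v = phi k v u ↔ q (u + v) = 0 := by
  rw [phi_def, phi_def, (ZMod.val_injective 2).eq_iff]
  unfold q
  simp only [Prod.fst_add, Prod.snd_add, add_dotProduct, dotProduct_add]
  rw [dotProduct_comm v.2 v.1, dotProduct_comm v.2 u.1, dotProduct_comm u.2 u.1, dotProduct_comm u.2 v.1]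
  generalize v.1 ⬝ᵥ v.2 = a, u.1 ⬝ᵥ v.2 = b, u.1 ⬝ᵥ u.2 = c, v.1 ⬝ᵥ u.2 = d
  revert a b c d; decide

lemma dot_nondeg {k : ℕ} (x : VV k) (h : ∀ y, x ⬝ᵥ y = 0) : x = 0 := dotProduct_eq_zero x h

lemma pol_comm {k : ℕ} (u v : VV k × VV k) : pol u v = pol v u := by unfold pol; ring
lemma pol_add {k : ℕ} (u v w : VV k × VV k) : pol (u + v) w = pol u w + pol v w := by
  unfold pol; simp only [Prod.fst_add, Prod.snd_add, add_dotProduct, dotProduct_add]; ring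
lemma pol_nondeg {k : ℕ} (u : VV k × VV k) (h : ∀ v, pol u v = 0) : u = 0 := by
  apply Prod.ext
  · apply dot_nondeg; intro y; have := h (0, y); unfold pol at this; simpa using this
  · apply dot_nondeg; intro y; have := h (y, 0); unfold pol at this; rw [dotProduct_comm]; simpa using this

lemma iso_le {k : ℕ} (W : Finset (VV k × VV k)) (h0 : 0 ∈ W) (hW : ∀ x ∈ W, ∀ y ∈ W, x + y ∈ W)
    (hp : ∀ x ∈ W, ∀ y ∈ W, pol x y = 0) :
    W.card ≤ 2 ^ k ∧ (W.card = 2 ^ k → ∀ y, (∀ x ∈ W, pol x y = 0) → y ∈ W) := by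
  have h1 := perp_card vv2 pol pol_add (fun x y z => by rw [pol_comm, pol_add, pol_comm x, pol_comm y]) pol_nondeg W h0 hW
  have h2 : W ⊆ univ.filter fun y => ∀ x ∈ W, pol x y = 0 := by
    intro y hy; rw [mem_filter]; exact ⟨mem_univ _, fun x hx => hp x hx y hy⟩
  have h4 := card_le_card h2
  set P := univ.filter fun y => ∀ x ∈ W, pol x y = 0 with hP
  have h3 : W.card * P.card = 2 ^ k * 2 ^ k := by
    have h3 : W.card * P.card = Fintype.card (VV k × VV k) := by convert h1
    rw [h3]; simp [ZMod.card]
  clear h1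
  constructor
  · by_contra! hlt
    have : 2 ^ k * 2 ^ k < W.card * W.card := Nat.mul_lt_mul'' hlt hlt
    have := Nat.mul_le_mul_left W.card h4
    omega
  · intro hc y hy
    have h6 : 0 < 2 ^ k := by positivity
    have h5 : W = P := by
      apply eq_of_subset_of_card_le h2
      rw [hc] at h3 ⊢
      exact (Nat.eq_of_mul_eq_mul_left h6 h3).le
    have h7 : y ∈ P := by rw [hP, mem_filter]; exact ⟨mem_univ _, hy⟩
    rw [h5]; exact h7

lemma unl_iff {k : ℕ} (B : Finset (VV k × VV k)) : unl (phi k) B ↔ ∀ u ∈ B, ∀ v ∈ B, q (u + v) = 0 := by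
  unfold unl; simp only [phi_iff]

lemma unl_struct {k : ℕ} {B : Finset (VV k × VV k)} (hB : unl (phi k) B) {c : VV k × VV k} (hc : c ∈ B) :
    ∃ W : Finset (VV k × VV k), 0 ∈ W ∧ (∀ x ∈ W, ∀ y ∈ W, x + y ∈ W) ∧ (∀ x ∈ W, ∀ y ∈ W, pol x y = 0) ∧
      (∀ u ∈ B, c + u ∈ W) := by
  rw [unl_iff] at hB
  set S := Submodule.span (ZMod 2) {x | ∃ u ∈ B, x = c + u} with hS
  have hgen : ∀ x y, (∃ u ∈ B, x = c + u) → (∃ u ∈ B, y = c + u) → pol x y = 0 := by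
    rintro x y ⟨u, hu, rfl⟩ ⟨v, hv, rfl⟩
    have h1 := q_add (c + u) (c + v)
    rw [hB c hc u hu, hB c hc v hv] at h1
    have h2 : c + u + (c + v) = u + v := by rw [add_comm c u, add_assoc, cc]
    rw [h2, hB u hu v hv] at h1
    simpa using h1.symm
  have z1 : ∀ y : VV k × VV k, pol 0 y = 0 := by intro y; unfold pol; simp
  have zs : ∀ (a : ZMod 2) (x y : VV k × VV k), pol x y = 0 → pol (a • x) y = 0 := by
    intro a x y h
    rcases z2 a with rfl | rfl
    · rw [zero_smul]; exact z1 y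
    · rwa [one_smul]
  have hp : ∀ x ∈ S, ∀ y ∈ S, pol x y = 0 := by
    intro x hx y hy
    induction hx using Submodule.span_induction with
    | mem x hx =>
      induction hy using Submodule.span_induction with
      | mem y hy => exact hgen x y hx hy
      | zero => rw [pol_comm]; exact z1 _
      | add y z _ _ h1 h2 => rw [pol_comm, pol_add, pol_comm y, pol_comm z, h1, h2, add_zero]
      | smul a y _ h1 => rw [pol_comm]; exact zs a y x (by rw [pol_comm]; exact h1)
    | zero => exact z1 _
    | add x z _ _ h1 h2 => rw [pol_add, h1, h2, add_zero]
    | smul a x _ h1 => exact zs a x y h1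
  refine ⟨univ.filter (· ∈ S), ?_, ?_, ?_, ?_⟩
  · simp [S.zero_mem]
  · intro x hx y hy; simp only [mem_filter, mem_univ, true_and] at *; exact S.add_mem hx hy
  · intro x hx y hy; simp only [mem_filter, mem_univ, true_and] at *; exact hp x hx y hy
  · intro u hu; simp only [mem_filter, mem_univ, true_and]; exact Submodule.subset_span ⟨u, hu, rfl⟩

lemma C1 {k : ℕ} (B : Finset (VV k × VV k)) (hB : unl (phi k) B) : B.card ≤ 2 ^ k := by
  rcases B.eq_empty_or_nonempty with rfl | ⟨c, hc⟩
  · simp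
  obtain ⟨W, h0, hW, hp, hBW⟩ := unl_struct hB hc
  refine le_trans ?_ (iso_le W h0 hW hp).1
  apply card_le_card_of_injOn (fun u => c + u) hBW
  intro a _ b _ h; exact add_left_cancel h

/-- full structure of the maximal unlinked sets -/
lemma max_struct {k : ℕ} {B : Finset (VV k × VV k)} (hB : unl (phi k) B) (hcard : B.card = 2 ^ k)
    {c : VV k × VV k} (hc : c ∈ B) :
    ∃ W : Finset (VV k × VV k), 0 ∈ W ∧ (∀ x ∈ W, ∀ y ∈ W, x + y ∈ W) ∧ (∀ x ∈ W, ∀ y ∈ W, pol x y = 0) ∧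
      (∀ u, u ∈ B ↔ c + u ∈ W) ∧ (∀ x ∈ W, q x = 0) ∧ (∀ y, (∀ x ∈ W, pol x y = 0) → y ∈ W) := by
  obtain ⟨W, h0, hW, hp, hBW⟩ := unl_struct hB hc
  have hle := iso_le W h0 hW hp
  have himg : B.image (fun u => c + u) = W := by
    apply eq_of_subset_of_card_le
    · intro x hx; obtain ⟨u, hu, rfl⟩ := mem_image.1 hx; exact hBW u hu
    · rw [card_image_of_injective _ (add_right_injective c), hcard]; exact hle.1
  have hiff : ∀ u, u ∈ B ↔ c + u ∈ W := by
    intro u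
    refine ⟨hBW u, fun h => ?_⟩
    rw [← himg] at h
    obtain ⟨v, hv, e⟩ := mem_image.1 h
    rwa [← add_left_cancel e]
  refine ⟨W, h0, hW, hp, hiff, ?_, ?_⟩
  · intro x hx
    rw [← cc c x]
    rw [unl_iff] at hB
    apply hB c hc
    rw [hiff, cc]; exact hx
  · apply hle.2
    rw [← himg, card_image_of_injective _ (add_right_injective c), hcard]

lemma C2 {k : ℕ} (B : Finset (VV k × VV k)) (hB : unl (phi k) B) (hcard : B.card = 2 ^ k) (w : VV k × VV k)
    (hw : w ∉ B) : (∃ u ∈ B, phi k w u ≠ phi k u w) ∧ ∃ v ∈ B, phi k w v = phi k v w := by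
  constructor
  · by_contra! hcon
    have h1 : unl (phi k) (insert w B) := by
      intro u hu v hv
      rcases mem_insert.1 hu with hu | hu <;> rcases mem_insert.1 hv with hv | hv
      · rw [hu, hv]
      · rw [hu]; exact hcon v hv
      · rw [hv]; exact (hcon u hu).symm
      · exact hB u hu v hv
    have := C1 _ h1
    rw [card_insert_of_notMem hw] at this
    omega
  · by_contra! hcon
    obtain ⟨c, hc⟩ : B.Nonempty := by rw [← card_pos, hcard]; positivity
    obtain ⟨W, h0, hW, hp, hiff, hq, hmax⟩ := max_struct hB hcard hc
    apply hw
    rw [hiff]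
    apply hmax
    intro s hs
    have hl : ∀ v ∈ B, q (w + v) = 1 := fun v hv => z2n fun h => hcon v hv ((phi_iff w v).2 h)
    have h1 := hl c hc
    have h2 := hl (c + s) (by rw [hiff, cc]; exact hs)
    have h3 := q_add s (c + w)
    have e1 : s + (c + w) = w + (c + s) := by abel
    rw [e1, h2, add_comm c w, h1, hq s hs, zero_add, add_comm w c] at h3
    exact left_eq_add.1 h3

end FK

namespace FK
open Finset

lemma sg_sum {ι : Type*} (s : Finset ι) (f : ι → ZMod 2) : sg (∑ i ∈ s, f i) = ∏ i ∈ s, sg (f i) := by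
  induction s using Finset.induction_on with
  | empty => simp [sg_zero]
  | insert a s ha ih => rw [prod_insert ha, sum_insert ha, sg_add, ih]

section
variable {k : ℕ}

noncomputable def ph (u v : VV k × VV k) : ZMod 2 := v.2 ⬝ᵥ (v.1 + u.1)
noncomputable def Ar (r : VV k × VV k → ℕ) (u v : VV k × VV k) : ZMod 2 := if r u < r v then ph u v else 0
noncomputable def Qf (r : VV k × VV k → ℕ) (N : Finset (VV k × VV k)) : ZMod 2 :=
  ∑ u ∈ N, ∑ v ∈ N, Ar r u v + ∑ u ∈ N, q u

lemma sgn_eq (r : VV k × VV k → ℕ) (N : Finset (VV k × VV k)) :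
    sgn (phi k) (lamb k) r N = sg (Qf r N) := by
  unfold sgn Qf
  rw [sg_add, sg_sum, sg_sum]
  congr 1
  · apply prod_congr rfl; intro u _
    rw [sg_sum]
    apply prod_congr rfl; intro v _
    unfold Ar
    split_ifs
    · rfl
    · exact sg_zero.symm
  · apply prod_congr rfl; intro u _
    have : q u = u.2 ⬝ᵥ u.1 := dotProduct_comm _ _
    rw [this]; rfl

lemma cB_eq (r : VV k × VV k → ℕ) (B : Finset (VV k × VV k)) :
    cB (phi k) (lamb k) r B = (1/2) ^ B.card * ∑ N ∈ B.powerset, sg (Qf r N) * (1 - (-1) ^ N.card) := by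
  unfold cB fh
  rw [← mul_sub, ← sum_sub_distrib]
  congr 1
  apply sum_congr rfl; intro N hN
  rw [prod_pm (mem_powerset.1 hN), prod_empty, sgn_eq]; ring

lemma ph_symm {u v : VV k × VV k} (h : q (u + v) = 0) : ph u v = ph v u := by
  have := (phi_iff u v).2 h
  exact ZMod.val_injective 2 this

lemma ph_self (u : VV k × VV k) : ph u u = 0 := by unfold ph; rw [v2, dotProduct_zero]

lemma Ar_add {r : VV k × VV k → ℕ} (hr : Function.Injective r) {u v : VV k × VV k} (h : q (u + v) = 0) :
    Ar r u v + Ar r v u = ph v u := by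
  unfold Ar
  rcases lt_trichotomy (r u) (r v) with h1 | h1 | h1
  · rw [if_pos h1, if_neg (by omega), add_zero, ph_symm h]
  · rw [hr h1, ph_self]; simp
  · rw [if_neg (by omega), if_pos h1, zero_add]

noncomputable def ind (N : Finset (VV k × VV k)) (u : VV k × VV k) : ZMod 2 := if u ∈ N then 1 else 0

lemma sum_ind (N : Finset (VV k × VV k)) (f : VV k × VV k → ZMod 2) : ∑ u ∈ N, f u = ∑ u, ind N u * f u := by
  unfold ind; simp

lemma ind_symmDiff (N E : Finset (VV k × VV k)) (u) : ind (symmDiff N E) u = ind N u + ind E u := by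
  unfold ind
  have : (1 + 1 : ZMod 2) = 0 := by decide
  by_cases h1 : u ∈ N <;> by_cases h2 : u ∈ E <;> simp [mem_symmDiff, h1, h2, this]

lemma sum_symmDiff (N E : Finset (VV k × VV k)) (f : VV k × VV k → ZMod 2) :
    ∑ u ∈ symmDiff N E, f u = ∑ u ∈ N, f u + ∑ u ∈ E, f u := by
  rw [sum_ind, sum_ind N, sum_ind E, ← sum_add_distrib]
  apply sum_congr rfl; intro u _; rw [ind_symmDiff]; ring

lemma neg_one_pow_card (N : Finset (VV k × VV k)) : (-1 : ℝ) ^ N.card = sg (∑ _u ∈ N, 1) := by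
  rw [sg_sum, sg_one, prod_const]

lemma Qf_symmDiff {r : VV k × VV k → ℕ} (hr : Function.Injective r) {N E : Finset (VV k × VV k)}
    (h : ∀ u ∈ N, ∀ v ∈ E, q (u + v) = 0) :
    Qf r (symmDiff N E) = Qf r N + Qf r E + ∑ u ∈ N, ∑ v ∈ E, ph v u := by
  have e : ∑ u ∈ N, ∑ v ∈ E, ph v u = ∑ u ∈ N, ∑ v ∈ E, Ar r u v + ∑ u ∈ E, ∑ v ∈ N, Ar r u v := by
    rw [sum_comm (s := E), ← sum_add_distrib]
    apply sum_congr rfl; intro u hu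
    rw [← sum_add_distrib]
    apply sum_congr rfl; intro v hv
    rw [Ar_add hr (h u hu v hv)]
  rw [e]
  unfold Qf
  simp only [sum_symmDiff, sum_add_distrib]
  ring

lemma sum4 {ι M : Type*} [DecidableEq ι] [AddCommMonoid M] {a b c d : ι} (h1 : a ≠ b) (h2 : a ≠ c) (h3 : a ≠ d) (h4 : b ≠ c)
    (h5 : b ≠ d) (h6 : c ≠ d) (f : ι → M) : ∑ u ∈ ({a, b, c, d} : Finset ι), f u = f a + (f b + (f c + f d)) := by
  rw [sum_insert (by simp [h1, h2, h3]), sum_insert (by simp [h4, h5]), sum_pair h6]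

lemma q_coset {W : Finset (VV k × VV k)} (hW : ∀ x ∈ W, ∀ y ∈ W, x + y ∈ W) (hq : ∀ x ∈ W, q x = 0) {c : VV k × VV k}
    {u v : VV k × VV k} (hu : u ∈ W.image (c + ·)) (hv : v ∈ W.image (c + ·)) : q (u + v) = 0 := by
  obtain ⟨a, ha, rfl⟩ := mem_image.1 hu
  obtain ⟨b, hb, rfl⟩ := mem_image.1 hv
  have : c + a + (c + b) = a + b := by rw [add_comm c a, add_assoc, cc]
  simp only [this]; exact hq _ (hW a ha b hb)

set_option maxHeartbeats 1000000 in
lemma bad_zero {r : VV k × VV k → ℕ} (hr : Function.Injective r) {W : Finset (VV k × VV k)} (h0 : 0 ∈ W)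
    (hW : ∀ x ∈ W, ∀ y ∈ W, x + y ∈ W) (hp : ∀ x ∈ W, ∀ y ∈ W, pol x y = 0) (hq : ∀ x ∈ W, q x = 0)
    {w w' : VV k × VV k} (hw : w ∈ W) (hw' : w' ∈ W) (hb : w.1 ⬝ᵥ w'.2 ≠ 0) (c : VV k × VV k) :
    cB (phi k) (lamb k) r (W.image (c + ·)) = 0 := by
  have hb1 := z2n hb
  have hb2 : w'.1 ⬝ᵥ w.2 = 1 := by
    have := hp w hw w' hw'
    unfold pol at this
    rw [hb1] at this
    apply z2n; intro h; rw [h] at this; simp at this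
  have qw : w.1 ⬝ᵥ w.2 = 0 := hq w hw
  have qw' : w'.1 ⬝ᵥ w'.2 = 0 := hq w' hw'
  have n1 : w ≠ 0 := by rintro rfl; simp at hb
  have n2 : w' ≠ 0 := by rintro rfl; simp at hb
  have n3 : w ≠ w' := by rintro rfl; exact hb qw
  have n4 : w + w' ≠ 0 := by
    intro h; apply n3
    have := congrArg (w + ·) h
    simp only [cc, add_zero] at this
    exact this.symm
  have d1 : c ≠ c + w := by intro h; exact n1 (left_eq_add.1 h)
  have d2 : c ≠ c + w' := by intro h; exact n2 (left_eq_add.1 h)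
  have d3 : c ≠ c + (w + w') := by intro h; exact n4 (left_eq_add.1 h)
  have d4 : c + w ≠ c + w' := by intro h; exact n3 (add_left_cancel h)
  have d5 : c + w ≠ c + (w + w') := by intro h; exact n2 (left_eq_add.1 (add_left_cancel h))
  have d6 : c + w' ≠ c + (w + w') := by intro h; exact n1 (right_eq_add.1 (add_left_cancel h))
  set B := W.image (c + ·) with hB
  have m : ∀ x ∈ W, c + x ∈ B := fun x hx => mem_image_of_mem _ hx
  have m1 : c ∈ B := by have := m 0 h0; rwa [add_zero] at this
  have m2 := m w hw
  have m3 := m w' hw'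
  have m4 := m _ (hW w hw w' hw')
  have hqq : ∀ {u v}, u ∈ B → v ∈ B → q (u + v) = 0 := fun hu hv => q_coset hW hq hu hv
  set E : Finset (VV k × VV k) := {c, c + w, c + w', c + (w + w')} with hE
  have hEB : E ⊆ B := by
    intro x hx
    rw [hE] at hx
    simp only [mem_insert, mem_singleton] at hx
    rcases hx with rfl | rfl | rfl | rfl <;> assumption
  have hsum : ∀ f : VV k × VV k → ZMod 2, ∑ u ∈ E, f u = f c + (f (c + w) + (f (c + w') + f (c + (w + w')))) :=
    fun f => sum4 d1 d2 d3 d4 d5 d6 f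
  have hA0 : ∀ u, Ar r u u = 0 := by intro u; unfold Ar; simp
  have hQE : Qf r E = 1 := by
    have p12 := Ar_add hr (hqq m1 m2)
    have p13 := Ar_add hr (hqq m1 m3)
    have p14 := Ar_add hr (hqq m1 m4)
    have p23 := Ar_add hr (hqq m2 m3)
    have p24 := Ar_add hr (hqq m2 m4)
    have p34 := Ar_add hr (hqq m3 m4)
    have e : Qf r E = (ph (c + w) c + ph (c + w') c + ph (c + (w + w')) c + ph (c + w') (c + w) +
        ph (c + (w + w')) (c + w) + ph (c + (w + w')) (c + w')) + (q c + q (c + w) + q (c + w') + q (c + (w + w'))) := by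
      unfold Qf
      simp only [hsum, hA0]
      linear_combination p12 + p13 + p14 + p23 + p24 + p34
    rw [e]
    unfold ph q
    simp only [Prod.fst_add, Prod.snd_add, add_dotProduct, dotProduct_add]
    rw [dotProduct_comm w.2 w.1, dotProduct_comm w.2 w'.1, dotProduct_comm w'.2 w.1, dotProduct_comm w'.2 w'.1,
      dotProduct_comm c.2 c.1, dotProduct_comm c.2 w.1, dotProduct_comm c.2 w'.1, dotProduct_comm w.2 c.1, dotProduct_comm w'.2 c.1,
      qw, qw', hb1, hb2]
    generalize c.1 ⬝ᵥ c.2 = a1, w.1 ⬝ᵥ c.2 = a2, w'.1 ⬝ᵥ c.2 = a3, c.1 ⬝ᵥ w.2 = a4, c.1 ⬝ᵥ w'.2 = a5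
    revert a1 a2 a3 a4 a5; decide
  have hcross : ∀ u, ∑ v ∈ E, ph v u = 0 := by
    intro u
    rw [hsum]
    unfold ph
    simp only [Prod.fst_add, dotProduct_add]
    generalize u.2 ⬝ᵥ u.1 = a1, u.2 ⬝ᵥ c.1 = a2, u.2 ⬝ᵥ w.1 = a3, u.2 ⬝ᵥ w'.1 = a4
    revert a1 a2 a3 a4; decide
  have hQ : ∀ N ∈ B.powerset, Qf r (symmDiff N E) = Qf r N + 1 := by
    intro N hN
    rw [Qf_symmDiff hr (fun u hu v hv => hqq (mem_powerset.1 hN hu) (hEB hv)), hQE, sum_eq_zero (fun u _ => hcross u), add_zero]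
  have hpar : ∀ N : Finset (VV k × VV k), (-1 : ℝ) ^ (symmDiff N E).card = (-1) ^ N.card := by
    intro N
    have : (1 + (1 + (1 + 1)) : ZMod 2) = 0 := by decide
    rw [neg_one_pow_card, neg_one_pow_card, sum_symmDiff, hsum, this, add_zero]
  have hmem : ∀ N ∈ B.powerset, symmDiff N E ∈ B.powerset := by
    intro N hN
    rw [mem_powerset] at hN ⊢
    intro x hx
    rcases mem_symmDiff.1 hx with h | h
    · exact hN h.1
    · exact hEB h.1
  rw [cB_eq]
  have key : ∑ N ∈ B.powerset, sg (Qf r N) * (1 - (-1) ^ N.card) =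
      ∑ N ∈ B.powerset, -(sg (Qf r N) * (1 - (-1) ^ N.card)) := by
    apply sum_nbij' (fun N => symmDiff N E) (fun N => symmDiff N E) hmem hmem
    · intro N _; exact symmDiff_symmDiff_cancel_right _ _
    · intro N _; exact symmDiff_symmDiff_cancel_right _ _
    · intro N hN
      rw [hpar, hQ N hN, sg_add, sg_one]; ring
  rw [sum_neg_distrib] at key
  have : ∑ N ∈ B.powerset, sg (Qf r N) * (1 - (-1) ^ N.card) = 0 := by linarith
  rw [this, mul_zero]

lemma sum_sg_q : ∑ c : VV k × VV k, sg (q c) = 2 ^ k := by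
  rw [Fintype.sum_prod_type]
  unfold q
  simp only
  rw [sum_congr rfl (fun x _ => orth v2 univ (fun _ _ _ _ => mem_univ _) (fun y => x ⬝ᵥ y) (fun a b => dotProduct_add x a b)),
    sum_eq_single_of_mem 0 (mem_univ _)]
  · simp [ZMod.card]
  · intro x _ hx
    rw [if_neg]
    intro h; exact hx (dot_nondeg x fun y => h y (mem_univ y))

lemma good_sum {r : VV k × VV k → ℕ} (hr : Function.Injective r) {W : Finset (VV k × VV k)} (h0 : 0 ∈ W)
    (hW : ∀ x ∈ W, ∀ y ∈ W, x + y ∈ W) (hq : ∀ x ∈ W, q x = 0)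
    (hb : ∀ x ∈ W, ∀ y ∈ W, x.1 ⬝ᵥ y.2 = 0) :
    ∑ c, cB (phi k) (lamb k) r (W.image (c + ·)) = 2 ^ k := by
  have hpol : ∀ x ∈ W, ∀ y ∈ W, pol x y = 0 := by
    intro x hx y hy; unfold pol; rw [hb x hx y hy, hb y hy x hx, add_zero]
  have hsW : ∀ N ⊆ W, ∑ x ∈ N, x ∈ W := by
    intro N
    induction N using Finset.induction_on with
    | empty => intro _; simpa using h0
    | insert a s ha ih =>
      intro h; rw [sum_insert ha]
      exact hW _ (h (mem_insert_self _ _)) _ (ih ((subset_insert _ _).trans h))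
  have hpow : ∀ c, ∑ N ∈ (W.image (c + ·)).powerset, sg (Qf r N) * (1 - (-1) ^ N.card) =
      ∑ N ∈ W.powerset, sg (q (c + ∑ x ∈ N, x)) * (1 - (-1) ^ N.card) := by
    intro c
    have hinv : ∀ N : Finset (VV k × VV k), (N.image (c + ·)).image (c + ·) = N := by
      intro N; rw [image_image]
      have : ((c + ·) ∘ (c + ·) : VV k × VV k → VV k × VV k) = id := by funext x; exact cc c x
      rw [this, image_id]
    symm
    apply sum_nbij' (fun N => N.image (c + ·)) (fun N => N.image (c + ·))
    · intro N hN; rw [mem_powerset] at hN ⊢; exact image_subset_image hN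
    · intro N hN; rw [mem_powerset] at hN ⊢; have := image_subset_image (f := (c + ·)) hN; rwa [hinv] at this
    · intro N _; exact hinv N
    · intro N _; exact hinv N
    · intro N hN
      rw [mem_powerset] at hN
      have hinj : Set.InjOn (c + ·) (N : Set (VV k × VV k)) := (add_right_injective c).injOn
      rw [card_image_of_injOn hinj]
      rcases Nat.even_or_odd N.card with hev | hodd
      · rw [hev.neg_one_pow]; simp
      congr 2
      have hcard : (∑ _x ∈ N, (1 : ZMod 2)) = 1 := by
        rw [sum_const, nsmul_eq_mul, mul_one]
        exact (ZMod.natCast_eq_one_iff_odd).2 hodd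
      -- linear part
      have hlin : ∑ u ∈ N.image (c + ·), q u = q (c + ∑ x ∈ N, x) := by
        rw [sum_image hinj]
        have e1 : ∀ x ∈ N, q (c + x) = q c * 1 + pol c x := by
          intro x hx; rw [q_add, hq x (hN hx)]; ring
        rw [sum_congr rfl e1, sum_add_distrib, ← mul_sum, hcard, q_add, hq _ (hsW N hN)]
        have e2 : ∀ s : Finset (VV k × VV k), pol c (∑ x ∈ s, x) = ∑ x ∈ s, pol c x := by
          intro s
          induction s using Finset.induction_on with
          | empty => unfold pol; simp
          | insert a s ha ih => rw [sum_insert ha, sum_insert ha, pol_comm, pol_add, pol_comm a, pol_comm _ c, ih]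
        rw [e2]; ring
      have hquad : ∑ u ∈ N.image (c + ·), ∑ v ∈ N.image (c + ·), Ar r u v = 0 := by
        set M := N.image (c + ·) with hM
        set f : VV k × VV k → ZMod 2 := fun u => c.2 ⬝ᵥ u.1 with hf
        have hMc : (∑ _x ∈ M, (1 : ZMod 2)) = 1 := by rw [hM, sum_image hinj]; exact hcard
        have e1 : ∀ u ∈ M, ∀ v ∈ M, ph u v = f u + f v := by
          intro u hu v hv
          obtain ⟨a, ha, rfl⟩ := mem_image.1 hu
          obtain ⟨b, hb', rfl⟩ := mem_image.1 hv
          have b1 := hb a (hN ha) b (hN hb')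
          have b2 := hb b (hN hb') b (hN hb')
          rw [hf]; unfold ph
          simp only [Prod.fst_add, Prod.snd_add, add_dotProduct, dotProduct_add]
          rw [dotProduct_comm b.2 a.1, dotProduct_comm b.2 b.1, b1, b2]
          generalize c.2 ⬝ᵥ c.1 = a1, c.2 ⬝ᵥ a.1 = a2, c.2 ⬝ᵥ b.1 = a3, b.2 ⬝ᵥ c.1 = a4
          revert a1 a2 a3 a4; decide
        set g : VV k × VV k → VV k × VV k → ZMod 2 := fun u v => if r u < r v then 1 else 0 with hg
        have e2 : ∀ u ∈ M, ∀ v ∈ M, Ar r u v = g u v * f u + g u v * f v := by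
          intro u hu v hv
          unfold Ar
          rw [hg, e1 u hu v hv]
          simp only; split_ifs <;> simp
        rw [sum_congr rfl (fun u hu => sum_congr rfl (fun v hv => e2 u hu v hv))]
        simp only [sum_add_distrib]
        rw [sum_comm (f := fun u v => g u v * f v), ← sum_add_distrib]
        apply sum_eq_zero
        intro u hu
        rw [← sum_add_distrib]
        have e3 : ∀ v ∈ M, g u v * f u + g v u * f u = f u * (1 + if v = u then 1 else 0) := by
          intro v _
          rw [hg]
          have h11 : (1 + 1 : ZMod 2) = 0 := by decide
          rcases lt_trichotomy (r u) (r v) with h1 | h1 | h1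
          · have : v ≠ u := by rintro rfl; omega
            simp [h1, this, not_lt.2 h1.le]
          · have : u = v := hr h1
            subst this
            simp [h11]
          · have : v ≠ u := by rintro rfl; omega
            simp [h1, this, not_lt.2 h1.le]
        rw [sum_congr rfl e3, ← mul_sum, sum_add_distrib, hMc, sum_ite_eq' M u, if_pos hu]
        have h11 : (1 + 1 : ZMod 2) = 0 := by decide
        rw [h11, mul_zero]
      unfold Qf
      rw [hquad, hlin, zero_add]
  have hcc : ∀ c, (W.image (c + ·)).card = W.card := fun c => card_image_of_injective _ (add_right_injective c)
  simp only [cB_eq, hpow, hcc]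
  rw [← mul_sum, sum_comm]
  have e1 : ∀ N ∈ W.powerset, ∑ c, sg (q (c + ∑ x ∈ N, x)) * (1 - (-1) ^ N.card) = 2 ^ k * (1 - (-1) ^ N.card) := by
    intro N _
    rw [← sum_mul, ← sum_sg_q]
    congr 1
    exact Fintype.sum_equiv (Equiv.addRight (∑ x ∈ N, x)) _ _ (fun _ => rfl)
  rw [sum_congr rfl e1, ← mul_sum, sum_sub_distrib, sum_const, card_powerset]
  have e2 : ∑ N ∈ W.powerset, (-1 : ℝ) ^ N.card = 0 := by
    have := sum_powerset_neg_one_pow_card_of_nonempty (x := W) ⟨0, h0⟩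
    exact_mod_cast congrArg (fun z : ℤ => (z : ℝ)) this
  rw [e2, sub_zero, nsmul_eq_mul, mul_one]
  push_cast
  rw [mul_comm ((2 : ℝ) ^ k), ← mul_assoc, ← mul_pow]
  norm_num

end
end FK

namespace FK
open Finset

section
variable {k : ℕ}

noncomputable def BB (k : ℕ) : Finset (Finset (VV k × VV k)) :=
  univ.filter (fun B => unl (phi k) B ∧ B.card = 2 ^ k)

lemma mem_BB (B : Finset (VV k × VV k)) : B ∈ BB k ↔ unl (phi k) B ∧ B.card = 2 ^ k := by
  unfold BB; simp

lemma img_inv (c : VV k × VV k) (N : Finset (VV k × VV k)) : (N.image (c + ·)).image (c + ·) = N := by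
  rw [image_image]
  have : ((c + ·) ∘ (c + ·) : VV k × VV k → VV k × VV k) = id := by funext x; exact cc c x
  rw [this, image_id]

lemma BB_img {B : Finset (VV k × VV k)} (h : B ∈ BB k) (c : VV k × VV k) : B.image (c + ·) ∈ BB k := by
  rw [mem_BB, unl_iff] at h ⊢
  refine ⟨?_, ?_⟩
  · intro u hu v hv
    obtain ⟨a, ha, rfl⟩ := mem_image.1 hu
    obtain ⟨b, hb, rfl⟩ := mem_image.1 hv
    have : c + a + (c + b) = a + b := by rw [add_comm c a, add_assoc, cc]
    simp only [this]; exact h.1 a ha b hb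
  · rw [card_image_of_injective _ (add_right_injective c)]; exact h.2

lemma BB0_struct {B : Finset (VV k × VV k)} (h : B ∈ BB k) (h0 : 0 ∈ B) :
    (∀ x ∈ B, ∀ y ∈ B, x + y ∈ B) ∧ (∀ x ∈ B, ∀ y ∈ B, pol x y = 0) ∧ (∀ x ∈ B, q x = 0) := by
  rw [mem_BB] at h
  obtain ⟨W, -, hW, hp, hiff, hq, -⟩ := max_struct h.1 h.2 h0
  have : W = B := by ext u; rw [hiff u, zero_add]
  subst this
  exact ⟨hW, hp, hq⟩

lemma reorg (f : Finset (VV k × VV k) → ℝ) :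
    2 ^ k * ∑ B ∈ BB k, f B = ∑ B ∈ (BB k).filter (fun B => 0 ∈ B), ∑ c, f (B.image (c + ·)) := by
  have e1 : (2 : ℝ) ^ k * ∑ B ∈ BB k, f B = ∑ B ∈ BB k, ∑ c, if c ∈ B then f B else 0 := by
    rw [mul_sum]
    apply sum_congr rfl; intro B hB
    rw [mem_BB] at hB
    rw [← sum_filter, sum_const, filter_mem_eq_inter, univ_inter, hB.2, nsmul_eq_mul]
    push_cast; rfl
  rw [e1, sum_comm, sum_comm (s := (BB k).filter _)]
  apply sum_congr rfl; intro c _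
  rw [← sum_filter]
  apply sum_nbij' (fun B => B.image (c + ·)) (fun B => B.image (c + ·))
  · intro B hB
    rw [mem_filter] at hB ⊢
    refine ⟨BB_img hB.1 c, mem_image.2 ⟨c, hB.2, vv2 c⟩⟩
  · intro B hB
    rw [mem_filter] at hB ⊢
    refine ⟨BB_img hB.1 c, mem_image.2 ⟨0, hB.2, add_zero c⟩⟩
  · intro B _; exact img_inv c B
  · intro B _; exact img_inv c B
  · intro B _; rw [img_inv]

noncomputable def GG (k : ℕ) : Finset (Finset (VV k × VV k)) :=
  (BB k).filter (fun B => 0 ∈ B ∧ ∀ x ∈ B, ∀ y ∈ B, x.1 ⬝ᵥ y.2 = 0)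

lemma mem_GG (B : Finset (VV k × VV k)) :
    B ∈ GG k ↔ B ∈ BB k ∧ 0 ∈ B ∧ ∀ x ∈ B, ∀ y ∈ B, x.1 ⬝ᵥ y.2 = 0 := by
  unfold GG; rw [mem_filter]

lemma sum_cB {r : VV k × VV k → ℕ} (hr : Function.Injective r) :
    ∑ B ∈ BB k, cB (phi k) (lamb k) r B = (GG k).card := by
  have h2 : (2 : ℝ) ^ k ≠ 0 := by positivity
  apply mul_left_cancel₀ h2
  rw [reorg]
  have hsub : GG k ⊆ (BB k).filter (fun B => 0 ∈ B) := by
    intro B hB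
    rw [mem_GG] at hB
    exact mem_filter.2 ⟨hB.1, hB.2.1⟩
  rw [← sum_subset hsub]
  · rw [sum_congr rfl (g := fun _ => (2 : ℝ) ^ k), sum_const, nsmul_eq_mul, mul_comm]
    intro B hB
    rw [mem_GG] at hB
    obtain ⟨hW, hp, hq⟩ := BB0_struct hB.1 hB.2.1
    exact good_sum hr hB.2.1 hW hq hB.2.2
  · intro B hB hB'
    rw [mem_filter] at hB
    obtain ⟨hW, hp, hq⟩ := BB0_struct hB.1 hB.2
    rw [mem_GG] at hB'
    have h : ¬ ∀ x ∈ B, ∀ y ∈ B, x.1 ⬝ᵥ y.2 = 0 := fun h => hB' ⟨hB.1, hB.2, h⟩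
    push Not at h
    obtain ⟨w, hw, w', hw', hb⟩ := h
    exact sum_eq_zero fun c _ => bad_zero hr hB.2 hW hp hq hw hw' hb c

noncomputable def FF (V : Submodule (ZMod 2) (VV k)) : Finset (VV k × VV k) :=
  univ.filter (fun u => u.1 ∈ V ∧ ∀ x ∈ V, x ⬝ᵥ u.2 = 0)

lemma mem_FF (V : Submodule (ZMod 2) (VV k)) (u : VV k × VV k) :
    u ∈ FF V ↔ u.1 ∈ V ∧ ∀ x ∈ V, x ⬝ᵥ u.2 = 0 := by unfold FF; simp

lemma FF_card (V : Submodule (ZMod 2) (VV k)) : (FF V).card = 2 ^ k := by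
  have h := perp_card (G := VV k) v2 (fun x y => x ⬝ᵥ y) (fun x y z => add_dotProduct x y z)
    (fun x y z => dotProduct_add z x y) (fun x h => dot_nondeg x h) (univ.filter (fun x => x ∈ V))
    (by simp) (by simp only [mem_filter, mem_univ, true_and]; intro x hx y hy; exact V.add_mem hx hy)
  have hc : Fintype.card (VV k) = 2 ^ k := by simp [VV, ZMod.card]
  rw [hc] at h
  rw [← h, ← card_product]
  congr 1
  ext u
  rw [mem_FF, mem_product]
  simp

lemma FF_mem (V : Submodule (ZMod 2) (VV k)) : FF V ∈ GG k := by
  unfold GG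
  have hb : ∀ x ∈ FF V, ∀ y ∈ FF V, x.1 ⬝ᵥ y.2 = 0 := by
    intro x hx y hy
    rw [mem_FF] at hx hy
    exact hy.2 _ hx.1
  rw [mem_filter, mem_BB, unl_iff]
  refine ⟨⟨?_, FF_card V⟩, ?_, hb⟩
  · intro u hu v hv
    unfold q
    rw [Prod.fst_add, Prod.snd_add, add_dotProduct, dotProduct_add, dotProduct_add, hb u hu u hu, hb u hu v hv,
      hb v hv u hu, hb v hv v hv]
    simp
  · rw [mem_FF]; simp

lemma FF_inj : Function.Injective (FF (k := k)) := by
  have key : ∀ (V : Submodule (ZMod 2) (VV k)) (x : VV k), x ∈ V ↔ ((x, 0) : VV k × VV k) ∈ FF V := by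
    intro V x; rw [mem_FF]; simp
  intro V V' h
  ext x
  rw [key V, key V', h]

lemma FF_surj {B : Finset (VV k × VV k)} (h : B ∈ GG k) : ∃ V : Submodule (ZMod 2) (VV k), FF V = B := by
  unfold GG at h
  rw [mem_filter, mem_BB] at h
  obtain ⟨⟨hu, hc⟩, h0, hb⟩ := h
  refine ⟨Submodule.span (ZMod 2) (Prod.fst '' (B : Set (VV k × VV k))), ?_⟩
  symm
  apply eq_of_subset_of_card_le
  · intro u hu
    rw [mem_FF]
    refine ⟨Submodule.subset_span ⟨u, hu, rfl⟩, ?_⟩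
    intro x hx
    induction hx using Submodule.span_induction with
    | mem x hx => obtain ⟨y, hy, rfl⟩ := hx; exact hb y hy u hu
    | zero => simp
    | add x y _ _ h1 h2 => rw [add_dotProduct, h1, h2, add_zero]
    | smul a x _ h1 => rw [smul_dotProduct, h1, smul_zero]
  · rw [FF_card, hc]

lemma GG_card (k : ℕ) : (GG k).card = Nat.card (Submodule (ZMod 2) (Fin k → ZMod 2)) := by
  have : GG k = univ.image (FF (k := k)) := by
    ext B
    rw [mem_image]
    constructor
    · intro h; obtain ⟨V, hV⟩ := FF_surj h; exact ⟨V, mem_univ _, hV⟩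
    · rintro ⟨V, -, rfl⟩; exact FF_mem V
  rw [this, card_image_of_injective _ FF_inj, card_univ, Nat.card_eq_fintype_card]

end
end FK

namespace FK
open Finset

lemma phi_self (k : ℕ) (u : VV k × VV k) : phi k u u = 0 := by
  rw [phi_def, v2, dotProduct_zero]; rfl

lemma phi_le (k : ℕ) (u v : VV k × VV k) : phi k u v ≤ 1 := by
  rw [phi_def]
  exact Nat.lt_succ_iff.1 (ZMod.val_lt _)

lemma main_asymp (k : ℕ) (hk : 1 ≤ k) {ε : ℝ} (hε : 0 < ε) : ∃ Y0 : ℕ, ∀ Y : ℕ, Y0 ≤ Y →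
    |∑ d ∈ Aset Y, (fcount d : ℝ) ^ k - (Nat.card (Submodule (ZMod 2) (Fin k → ZMod 2)) : ℝ) * (Aset Y).card| ≤
      ε * (Y / Real.sqrt (Real.log Y)) := by
  obtain ⟨r, hr⟩ : ∃ r : VV k × VV k → ℕ, Function.Injective r :=
    ⟨fun u => (Fintype.equivFin _ u : ℕ), fun u v h => (Fintype.equivFin _).injective (Fin.ext h)⟩
  obtain ⟨Y0, h⟩ := abstract_main (phi k) (lamb k) (phi_self k) (phi_le k) r hr ((1/2 : ℝ) ^ k) (by positivity)
    (by calc ((1/2 : ℝ)) ^ k ≤ (1/2) ^ 1 := pow_le_pow_of_le_one (by norm_num) (by norm_num) hk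
          _ = 1/2 := pow_one _)
    (2 ^ k) (by push_cast; rw [← mul_pow]; norm_num) (fun B hB => C1 B hB) (fun B hB hc w hw => C2 B hB hc w hw) hε
  refine ⟨Y0, fun Y hY => ?_⟩
  have h1 := h Y hY
  have e1 : ∑ d ∈ Aset Y, ((1/2 : ℝ) ^ k) ^ d.primeFactors.card *
      ∑ c : d.primeFactors → VV k × VV k, tj (phi k) (lamb k) (ctup c) = ∑ d ∈ Aset Y, (fcount d : ℝ) ^ k := by
    apply sum_congr rfl; intro d hd
    unfold Aset at hd
    rw [mem_filter, mem_sf] at hd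
    exact (fcount_pow k hd.1.2 (by omega)).symm
  have e2 := sum_cB hr
  rw [GG_card] at e2
  have e3 : ∑ B ∈ univ.filter (fun B => unl (phi k) B ∧ B.card = 2 ^ k), cB (phi k) (lamb k) r B =
      (Nat.card (Submodule (ZMod 2) (Fin k → ZMod 2)) : ℝ) := by
    rw [← e2]
    apply sum_congr
    · ext B; rw [mem_BB]; simp
    · intros; rfl
  rw [e1, e3] at h1
  exact h1

lemma jac_iff {p : ℕ} (hp : p.Prime) (h2 : p % 2 = 1) : jacobiSym 2 p = 1 ↔ p % 8 = 1 ∨ p % 8 = 7 := by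
  rw [jacobiSym.at_two (Nat.odd_iff.2 h2), ZMod.χ₈_nat_eq_if_mod_eight, if_neg (by omega)]
  split_ifs with h
  · simp [h]
  · simp [h]

lemma dCond_iff (X : ℝ) (hX : 0 ≤ X) (d : ℕ) : dCond X d ↔ d ∈ Aset ⌊X / 2⌋₊ := by
  unfold dCond Aset
  rw [mem_filter, mem_sf]
  have hle : d ≤ ⌊X / 2⌋₊ ↔ (2 * d : ℝ) ≤ X := by
    rw [Nat.le_floor_iff (by positivity)]
    constructor <;> intro h <;> linarith
  rw [hle]
  constructor
  · rintro ⟨hsq, h4, h1, hX, hp⟩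
    refine ⟨⟨⟨by omega, hX⟩, hsq⟩, ?_, h4⟩
    intro p hpm
    have hpp := Nat.prime_of_mem_primeFactors hpm
    have hpd := Nat.dvd_of_mem_primeFactors hpm
    have hodd : p % 2 = 1 := by
      have : Odd p := Odd.of_dvd_nat (Nat.odd_iff.2 (by omega)) hpd
      exact Nat.odd_iff.1 this
    exact (jac_iff hpp hodd).1 (hp p hpp hpd)
  · rintro ⟨⟨⟨h0, hX⟩, hsq⟩, hS, h4⟩
    refine ⟨hsq, h4, by omega, hX, ?_⟩
    intro p hpp hpd
    have h := hS p (Nat.mem_primeFactors.2 ⟨hpp, hpd, by omega⟩)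
    exact (jac_iff hpp (by omega)).2 h

lemma filt_eq (X : ℝ) (hX : 0 ≤ X) : (range (⌊X⌋₊ + 1)).filter (fun d => dCond X d) = Aset ⌊X / 2⌋₊ := by
  ext d
  rw [mem_filter, dCond_iff X hX]
  refine ⟨fun h => h.2, fun h => ⟨?_, h⟩⟩
  have h' := (dCond_iff X hX d).2 h
  rw [mem_range, Nat.lt_succ_iff, Nat.le_floor_iff hX]
  have h1 : (2 * d : ℝ) ≤ X := h'.2.2.2.1
  have : (0 : ℝ) ≤ d := Nat.cast_nonneg d
  linarith

lemma Acount_eq (X : ℝ) (hX : 0 ≤ X) : Acount34 X = (Aset ⌊X / 2⌋₊).card := by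
  unfold Acount34
  rw [← sum_filter, filt_eq X hX, sum_const, nsmul_eq_mul, mul_one]

lemma Scount_eq (k : ℕ) (X : ℝ) (hX : 0 ≤ X) : Scount k X = ∑ d ∈ Aset ⌊X / 2⌋₊, (fcount d : ℝ) ^ k := by
  unfold Scount
  rw [← sum_filter, filt_eq X hX]
  apply sum_congr rfl
  intro d hd
  obtain ⟨h1, h2, -, -, h3⟩ := (dCond_iff X hX d).2 hd
  rw [fourRank_eq_fcount d h1 h2 h3]

lemma final (k : ℕ) (hk : 1 ≤ k) :
    Asymptotics.IsEquivalent Filter.atTop (fun X : ℝ => Scount k X)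
      (fun X : ℝ => (Nat.card (Submodule (ZMod 2) (Fin k → ZMod 2)) : ℝ) * Acount34 X) := by
  have hN : (1 : ℝ) ≤ Nat.card (Submodule (ZMod 2) (Fin k → ZMod 2)) := by
    have : 0 < Nat.card (Submodule (ZMod 2) (Fin k → ZMod 2)) := Nat.card_pos
    exact_mod_cast this
  unfold Asymptotics.IsEquivalent
  rw [Asymptotics.isLittleO_iff]
  intro ε hε
  obtain ⟨c, hc, Y1, h1⟩ := A_lower
  obtain ⟨Y2, h2⟩ := main_asymp k hk (ε := ε * c) (by positivity)
  have ht : Filter.Tendsto (fun X : ℝ => ⌊X / 2⌋₊) Filter.atTop Filter.atTop :=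
    tendsto_nat_floor_atTop.comp (Filter.tendsto_id.atTop_div_const (by norm_num))
  filter_upwards [Filter.eventually_ge_atTop 0, ht.eventually_ge_atTop Y1, ht.eventually_ge_atTop Y2] with X hX g1 g2
  simp only [Pi.sub_apply]
  rw [Acount_eq X hX, Scount_eq k X hX, Real.norm_eq_abs, Real.norm_eq_abs]
  have a1 := h1 _ g1
  have a2 := h2 _ g2
  have hA : (0 : ℝ) ≤ (Aset ⌊X / 2⌋₊).card := Nat.cast_nonneg _
  rw [abs_of_nonneg (a := (Nat.card (Submodule (ZMod 2) (Fin k → ZMod 2)) : ℝ) * _) (by positivity)]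
  refine a2.trans ?_
  calc ε * c * ((⌊X / 2⌋₊ : ℝ) / Real.sqrt (Real.log ⌊X / 2⌋₊))
      = ε * (c * ⌊X / 2⌋₊ / Real.sqrt (Real.log ⌊X / 2⌋₊)) := by ring
    _ ≤ ε * (Aset ⌊X / 2⌋₊).card := by gcongr
    _ ≤ ε * ((Nat.card (Submodule (ZMod 2) (Fin k → ZMod 2)) : ℝ) * (Aset ⌊X / 2⌋₊).card) := by
        gcongr
        exact le_mul_of_one_le_left hA hN

end FK

/-- `S(X, k; 3, 4) ~ N(k, 2)·A(X; 3, 4)` as `X → ∞`, where `N(k, 2)` is the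
number of `𝔽₂`-subspaces of `𝔽₂^k`. -/
theorem stmt16 (k : ℕ) (hk : 1 ≤ k) :
    Asymptotics.IsEquivalent Filter.atTop (fun X : ℝ => Scount k X)
      (fun X : ℝ => (Nat.card (Submodule (ZMod 2) (Fin k → ZMod 2)) : ℝ) * Acount34 X) := by
  exact FK.final k hk
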